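/- Suppose ρ satisfies condition (3) with S = 0, and let K̂ be the polynomial hull of K = K¹. For every z ∈ Δ the fiber K̂_z is a hypoconvex subset of ℂⁿ (its complement is a union of complex (n−1)-dimensional affine planes) with C¹ boundary; in fact K̂₀ = {w ∈ ℂⁿ : P(w) ≤ 1}, where P(w) = ρ(z, F(w)(z)) for the globally extended map F of Theorem 1 (with P(0) = 0). -/

import Mathlib

open Complex Metric MeasureTheory Filter Set

noncomputable section

/-- The unit circle `Γ` in `ℂ`. -/
def Circ : Set ℂ := Metric.sphere (0 : ℂ) 1

/-- The closed unit disk `Δ` in `ℂ`. -/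
def Disk : Set ℂ := Metric.closedBall (0 : ℂ) 1

/-- The Euclidean norm on `ℂⁿ`. -/
def euclNorm {n : ℕ} (w : Fin n → ℂ) : ℝ := Real.sqrt (∑ j, Complex.normSq (w j))

/-- The complex partial derivative `∂g/∂wⱼ` of a real-valued function `g` on `ℂⁿ`. -/
def wderiv {n : ℕ} (g : (Fin n → ℂ) → ℝ) (w : Fin n → ℂ) (j : Fin n) : ℂ :=
  (((fderiv ℝ g w) (Pi.single j 1) : ℝ) - Complex.I * ((fderiv ℝ g w) (Pi.single j Complex.I) : ℝ)) / 2

/-- The affine complex tangent plane at `p` to the level set of `g` through `p`. -/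
def TangentPlane {n : ℕ} (g : (Fin n → ℂ) → ℝ) (p : Fin n → ℂ) : Set (Fin n → ℂ) :=
  {w | ∑ j, (w j - p j) * wderiv g p j = 0}

/-- `ρ` is strictly hypoconvex on a subset `U` of `Γ × ℂⁿ`: on every compact subset
there is `𝒦 > 0` such that the real Hessian in `w` is `≥ 𝒦‖u‖²` on complex tangent
vectors `u` of the fibers. -/
def StrictHypoconvexOn {n : ℕ} (ρ : ℂ → (Fin n → ℂ) → ℝ) (U : Set (ℂ × (Fin n → ℂ))) : Prop :=
  ∀ C : Set (ℂ × (Fin n → ℂ)), C ⊆ U → IsCompact C →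
    ∃ K0 > (0:ℝ), ∀ p ∈ C, ∀ u : Fin n → ℂ,
      (∑ j, u j * wderiv (ρ p.1) p.2 j) = 0 →
      K0 * (euclNorm u)^2 ≤ iteratedFDeriv ℝ 2 (ρ p.1) p.2 ![u, u]

/-- Two subsets of real normed spaces are (C⁶-)diffeomorphic: there are C⁶ maps on
open neighborhoods carrying one onto the other, inverse to each other on the sets. -/
def DiffeomorphicSets {E F : Type*} [NormedAddCommGroup E] [NormedSpace ℝ E]
    [NormedAddCommGroup F] [NormedSpace ℝ F] (A : Set E) (B : Set F) : Prop :=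
  ∃ (U : Set E) (V : Set F) (f : E → F) (g : F → E),
    IsOpen U ∧ IsOpen V ∧ A ⊆ U ∧ B ⊆ V ∧
    ContDiffOn ℝ 6 f U ∧ ContDiffOn ℝ 6 g V ∧
    Set.MapsTo f A B ∧ Set.MapsTo g B A ∧
    (∀ x ∈ A, g (f x) = x) ∧ (∀ y ∈ B, f (g y) = y)

/-- Condition (3) of the paper, for `ρ` with respect to `R` and `S`. -/
structure Cond3 (n : ℕ) (ρ : ℂ → (Fin n → ℂ) → ℝ) (R : ℝ) (S : ℂ → Fin n → ℂ) : Prop where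
  hn : 2 ≤ n
  nonneg : ∀ z ∈ Circ, ∀ w, 0 ≤ ρ z w
  cont : ContinuousOn (fun p : ℂ × (Fin n → ℂ) => ρ p.1 p.2) {p | p.1 ∈ Circ}
  smooth : ContDiffOn ℝ 6 (fun p : ℂ × (Fin n → ℂ) => ρ p.1 p.2)
      {p | p.1 ∈ Circ ∧ ρ p.1 p.2 ≠ 0}
  hR : 1 < R
  grad_ne : ∀ z ∈ Circ, ∀ w, 0 < ρ z w → ρ z w ≤ R → fderiv ℝ (ρ z) w ≠ 0
  hypo : StrictHypoconvexOn ρ {p | p.1 ∈ Circ ∧ ρ p.1 p.2 ≠ 0}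
  levelCompact : ∀ t : ℝ, 0 < t → t ≤ R →
      IsCompact {p : ℂ × (Fin n → ℂ) | p.1 ∈ Circ ∧ ρ p.1 p.2 = t}
  fiberSphere : ∀ t : ℝ, 0 < t → t ≤ R → ∀ z ∈ Circ,
      DiffeomorphicSets {w | ρ z w = t} (Metric.sphere (0 : EuclideanSpace ℂ (Fin n)) 1)
  levelR : ∀ z ∈ Circ, ∀ w, ρ z w = R ↔ euclNorm w = R
  aboveR : ∀ z ∈ Circ, ∀ w, R < euclNorm w → R < ρ z w
  Scont : ContinuousOn S Circ
  Ssmall : ∀ z ∈ Circ, euclNorm (S z) < R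
  Szero : ∀ z ∈ Circ, ∀ w, ρ z w = 0 ↔ w = S z

/-- The `j`-th Fourier coefficient of the boundary values of `f` on the circle. -/
def bCoeff (f : ℂ → ℂ) (j : ℤ) : ℂ :=
  (1 / (2 * Real.pi) : ℂ) * ∫ θ in (0:ℝ)..(2 * Real.pi),
    f (Complex.exp (↑θ * Complex.I)) * Complex.exp (-(j : ℂ) * ↑θ * Complex.I)

/-- The Hilbert space `ℓ²(ℤ)` used to represent `W^{1,2}(Γ)`. -/
abbrev Seq2 : Type := lp (fun _ : ℤ => ℂ) 2

/-- `a ∈ ℓ²(ℤ)` is the (weighted) Fourier coefficient representation of `f` in the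
Sobolev space `W^{1,2}(Γ)`; the weight `√(1+j²)` makes the `ℓ²` norm of `a`
equivalent to the `W^{1,2}` norm of `f`. -/
def RepOf (a : Seq2) (f : ℂ → ℂ) : Prop :=
  ∀ j : ℤ, (a : ∀ _ : ℤ, ℂ) j = (Real.sqrt (1 + (j:ℝ)^2) : ℂ) * bCoeff f j

/-- Membership in `H^{1,2}(Δ) = H²(Δ) ∩ W^{1,2}(Γ)` (whose elements extend
continuously to the closed disk). -/
def MemH12 (f : ℂ → ℂ) : Prop :=
  ContinuousOn f Disk ∧ DifferentiableOn ℂ f (Metric.ball (0:ℂ) 1) ∧ ∃ a : Seq2, RepOf a f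

/-- Membership in the disk algebra `A(Δ)`. -/
def MemA (f : ℂ → ℂ) : Prop :=
  ContinuousOn f Disk ∧ DifferentiableOn ℂ f (Metric.ball (0:ℂ) 1)

/-- Membership in `H^∞(Δ)`. -/
def MemHinf (f : ℂ → ℂ) : Prop :=
  DifferentiableOn ℂ f (Metric.ball (0:ℂ) 1) ∧ ∃ M : ℝ, ∀ z ∈ Metric.ball (0:ℂ) 1, ‖f z‖ ≤ M

/-- `f` is `C^k`-smooth on the circle `Γ`. -/
def CkCirc (k : ℕ) (f : ℂ → ℂ) : Prop :=
  ContDiff ℝ k (fun θ : ℝ => f (Complex.exp (↑θ * Complex.I)))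

/-- `f` is `C⁴`-smooth on the circle `Γ`. -/
def C4Circ (f : ℂ → ℂ) : Prop := CkCirc 4 f

/-- Vector-valued versions. -/
def MemH12V {n : ℕ} (f : ℂ → Fin n → ℂ) : Prop := ∀ j, MemH12 fun z => f z j
def MemAV {n : ℕ} (f : ℂ → Fin n → ℂ) : Prop := ∀ j, MemA fun z => f z j
def MemHinfV {n : ℕ} (f : ℂ → Fin n → ℂ) : Prop := ∀ j, MemHinf fun z => f z j
def C4CircV {n : ℕ} (f : ℂ → Fin n → ℂ) : Prop := ∀ j, C4Circ fun z => f z j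

/-- The coordinates of a point of `ℂ × ℂⁿ` as a point of `ℂ^{n+1}`. -/
def pcoords {n : ℕ} (p : ℂ × (Fin n → ℂ)) : Fin (n+1) → ℂ := Fin.cons p.1 p.2

/-- The polynomial hull of a subset of `ℂ × ℂⁿ ≅ ℂ^{n+1}`. -/
def polyHull {n : ℕ} (Y : Set (ℂ × (Fin n → ℂ))) : Set (ℂ × (Fin n → ℂ)) :=
  {p | ∀ P : MvPolynomial (Fin (n+1)) ℂ, ∀ M : ℝ,
    (∀ q ∈ Y, ‖MvPolynomial.eval (pcoords q) P‖ ≤ M) → ‖MvPolynomial.eval (pcoords p) P‖ ≤ M}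

/-- The polynomial hull of a subset of `ℂⁿ`. -/
def polyHulln {n : ℕ} (Y : Set (Fin n → ℂ)) : Set (Fin n → ℂ) :=
  {w | ∀ P : MvPolynomial (Fin n) ℂ, ∀ M : ℝ,
    (∀ v ∈ Y, ‖MvPolynomial.eval v P‖ ≤ M) → ‖MvPolynomial.eval w P‖ ≤ M}

/-- The coordinates of a point of `ℂ × ℂⁿ × ℂⁿ` as a point of `ℂ^{2n+1}`. -/
def pcoords2 {n : ℕ} (p : ℂ × ((Fin n → ℂ) × (Fin n → ℂ))) : Fin (n + n + 1) → ℂ :=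
  Fin.cons p.1 (Fin.append p.2.1 p.2.2)

/-- The polynomial hull of a subset of `ℂ × ℂⁿ × ℂⁿ ≅ ℂ^{2n+1}`. -/
def polyHull2 {n : ℕ} (Y : Set (ℂ × ((Fin n → ℂ) × (Fin n → ℂ)))) :
    Set (ℂ × ((Fin n → ℂ) × (Fin n → ℂ))) :=
  {p | ∀ P : MvPolynomial (Fin (n + n + 1)) ℂ, ∀ M : ℝ,
    (∀ q ∈ Y, ‖MvPolynomial.eval (pcoords2 q) P‖ ≤ M) → ‖MvPolynomial.eval (pcoords2 p) P‖ ≤ M}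

/-- A subset of `ℂⁿ` is hypoconvex if its complement is a union of complex affine
hyperplanes. -/
def HypoconvexSet {n : ℕ} (A : Set (Fin n → ℂ)) : Prop :=
  ∀ v : Fin n → ℂ, v ∉ A → ∃ (c : Fin n → ℂ) (d : ℂ), c ≠ 0 ∧
    (∑ j, c j * v j) = d ∧ ∀ w ∈ A, (∑ j, c j * w j) ≠ d

/-- `A` has `C^k` boundary: near each boundary point the boundary is the zero set of a
`C^k` function with nonvanishing gradient. -/
def CkBoundary {E : Type*} [NormedAddCommGroup E] [NormedSpace ℝ E] (k : ℕ) (A : Set E) : Prop :=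
  ∀ p ∈ frontier A, ∃ U : Set E, IsOpen U ∧ p ∈ U ∧
    ∃ φ : E → ℝ, ContDiffOn ℝ k φ U ∧ (∀ x ∈ U, fderiv ℝ φ x ≠ 0) ∧
      frontier A ∩ U = {x | φ x = 0} ∩ U

/-- `fb` gives the a.e. radial boundary values on `Γ` of the function `f` on the open disk. -/
def IsBdryVal {n : ℕ} (f fb : ℂ → Fin n → ℂ) : Prop :=
  ∀ᵐ (θ : ℝ) ∂(volume.restrict (Set.Ioc (0:ℝ) (2 * Real.pi))),
    Filter.Tendsto (fun r : ℝ => f ((r : ℂ) * Complex.exp (↑θ * Complex.I)))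
      (nhdsWithin 1 (Set.Iio 1)) (nhds (fb (Complex.exp (↑θ * Complex.I))))

/-- The optimal control `γ_ρ = inf_{f ∈ H^∞(Δ)ⁿ} ess sup_{z ∈ Γ} ρ(z,f(z))`. -/
def gammaRho {n : ℕ} (ρ : ℂ → (Fin n → ℂ) → ℝ) : ℝ :=
  sInf {c : ℝ | ∃ f fb : ℂ → Fin n → ℂ, MemHinfV f ∧ IsBdryVal f fb ∧
    ∀ᵐ (θ : ℝ) ∂(volume.restrict (Set.Ioc (0:ℝ) (2 * Real.pi))),
      ρ (Complex.exp (↑θ * Complex.I)) (fb (Complex.exp (↑θ * Complex.I))) ≤ c}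

/-- `δ_ρ = inf_{f ∈ A(Δ)ⁿ} sup_{z ∈ Γ} ρ(z,f(z))`. -/
def deltaRho {n : ℕ} (ρ : ℂ → (Fin n → ℂ) → ℝ) : ℝ :=
  sInf {c : ℝ | ∃ f : ℂ → Fin n → ℂ, MemAV f ∧ ∀ z ∈ Circ, ρ z (f z) ≤ c}

/-- `ρ_m(z,w) = ρ(z, w/zᵐ)`. -/
def rhoShift {n : ℕ} (ρ : ℂ → (Fin n → ℂ) → ℝ) (m : ℕ) : ℂ → (Fin n → ℂ) → ℝ :=
  fun z w => ρ z (fun j => w j / z ^ m)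

/-- `q` is an `n`-tuple of harmonic polynomials. -/
def HarmPolyTuple {n : ℕ} (q : ℂ → Fin n → ℂ) : Prop :=
  ∃ (d : ℕ) (a b : ℕ → Fin n → ℂ), ∀ z : ℂ, ∀ j,
    q z j = ∑ i ∈ Finset.range (d+1), (a i j * z ^ i + b i j * (starRingEnd ℂ z) ^ i)

/-- `zᵐ q(z)` has analytic polynomial coordinates (as boundary values on `Γ`). -/
def ZmAnalytic {n : ℕ} (m : ℕ) (q : ℂ → Fin n → ℂ) : Prop :=
  ∀ j, ∃ p : Polynomial ℂ, ∀ z ∈ Circ, z ^ m * q z j = Polynomial.eval z p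

/-- The boundary function `q` on `Γ` is analytic, i.e. agrees on `Γ` with an element
of `A(Δ)ⁿ`. -/
def BoundaryAnalytic {n : ℕ} (q : ℂ → Fin n → ℂ) : Prop :=
  ∃ h : ℂ → Fin n → ℂ, MemAV h ∧ ∀ z ∈ Circ, h z = q z





/-- Moebius map of the disk sending `0` to `a`. -/
def mob (a z : ℂ) : ℂ := (z + a) / (1 + (starRingEnd ℂ a) * z)

lemma mob_den_ne {a z : ℂ} (ha : ‖a‖ < 1) (hz : ‖z‖ ≤ 1) : 1 + (starRingEnd ℂ a) * z ≠ 0 := by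
  intro h
  have h1 : (starRingEnd ℂ a) * z = -1 := by linear_combination h
  have h2 : ‖(starRingEnd ℂ a) * z‖ = 1 := by rw [h1]; simp
  rw [norm_mul, RCLike.norm_conj] at h2
  nlinarith [norm_nonneg a, norm_nonneg z]

lemma mob_identity (a z : ℂ) : normSq (1 + (starRingEnd ℂ a) * z) - normSq (z + a)
    = (1 - normSq a) * (1 - normSq z) := by
  simp only [normSq_apply, add_re, add_im, mul_re, mul_im, conj_re, conj_im, one_re, one_im]
  ring

lemma mob_zero (a : ℂ) : mob a 0 = a := by simp [mob]

lemma mob_norm_lt {a z : ℂ} (ha : ‖a‖ < 1) (hz : ‖z‖ < 1) : ‖mob a z‖ < 1 := by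
  have hd := mob_den_ne ha hz.le
  rw [mob, norm_div, div_lt_one (norm_pos_iff.2 hd)]
  have h := mob_identity a z
  simp only [normSq_eq_norm_sq] at h
  have h1 : 0 < (1 - ‖a‖^2) * (1 - ‖z‖^2) := by
    apply mul_pos <;> nlinarith [norm_nonneg a, norm_nonneg z]
  exact lt_of_pow_lt_pow_left₀ 2 (norm_nonneg _) (by linarith)

lemma mob_norm_eq {a z : ℂ} (ha : ‖a‖ < 1) (hz : ‖z‖ = 1) : ‖mob a z‖ = 1 := by
  have hd := mob_den_ne ha hz.le
  rw [mob, norm_div, div_eq_one_iff_eq (norm_ne_zero_iff.2 hd)]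
  have h := mob_identity a z
  simp only [normSq_eq_norm_sq] at h
  rw [hz] at h
  have : ‖z + a‖^2 = ‖1 + (starRingEnd ℂ a) * z‖^2 := by linarith
  exact (pow_left_inj₀ (norm_nonneg _) (norm_nonneg _) two_ne_zero).1 this

lemma mob_mapsTo_ball {a : ℂ} (ha : ‖a‖ < 1) : MapsTo (mob a) (ball 0 1) (ball 0 1) := by
  intro z hz
  rw [mem_ball_zero_iff] at hz ⊢
  exact mob_norm_lt ha hz

lemma mob_mapsTo_circ {a : ℂ} (ha : ‖a‖ < 1) : MapsTo (mob a) Circ Circ := by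
  intro z hz
  rw [Circ, mem_sphere_zero_iff_norm] at hz ⊢
  exact mob_norm_eq ha hz

lemma mob_mapsTo_disk {a : ℂ} (ha : ‖a‖ < 1) : MapsTo (mob a) Disk Disk := by
  intro z hz
  rw [Disk, mem_closedBall_zero_iff] at hz ⊢
  rcases hz.lt_or_eq with h | h
  · exact (mob_norm_lt ha h).le
  · exact (mob_norm_eq ha h).le

lemma mob_contOn {a : ℂ} (ha : ‖a‖ < 1) : ContinuousOn (mob a) Disk := by
  intro z hz
  rw [Disk, mem_closedBall_zero_iff] at hz
  have := mob_den_ne ha hz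
  unfold mob
  exact ContinuousAt.continuousWithinAt (by fun_prop (disch := assumption))

lemma mob_diffOn {a : ℂ} (ha : ‖a‖ < 1) : DifferentiableOn ℂ (mob a) (ball 0 1) := by
  intro z hz
  rw [mem_ball_zero_iff] at hz
  have := mob_den_ne ha hz.le
  unfold mob
  exact DifferentiableAt.differentiableWithinAt (by fun_prop (disch := assumption))

lemma circ_sub_disk : Circ ⊆ Disk := sphere_subset_closedBall
lemma ball_sub_disk : ball (0:ℂ) 1 ⊆ Disk := ball_subset_closedBall
lemma norm_of_circ {z : ℂ} (hz : z ∈ Circ) : ‖z‖ = 1 := by simpa [Circ] using hz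
lemma mem_disk_iff {z : ℂ} : z ∈ Disk ↔ ‖z‖ ≤ 1 := by simp [Disk]
lemma isCompact_circ : IsCompact Circ := isCompact_sphere _ _
lemma isCompact_disk : IsCompact Disk := isCompact_closedBall _ _
lemma one_mem_circ : (1:ℂ) ∈ Circ := by simp [Circ]

lemma MemA.comp_mob {H : ℂ → ℂ} (hH : MemA H) {a : ℂ} (ha : ‖a‖ < 1) :
    MemA (fun z => H (mob a z)) :=
  ⟨hH.1.comp (mob_contOn ha) (mob_mapsTo_disk ha), hH.2.comp (mob_diffOn ha) (mob_mapsTo_ball ha)⟩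

lemma MemA.diffContOnCl {H : ℂ → ℂ} (hH : MemA H) : DiffContOnCl ℂ H (ball 0 1) := by
  refine ⟨hH.2, ?_⟩
  rw [closure_ball _ one_ne_zero]; exact hH.1

lemma MemA.of_differentiable {H : ℂ → ℂ} (hH : Differentiable ℂ H) : MemA H :=
  ⟨hH.continuous.continuousOn, hH.differentiableOn⟩
lemma MemA.const (c : ℂ) : MemA (fun _ => c) := .of_differentiable (differentiable_const c)
lemma MemA.add {f g : ℂ → ℂ} (hf : MemA f) (hg : MemA g) : MemA (fun z => f z + g z) :=
  ⟨hf.1.add hg.1, hf.2.add hg.2⟩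
lemma MemA.sub {f g : ℂ → ℂ} (hf : MemA f) (hg : MemA g) : MemA (fun z => f z - g z) :=
  ⟨hf.1.sub hg.1, hf.2.sub hg.2⟩
lemma MemA.mul {f g : ℂ → ℂ} (hf : MemA f) (hg : MemA g) : MemA (fun z => f z * g z) :=
  ⟨hf.1.mul hg.1, hf.2.mul hg.2⟩
lemma MemA.sum {ι : Type*} {s : Finset ι} {f : ι → ℂ → ℂ} (hf : ∀ i ∈ s, MemA (f i)) :
    MemA (fun z => ∑ i ∈ s, f i z) :=
  ⟨continuousOn_finsetSum _ fun i hi => (hf i hi).1, DifferentiableOn.fun_sum fun i hi => (hf i hi).2⟩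
lemma MemA.comp_diff {f g : ℂ → ℂ} (hf : Differentiable ℂ f) (hg : MemA g) :
    MemA (fun z => f (g z)) :=
  ⟨hf.continuous.comp_continuousOn hg.1, hf.comp_differentiableOn hg.2⟩

/-- maximum principle in the disk algebra -/
lemma MemA.norm_le {H : ℂ → ℂ} (hH : MemA H) {C : ℝ} (h : ∀ z ∈ Circ, ‖H z‖ ≤ C) :
    ∀ z ∈ Disk, ‖H z‖ ≤ C := by
  intro z hz
  refine Complex.norm_le_of_forall_mem_frontier_norm_le (U := ball 0 1) isBounded_ball
    hH.diffContOnCl ?_ ?_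
  · intro w hw
    rw [frontier_ball _ one_ne_zero] at hw; exact h w hw
  · rw [closure_ball _ one_ne_zero]; exact hz

lemma MemA.eq_const {H : ℂ → ℂ} (hH : MemA H) {c : ℂ} (h : ∀ z ∈ Circ, H z = c) :
    ∀ z ∈ Disk, H z = c := by
  intro z hz
  have := (hH.sub (.const c)).norm_le (C := 0) (fun w hw => by simp [h w hw]) z hz
  exact sub_eq_zero.1 (norm_le_zero_iff.1 this)

/-- average against harmonic measure at `a` -/
def avg {E : Type*} [NormedAddCommGroup E] [NormedSpace ℝ E] (a : ℂ) (h : ℂ → E) : E :=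
  Real.circleAverage (fun z => h (mob a z)) 0 1

section avg
set_option linter.unusedSectionVars false
variable {E : Type*} [NormedAddCommGroup E] [NormedSpace ℝ E]

lemma avg_integrable {a : ℂ} (ha : ‖a‖ < 1) {h : ℂ → E} (hh : ContinuousOn h Circ) :
    CircleIntegrable (fun z => h (mob a z)) 0 1 := by
  apply ContinuousOn.circleIntegrable zero_le_one
  exact hh.comp ((mob_contOn ha).mono circ_sub_disk) (mob_mapsTo_circ ha)

lemma avg_mono {a : ℂ} (ha : ‖a‖ < 1) {f g : ℂ → ℝ} (hf : ContinuousOn f Circ)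
    (hg : ContinuousOn g Circ) (h : ∀ z ∈ Circ, f z ≤ g z) : avg a f ≤ avg a g := by
  apply Real.circleAverage_mono (avg_integrable ha hf) (avg_integrable ha hg)
  intro z hz
  rw [abs_one] at hz
  exact h _ (mob_mapsTo_circ ha hz)

lemma avg_congr {a : ℂ} (ha : ‖a‖ < 1) {f g : ℂ → E} (h : ∀ z ∈ Circ, f z = g z) :
    avg a f = avg a g := by
  apply Real.circleAverage_congr_sphere
  intro z hz
  rw [abs_one] at hz
  exact h _ (mob_mapsTo_circ ha hz)

lemma avg_const (a : ℂ) (c : ℝ) : avg a (fun _ => c) = c := Real.circleAverage_const _ _ _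

lemma avg_add {a : ℂ} (ha : ‖a‖ < 1) {f g : ℂ → E} (hf : ContinuousOn f Circ)
    (hg : ContinuousOn g Circ) : avg a (fun z => f z + g z) = avg a f + avg a g :=
  Real.circleAverage_fun_add (avg_integrable ha hf) (avg_integrable ha hg)

lemma avg_sub {a : ℂ} (ha : ‖a‖ < 1) {f g : ℂ → E} (hf : ContinuousOn f Circ)
    (hg : ContinuousOn g Circ) : avg a (fun z => f z - g z) = avg a f - avg a g :=
  Real.circleAverage_fun_sub (avg_integrable ha hf) (avg_integrable ha hg)

lemma avg_mul (a : ℂ) (c : ℝ) (f : ℂ → ℝ) : avg a (fun z => c * f z) = c * avg a f := by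
  have := Real.circleAverage_fun_smul (a := c) (f := fun z => f (mob a z)) (c := 0) (R := 1)
  simpa [avg] using this

lemma avg_mean {a : ℂ} (ha : ‖a‖ < 1) {H : ℂ → ℂ} (hH : MemA H) : avg a H = H a := by
  have := DiffContOnCl.circleAverage (f := fun z => H (mob a z)) (c := 0) (R := 1)
    (by rw [abs_one]; exact (hH.comp_mob ha).diffContOnCl)
  rw [avg, this, mob_zero]

lemma avg_im {a : ℂ} (ha : ‖a‖ < 1) {H : ℂ → ℂ} (hH : ContinuousOn H Circ) :
    avg a (fun z => (H z).im) = (avg a H).im := by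
  have := ContinuousLinearMap.circleAverage_comp_comm Complex.imCLM (avg_integrable ha hH)
  exact this

lemma avg_re {a : ℂ} (ha : ‖a‖ < 1) {H : ℂ → ℂ} (hH : ContinuousOn H Circ) :
    avg a (fun z => (H z).re) = (avg a H).re := by
  have := ContinuousLinearMap.circleAverage_comp_comm Complex.reCLM (avg_integrable ha hH)
  exact this

lemma avg_abs_le {a : ℂ} (f : ℂ → ℝ) : |avg a f| ≤ avg a (fun z => |f z|) :=
  Real.abs_circleAverage_le_circleAverage_abs

/-- positivity: sup bound -/
lemma avg_le_const {a : ℂ} (ha : ‖a‖ < 1) {f : ℂ → ℝ} (hf : ContinuousOn f Circ) {c : ℝ}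
    (h : ∀ z ∈ Circ, f z ≤ c) : avg a f ≤ c := by
  have := avg_mono ha hf continuousOn_const h
  rwa [avg_const] at this

lemma avg_nonneg {a : ℂ} (ha : ‖a‖ < 1) {f : ℂ → ℝ} (hf : ContinuousOn f Circ)
    (h : ∀ z ∈ Circ, 0 ≤ f z) : 0 ≤ avg a f := by
  have := avg_mono ha continuousOn_const hf h
  rwa [avg_const] at this

/-- convergence of averages under uniform convergence -/
lemma avg_dist_le {a : ℂ} (ha : ‖a‖ < 1) {f g : ℂ → ℝ} (hf : ContinuousOn f Circ)
    (hg : ContinuousOn g Circ) {c : ℝ} (h : ∀ z ∈ Circ, |f z - g z| ≤ c) :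
    |avg a f - avg a g| ≤ c := by
  rw [← avg_sub ha hf hg]
  exact (avg_abs_le _).trans (avg_le_const ha (hf.sub hg).abs h)

end avg

/-- Approximate conjugates: real continuous functions on the circle are uniformly approximated
by imaginary parts of entire functions. -/
lemma exists_entire_im_approx {θ : ℂ → ℝ} (hθ : ContinuousOn θ Circ) {ε : ℝ} (hε : 0 < ε) :
    ∃ Q : ℂ → ℂ, Differentiable ℂ Q ∧ ∀ z ∈ Circ, |(Q z).im - θ z| < ε := by
  have : Fact (0 < 2 * Real.pi) := ⟨Real.two_pi_pos⟩
  let e : AddCircle (2 * Real.pi) → ℂ := fun x => (AddCircle.toCircle x : ℂ)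
  have he : Continuous e := continuous_subtype_val.comp AddCircle.continuous_toCircle
  have hem : ∀ x, e x ∈ Circ := fun x => by simpa [Circ] using Circle.norm_coe (AddCircle.toCircle x)
  have hes : ∀ z ∈ Circ, ∃ x, e x = z := by
    intro z hz
    have hz1 : ‖z‖ = 1 := norm_of_circ hz
    refine ⟨((arg z : ℝ) : AddCircle (2 * Real.pi)), ?_⟩
    show ((AddCircle.toCircle ((arg z : ℝ) : AddCircle (2 * Real.pi)) : Circle) : ℂ) = z
    rw [AddCircle.toCircle_apply_mk, div_self Real.two_pi_pos.ne', one_mul, Circle.coe_exp]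
    have := norm_mul_exp_arg_mul_I z
    rwa [hz1, ofReal_one, one_mul] at this
  let g : C(AddCircle (2 * Real.pi), ℂ) := ⟨fun x => (θ (e x) : ℂ),
    continuous_ofReal.comp (hθ.comp_continuous he hem)⟩
  have hg : g ∈ (Submodule.span ℂ (range <| @fourier (2 * Real.pi))).topologicalClosure := by
    rw [span_fourier_closure_eq_top]; trivial
  obtain ⟨h, hh, hd⟩ := Metric.mem_closure_iff.1 hg ε hε
  have key : ∀ h ∈ Submodule.span ℂ (range <| @fourier (2 * Real.pi)), ∃ Q1 Q2 : ℂ → ℂ,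
      Differentiable ℂ Q1 ∧ Differentiable ℂ Q2 ∧
      ∀ x, h x = Q1 (e x) + (starRingEnd ℂ) (Q2 (e x)) := by
    intro h hh
    induction hh using Submodule.span_induction with
    | mem x hx =>
      obtain ⟨k, rfl⟩ := hx
      obtain ⟨m, rfl | rfl⟩ := k.eq_nat_or_neg
      · refine ⟨fun z => z ^ m, fun _ => 0, by fun_prop, by fun_prop, fun x => ?_⟩
        simp [fourier_apply, e, AddCircle.toCircle_nsmul]
      · refine ⟨fun _ => 0, fun z => z ^ m, by fun_prop, by fun_prop, fun x => ?_⟩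
        rw [fourier_neg]
        simp [fourier_apply, e, AddCircle.toCircle_nsmul]
    | zero => exact ⟨fun _ => 0, fun _ => 0, by fun_prop, by fun_prop, by simp⟩
    | add x y _ _ hx hy =>
      obtain ⟨Q1, Q2, h1, h2, h3⟩ := hx
      obtain ⟨Q1', Q2', h1', h2', h3'⟩ := hy
      refine ⟨fun z => Q1 z + Q1' z, fun z => Q2 z + Q2' z, by fun_prop, by fun_prop, fun x => ?_⟩
      simp only [ContinuousMap.add_apply, h3, h3', map_add]; ring
    | smul c x _ hx =>
      obtain ⟨Q1, Q2, h1, h2, h3⟩ := hx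
      refine ⟨fun z => c * Q1 z, fun z => (starRingEnd ℂ c) * Q2 z, by fun_prop, by fun_prop, fun x => ?_⟩
      simp only [ContinuousMap.smul_apply, h3, map_mul, smul_eq_mul, Complex.conj_conj]; ring
  obtain ⟨Q1, Q2, h1, h2, h3⟩ := key h hh
  refine ⟨fun z => I * (Q1 z + Q2 z), by fun_prop, fun z hz => ?_⟩
  obtain ⟨x, rfl⟩ := hes z hz
  have h4 : dist (g x) (h x) < ε := lt_of_le_of_lt (ContinuousMap.dist_apply_le_dist x) hd
  have h5 : (I * (Q1 (e x) + Q2 (e x))).im = (h x).re := by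
    rw [h3]; simp
  rw [h5]
  have h6 : (h x).re - θ (e x) = (h x - g x).re := by simp [g]
  rw [h6]
  calc |(h x - g x).re| ≤ ‖h x - g x‖ := abs_re_le_norm _
    _ = dist (g x) (h x) := by rw [dist_comm, dist_eq_norm]
    _ < ε := h4

/-- positivity of the real part propagates inside -/
lemma MemA.re_pos {u : ℂ → ℂ} (hu : MemA u) (h : ∀ z ∈ Circ, 0 < (u z).re) :
    ∀ z ∈ Disk, 0 < (u z).re := by
  obtain ⟨z0, hz0, hmin⟩ := isCompact_circ.exists_isMinOn ⟨1, one_mem_circ⟩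
    (continuous_re.comp_continuousOn (hu.1.mono circ_sub_disk))
  intro z hz
  have h1 : MemA (fun z => exp (-(u z))) := by
    have := MemA.comp_diff (f := fun w => exp (-w)) (by fun_prop) hu
    exact this
  have h2 := h1.norm_le (C := Real.exp (-(u z0).re)) (fun w hw => by
    rw [norm_exp]; apply Real.exp_le_exp.2
    have := hmin hw
    simp only [mem_ofPred_eq, Function.comp] at this
    simp only [neg_re]; linarith) z hz
  rw [norm_exp, Real.exp_le_exp] at h2
  simp only [neg_re] at h2
  have := h z0 hz0
  linarith

/-- S5: a disk algebra function with a continuous logarithm on the circle. -/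
lemma log_disk {H : ℂ → ℂ} (hH : MemA H) {L : ℂ → ℂ} (hL : ContinuousOn L Circ)
    (hexp : ∀ z ∈ Circ, exp (L z) = H z) :
    ∃ ℓ : ℂ → ℂ, MemA ℓ ∧ (∀ z ∈ Disk, exp (ℓ z) = H z) ∧ (∀ z ∈ Circ, ℓ z = L z) := by
  obtain ⟨Q, hQ, hQa⟩ := exists_entire_im_approx (θ := fun z => (L z).im)
    (continuous_im.comp_continuousOn hL) (ε := Real.pi / 4) (by positivity)
  have hu : MemA (fun z => H z * exp (-(Q z))) :=
    hH.mul (.of_differentiable (by fun_prop))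
  have hu1 : ∀ z ∈ Circ, H z * exp (-(Q z)) = exp (L z - Q z) := by
    intro z hz
    rw [← hexp z hz, ← exp_add, sub_eq_add_neg]
  have hb : ∀ z ∈ Circ, |(L z - Q z).im| < Real.pi / 4 := by
    intro z hz
    have := hQa z hz
    rwa [sub_im, abs_sub_comm]
  have hre : ∀ z ∈ Disk, 0 < (H z * exp (-(Q z))).re := by
    apply hu.re_pos
    intro z hz
    rw [hu1 z hz, exp_re]
    have h1 := abs_lt.1 (hb z hz)
    have := Real.cos_pos_of_mem_Ioo (x := (L z - Q z).im) ⟨by linarith [Real.pi_pos], by linarith [Real.pi_pos]⟩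
    positivity
  have hslit : ∀ z ∈ Disk, H z * exp (-(Q z)) ∈ slitPlane := fun z hz => Or.inl (hre z hz)
  refine ⟨fun z => Q z + log (H z * exp (-(Q z))), ⟨?_, ?_⟩, ?_, ?_⟩
  · exact hQ.continuous.continuousOn.add (hu.1.clog hslit)
  · exact hQ.differentiableOn.add (hu.2.clog fun z hz => hslit z (ball_sub_disk hz))
  · intro z hz
    have hne : H z * exp (-(Q z)) ≠ 0 := slitPlane_ne_zero (hslit z hz)
    rw [exp_add, exp_log hne, mul_comm, mul_assoc, ← exp_add]; simp
  · intro z hz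
    have h1 := abs_lt.1 (hb z hz)
    simp only
    rw [hu1 z hz, log_exp (by linarith [Real.pi_pos]) (by linarith [Real.pi_pos])]; ring

/-- S5 -/
lemma log_disk_avg {H : ℂ → ℂ} (hH : MemA H) {L : ℂ → ℂ} (hL : ContinuousOn L Circ)
    (hexp : ∀ z ∈ Circ, exp (L z) = H z) {a : ℂ} (ha : ‖a‖ < 1) :
    H a ≠ 0 ∧ H a = ‖H a‖ * exp ((avg a (fun z => (L z).im) : ℝ) * I) ∧
    ∀ β M : ℝ, 0 < β → β * M ≤ Real.pi / 4 → (∀ z ∈ Circ, |(L z).im| ≤ M) →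
      avg a (fun z => ‖H z‖ ^ β) ≤ 2 * ‖H a‖ ^ β := by
  obtain ⟨ℓ, hℓ, he, hc⟩ := log_disk hH hL hexp
  have had : a ∈ Disk := mem_disk_iff.2 ha.le
  have hH0 : H a ≠ 0 := by rw [← he a had]; exact exp_ne_zero _
  have him : (ℓ a).im = avg a (fun z => (L z).im) := by
    rw [← avg_mean ha hℓ, ← avg_im ha (hℓ.1.mono circ_sub_disk)]
    exact avg_congr ha fun z hz => by rw [hc z hz]
  refine ⟨hH0, ?_, ?_⟩
  · rw [← him, ← he a had, norm_exp, ofReal_exp, ← exp_add, re_add_im]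
  intro β M hβ hβM hM
  have hm : MemA (fun z => exp (β * ℓ z)) := MemA.comp_diff (f := fun w => exp (β * w)) (by fun_prop) hℓ
  have hn : ∀ z ∈ Disk, ‖H z‖ ^ β = Real.exp (β * (ℓ z).re) := by
    intro z hz
    rw [← he z hz, norm_exp, ← Real.exp_mul, mul_comm]
  have hHc : ContinuousOn (fun z => ‖H z‖ ^ β) Circ := by
    apply ContinuousOn.rpow_const ((hH.1.mono circ_sub_disk).norm)
    intro z hz; right; exact hβ.le
  have h1 : avg a (fun z => ‖H z‖ ^ β) ≤ avg a (fun z => 2 * (exp (β * ℓ z)).re) := by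
    apply avg_mono ha hHc
    · exact continuousOn_const.mul (continuous_re.comp_continuousOn (hm.1.mono circ_sub_disk))
    · intro z hz
      rw [hn z (circ_sub_disk hz), exp_re, re_ofReal_mul, im_ofReal_mul]
      have hcos : (1:ℝ) ≤ 2 * Real.cos (β * (ℓ z).im) := by
        have h2 : |β * (ℓ z).im| ≤ Real.pi / 4 := by
          rw [abs_mul, abs_of_pos hβ, hc z hz]
          exact (mul_le_mul_of_nonneg_left (hM z hz) hβ.le).trans hβM
        rw [← Real.cos_abs]
        have h3 : Real.cos (Real.pi / 3) ≤ Real.cos |β * (ℓ z).im| :=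
          Real.cos_le_cos_of_nonneg_of_le_pi (abs_nonneg _) (by linarith [Real.pi_pos]) (by linarith [Real.pi_pos])
        rw [Real.cos_pi_div_three] at h3; linarith
      nlinarith [Real.exp_pos (β * (ℓ z).re)]
  refine h1.trans ?_
  rw [avg_mul, avg_re ha (hm.1.mono circ_sub_disk), avg_mean ha hm, hn a had]
  have : (exp (β * ℓ a)).re ≤ Real.exp (β * (ℓ a).re) := by
    refine (re_le_norm _).trans ?_
    rw [norm_exp, re_ofReal_mul]
  linarith



section Brouwer
open scoped Topology NNReal

lemma brouwer_small {m : ℕ} (s : EuclideanSpace ℝ (Fin m) → EuclideanSpace ℝ (Fin m))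
    (hs : ContDiff ℝ 1 s) (r : ℝ) (hr : ∀ x, r ≤ ‖x‖ → s x = 0) :
    ∃ t0 > (0:ℝ), ∀ t ∈ Ioo 0 t0, ∀ φ : EuclideanSpace ℝ (Fin m) → ℝ,
      ∫ x in ball 0 r, (1 + t • fderiv ℝ s x).det * φ (x + t • s x) = ∫ x in ball 0 r, φ x := by
  have hsupp : HasCompactSupport s := by
    apply HasCompactSupport.intro (isCompact_closedBall 0 r)
    intro x hx
    apply hr
    simp only [mem_closedBall, dist_zero_right, not_le] at hx
    exact hx.le
  obtain ⟨C, hC⟩ := hs.lipschitzWith_of_hasCompactSupport hsupp one_ne_zero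
  have hdet : ∀ᶠ t : ℝ in 𝓝 0, ∀ x ∈ closedBall (0:EuclideanSpace ℝ (Fin m)) r,
      0 < (1 + t • fderiv ℝ s x).det := by
    apply (isCompact_closedBall (0:EuclideanSpace ℝ (Fin m)) r).eventually_forall_of_forall_eventually
    intro x _
    have hc : Continuous (fun q : ℝ × EuclideanSpace ℝ (Fin m) => (1 + q.1 • fderiv ℝ s q.2).det) := by
      apply ContinuousLinearMap.continuous_det.comp
      have := hs.continuous_fderiv one_ne_zero
      fun_prop
    have h1 : (0:ℝ) < (1 + (0:ℝ) • fderiv ℝ s x).det := by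
      simp [ContinuousLinearMap.det]
    have := hc.continuousAt (x := ((0:ℝ), x)) |>.eventually (lt_mem_nhds h1)
    exact this
  obtain ⟨t1, ht1, hdet⟩ := Metric.eventually_nhds_iff.1 hdet
  refine ⟨min t1 (1 / (C + 1)), by positivity, ?_⟩
  intro t ht φ
  have ht0 := ht.1
  have htC : t * C < 1 := by
    have := ht.2.trans_le (min_le_right _ _)
    rw [lt_div_iff₀ (by positivity)] at this
    nlinarith
  set f := fun x => x + t • s x with hf
  have hinj : Function.Injective f := by
    intro x y hxy
    simp only [hf] at hxy
    by_contra hne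
    have h1 : x - y = t • (s y - s x) := by
      rw [smul_sub, sub_eq_sub_iff_add_eq_add, hxy]; abel
    have h2 : ‖x - y‖ ≤ t * (C * ‖x - y‖) := by
      conv_lhs => rw [h1]
      rw [norm_smul, Real.norm_of_nonneg ht0.le, norm_sub_rev (s y)]
      exact mul_le_mul_of_nonneg_left (hC.norm_sub_le _ _) ht0.le
    have h3 : 0 < ‖x - y‖ := norm_pos_iff.2 (sub_ne_zero.2 hne)
    nlinarith
  have hsurj : Function.Surjective f := by
    intro y
    have hcon : ContractingWith (Real.toNNReal (t * C)) (fun x => y - t • s x) := by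
      constructor
      · rw [← NNReal.coe_lt_coe, Real.coe_toNNReal _ (by positivity)]; exact htC
      · apply LipschitzWith.of_dist_le_mul
        intro a b
        rw [Real.coe_toNNReal _ (by positivity), dist_eq_norm, sub_sub_sub_cancel_left, ← smul_sub,
          norm_smul, Real.norm_of_nonneg ht0.le, mul_assoc, ← dist_eq_norm, dist_comm]
        exact mul_le_mul_of_nonneg_left (hC.dist_le_mul _ _) ht0.le
    obtain ⟨x, hx, -⟩ := hcon.exists_fixedPoint 0 (edist_ne_top _ _)
    refine ⟨x, ?_⟩
    have : y - t • s x = x := hx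
    simp only [hf]; rw [← eq_sub_iff_add_eq]; exact this.symm
  have hout : ∀ x, r ≤ ‖x‖ → f x = x := fun x hx => by simp [hf, hr x hx]
  have himg : f '' (ball 0 r) = ball 0 r := by
    apply Subset.antisymm
    · rintro _ ⟨x, hx, rfl⟩
      by_contra hn
      rw [mem_ball_zero_iff, not_lt] at hn
      have := hinj (hout _ hn)
      rw [this] at hn
      rw [mem_ball_zero_iff] at hx
      linarith
    · intro y hy
      obtain ⟨x, rfl⟩ := hsurj y
      refine ⟨x, ?_, rfl⟩
      by_contra hn
      rw [mem_ball_zero_iff, not_lt] at hn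
      rw [hout x hn, mem_ball_zero_iff] at hy
      linarith
  have hder : ∀ x ∈ ball (0:EuclideanSpace ℝ (Fin m)) r,
      HasFDerivWithinAt f (1 + t • fderiv ℝ s x) (ball 0 r) x := by
    intro x _
    have h1 := ((hs.differentiable one_ne_zero) x).hasFDerivAt
    exact ((hasFDerivAt_id x).add (h1.const_smul t)).hasFDerivWithinAt
  have key := integral_image_eq_integral_abs_det_fderiv_smul volume measurableSet_ball hder
    hinj.injOn φ
  rw [himg] at key
  rw [key]
  apply setIntegral_congr_fun measurableSet_ball
  intro x hx
  have := hdet (y := t) (by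
    rw [dist_zero_right, Real.norm_of_nonneg ht0.le]; exact ht.2.trans_le (min_le_left _ _)) x
    (ball_subset_closedBall hx)
  simp only [smul_eq_mul]
  rw [abs_of_pos this]

lemma brouwer_poly {m : ℕ} (k : ℕ) (c : ℝ) (A : EuclideanSpace ℝ (Fin m) →L[ℝ] EuclideanSpace ℝ (Fin m))
    (x y : EuclideanSpace ℝ (Fin m)) : ∃ q : Polynomial ℝ, q.natDegree ≤ m + 2 * k ∧
      ∀ t : ℝ, q.eval t = (1 + t • A).det * (1 - c * ‖x + t • y‖ ^ 2) ^ k := by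
  let B := LinearMap.toMatrix (EuclideanSpace.basisFun (Fin m) ℝ).toBasis
    (EuclideanSpace.basisFun (Fin m) ℝ).toBasis (A : EuclideanSpace ℝ (Fin m) →ₗ[ℝ] EuclideanSpace ℝ (Fin m))
  let q1 : Polynomial ℝ := Matrix.det ((Polynomial.X : Polynomial ℝ) • B.map Polynomial.C
      + (1 : Matrix (Fin m) (Fin m) ℝ).map Polynomial.C)
  let q2 : Polynomial ℝ := Polynomial.C (1 - c * ‖x‖^2) + Polynomial.C (- 2 * c * inner ℝ x y) * Polynomial.X
     + Polynomial.C (- c * ‖y‖^2) * Polynomial.X ^ 2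
  have hq1 : q1.natDegree ≤ m := by
    exact (Polynomial.natDegree_det_X_add_C_le B 1).trans (by simp)
  have hq2 : q2.natDegree ≤ 2 := by
    simp only [q2]; compute_degree
  refine ⟨q1 * q2 ^ k, ?_, ?_⟩
  · refine Polynomial.natDegree_mul_le.trans ?_
    have := Polynomial.natDegree_pow_le (p := q2) (n := k)
    nlinarith
  · intro t
    rw [Polynomial.eval_mul, Polynomial.eval_pow]
    congr 1
    · have h1 : (1 + t • A).det = LinearMap.det (1 + t • (A : EuclideanSpace ℝ (Fin m) →ₗ[ℝ] EuclideanSpace ℝ (Fin m))) := rfl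
      rw [h1, ← LinearMap.det_toMatrix (EuclideanSpace.basisFun (Fin m) ℝ).toBasis]
      simp only [q1]
      rw [← Polynomial.coe_evalRingHom, RingHom.map_det]
      congr 1
      have h2 : (LinearMap.toMatrix (EuclideanSpace.basisFun (Fin m) ℝ).toBasis (EuclideanSpace.basisFun (Fin m) ℝ).toBasis)
        (1 + t • (A : EuclideanSpace ℝ (Fin m) →ₗ[ℝ] EuclideanSpace ℝ (Fin m))) = 1 + t • B := by
        rw [map_add, map_smul, LinearMap.toMatrix_one]
      rw [h2]
      ext i j
      simp only [RingHom.mapMatrix_apply, Matrix.map_apply, Matrix.add_apply, Matrix.smul_apply,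
        map_add, smul_eq_mul, Polynomial.eval_mul, Polynomial.coe_evalRingHom, Polynomial.eval_X, Polynomial.eval_C, B]
      ring
    · congr 1
      simp only [q2, Polynomial.eval_add, Polynomial.eval_mul, Polynomial.eval_C, Polynomial.eval_X, Polynomial.eval_pow]
      rw [norm_add_sq_real, inner_smul_right, norm_smul, Real.norm_eq_abs, mul_pow, sq_abs]
      ring

lemma brouwer_one {m : ℕ} (s : EuclideanSpace ℝ (Fin m) → EuclideanSpace ℝ (Fin m))
    (hs : ContDiff ℝ 1 s) (r : ℝ) (hr : ∀ x, r ≤ ‖x‖ → s x = 0) (p : EuclideanSpace ℝ (Fin m))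
    (c : ℝ) (k : ℕ) :
      ∫ x in ball 0 r, (1 + fderiv ℝ s x).det * (1 - c * ‖x + s x - p‖ ^ 2) ^ k
        = ∫ x in ball 0 r, (1 - c * ‖x - p‖ ^ 2) ^ k := by
  obtain ⟨t0, ht0, H⟩ := brouwer_small s hs r hr
  set N := m + 2 * k + 1 with hN
  let v : ℕ → ℝ := fun i => t0 / (i + 2)
  have hv : ∀ i, v i ∈ Ioo 0 t0 := by
    intro i
    refine ⟨by positivity, ?_⟩
    rw [div_lt_iff₀ (by positivity)]
    nlinarith [(Nat.cast_nonneg i : (0:ℝ) ≤ i)]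
  have hvi : Set.InjOn v (Finset.range N : Set ℕ) := by
    intro i _ j _ hij
    simp only [v] at hij
    rw [div_eq_div_iff (by positivity) (by positivity)] at hij
    have := mul_left_cancel₀ ht0.ne' hij
    have h2 : (i:ℝ) = j := by linarith
    exact_mod_cast h2
  let w : ℕ → ℝ := fun i => (Lagrange.basis (Finset.range N) v i).eval 1
  have hIpol : ∀ q : Polynomial ℝ, q.natDegree ≤ m + 2 * k →
      q.eval 1 = ∑ i ∈ Finset.range N, q.eval (v i) * w i := by
    intro q hq
    have hd : q.degree < (Finset.range N).card := by
      rw [Finset.card_range]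
      refine (Polynomial.degree_le_natDegree).trans_lt ?_
      exact_mod_cast (by omega : q.natDegree < N)
    have h1 := Lagrange.eq_interpolate hvi hd
    conv_lhs => rw [h1]
    rw [Lagrange.interpolate_apply, Polynomial.eval_finsetSum]
    simp [w]
  have hw : ∑ i ∈ Finset.range N, w i = 1 := by
    have := hIpol 1 (by simp)
    simpa using this.symm
  have hpt : ∀ x, (1 + fderiv ℝ s x).det * (1 - c * ‖x + s x - p‖ ^ 2) ^ k
      = ∑ i ∈ Finset.range N, ((1 + v i • fderiv ℝ s x).det *
          (1 - c * ‖x + v i • s x - p‖ ^ 2) ^ k) * w i := by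
    intro x
    obtain ⟨q, hq, hqe⟩ := brouwer_poly k c (fderiv ℝ s x) (x - p) (s x)
    have h1 := hIpol q hq
    simp only [hqe, one_smul, sub_add_eq_add_sub] at h1
    exact h1
  simp_rw [hpt]
  rw [integral_finsetSum]
  · simp_rw [integral_mul_const]
    have : ∀ i, ∫ x in ball 0 r, (1 + v i • fderiv ℝ s x).det *
          (1 - c * ‖x + v i • s x - p‖ ^ 2) ^ k = ∫ x in ball 0 r, (1 - c * ‖x - p‖ ^ 2) ^ k :=
      fun i => H (v i) (hv i) (fun y => (1 - c * ‖y - p‖ ^ 2) ^ k)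
    simp_rw [this]
    rw [← Finset.mul_sum, hw, mul_one]
  · intro i _
    apply IntegrableOn.mono_set _ ball_subset_closedBall
    apply ContinuousOn.integrableOn_compact (isCompact_closedBall _ _)
    apply Continuous.continuousOn
    have h1 := hs.continuous_fderiv one_ne_zero
    have h2 := hs.continuous
    have h3 : Continuous (fun x => (1 + v i • fderiv ℝ s x).det) :=
      ContinuousLinearMap.continuous_det.comp (by fun_prop)
    fun_prop

lemma brouwer_euclid {m : ℕ} (T : EuclideanSpace ℝ (Fin m) → EuclideanSpace ℝ (Fin m))
    (hT : Continuous T) (r : ℝ) (hr : ∀ x, r ≤ ‖x‖ → T x = x) : Function.Surjective T := by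
  intro p
  by_contra hp
  push Not at hp
  by_cases hpr : r ≤ ‖p‖
  · exact hp p (hr p hpr)
  push Not at hpr
  have hr0 : 0 < r := (norm_nonneg p).trans_lt hpr
  -- distance
  obtain ⟨η, hη, hηT⟩ : ∃ η > 0, ∀ x, η ≤ ‖T x - p‖ := by
    obtain ⟨x0, hx0, hmin⟩ := (isCompact_closedBall (0:EuclideanSpace ℝ (Fin m)) r).exists_isMinOn
      ⟨0, by simp [hr0.le]⟩ (f := fun x => ‖T x - p‖) (by fun_prop)
    refine ⟨min ‖T x0 - p‖ (r - ‖p‖), lt_min (norm_pos_iff.2 (sub_ne_zero.2 (hp x0))) (by linarith), ?_⟩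
    intro x
    by_cases hx : r ≤ ‖x‖
    · rw [hr x hx]
      refine (min_le_right _ _).trans ?_
      have := norm_sub_norm_le x p
      linarith
    · exact (min_le_left _ _).trans (hmin (by rw [mem_closedBall_zero_iff]; linarith))
  obtain ⟨s, hs, hsd, hss⟩ := Continuous.exists_contDiff_approx (n := 1) (f := fun x => T x - x)
    (ε := fun _ => η / 2) (by fun_prop) (by fun_prop) (fun _ => by positivity)
  have hsr : ∀ x, r ≤ ‖x‖ → s x = 0 := by
    intro x hx
    by_contra h
    exact (hss h) (by simp [hr x hx])
  have hf : ∀ x, η / 2 ≤ ‖x + s x - p‖ := by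
    intro x
    have h1 := hsd x
    rw [dist_eq_norm] at h1
    have h2 := hηT x
    have h3 : T x - p = (x + s x - p) - (s x - (T x - x)) := by abel
    rw [h3] at h2
    have := norm_sub_le (x + s x - p) (s x - (T x - x))
    linarith
  -- bounds
  obtain ⟨C, hC⟩ := (isCompact_closedBall (0:EuclideanSpace ℝ (Fin m)) r).exists_bound_of_continuousOn
    (f := fun x => (1 + fderiv ℝ s x).det) (by
      have h1 := hs.continuous_fderiv one_ne_zero
      exact (ContinuousLinearMap.continuous_det.comp (by fun_prop)).continuousOn)
  obtain ⟨L0, hL0⟩ := (isCompact_closedBall (0:EuclideanSpace ℝ (Fin m)) r).exists_bound_of_continuousOn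
    (f := fun x => ‖x + s x - p‖ + ‖x - p‖) (by have := hs.continuous; fun_prop)
  set L := max L0 η with hLdef
  have hL : 0 < L := lt_of_lt_of_le hη (le_max_right _ _)
  set c := 1 / L ^ 2 with hc
  have hc0 : 0 < c := by positivity
  have hcL : c * L ^ 2 = 1 := by rw [hc]; field_simp
  have hLx : ∀ x ∈ ball (0:EuclideanSpace ℝ (Fin m)) r, ‖x + s x - p‖ ≤ L ∧ ‖x - p‖ ≤ L := by
    intro x hx
    have h1 := (le_abs_self _).trans (hL0 x (ball_subset_closedBall hx))
    have h2 := h1.trans (le_max_left _ η)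
    constructor
    · linarith [norm_nonneg (x - p)]
    · linarith [norm_nonneg (x + s x - p)]
  set a := 1 - c * (η/2) ^ 2 with ha
  set b := 1 - c * (η/4) ^ 2 with hb
  have hab : a < b := by rw [ha, hb]; nlinarith [mul_pos hc0 (pow_pos hη 2)]
  have ha0 : 0 ≤ a := by
    rw [ha]
    have : (η/2)^2 ≤ L^2 := pow_le_pow_left₀ (by positivity) (by linarith [le_max_right L0 η]) 2
    nlinarith
  set V := (volume (ball (0:EuclideanSpace ℝ (Fin m)) r)).toReal
  set W := (volume (ball p (η/4) ∩ ball 0 r)).toReal with hW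
  have hWpos : 0 < W := by
    apply ENNReal.toReal_pos
    · apply ne_of_gt
      apply IsOpen.measure_pos
      · exact isOpen_ball.inter isOpen_ball
      · exact ⟨p, mem_ball_self (by positivity), by simpa using hpr⟩
    · exact (measure_lt_top_of_subset inter_subset_right measure_ball_lt_top.ne).ne
  have hineq : ∀ k : ℕ, b ^ k * W ≤ C * a ^ k * V := by
    intro k
    have e := brouwer_one s hs r hsr p c k
    have hup : ∫ x in ball 0 r, (1 + fderiv ℝ s x).det * (1 - c * ‖x + s x - p‖ ^ 2) ^ k ≤ C * a ^ k * V := by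
      refine (le_abs_self _).trans ?_
      rw [← Real.norm_eq_abs]
      refine norm_setIntegral_le_of_norm_le_const measure_ball_lt_top ?_
      intro x hx
      rw [norm_mul, norm_pow]
      have h1 := hC x (ball_subset_closedBall hx)
      have h2 : ‖1 - c * ‖x + s x - p‖ ^ 2‖ ≤ a := by
        have h3 := (hLx x hx).1
        have h4 : ‖x + s x - p‖^2 ≤ L^2 := pow_le_pow_left₀ (norm_nonneg _) h3 2
        have h5 : (η/2)^2 ≤ ‖x + s x - p‖^2 := pow_le_pow_left₀ (by positivity) (hf x) 2
        rw [Real.norm_of_nonneg (by nlinarith), ha]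
        nlinarith
      have h6 := pow_le_pow_left₀ (norm_nonneg _) h2 k
      exact mul_le_mul h1 h6 (by positivity) ((norm_nonneg _).trans h1)
    have hIntg : IntegrableOn (fun x => (1 - c * ‖x - p‖ ^ 2) ^ k) (ball (0:EuclideanSpace ℝ (Fin m)) r) := by
      apply IntegrableOn.mono_set _ ball_subset_closedBall
      exact ContinuousOn.integrableOn_compact (isCompact_closedBall _ _) (by fun_prop)
    have hlow : b ^ k * W ≤ ∫ x in ball 0 r, (1 - c * ‖x - p‖ ^ 2) ^ k := by
      have h1 : ∫ x in ball p (η/4) ∩ ball 0 r, b ^ k ≤ ∫ x in ball p (η/4) ∩ ball 0 r, (1 - c * ‖x - p‖ ^ 2) ^ k := by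
        apply setIntegral_mono_on
        · exact integrableOn_const (hs := (measure_lt_top_of_subset inter_subset_right measure_ball_lt_top.ne).ne)
        · exact hIntg.mono_set inter_subset_right
        · exact measurableSet_ball.inter measurableSet_ball
        · intro x hx
          have h2 : ‖x - p‖ < η/4 := by simpa [dist_eq_norm] using hx.1
          have h3 : ‖x - p‖^2 ≤ (η/4)^2 := pow_le_pow_left₀ (norm_nonneg _) h2.le 2
          apply pow_le_pow_left₀ (ha0.trans hab.le)
          rw [hb]; nlinarith
      rw [setIntegral_const, smul_eq_mul, mul_comm] at h1
      refine h1.trans ?_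
      apply setIntegral_mono_set hIntg
      · rw [EventuallyLE, ae_restrict_iff' measurableSet_ball]
        refine Eventually.of_forall fun x hx => ?_
        have h3 := (hLx x hx).2
        have h4 : ‖x - p‖^2 ≤ L^2 := pow_le_pow_left₀ (norm_nonneg _) h3 2
        apply pow_nonneg
        nlinarith
      · exact inter_subset_right.eventuallyLE
    rw [e] at hup
    exact hlow.trans hup
  have hb0 : 0 < b := ha0.trans_lt hab
  have hlim : Tendsto (fun k : ℕ => C * V * (a / b) ^ k) atTop (𝓝 (C * V * 0)) :=
    (tendsto_pow_atTop_nhds_zero_of_lt_one (by positivity) ((div_lt_one hb0).2 hab)).const_mul _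
  have hle : W ≤ C * V * 0 := by
    apply ge_of_tendsto' hlim
    intro k
    rw [div_pow, ← mul_div_assoc, le_div_iff₀ (by positivity)]
    have := hineq k
    linarith
  linarith

lemma brouwer_fin {n : ℕ} (T : (Fin n → ℂ) → (Fin n → ℂ))
    (hT : Continuous T) (r : ℝ) (hr : ∀ x, r ≤ ‖x‖ → T x = x) : Function.Surjective T := by
  let m := Module.finrank ℝ (Fin n → ℂ)
  have hfr : Module.finrank ℝ (Fin n → ℂ) = Module.finrank ℝ (EuclideanSpace ℝ (Fin m)) := by
    simp [m]
  let e : (Fin n → ℂ) ≃L[ℝ] EuclideanSpace ℝ (Fin m) := ContinuousLinearEquiv.ofFinrankEq hfr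
  have h := brouwer_euclid (fun x => e (T (e.symm x))) (by fun_prop)
    (‖(e : (Fin n → ℂ) →L[ℝ] EuclideanSpace ℝ (Fin m))‖ * r) (by
      intro x hx
      by_cases h : r ≤ ‖e.symm x‖
      · rw [hr _ h]; simp
      · push Not at h
        by_cases hz : ‖(e : (Fin n → ℂ) →L[ℝ] EuclideanSpace ℝ (Fin m))‖ = 0
        · have h0 : ∀ y, e y = 0 := fun y => by
            have := (e : (Fin n → ℂ) →L[ℝ] EuclideanSpace ℝ (Fin m)).le_opNorm y
            rw [hz, zero_mul] at this
            exact norm_le_zero_iff.1 this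
          have h1 : x = 0 := by rw [← e.apply_symm_apply x, h0]
          rw [h0, h1]
        · exfalso
          have h1 := (e : (Fin n → ℂ) →L[ℝ] EuclideanSpace ℝ (Fin m)).le_opNorm (e.symm x)
          simp only [ContinuousLinearEquiv.coe_coe, ContinuousLinearEquiv.apply_symm_apply] at h1
          have h2 : 0 < ‖(e : (Fin n → ℂ) →L[ℝ] EuclideanSpace ℝ (Fin m))‖ :=
            lt_of_le_of_ne (norm_nonneg _) (Ne.symm hz)
          nlinarith)
  intro y
  obtain ⟨x, hx⟩ := h (e y)
  exact ⟨e.symm x, e.injective hx⟩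

end Brouwer



section Cone
open scoped Topology

lemma cone_boundary {E : Type*} [NormedAddCommGroup E] [NormedSpace ℝ E] (A : Set E)
    (hA : IsClosed A) (N : E → (E →L[ℝ] ℝ)) (hN : ContinuousOn N (frontier A))
    (hne : ∀ p ∈ frontier A, N p ≠ 0)
    (hout : ∀ p ∈ frontier A, ∀ ε > (0:ℝ), ∃ δ > (0:ℝ), ∀ d : E, ‖d‖ < δ → ε * ‖d‖ < N p d → p + d ∉ A)
    (hin : ∀ p ∈ frontier A, ∀ ε > (0:ℝ), ∃ δ > (0:ℝ), ∀ d : E, ‖d‖ < δ → N p d < - ε * ‖d‖ → p + d ∈ A) :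
    CkBoundary 1 A := by
  intro p0 hp0
  obtain ⟨ν, hν⟩ : ∃ ν, 0 < N p0 ν := by
    obtain ⟨v, hv⟩ : ∃ v, N p0 v ≠ 0 := by
      by_contra h; push Not at h
      exact hne p0 hp0 (ContinuousLinearMap.ext (by simpa using h))
    rcases lt_or_gt_of_ne hv with h | h
    · exact ⟨-v, by simpa using h⟩
    · exact ⟨v, h⟩
  have hν0 : ν ≠ 0 := by rintro rfl; simp at hν
  have hνn : 0 < ‖ν‖ := norm_pos_iff.2 hν0
  obtain ⟨r, hr, hrN⟩ : ∃ r > 0, ∀ p ∈ frontier A, ‖p - p0‖ < r → 0 < N p ν := by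
    have h1 : ContinuousWithinAt (fun p => N p ν) (frontier A) p0 :=
      (hN p0 hp0).clm_apply continuousWithinAt_const
    have h2 := h1.eventually (lt_mem_nhds hν)
    obtain ⟨r, hr, h⟩ := Metric.mem_nhdsWithin_iff.1 h2
    exact ⟨r, hr, fun p hp hpr => h ⟨by rwa [mem_ball, dist_eq_norm], hp⟩⟩
  -- short moves along ν
  have hup : ∀ p ∈ frontier A, ‖p - p0‖ < r → ∃ δ > (0:ℝ), ∀ s ∈ Ioo 0 δ, p + s • ν ∉ A := by
    intro p hp hpr
    have hpos := hrN p hp hpr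
    obtain ⟨δ, hδ, h⟩ := hout p hp (N p ν / (2 * ‖ν‖)) (by positivity)
    refine ⟨δ / ‖ν‖, by positivity, fun s hs => h _ ?_ ?_⟩
    · rw [norm_smul, Real.norm_of_nonneg hs.1.le]; exact (lt_div_iff₀ hνn).1 hs.2
    · rw [norm_smul, Real.norm_of_nonneg hs.1.le, map_smul, smul_eq_mul]
      have : N p ν / (2 * ‖ν‖) * (s * ‖ν‖) = s * N p ν / 2 := by field_simp
      rw [this]; have := mul_pos hs.1 hpos; linarith
  have hdown : ∀ p ∈ frontier A, ‖p - p0‖ < r → ∃ δ > (0:ℝ), ∀ s ∈ Ioo 0 δ, p - s • ν ∈ A := by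
    intro p hp hpr
    have hpos := hrN p hp hpr
    obtain ⟨δ, hδ, h⟩ := hin p hp (N p ν / (2 * ‖ν‖)) (by positivity)
    refine ⟨δ / ‖ν‖, by positivity, fun s hs => ?_⟩
    rw [sub_eq_add_neg]
    refine h _ ?_ ?_
    · rw [norm_neg, norm_smul, Real.norm_of_nonneg hs.1.le]; exact (lt_div_iff₀ hνn).1 hs.2
    · rw [norm_neg, norm_smul, Real.norm_of_nonneg hs.1.le, map_neg, map_smul, smul_eq_mul]
      have : -(N p ν / (2 * ‖ν‖)) * (s * ‖ν‖) = - (s * N p ν / 2) := by field_simp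
      rw [this]; have := mul_pos hs.1 hpos; linarith
  set H := r / (2 * ‖ν‖) with hH
  have hHpos : 0 < H := by positivity
  have hbox : ∀ x, ‖x - p0‖ < r / 2 → ∀ s, |s| ≤ H → ‖x + s • ν - p0‖ < r := by
    intro x hx s hs
    have h1 : x + s • ν - p0 = (x - p0) + s • ν := by abel
    rw [h1]
    have h2 := norm_add_le (x - p0) (s • ν)
    rw [norm_smul, Real.norm_eq_abs] at h2
    have h3 : |s| * ‖ν‖ ≤ r / 2 := by
      have := mul_le_mul_of_nonneg_right hs hνn.le
      have e : H * ‖ν‖ = r / 2 := by rw [hH]; field_simp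
      linarith
    linarith
  have hmono : ∀ x, ‖x - p0‖ < r / 2 → ∀ s0 s, -H ≤ s → s ≤ s0 → s0 ≤ H → x + s0 • ν ∈ A →
      x + s • ν ∈ A := by
    intro x hx s0 s hs hss hs0 hxA
    have key : Icc 0 (s0 - s) ⊆ {u : ℝ | x + (s0 - u) • ν ∈ A} := by
      apply IsClosed.Icc_subset_of_forall_exists_gt
      · exact (hA.preimage (by fun_prop : Continuous fun u : ℝ => x + (s0 - u) • ν)).inter isClosed_Icc
      · simpa using hxA
      · rintro u ⟨huA, hu0, hu1⟩ y hy
        have huA : x + (s0 - u) • ν ∈ A := huA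
        by_cases hIntg : x + (s0 - u) • ν ∈ interior A
        · have hc : Continuous fun u : ℝ => x + (s0 - u) • ν := by fun_prop
          have hnh := hc.continuousAt.preimage_mem_nhds (isOpen_interior.mem_nhds hIntg)
          have h3 : ∀ᶠ u' in 𝓝[>] u, x + (s0 - u') • ν ∈ interior A := nhdsWithin_le_nhds hnh
          obtain ⟨u', hu', hu''⟩ := (h3.and (Ioc_mem_nhdsGT hy)).exists
          exact ⟨u', interior_subset (s := A) hu', hu''⟩
        · have hfr : x + (s0 - u) • ν ∈ frontier A := by
            rw [hA.frontier_eq]; exact ⟨huA, hIntg⟩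
          obtain ⟨δ, hδ, hd⟩ := hdown _ hfr (hbox x hx _ (abs_le.2 ⟨by linarith, by linarith⟩))
          have hy' : u < y := hy
          refine ⟨u + min (δ/2) (y - u), ?_, ?_, ?_⟩
          · have := hd (min (δ/2) (y - u)) ⟨lt_min (by linarith) (by linarith), (min_le_left _ _).trans_lt (by linarith)⟩
            show x + (s0 - (u + min (δ/2) (y - u))) • ν ∈ A
            convert this using 1
            rw [← sub_sub, sub_smul (s0 - u)]; abel
          · have : 0 < min (δ/2) (y - u) := lt_min (by linarith) (by linarith)
            linarith
          · have := min_le_right (δ/2) (y - u); linarith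
    have := key (show s0 - s ∈ Icc 0 (s0 - s) from ⟨by linarith, le_rfl⟩)
    simpa using this
  have hstrict : ∀ x, ‖x - p0‖ < r / 2 → ∀ s0 s, -H ≤ s → s < s0 → s0 ≤ H → x + s0 • ν ∈ A →
      x + s • ν ∈ interior A := by
    intro x hx s0 s hs hss hs0 hxA
    by_contra hni
    have hfr : x + s • ν ∈ frontier A := by
      rw [hA.frontier_eq]; exact ⟨hmono x hx s0 s hs hss.le hs0 hxA, hni⟩
    obtain ⟨δ, hδ, hd⟩ := hup _ hfr (hbox x hx _ (abs_le.2 ⟨by linarith, by linarith⟩))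
    have hm : 0 < min (δ/2) (s0 - s) := lt_min (by linarith) (by linarith)
    apply hd (min (δ/2) (s0 - s)) ⟨hm, (min_le_left _ _).trans_lt (by linarith)⟩
    rw [add_assoc, ← add_smul]
    exact hmono x hx s0 _ (by linarith) (by linarith [min_le_right (δ/2) (s0 - s)]) hs0 hxA
  have hp0A : p0 ∈ A := hA.frontier_subset hp0
  obtain ⟨h, hh0, hhH, hhA⟩ : ∃ h > 0, h ≤ H ∧ p0 + h • ν ∉ A := by
    obtain ⟨δ, hδ, hd⟩ := hup p0 hp0 (by simpa using hr)
    refine ⟨min (δ/2) H, lt_min (by linarith) hHpos, min_le_right _ _, hd _ ⟨lt_min (by linarith) hHpos, ?_⟩⟩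
    exact (min_le_left _ _).trans_lt (by linarith)
  have hp0i : p0 + (-h) • ν ∈ interior A :=
    hstrict p0 (by simpa using hr) 0 (-h) (by linarith) (by linarith) hHpos.le (by simpa using hp0A)
  set U : Set E := {x | ‖x - p0‖ < r / 2 ∧ x + h • ν ∈ Aᶜ ∧ x + (-h) • ν ∈ interior A} with hU
  have hUo : IsOpen U := by
    refine IsOpen.and (isOpen_lt (by fun_prop) (by fun_prop)) (IsOpen.and ?_ ?_)
    · exact hA.isOpen_compl.preimage (by fun_prop : Continuous fun x : E => x + h • ν)
    · exact isOpen_interior.preimage (by fun_prop : Continuous fun x : E => x + (-h) • ν)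
  have hp0U : p0 ∈ U := ⟨by simpa using hr, hhA, hp0i⟩
  let σ : E → ℝ := fun x => sSup {s | s ∈ Icc (-h) h ∧ x + s • ν ∈ A}
  have hσ : ∀ x ∈ U, -h < σ x ∧ σ x < h ∧ (∀ s ∈ Icc (-h) h, (x + s • ν ∈ A ↔ s ≤ σ x)) := by
    rintro x ⟨hx, hx1, hx2⟩
    set S := {s | s ∈ Icc (-h) h ∧ x + s • ν ∈ A} with hS
    have hSc : IsCompact S := by
      apply isCompact_Icc.inter_right
      exact hA.preimage (by fun_prop : Continuous fun s : ℝ => x + s • ν)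
    have hSne : S.Nonempty := ⟨-h, ⟨le_rfl, by linarith⟩, interior_subset hx2⟩
    have hmem : σ x ∈ S := hSc.sSup_mem hSne
    have hiff : ∀ s ∈ Icc (-h) h, (x + s • ν ∈ A ↔ s ≤ σ x) := by
      intro s hs
      constructor
      · intro h1; exact le_csSup hSc.bddAbove ⟨hs, h1⟩
      · intro h1; exact hmono x hx (σ x) s (by linarith [hs.1]) h1 (by linarith [hmem.1.2]) hmem.2
    refine ⟨?_, ?_, hiff⟩
    · have hc : Continuous fun u : ℝ => x + u • ν := by fun_prop
      have hnh := hc.continuousAt.preimage_mem_nhds (isOpen_interior.mem_nhds hx2)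
      have h3 : ∀ᶠ u' in 𝓝[>] (-h), x + u' • ν ∈ interior A := nhdsWithin_le_nhds hnh
      obtain ⟨u', hu', hu''⟩ := (h3.and (Ioc_mem_nhdsGT (show -h < h by linarith))).exists
      have := (hiff u' ⟨hu''.1.le, hu''.2⟩).1 (interior_subset hu')
      linarith [hu''.1]
    · refine lt_of_le_of_ne hmem.1.2 ?_
      intro he
      apply hx1
      rw [← he]; exact hmem.2
  have hq : ∀ x ∈ U, x + σ x • ν ∈ frontier A := by
    intro x hx
    obtain ⟨h1, h2, h3⟩ := hσ x hx
    rw [hA.frontier_eq]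
    refine ⟨(h3 _ ⟨h1.le, h2.le⟩).2 le_rfl, ?_⟩
    intro hIntg
    have hc : Continuous fun u : ℝ => x + u • ν := by fun_prop
    have hnh := hc.continuousAt.preimage_mem_nhds (isOpen_interior.mem_nhds hIntg)
    have h4 : ∀ᶠ u' in 𝓝[>] (σ x), x + u' • ν ∈ interior A := nhdsWithin_le_nhds hnh
    obtain ⟨u', hu', hu''⟩ := (h4.and (Ioc_mem_nhdsGT h2)).exists
    have := (h3 u' ⟨by linarith [hu''.1], hu''.2⟩).1 (interior_subset hu')
    linarith [hu''.1]
  have hNq : ∀ x ∈ U, 0 < N (x + σ x • ν) ν := by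
    intro x hx
    obtain ⟨h1, h2, h3⟩ := hσ x hx
    exact hrN _ (hq x hx) (hbox x hx.1 _ (abs_le.2 ⟨by linarith, by linarith⟩))
  have hder : ∀ x ∈ U, HasFDerivAt (fun x => - σ x) ((N (x + σ x • ν) ν)⁻¹ • N (x + σ x • ν)) x := by
    intro x hx
    obtain ⟨hs1, hs2, hs3⟩ := hσ x hx
    set q := x + σ x • ν with hqdef
    set c := N q ν with hc
    have hc0 : 0 < c := hNq x hx
    rw [hasFDerivAt_iff_isLittleO_nhds_zero, Asymptotics.isLittleO_iff]
    intro ε hε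
    set C := 1 + (‖N q‖ / c + ε) * ‖ν‖ with hC
    have hC0 : 0 < C := by positivity
    obtain ⟨δ1, hδ1, ho⟩ := hout q (hq x hx) (ε * c / (2 * C)) (by positivity)
    obtain ⟨δ2, hδ2, hi⟩ := hin q (hq x hx) (ε * c / (2 * C)) (by positivity)
    set B := ‖N q‖ / c + ε with hB
    have hB0 : 0 < B := by positivity
    have hm : 0 < min (h - σ x) (σ x + h) := lt_min (by linarith) (by linarith)
    have ev1 : ∀ᶠ d : E in 𝓝 0, x + d ∈ U := by
      have : ContinuousAt (fun d : E => x + d) 0 := by fun_prop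
      exact this.preimage_mem_nhds (by simpa using hUo.mem_nhds hx)
    have ev2 : ∀ᶠ d : E in 𝓝 0, C * ‖d‖ < min δ1 δ2 := by
      have : ContinuousAt (fun d : E => C * ‖d‖) 0 := by fun_prop
      exact this.eventually (gt_mem_nhds (by simpa using And.intro hδ1 hδ2))
    have ev3 : ∀ᶠ d : E in 𝓝 0, B * ‖d‖ < min (h - σ x) (σ x + h) := by
      have : ContinuousAt (fun d : E => B * ‖d‖) 0 := by fun_prop
      exact this.eventually (gt_mem_nhds (by simpa using hm))
    filter_upwards [ev1, ev2, ev3] with d hd1 hd2 hd3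
    obtain ⟨ht1, ht2, ht3⟩ := hσ (x + d) hd1
    by_cases hd0 : d = 0
    · simp [hd0]
    have hdn : 0 < ‖d‖ := norm_pos_iff.2 hd0
    set a := N q d / c with ha
    have hab : |a| ≤ ‖N q‖ / c * ‖d‖ := by
      rw [ha, abs_div, abs_of_pos hc0, div_mul_eq_mul_div]
      exact div_le_div_of_nonneg_right ((N q).le_opNorm d) hc0.le
    have hac : a * c = N q d := by rw [ha]; field_simp
    have gen : ∀ τ : ℝ, |τ| ≤ ε → ‖d + (- a + τ * ‖d‖) • ν‖ ≤ C * ‖d‖ ∧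
        N q (d + (- a + τ * ‖d‖) • ν) = τ * ‖d‖ * c ∧ σ x + (-a + τ * ‖d‖) ∈ Icc (-h) h := by
      intro τ hτ
      have hb : |-a + τ * ‖d‖| ≤ B * ‖d‖ := by
        refine (abs_add_le _ _).trans ?_
        rw [abs_neg, abs_mul, abs_of_pos hdn, hB]
        nlinarith
      refine ⟨?_, ?_, ?_⟩
      · refine (norm_add_le _ _).trans ?_
        rw [norm_smul, Real.norm_eq_abs]
        have := mul_le_mul_of_nonneg_right hb hνn.le
        rw [hC]; nlinarith
      · rw [map_add, map_smul, smul_eq_mul, ← hc, ← hac]; ring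
      · have h1 := abs_le.1 hb
        have h2 := hd3.trans_le (min_le_left _ _)
        have h3 := hd3.trans_le (min_le_right _ _)
        constructor <;> linarith
    have eqp : ∀ τ : ℝ, x + d + (σ x + (-a + τ * ‖d‖)) • ν = q + (d + (- a + τ * ‖d‖) • ν) := by
      intro τ; rw [hqdef, add_smul]; abel
    have hk : ∀ y : ℝ, y ≤ C * ‖d‖ → ε * c / (2 * C) * y < ε * ‖d‖ * c := by
      intro y hy
      have h1 : ε * c / (2 * C) * y ≤ ε * c / (2 * C) * (C * ‖d‖) :=
        mul_le_mul_of_nonneg_left hy (by positivity)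
      have h2 : ε * c / (2 * C) * (C * ‖d‖) = ε * ‖d‖ * c / 2 := by field_simp
      have h3 : 0 < ε * ‖d‖ * c := by positivity
      linarith
    have up : σ (x + d) < σ x + (-a + ε * ‖d‖) := by
      obtain ⟨g1, g2, g3⟩ := gen ε (abs_of_pos hε).le
      have := ho (d + (- a + ε * ‖d‖) • ν) (g1.trans_lt (hd2.trans_le (min_le_left _ _)))
        (by rw [g2]; exact hk _ g1)
      rw [← eqp, ht3 _ g3] at this
      exact not_le.1 this
    have lo : σ x + (-a + (-ε) * ‖d‖) ≤ σ (x + d) := by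
      obtain ⟨g1, g2, g3⟩ := gen (-ε) (by rw [abs_neg]; exact (abs_of_pos hε).le)
      have := hi (d + (- a + (-ε) * ‖d‖) • ν) (g1.trans_lt (hd2.trans_le (min_le_right _ _)))
        (by rw [g2]; have := hk _ g1; nlinarith)
      rw [← eqp, ht3 _ g3] at this
      exact this
    have e1 : (c⁻¹ • N q) d = a := by
      rw [ha, smul_apply, smul_eq_mul, div_eq_inv_mul]
    rw [e1, Real.norm_eq_abs, abs_le]
    constructor <;> linarith
  refine ⟨U, hUo, hp0U, fun x => - σ x, ?_, ?_, ?_⟩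
  · have hdiff : DifferentiableOn ℝ (fun x => - σ x) U :=
      fun x hx => (hder x hx).differentiableAt.differentiableWithinAt
    rw [show ((1:ℕ) : WithTop ℕ∞) = 1 by rfl]
    rw [← zero_add 1, contDiffOn_succ_iff_fderiv_of_isOpen hUo]
    refine ⟨hdiff, by simp, contDiffOn_zero.2 ?_⟩
    have hσc : ContinuousOn σ U := by
      exact hdiff.continuousOn.neg.congr fun x _ => by simp
    have hqc : ContinuousOn (fun x => N (x + σ x • ν)) U := by
      refine hN.comp ?_ (fun x hx => hq x hx)
      exact continuousOn_id.add (hσc.smul continuousOn_const)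
    have : ContinuousOn (fun x => (N (x + σ x • ν) ν)⁻¹ • N (x + σ x • ν)) U := by
      refine ContinuousOn.smul (ContinuousOn.inv₀ (hqc.clm_apply continuousOn_const) ?_) hqc
      intro x hx; exact (hNq x hx).ne'
    exact this.congr fun x hx => (hder x hx).fderiv
  · intro x hx h0
    rw [(hder x hx).fderiv] at h0
    have := congrArg (fun L : E →L[ℝ] ℝ => L ν) h0
    simp only [smul_apply, smul_eq_mul, zero_apply] at this
    rw [inv_mul_cancel₀ (hNq x hx).ne'] at this
    exact one_ne_zero this
  · ext x
    constructor
    · rintro ⟨hxf, hxU⟩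
      refine ⟨?_, hxU⟩
      obtain ⟨h1, h2, h3⟩ := hσ x hxU
      have hxA : x ∈ A := hA.frontier_subset hxf
      have h4 := (h3 0 ⟨by linarith, by linarith⟩).1 (by simpa using hxA)
      have h5 : σ x ≤ 0 := by
        by_contra hpos
        push Not at hpos
        have := hstrict x hxU.1 (σ x) 0 (by linarith) hpos (by linarith) ((h3 _ ⟨h1.le, h2.le⟩).2 le_rfl)
        rw [hA.frontier_eq] at hxf
        exact hxf.2 (by simpa using this)
      show - σ x = 0
      linarith
    · rintro ⟨hx0, hxU⟩
      have hx0 : - σ x = 0 := hx0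
      refine ⟨?_, hxU⟩
      have := hq x hxU
      have e : σ x = 0 := by linarith
      rwa [e, zero_smul, add_zero] at this
end Cone



section Hull
open scoped Topology
variable {n : ℕ}

/-- uniform approximability by polynomials on a set -/
def PolyApprox (X : Set (ℂ × (Fin n → ℂ))) (q : ℂ × (Fin n → ℂ) → ℂ) : Prop :=
  ∀ ε > (0:ℝ), ∃ P : MvPolynomial (Fin (n+1)) ℂ, ∀ p ∈ X, ‖q p - MvPolynomial.eval (pcoords p) P‖ ≤ ε

lemma subset_polyHull (X : Set (ℂ × (Fin n → ℂ))) : X ⊆ polyHull X :=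
  fun p hp _ _ h => h p hp

lemma continuous_pcoords : Continuous (pcoords : ℂ × (Fin n → ℂ) → (Fin (n+1) → ℂ)) := by
  apply continuous_pi
  intro i
  refine Fin.cases ?_ (fun j => ?_) i
  · simpa [pcoords] using continuous_fst
  · simp only [pcoords, Fin.cons_succ]; fun_prop

lemma pcoords_zero (p : ℂ × (Fin n → ℂ)) : pcoords p 0 = p.1 := rfl
lemma pcoords_succ (p : ℂ × (Fin n → ℂ)) (j : Fin n) : pcoords p j.succ = p.2 j := by
  simp [pcoords]

lemma pcoords_surj (x : Fin (n+1) → ℂ) : ∃ p, pcoords p = x :=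
  ⟨(x 0, fun j => x j.succ), by
    ext i; refine Fin.cases ?_ (fun j => ?_) i
    · rfl
    · simp [pcoords]⟩

lemma continuous_peval (P : MvPolynomial (Fin (n+1)) ℂ) :
    Continuous (fun p : ℂ × (Fin n → ℂ) => MvPolynomial.eval (pcoords p) P) :=
  (MvPolynomial.continuous_eval P).comp continuous_pcoords

lemma isClosed_polyHull (X : Set (ℂ × (Fin n → ℂ))) : IsClosed (polyHull X) := by
  have : polyHull X = ⋂ P : MvPolynomial (Fin (n+1)) ℂ, ⋂ M : ℝ,
      ⋂ _ : (∀ q ∈ X, ‖MvPolynomial.eval (pcoords q) P‖ ≤ M),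
        {p | ‖MvPolynomial.eval (pcoords p) P‖ ≤ M} := by
    ext p; simp only [polyHull, mem_iInter, mem_ofPred_eq]
  rw [this]
  refine isClosed_iInter fun P => isClosed_iInter fun M => isClosed_iInter fun _ => ?_
  exact isClosed_le (continuous_peval P).norm continuous_const

lemma PolyApprox.norm_le {X : Set (ℂ × (Fin n → ℂ))} {q : ℂ × (Fin n → ℂ) → ℂ}
    (hq : PolyApprox (polyHull X) q) {M : ℝ} (hM : ∀ p ∈ X, ‖q p‖ ≤ M) :
    ∀ p ∈ polyHull X, ‖q p‖ ≤ M := by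
  intro p hp
  apply le_of_forall_pos_le_add
  intro ε hε
  obtain ⟨P, hP⟩ := hq (ε/2) (by positivity)
  have h1 := hp P (M + ε/2) (fun x hx => by
    have h2 := hP x (subset_polyHull X hx)
    have h3 := norm_le_norm_add_norm_sub (q x) (MvPolynomial.eval (pcoords x) P)
    linarith [hM x hx])
  have h2 := hP p hp
  have h3 := norm_le_norm_add_norm_sub' (q p) (MvPolynomial.eval (pcoords p) P)
  linarith

lemma aux_char {Y : Type*} [TopologicalSpace Y] [CompactSpace Y] [Nonempty Y]
    (S : Subalgebra ℂ C(Y, ℂ)) (hS : IsClosed (S : Set C(Y, ℂ))) (χ : S →ₐ[ℂ] ℂ) (a : S) :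
    ‖χ a‖ ≤ ‖(a : C(Y, ℂ))‖ := by
  have : CompleteSpace S := hS.completeSpace_coe
  have : NormOneClass S := ⟨show ‖(1 : C(Y, ℂ))‖ = 1 from norm_one⟩
  exact AlgHom.norm_apply_le_self χ a

lemma aux_exists {Y : Type*} [TopologicalSpace Y] [CompactSpace Y] [Nonempty Y]
    (S : Subalgebra ℂ C(Y, ℂ)) (hS : IsClosed (S : Set C(Y, ℂ))) (a : S) (ha : ¬ IsUnit a) :
    ∃ χ : S →ₐ[ℂ] ℂ, χ a = 0 := by
  have : CompleteSpace S := hS.completeSpace_coe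
  have : Nontrivial S := inferInstance
  obtain ⟨χ, hχ⟩ := WeakDual.CharacterSpace.exists_apply_eq_zero ha
  exact ⟨WeakDual.CharacterSpace.toAlgHom χ, hχ⟩

lemma hull_lower_bound {X : Set (ℂ × (Fin n → ℂ))} (hX : IsCompact X) (hne : X.Nonempty)
    {q : ℂ × (Fin n → ℂ) → ℂ} (hq : PolyApprox (polyHull X) q)
    (hq0 : ∀ p ∈ polyHull X, q p ≠ 0) {δ : ℝ} (hδ : 0 < δ) (hqX : ∀ p ∈ X, δ ≤ ‖q p‖) :
    ∀ p ∈ polyHull X, δ ≤ ‖q p‖ := by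
  have : CompactSpace X := isCompact_iff_compactSpace.1 hX
  have : Nonempty X := hne.to_subtype
  let c : Fin (n+1) → C(X, ℂ) := fun i => ⟨fun x => pcoords x.1 i,
    (continuous_apply i).comp (continuous_pcoords.comp continuous_subtype_val)⟩
  let S0 : Subalgebra ℂ C(X, ℂ) := (MvPolynomial.aeval (R := ℂ) c).range
  let S : Subalgebra ℂ C(X, ℂ) := S0.topologicalClosure
  have hScl : IsClosed (S : Set C(X, ℂ)) := Subalgebra.isClosed_topologicalClosure S0
  have hev : ∀ (P : MvPolynomial (Fin (n+1)) ℂ) (x : X),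
      (MvPolynomial.aeval c P) x = MvPolynomial.eval (pcoords x.1) P := by
    intro P x
    have := MvPolynomial.comp_aeval_apply (f := c) (ContinuousMap.evalAlgHom ℂ ℂ x) P
    simp only [ContinuousMap.evalAlgHom_apply] at this
    rw [this, MvPolynomial.aeval_eq_eval]; rfl
  have hmem : ∀ P : MvPolynomial (Fin (n+1)) ℂ, MvPolynomial.aeval c P ∈ S :=
    fun P => S0.le_topologicalClosure ⟨P, rfl⟩
  choose! Pk hPk using fun k : ℕ => hq (1 / ((k:ℝ) + 1)) (by positivity)
  have hqc : Continuous (fun x : X => q x.1) := by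
    have : TendstoUniformly (fun (k : ℕ) (x : X) => MvPolynomial.eval (pcoords x.1) (Pk k))
        (fun x : X => q x.1) atTop := by
      rw [Metric.tendstoUniformly_iff]
      intro ε hε
      filter_upwards [(tendsto_one_div_add_atTop_nhds_zero_nat (𝕜 := ℝ)).eventually (gt_mem_nhds hε)] with k hk x
      rw [dist_eq_norm]
      exact (hPk k x.1 (subset_polyHull X x.2)).trans_lt hk
    refine this.continuous (Frequently.of_forall fun k => ?_)
    exact (continuous_peval (Pk k)).comp continuous_subtype_val
  let Q : C(X, ℂ) := ⟨fun x => q x.1, hqc⟩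
  have hQlim : Tendsto (fun k => MvPolynomial.aeval c (Pk k)) atTop (𝓝 Q) := by
    rw [tendsto_iff_norm_sub_tendsto_zero]
    refine squeeze_zero (fun _ => norm_nonneg _) (fun k => ?_) (tendsto_one_div_add_atTop_nhds_zero_nat (𝕜 := ℝ))
    rw [ContinuousMap.norm_le _ (by positivity)]
    intro x
    rw [ContinuousMap.sub_apply, hev, norm_sub_rev]
    exact hPk k x.1 (subset_polyHull X x.2)
  have hQS : Q ∈ S := (Subalgebra.isClosed_topologicalClosure S0).mem_of_tendsto hQlim
    (Eventually.of_forall fun k => hmem _)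
  have hunit : IsUnit (⟨Q, hQS⟩ : S) := by
    by_contra hnu
    obtain ⟨χa, hχ⟩ := aux_exists S hScl _ hnu
    let cS : Fin (n+1) → S := fun i => ⟨c i, by simpa using hmem (MvPolynomial.X i)⟩
    obtain ⟨p, hp⟩ := pcoords_surj (fun i => χa (cS i))
    have hval : ∀ P : MvPolynomial (Fin (n+1)) ℂ, χa ⟨MvPolynomial.aeval c P, hmem P⟩ =
        MvPolynomial.eval (pcoords p) P := by
      intro P
      have h1 : (⟨MvPolynomial.aeval c P, hmem P⟩ : S) = MvPolynomial.aeval cS P := by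
        apply Subtype.ext
        have := MvPolynomial.comp_aeval_apply (f := cS) S.val P
        rw [Subalgebra.coe_val] at this
        rw [this]
      rw [h1, MvPolynomial.comp_aeval_apply, hp, MvPolynomial.aeval_eq_eval]
    have hpX : p ∈ polyHull X := by
      intro P M hM
      have hM0 : 0 ≤ M := (norm_nonneg _).trans (hM _ hne.some_mem)
      rw [← hval]
      refine (aux_char S hScl χa _).trans ?_
      show ‖MvPolynomial.aeval c P‖ ≤ M
      rw [ContinuousMap.norm_le _ hM0]
      intro x; rw [hev]; exact hM _ x.2
    apply hq0 p hpX
    have hl1 : Tendsto (fun k => MvPolynomial.eval (pcoords p) (Pk k)) atTop (𝓝 (χa ⟨Q, hQS⟩)) := by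
      rw [tendsto_iff_norm_sub_tendsto_zero]
      refine squeeze_zero (fun _ => norm_nonneg _) (fun k => ?_)
        (tendsto_iff_norm_sub_tendsto_zero.1 hQlim)
      rw [← hval, ← map_sub]
      exact aux_char S hScl χa _
    have hl2 : Tendsto (fun k => MvPolynomial.eval (pcoords p) (Pk k)) atTop (𝓝 (q p)) := by
      rw [tendsto_iff_norm_sub_tendsto_zero]
      refine squeeze_zero (fun _ => norm_nonneg _) (fun k => ?_) (tendsto_one_div_add_atTop_nhds_zero_nat (𝕜 := ℝ))
      rw [norm_sub_rev]; exact hPk k p hpX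
    exact (tendsto_nhds_unique hl2 hl1).trans hχ
  obtain ⟨h, hh⟩ := hunit.exists_right_inv
  have hQh : ∀ x : X, q x.1 * (h : C(X, ℂ)) x = 1 := by
    intro x
    have := congrArg (fun s : S => (s : C(X, ℂ)) x) hh
    exact this
  have hhS : (h : C(X, ℂ)) ∈ closure (S0 : Set C(X, ℂ)) := h.2
  intro p hp
  apply le_of_forall_pos_le_add
  intro ε hε
  -- norm bound of `q` on the hull
  obtain ⟨B, hB⟩ : ∃ B : ℝ, ∀ x ∈ X, ‖q x‖ ≤ B := by
    refine ⟨‖Q‖, fun x hx => Q.norm_coe_le_norm ⟨x, hx⟩⟩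
  have hBp := hq.norm_le hB
  have hB0 : 0 ≤ B := (norm_nonneg _).trans (hB _ hne.some_mem)
  obtain ⟨η, hη0, hη1⟩ : ∃ η > 0, η * (2 * δ * B + 1) ≤ ε := by
    refine ⟨ε / (2 * δ * B + 1), by positivity, le_of_eq ?_⟩
    have : 2 * δ * B + 1 ≠ 0 := by positivity
    field_simp
  obtain ⟨_, ⟨H, rfl⟩, hH⟩ := Metric.mem_closure_iff.1 hhS η hη0
  have hHx : ∀ x ∈ X, ‖(1 / q x) - MvPolynomial.eval (pcoords x) H‖ ≤ η := by
    intro x hx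
    have h1 := hQh ⟨x, hx⟩
    have h2 : 1 / q x = (h : C(X, ℂ)) ⟨x, hx⟩ := by
      rw [one_div]; exact inv_eq_of_mul_eq_one_right h1
    have h3 := ((h : C(X, ℂ)) - MvPolynomial.aeval c H).norm_coe_le_norm ⟨x, hx⟩
    rw [ContinuousMap.sub_apply, hev] at h3
    rw [h2]
    rw [dist_eq_norm] at hH
    exact h3.trans hH.le
  have hHp : ‖MvPolynomial.eval (pcoords p) H‖ ≤ 1 / δ + η := by
    apply hp
    intro x hx
    have h1 := norm_le_norm_add_norm_sub (1 / q x) (MvPolynomial.eval (pcoords x) H)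
    have h2 : ‖1 / q x‖ ≤ 1 / δ := by
      rw [norm_div, norm_one]; exact one_div_le_one_div_of_le hδ (hqX x hx)
    linarith [hHx x hx]
  have hprod : PolyApprox (polyHull X) (fun x => q x * MvPolynomial.eval (pcoords x) H - 1) := by
    intro e he
    obtain ⟨M, hM0, hM⟩ : ∃ M > 0, ∀ x ∈ polyHull X, ‖MvPolynomial.eval (pcoords x) H‖ ≤ M := by
      obtain ⟨M, hM⟩ := (hX.image (continuous_peval H)).isBounded.exists_norm_le
      refine ⟨|M| + 1, by positivity, fun x hx => hx _ _ fun y hy => ?_⟩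
      exact (hM _ ⟨y, hy, rfl⟩).trans (by linarith [le_abs_self M])
    obtain ⟨P1, hP1⟩ := hq (e / M) (by positivity)
    refine ⟨P1 * H - 1, fun x hx => ?_⟩
    have : q x * MvPolynomial.eval (pcoords x) H - 1 - MvPolynomial.eval (pcoords x) (P1 * H - 1)
        = (q x - MvPolynomial.eval (pcoords x) P1) * MvPolynomial.eval (pcoords x) H := by
      simp; ring
    rw [this, norm_mul]
    calc _ ≤ e / M * M := mul_le_mul (hP1 x hx) (hM x hx) (norm_nonneg _) (by positivity)
      _ = e := by field_simp
  have h1 : ‖q p * MvPolynomial.eval (pcoords p) H - 1‖ ≤ B * η := by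
    refine hprod.norm_le (M := B * η) (fun x hx => ?_) p hp
    have hx0 := hq0 x (subset_polyHull X hx)
    have : q x * MvPolynomial.eval (pcoords x) H - 1 = - (q x * (1 / q x - MvPolynomial.eval (pcoords x) H)) := by
      field_simp; ring
    show ‖q x * MvPolynomial.eval (pcoords x) H - 1‖ ≤ _
    rw [this, norm_neg, norm_mul]
    exact mul_le_mul (hB x hx) (hHx x hx) (norm_nonneg _) hB0
  have h2 : 1 ≤ ‖q p * MvPolynomial.eval (pcoords p) H‖ + B * η := by
    have := norm_le_norm_add_norm_sub' (1:ℂ) (q p * MvPolynomial.eval (pcoords p) H)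
    rw [norm_one, norm_sub_rev] at this
    linarith
  rw [norm_mul] at h2
  have h3 : ‖q p‖ * ‖MvPolynomial.eval (pcoords p) H‖ ≤ ‖q p‖ * (1 / δ + η) :=
    mul_le_mul_of_nonneg_left hHp (norm_nonneg _)
  have h4 : δ * (1 / δ) = 1 := by field_simp
  have h5 := hBp p hp
  have h6 : δ * 1 ≤ δ * (‖q p‖ * (1 / δ + η) + B * η) := mul_le_mul_of_nonneg_left (by linarith) hδ.le
  have h7 : δ * (‖q p‖ * (1 / δ + η) + B * η) = ‖q p‖ * (δ * (1 / δ)) + δ * η * ‖q p‖ + δ * B * η := by ring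
  have h8 : δ * η * ‖q p‖ ≤ δ * η * B := mul_le_mul_of_nonneg_left h5 (by positivity)
  rw [h7, h4] at h6
  nlinarith
end Hull



section Rho
open scoped Topology
variable {n : ℕ}

lemma euclNorm_eq (w : Fin n → ℂ) : euclNorm w = ‖(WithLp.toLp 2 w : EuclideanSpace ℂ (Fin n))‖ := by
  rw [EuclideanSpace.norm_eq, euclNorm]
  simp [Complex.normSq_eq_norm_sq]

lemma continuous_euclNorm : Continuous (euclNorm : (Fin n → ℂ) → ℝ) := by
  unfold euclNorm; fun_prop

lemma euclNorm_nonneg (w : Fin n → ℂ) : 0 ≤ euclNorm w := Real.sqrt_nonneg _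

lemma euclNorm_zero : euclNorm (0 : Fin n → ℂ) = 0 := by simp [euclNorm]

lemma euclNorm_pos {w : Fin n → ℂ} : 0 < euclNorm w ↔ w ≠ 0 := by
  rw [euclNorm_eq, norm_pos_iff]; simp

lemma euclNorm_smul (c : ℂ) (w : Fin n → ℂ) : euclNorm (c • w) = ‖c‖ * euclNorm w := by
  rw [euclNorm_eq, euclNorm_eq, WithLp.toLp_smul, norm_smul]

lemma euclNorm_rsmul (c : ℝ) (w : Fin n → ℂ) : euclNorm (c • w) = |c| * euclNorm w := by
  rw [euclNorm_eq, euclNorm_eq, WithLp.toLp_smul, norm_smul, Real.norm_eq_abs]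

lemma euclNorm_add (v w : Fin n → ℂ) : euclNorm (v + w) ≤ euclNorm v + euclNorm w := by
  simp only [euclNorm_eq, WithLp.toLp_add]; exact norm_add_le _ _

lemma norm_le_euclNorm (w : Fin n → ℂ) : ‖w‖ ≤ euclNorm w := by
  rw [pi_norm_le_iff_of_nonneg (euclNorm_nonneg w)]
  intro i
  rw [euclNorm_eq]
  exact PiLp.norm_apply_le (p := 2) (WithLp.toLp 2 w : EuclideanSpace ℂ (Fin n)) i

lemma euclNorm_sq (w : Fin n → ℂ) : euclNorm w ^ 2 = ∑ j, Complex.normSq (w j) :=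
  Real.sq_sqrt (Finset.sum_nonneg fun _ _ => Complex.normSq_nonneg _)

lemma norm_dot_le (a b : Fin n → ℂ) : ‖∑ j, a j * b j‖ ≤ euclNorm a * euclNorm b := by
  refine (norm_sum_le _ _).trans ?_
  simp only [norm_mul, euclNorm, Complex.normSq_eq_norm_sq]
  exact Real.sum_mul_le_sqrt_mul_sqrt _ _ _

lemma convex_eucl (r : ℝ) : Convex ℝ {w : Fin n → ℂ | euclNorm w ≤ r} := by
  intro x hx y hy a b ha hb hab
  have hx' : euclNorm x ≤ r := hx
  have hy' : euclNorm y ≤ r := hy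
  show euclNorm (a • x + b • y) ≤ r
  refine (euclNorm_add _ _).trans ?_
  rw [euclNorm_rsmul, euclNorm_rsmul, abs_of_nonneg ha, abs_of_nonneg hb]
  calc _ ≤ a * r + b * r := by gcongr
    _ = r := by rw [← add_mul, hab, one_mul]

lemma isCompact_eucl (r : ℝ) : IsCompact {w : Fin n → ℂ | euclNorm w ≤ r} := by
  refine Metric.isCompact_of_isClosed_isBounded (isClosed_le continuous_euclNorm continuous_const) ?_
  refine (isBounded_iff_forall_norm_le).2 ⟨r, fun w hw => (norm_le_euclNorm w).trans hw⟩

/-- slices of a `C^{k+1}` function depend on parameters in a `C^k` way -/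
lemma slice_fderiv {E F : Type*} [NormedAddCommGroup E] [NormedSpace ℝ E] [NormedAddCommGroup F]
    [NormedSpace ℝ F] {f : ℂ → E → F} {s : Set (ℂ × E)} {k : ℕ}
    (hs : ∀ p ∈ s, {w | (p.1, w) ∈ s} ∈ 𝓝 p.2)
    (hf : ContDiffOn ℝ ((k + 1 : ℕ) : WithTop ℕ∞) (fun p : ℂ × E => f p.1 p.2) s) :
    ContDiffOn ℝ (k : WithTop ℕ∞) (fun p : ℂ × E => fderiv ℝ (f p.1) p.2) s := by
  intro x hx
  have h := hf x hx
  rw [Nat.cast_add, Nat.cast_one, contDiffWithinAt_succ_iff_hasFDerivWithinAt' (by simp)] at h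
  obtain ⟨u, hu, hus, -, f', hf', hf'c⟩ := h
  rw [insert_eq_of_mem hx] at hu hus
  have h1 : ContDiffWithinAt ℝ (k : WithTop ℕ∞)
      (fun p : ℂ × E => (f' p).comp (ContinuousLinearMap.inr ℝ ℂ E)) s x :=
    hf'c.clm_comp contDiffWithinAt_const
  refine h1.congr_of_eventuallyEq ?_ ?_
  · filter_upwards [hu] with p hp
    have h2 := hf' p hp
    have h3 : HasFDerivWithinAt (fun w : E => ((p.1, w) : ℂ × E)) (ContinuousLinearMap.inr ℝ ℂ E)
        {w | (p.1, w) ∈ s} p.2 := (hasFDerivAt_prodMk_right p.1 p.2).hasFDerivWithinAt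
    have h4 := (HasFDerivWithinAt.comp p.2 (show HasFDerivWithinAt _ (f' p) s (p.1, p.2) from h2) h3
      (fun w hw => hw))
    exact (h4.hasFDerivAt (hs p (hus hp))).fderiv
  · have hxu : x ∈ u := mem_of_mem_nhdsWithin hx hu
    have h2 := hf' x hxu
    have h3 : HasFDerivWithinAt (fun w : E => ((x.1, w) : ℂ × E)) (ContinuousLinearMap.inr ℝ ℂ E)
        {w | (x.1, w) ∈ s} x.2 := (hasFDerivAt_prodMk_right x.1 x.2).hasFDerivWithinAt
    have h4 := (HasFDerivWithinAt.comp x.2 (show HasFDerivWithinAt _ (f' x) s (x.1, x.2) from h2) h3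
      (fun w hw => hw))
    exact (h4.hasFDerivAt (hs x (hus hxu))).fderiv

/-- the domain of smoothness -/
def UU (ρ : ℂ → (Fin n → ℂ) → ℝ) : Set (ℂ × (Fin n → ℂ)) := {p | p.1 ∈ Circ ∧ ρ p.1 p.2 ≠ 0}

/-- complex gradient -/
def DD (ρ : ℂ → (Fin n → ℂ) → ℝ) (z : ℂ) (p : Fin n → ℂ) : Fin n → ℂ := fun j => wderiv (ρ z) p j

/-- second derivative -/
def D2 (ρ : ℂ → (Fin n → ℂ) → ℝ) (z : ℂ) (p : Fin n → ℂ) :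
    (Fin n → ℂ) →L[ℝ] (Fin n → ℂ) →L[ℝ] ℝ := fderiv ℝ (fun w => fderiv ℝ (ρ z) w) p

variable {ρ : ℂ → (Fin n → ℂ) → ℝ} {R : ℝ}

lemma taylor2 {E : Type*} [NormedAddCommGroup E] [NormedSpace ℝ E] (f : E → ℝ) (f' : E → E →L[ℝ] ℝ)
    (f'' : E → E →L[ℝ] E →L[ℝ] ℝ) (x h : E) (ε : ℝ) (hε : 0 ≤ ε)
    (h1 : ∀ s ∈ Icc (0:ℝ) 1, HasFDerivAt f (f' (x + s • h)) (x + s • h))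
    (h2 : ∀ s ∈ Icc (0:ℝ) 1, HasFDerivAt f' (f'' (x + s • h)) (x + s • h))
    (hb : ∀ s ∈ Icc (0:ℝ) 1, ‖f'' (x + s • h) - f'' x‖ ≤ ε) :
    |f (x + h) - f x - f' x h - f'' x h h / 2| ≤ ε * ‖h‖ ^ 2 := by
  have hl : ∀ s : ℝ, HasDerivAt (fun s : ℝ => x + s • h) h s := fun s => by
    simpa using ((hasDerivAt_id s).smul_const h).const_add x
  have hd1 : ∀ s ∈ Icc (0:ℝ) 1, HasDerivWithinAt (fun s : ℝ => f' (x + s • h) h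
      - f' x h - s * f'' x h h)
      (f'' (x + s • h) h h - f'' x h h) (Icc 0 1) s := by
    intro s hs
    have h3 : HasDerivAt (fun s : ℝ => f' (x + s • h)) (f'' (x + s • h) h) s :=
      (h2 s hs).comp_hasDerivAt s (hl s)
    have h3' : HasDerivAt (fun s : ℝ => f' (x + s • h) h) (f'' (x + s • h) h h) s :=
      (ContinuousLinearMap.apply ℝ ℝ h).hasFDerivAt.comp_hasDerivAt s h3
    have h4 := (h3'.sub_const (f' x h)).sub ((hasDerivAt_id s).mul_const (f'' x h h))
    rw [one_mul] at h4
    exact h4.hasDerivWithinAt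
  have hb1 : ∀ s ∈ Icc (0:ℝ) 1, ‖f' (x + s • h) h
      - f' x h - s * f'' x h h‖ ≤ ε * ‖h‖ ^ 2 := by
    intro s hs
    have := Convex.norm_image_sub_le_of_norm_hasDerivWithin_le (C := ε * ‖h‖^2) hd1 (fun x' hx => ?_)
      (convex_Icc 0 1) (left_mem_Icc.2 zero_le_one) hs
    · have h0 : (0:ℝ) ≤ ε * ‖h‖^2 := by positivity
      simp only [zero_smul, add_zero, sub_self, zero_mul, sub_zero] at this
      refine this.trans ?_
      rw [Real.norm_eq_abs, abs_of_nonneg hs.1]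
      nlinarith [hs.2]
    · have h5 : f'' (x + x' • h) h h - f'' x h h = (f'' (x + x' • h) - f'' x) h h := by simp
      rw [h5]
      refine (ContinuousLinearMap.le_opNorm _ _).trans ?_
      have := ContinuousLinearMap.le_opNorm (f'' (x + x' • h) - f'' x) h
      calc _ ≤ (‖f'' (x + x' • h) - f'' x‖ * ‖h‖) * ‖h‖ := by gcongr
        _ ≤ (ε * ‖h‖) * ‖h‖ := by gcongr; exact hb x' hx
        _ = _ := by ring
  have hd2 : ∀ s ∈ Icc (0:ℝ) 1, HasDerivWithinAt (fun s : ℝ => f (x + s • h) - f x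
      - s * f' x h - s ^ 2 * (f'' x h h / 2))
      (f' (x + s • h) h - f' x h - s * f'' x h h) (Icc 0 1) s := by
    intro s hs
    have h3 := (h1 s hs).comp_hasDerivAt s (hl s)
    have h4 := ((h3.sub_const (f x)).sub ((hasDerivAt_id s).mul_const (f' x h))).sub
      (((hasDerivAt_id s).pow 2).mul_const (f'' x h h / 2))
    refine (h4.hasDerivWithinAt).congr_deriv ?_
    simp; ring
  have := Convex.norm_image_sub_le_of_norm_hasDerivWithin_le hd2 hb1
      (convex_Icc 0 1) (left_mem_Icc.2 zero_le_one) (right_mem_Icc.2 zero_le_one)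
  simpa [Real.norm_eq_abs] using this

namespace Cond3
variable (hρ : Cond3 n ρ R (fun _ => 0))
include hρ

lemma cont_slice {z : ℂ} (hz : z ∈ Circ) : Continuous (ρ z) := by
  rw [← continuousOn_univ]
  exact hρ.cont.comp (f := fun w => ((z, w) : ℂ × (Fin n → ℂ))) (by fun_prop) (fun w _ => hz)

lemma zero_iff {z : ℂ} (hz : z ∈ Circ) {w : Fin n → ℂ} : ρ z w = 0 ↔ w = 0 := hρ.Szero z hz w

lemma R_pos : 0 < R := by linarith [hρ.hR]

lemma slice_nhds : ∀ p ∈ UU ρ, {w | (p.1, w) ∈ UU ρ} ∈ 𝓝 p.2 := by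
  intro p hp
  have : {w | ρ p.1 w ≠ 0} ∈ 𝓝 p.2 :=
    (isOpen_ne_fun (hρ.cont_slice hp.1) continuous_const).mem_nhds hp.2
  filter_upwards [this] with w hw
  exact ⟨hp.1, hw⟩

lemma contDiffOn_fderiv : ContDiffOn ℝ ((5 : ℕ) : WithTop ℕ∞)
    (fun p : ℂ × (Fin n → ℂ) => fderiv ℝ (ρ p.1) p.2) (UU ρ) :=
  slice_fderiv (k := 5) hρ.slice_nhds (hρ.smooth.of_le (by norm_num))

lemma contOn_fderiv : ContinuousOn (fun p : ℂ × (Fin n → ℂ) => fderiv ℝ (ρ p.1) p.2) (UU ρ) :=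
  hρ.contDiffOn_fderiv.continuousOn

lemma contOn_D2 : ContinuousOn (fun p : ℂ × (Fin n → ℂ) => D2 ρ p.1 p.2) (UU ρ) :=
  (slice_fderiv (k := 4) (f := fun z w => fderiv ℝ (ρ z) w) hρ.slice_nhds
    hρ.contDiffOn_fderiv).continuousOn

lemma contDiffAt_slice {p : ℂ × (Fin n → ℂ)} (hp : p ∈ UU ρ) : ContDiffAt ℝ 6 (ρ p.1) p.2 := by
  have h : ContDiffOn ℝ 6 (ρ p.1) {w | (p.1, w) ∈ UU ρ} :=
    hρ.smooth.comp (f := fun w => ((p.1, w) : ℂ × (Fin n → ℂ))) (by fun_prop) (fun w hw => hw)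
  exact h.contDiffAt (hρ.slice_nhds p hp)

lemma hasFDerivAt {p : ℂ × (Fin n → ℂ)} (hp : p ∈ UU ρ) :
    HasFDerivAt (ρ p.1) (fderiv ℝ (ρ p.1) p.2) p.2 :=
  ((hρ.contDiffAt_slice hp).differentiableAt (by norm_num)).hasFDerivAt

lemma hasFDerivAt2 {p : ℂ × (Fin n → ℂ)} (hp : p ∈ UU ρ) :
    HasFDerivAt (fun w => fderiv ℝ (ρ p.1) w) (D2 ρ p.1 p.2) p.2 :=
  (((hρ.contDiffAt_slice hp).fderiv_right (m := 1) (by norm_num)).differentiableAt (by norm_num)).hasFDerivAt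

lemma contOn_DD : ContinuousOn (fun p : ℂ × (Fin n → ℂ) => DD ρ p.1 p.2) (UU ρ) := by
  rw [continuousOn_pi]
  intro j
  have h := hρ.contOn_fderiv
  have h1 : ∀ v : Fin n → ℂ, ContinuousOn (fun p : ℂ × (Fin n → ℂ) => ((fderiv ℝ (ρ p.1) p.2 v : ℝ) : ℂ)) (UU ρ) :=
    fun v => continuous_ofReal.comp_continuousOn (h.clm_apply continuousOn_const)
  unfold DD wderiv
  exact ((h1 _).sub (continuousOn_const.mul (h1 _))).div_const 2

end Cond3

lemma fderiv_eq_DD (ρ : ℂ → (Fin n → ℂ) → ℝ) (z : ℂ) (p u : Fin n → ℂ) :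
    fderiv ℝ (ρ z) p u = 2 * (∑ j, u j * DD ρ z p j).re := by
  have hu : u = ∑ j, ((u j).re • (Pi.single j 1 : Fin n → ℂ) + (u j).im • (Pi.single j I : Fin n → ℂ)) := by
    ext i
    simp only [Finset.sum_apply, Pi.add_apply, Pi.smul_apply, Pi.single_apply]
    rw [Finset.sum_eq_single i]
    · simp [Complex.re_add_im]
    · intro b _ hb
      simp [hb.symm]
    · simp
  conv_lhs => rw [hu]
  rw [map_sum, Complex.re_sum, Finset.mul_sum]
  refine Finset.sum_congr rfl fun j _ => ?_
  rw [map_add, map_smul, map_smul]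
  simp only [DD, wderiv, smul_eq_mul]
  simp [Complex.mul_re]
  ring

lemma iter2_eq_D2 (ρ : ℂ → (Fin n → ℂ) → ℝ) (z : ℂ) (p u : Fin n → ℂ) :
    iteratedFDeriv ℝ 2 (ρ z) p ![u, u] = D2 ρ z p u u := by
  rw [iteratedFDeriv_two_apply]; rfl

namespace Cond3
variable (hρ : Cond3 n ρ R (fun _ => 0))
include hρ

lemma DD_ne {z : ℂ} (hz : z ∈ Circ) {p : Fin n → ℂ} (h0 : 0 < ρ z p) (hR : ρ z p ≤ R) :
    DD ρ z p ≠ 0 := by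
  intro h
  apply hρ.grad_ne z hz p h0 hR
  ext u
  rw [fderiv_eq_DD, h]; simp

lemma rho_zero {z : ℂ} (hz : z ∈ Circ) : ρ z 0 = 0 := (hρ.zero_iff hz).2 rfl

lemma le_R_iff {z : ℂ} (hz : z ∈ Circ) {w : Fin n → ℂ} : ρ z w ≤ R ↔ euclNorm w ≤ R := by
  constructor
  · intro h
    by_contra h1
    exact absurd (hρ.aboveR z hz w (not_le.1 h1)) (not_lt.2 h)
  · intro h
    by_contra h1
    rcases h.lt_or_eq with h2 | h2
    swap
    · exact h1 ((hρ.levelR z hz w).2 h2).le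
    have hc : ContinuousOn (fun s : ℝ => ρ z (s • w)) (Icc 0 1) :=
      ((hρ.cont_slice hz).comp (by fun_prop)).continuousOn
    have := intermediate_value_Icc zero_le_one hc
    have hm : R ∈ Icc (ρ z ((0:ℝ) • w)) (ρ z ((1:ℝ) • w)) := by
      rw [zero_smul, one_smul, hρ.rho_zero hz]
      exact ⟨hρ.R_pos.le, (not_le.1 h1).le⟩
    obtain ⟨s, hs, hs2⟩ := this hm
    have h3 := (hρ.levelR z hz _).1 hs2
    rw [euclNorm_rsmul, abs_of_nonneg hs.1] at h3
    nlinarith [hs.2, euclNorm_nonneg w]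

lemma lt_R_iff {z : ℂ} (hz : z ∈ Circ) {w : Fin n → ℂ} : ρ z w < R ↔ euclNorm w < R := by
  rw [lt_iff_le_and_ne, lt_iff_le_and_ne, hρ.le_R_iff hz, Ne, Ne, hρ.levelR z hz]

lemma pos_iff {z : ℂ} (hz : z ∈ Circ) {w : Fin n → ℂ} : 0 < ρ z w ↔ w ≠ 0 := by
  rw [Ne, ← hρ.zero_iff hz]
  exact ⟨fun h => h.ne', fun h => lt_of_le_of_ne (hρ.nonneg z hz w) (Ne.symm h)⟩

/-- sublevel tube compact -/
lemma isCompact_shell (t0 r : ℝ) :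
    IsCompact {p : ℂ × (Fin n → ℂ) | p.1 ∈ Circ ∧ t0 ≤ ρ p.1 p.2 ∧ euclNorm p.2 ≤ r} := by
  have h1 : IsCompact (Circ ×ˢ {w : Fin n → ℂ | euclNorm w ≤ r}) := isCompact_circ.prod (isCompact_eucl r)
  have h2 : ContinuousOn (fun p : ℂ × (Fin n → ℂ) => ρ p.1 p.2) (Circ ×ˢ {w : Fin n → ℂ | euclNorm w ≤ r}) :=
    hρ.cont.mono fun p hp => hp.1
  have h3 := h2.preimage_isClosed_of_isClosed h1.isClosed (isClosed_Ici (a := t0))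
  have h4 := h1.of_isClosed_subset h3 inter_subset_left
  convert h4 using 1
  ext p
  exact ⟨fun h => ⟨⟨h.1, h.2.2⟩, h.2.1⟩, fun h => ⟨h.1.1, h.2, h.1.2⟩⟩

omit hρ in
lemma shell_subset {t0 r : ℝ} (ht : 0 < t0) :
    {p : ℂ × (Fin n → ℂ) | p.1 ∈ Circ ∧ t0 ≤ ρ p.1 p.2 ∧ euclNorm p.2 ≤ r} ⊆ UU ρ :=
  fun _ hp => ⟨hp.1, (lt_of_lt_of_le ht hp.2.1).ne'⟩

/-- uniform closeness over compacts of a function continuous on `UU` -/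
lemma unif_close {C : Set (ℂ × (Fin n → ℂ))} (hC : IsCompact C) (hCU : C ⊆ UU ρ)
    {F : Type*} [PseudoMetricSpace F] {φ : ℂ × (Fin n → ℂ) → F} (hφ : ContinuousOn φ (UU ρ))
    {ε : ℝ} (hε : 0 < ε) :
    ∃ δ > 0, ∀ p ∈ C, ∀ h : Fin n → ℂ, ‖h‖ < δ →
      (p.1, p.2 + h) ∈ UU ρ ∧ dist (φ (p.1, p.2 + h)) (φ p) < ε := by
  have key : ∀ p ∈ C, ∀ᶠ x : (Fin n → ℂ) × (ℂ × (Fin n → ℂ)) in 𝓝 (0, p),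
      x.2 ∈ UU ρ → ((x.2.1, x.2.2 + x.1) ∈ UU ρ ∧ dist (φ (x.2.1, x.2.2 + x.1)) (φ x.2) < ε) := by
    intro p hp
    have hpU := hCU hp
    -- near `p`, in the tube, we stay in `UU` and `φ` is close to `φ p`
    have h1 : ∀ᶠ y in 𝓝[UU ρ] p, dist (φ y) (φ p) < ε / 2 :=
      (hφ p hpU).eventually (Metric.ball_mem_nhds _ (by positivity))
    have h2 : ∀ᶠ y in 𝓝[{p : ℂ × (Fin n → ℂ) | p.1 ∈ Circ}] p, ρ y.1 y.2 ≠ 0 :=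
      (hρ.cont p hpU.1).eventually_ne hpU.2
    rw [eventually_nhdsWithin_iff] at h1 h2
    have hc1 : Tendsto (fun x : (Fin n → ℂ) × (ℂ × (Fin n → ℂ)) => (x.2.1, x.2.2 + x.1))
        (𝓝 (0, p)) (𝓝 p) := by
      have : Continuous (fun x : (Fin n → ℂ) × (ℂ × (Fin n → ℂ)) => (x.2.1, x.2.2 + x.1)) := by fun_prop
      have := this.tendsto (0, p)
      simpa using this
    have hc2 : Tendsto (fun x : (Fin n → ℂ) × (ℂ × (Fin n → ℂ)) => x.2) (𝓝 (0, p)) (𝓝 p) :=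
      continuous_snd.tendsto (0, p)
    filter_upwards [hc1.eventually h1, hc1.eventually h2, hc2.eventually h1] with x a1 a2 a3 hx
    have hxU : (x.2.1, x.2.2 + x.1) ∈ UU ρ := ⟨hx.1, a2 hx.1⟩
    refine ⟨hxU, ?_⟩
    have b1 := a1 hxU
    have b3 := a3 hx
    rw [dist_comm] at b3
    linarith [dist_triangle (φ (x.2.1, x.2.2 + x.1)) (φ p) (φ x.2)]
  have := hC.eventually_forall_of_forall_eventually (x₀ := (0 : Fin n → ℂ))
    (P := fun h x => x ∈ UU ρ → ((x.1, x.2 + h) ∈ UU ρ ∧ dist (φ (x.1, x.2 + h)) (φ x) < ε)) key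
  obtain ⟨δ, hδ, h⟩ := Metric.eventually_nhds_iff.1 this
  refine ⟨δ, hδ, fun p hp v hv => h (by simpa using hv) p hp (hCU hp)⟩

/-- uniform first order expansion -/
lemma fo_unif {C : Set (ℂ × (Fin n → ℂ))} (hC : IsCompact C) (hCU : C ⊆ UU ρ) {ε : ℝ} (hε : 0 < ε) :
    ∃ δ > 0, ∀ p ∈ C, ∀ h : Fin n → ℂ, ‖h‖ < δ → (p.1, p.2 + h) ∈ UU ρ ∧
      |ρ p.1 (p.2 + h) - ρ p.1 p.2 - fderiv ℝ (ρ p.1) p.2 h| ≤ ε * ‖h‖ := by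
  obtain ⟨δ, hδ, H⟩ := hρ.unif_close hC hCU (F := (Fin n → ℂ) →L[ℝ] ℝ)
    (φ := fun p => fderiv ℝ (ρ p.1) p.2) hρ.contOn_fderiv hε
  refine ⟨δ, hδ, fun p hp h hh => ⟨(H p hp h hh).1, ?_⟩⟩
  have := Convex.norm_image_sub_le_of_norm_hasFDerivWithin_le' (𝕜 := ℝ) (f := ρ p.1)
    (f' := fun w => fderiv ℝ (ρ p.1) w) (s := Metric.ball p.2 δ) (φ := fderiv ℝ (ρ p.1) p.2)
    (C := ε) (x := p.2) (y := p.2 + h) ?_ ?_ (convex_ball _ _) (mem_ball_self hδ) (by simpa using hh)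
  · simpa [Real.norm_eq_abs] using this
  · intro x hx
    have := (H p hp (x - p.2) (by simpa [dist_eq_norm] using hx)).1
    rw [add_sub_cancel] at this
    exact (hρ.hasFDerivAt this).hasFDerivWithinAt
  · intro x hx
    have := (H p hp (x - p.2) (by simpa [dist_eq_norm] using hx)).2
    rw [add_sub_cancel, dist_eq_norm] at this
    exact this.le

/-- uniform second order lower bound -/
lemma so_unif {C : Set (ℂ × (Fin n → ℂ))} (hC : IsCompact C) (hCU : C ⊆ UU ρ) {ε : ℝ} (hε : 0 < ε) :
    ∃ δ > 0, ∀ p ∈ C, ∀ h : Fin n → ℂ, ‖h‖ < δ → (p.1, p.2 + h) ∈ UU ρ ∧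
      |ρ p.1 (p.2 + h) - ρ p.1 p.2 - fderiv ℝ (ρ p.1) p.2 h - D2 ρ p.1 p.2 h h / 2| ≤ ε * ‖h‖ ^ 2 := by
  obtain ⟨δ, hδ, H⟩ := hρ.unif_close hC hCU (F := (Fin n → ℂ) →L[ℝ] (Fin n → ℂ) →L[ℝ] ℝ)
    (φ := fun p => D2 ρ p.1 p.2) hρ.contOn_D2 hε
  refine ⟨δ, hδ, fun p hp h hh => ⟨(H p hp h hh).1, ?_⟩⟩
  have hU : ∀ s : ℝ, s ∈ Icc (0:ℝ) 1 → ‖s • h‖ < δ := by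
    intro s hs
    rw [norm_smul, Real.norm_eq_abs, abs_of_nonneg hs.1]
    nlinarith [norm_nonneg h, hs.2]
  refine taylor2 (ρ p.1) (fun w => fderiv ℝ (ρ p.1) w) (fun w => D2 ρ p.1 w) p.2 h ε hε.le ?_ ?_ ?_
  · exact fun s hs => hρ.hasFDerivAt (H p hp _ (hU s hs)).1
  · exact fun s hs => hρ.hasFDerivAt2 (H p hp _ (hU s hs)).1
  · exact fun s hs => by
      have h5 := (H p hp _ (hU s hs)).2
      rw [dist_eq_norm (E := (Fin n → ℂ) →L[ℝ] (Fin n → ℂ) →L[ℝ] ℝ)] at h5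
      exact h5.le

end Cond3
end Rho



section LC
open scoped Topology
variable {n : ℕ}

/-- bilinear pairing -/
def dt (a b : Fin n → ℂ) : ℂ := ∑ j, a j * b j

lemma dt_comm (a b : Fin n → ℂ) : dt a b = dt b a := by
  unfold dt; exact Finset.sum_congr rfl fun j _ => mul_comm _ _
lemma dt_add (a b c : Fin n → ℂ) : dt a (b + c) = dt a b + dt a c := by
  simp [dt, mul_add, Finset.sum_add_distrib]
lemma dt_sub (a b c : Fin n → ℂ) : dt a (b - c) = dt a b - dt a c := by
  simp [dt, mul_sub, Finset.sum_sub_distrib]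
lemma dt_smul (a b : Fin n → ℂ) (c : ℂ) : dt a (c • b) = c * dt a b := by
  simp [dt, Finset.mul_sum, mul_left_comm]
lemma dt_rsmul (a b : Fin n → ℂ) (c : ℝ) : dt a (c • b) = c * dt a b := by
  simp [dt, Finset.mul_sum, mul_left_comm]
lemma add_dt (a b c : Fin n → ℂ) : dt (b + c) a = dt b a + dt c a := by
  rw [dt_comm, dt_add, dt_comm a b, dt_comm a c]
lemma sub_dt (a b c : Fin n → ℂ) : dt (b - c) a = dt b a - dt c a := by
  rw [dt_comm, dt_sub, dt_comm a b, dt_comm a c]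
lemma smul_dt (a b : Fin n → ℂ) (c : ℂ) : dt (c • b) a = c * dt b a := by
  rw [dt_comm, dt_smul, dt_comm a b]
lemma dt_zero (a : Fin n → ℂ) : dt a 0 = 0 := by simp [dt]
lemma zero_dt (a : Fin n → ℂ) : dt 0 a = 0 := by simp [dt]
lemma norm_dt_le (a b : Fin n → ℂ) : ‖dt a b‖ ≤ n * ‖a‖ * ‖b‖ := by
  unfold dt
  refine (norm_sum_le _ _).trans ?_
  calc _ ≤ ∑ j : Fin n, ‖a‖ * ‖b‖ := Finset.sum_le_sum fun j _ => by
          rw [norm_mul]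
          exact mul_le_mul (norm_le_pi_norm a j) (norm_le_pi_norm b j) (norm_nonneg _) (norm_nonneg _)
    _ = _ := by simp [mul_assoc]
lemma norm_dt_le' (a b : Fin n → ℂ) : ‖dt a b‖ ≤ euclNorm a * euclNorm b := norm_dot_le a b
lemma continuous_dt : Continuous (fun p : (Fin n → ℂ) × (Fin n → ℂ) => dt p.1 p.2) := by
  unfold dt; fun_prop
lemma ContinuousOn.dt {X : Type*} [TopologicalSpace X] {f g : X → Fin n → ℂ} {s : Set X}
    (hf : ContinuousOn f s) (hg : ContinuousOn g s) : ContinuousOn (fun x => _root_.dt (f x) (g x)) s :=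
  continuous_dt.comp_continuousOn (hf.prodMk hg)
lemma Continuous.dt {X : Type*} [TopologicalSpace X] {f g : X → Fin n → ℂ}
    (hf : Continuous f) (hg : Continuous g) : Continuous (fun x => _root_.dt (f x) (g x)) :=
  continuous_dt.comp (hf.prodMk hg)

/-- conjugate vector -/
def cj (a : Fin n → ℂ) : Fin n → ℂ := fun j => (starRingEnd ℂ) (a j)

lemma dt_cj (a : Fin n → ℂ) : dt a (cj a) = ((euclNorm a ^ 2 : ℝ) : ℂ) := by
  rw [euclNorm_sq]; simp [dt, cj, Complex.mul_conj]

lemma norm_cj (a : Fin n → ℂ) : ‖cj a‖ = ‖a‖ := by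
  simp [Pi.norm_def, cj]

lemma continuous_cj : Continuous (cj : (Fin n → ℂ) → _) := by
  unfold cj; fun_prop

variable {ρ : ℂ → (Fin n → ℂ) → ℝ} {R : ℝ}

lemma fderiv_eq_dt (ρ : ℂ → (Fin n → ℂ) → ℝ) (z : ℂ) (p u : Fin n → ℂ) :
    fderiv ℝ (ρ z) p u = 2 * (dt (DD ρ z p) u).re := by
  rw [fderiv_eq_DD, dt_comm]; rfl

namespace Cond3
variable (hρ : Cond3 n ρ R (fun _ => 0))
include hρ

lemma contOn_nD2 : ContinuousOn (fun p : ℂ × (Fin n → ℂ) => ‖D2 ρ p.1 p.2‖) (UU ρ) := by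
  have h := (slice_fderiv (k := 4) (f := fun z w => fderiv ℝ (ρ z) w) hρ.slice_nhds
    hρ.contDiffOn_fderiv).continuousOn
  exact h.norm
lemma D2_bound {t0 : ℝ} (ht0 : 0 < t0) : ∃ M2, ∀ p ∈ {p : ℂ × (Fin n → ℂ) | p.1 ∈ Circ ∧ t0 ≤ ρ p.1 p.2 ∧ euclNorm p.2 ≤ R}, ‖D2 ρ p.1 p.2‖ ≤ M2 := by
  have hC := hρ.isCompact_shell t0 R
  have hCU := shell_subset (ρ := ρ) (r := R) ht0
  obtain ⟨M, hM⟩ := (hC.image_of_continuousOn (hρ.contOn_nD2.mono hCU)).bddAbove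
  exact ⟨M, fun p hp => hM ⟨p, hp, rfl⟩⟩

/-- bounds for gradient on the shell -/
lemma DD_bound {t0 : ℝ} (ht0 : 0 < t0) : ∃ M2, ∀ p ∈ {p : ℂ × (Fin n → ℂ) | p.1 ∈ Circ ∧ t0 ≤ ρ p.1 p.2 ∧ euclNorm p.2 ≤ R}, ‖DD ρ p.1 p.2‖ ≤ M2 := by
  have hC := hρ.isCompact_shell t0 R
  have hCU := shell_subset (ρ := ρ) (r := R) ht0
  obtain ⟨M, hM⟩ := (hC.image_of_continuousOn (hρ.contOn_DD.norm.mono hCU)).bddAbove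
  exact ⟨M, fun p hp => hM ⟨p, hp, rfl⟩⟩

lemma DD_lower {t0 : ℝ} (ht0 : 0 < t0) : ∃ m > 0, ∀ p ∈ {p : ℂ × (Fin n → ℂ) | p.1 ∈ Circ ∧ t0 ≤ ρ p.1 p.2 ∧ euclNorm p.2 ≤ R},
      m ≤ euclNorm (DD ρ p.1 p.2) := by
  have hC := hρ.isCompact_shell t0 R
  have hCU := shell_subset (ρ := ρ) (r := R) ht0
  rcases eq_empty_or_nonempty {p : ℂ × (Fin n → ℂ) | p.1 ∈ Circ ∧ t0 ≤ ρ p.1 p.2 ∧ euclNorm p.2 ≤ R} with he | hne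
  · rw [he]; exact ⟨1, one_pos, fun p hp => absurd hp (notMem_empty p)⟩
  · have hco : ContinuousOn (fun p : ℂ × (Fin n → ℂ) => euclNorm (DD ρ p.1 p.2)) _ :=
      continuous_euclNorm.comp_continuousOn (hρ.contOn_DD.mono hCU)
    obtain ⟨q, hq, hmin⟩ := hC.exists_isMinOn hne hco
    refine ⟨euclNorm (DD ρ q.1 q.2),
      euclNorm_pos.2 (hρ.DD_ne hq.1 (ht0.trans_le hq.2.1) ((hρ.le_R_iff hq.1).2 hq.2.2)), fun p hp => ?_⟩
    exact hmin hp

lemma grad_bounds {t0 : ℝ} (ht0 : 0 < t0) : ∃ m > 0, ∃ M > 0, ∀ z ∈ Circ, ∀ p, t0 ≤ ρ z p → ρ z p ≤ R →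
    m ≤ euclNorm (DD ρ z p) ∧ ‖DD ρ z p‖ ≤ M ∧ ‖D2 ρ z p‖ ≤ M := by
  obtain ⟨M1, hM1⟩ := hρ.DD_bound ht0
  obtain ⟨M2, hM2⟩ := hρ.D2_bound ht0
  obtain ⟨m, hm, hm'⟩ := hρ.DD_lower ht0
  refine ⟨m, hm, max (max M1 M2) 1, lt_of_lt_of_le one_pos (le_max_right _ _), fun z hz p h1 h2 => ?_⟩
  have hp : (z, p) ∈ {p : ℂ × (Fin n → ℂ) | p.1 ∈ Circ ∧ t0 ≤ ρ p.1 p.2 ∧ euclNorm p.2 ≤ R} :=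
    ⟨hz, h1, (hρ.le_R_iff hz).1 h2⟩
  have a1 := hm' _ hp
  have a2 := hM1 _ hp
  have a3 := hM2 _ hp
  dsimp only at a1 a2 a3
  have l1 : M1 ≤ max (max M1 M2) 1 := (le_max_left _ _).trans (le_max_left _ _)
  have l2 : M2 ≤ max (max M1 M2) 1 := (le_max_right _ _).trans (le_max_left _ _)
  exact ⟨a1, le_trans a2 l1, le_trans a3 l2⟩

set_option maxHeartbeats 1000000 in
lemma soe {t0 : ℝ} (ht0 : 0 < t0) : ∃ δ > 0, ∃ C0 > 0, ∃ c0 > 0, ∀ z ∈ Circ, ∀ p, t0 ≤ ρ z p → ρ z p ≤ R →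
    ∀ d : Fin n → ℂ, ‖d‖ < δ → ρ z p + 2 * (dt (DD ρ z p) d).re - C0 * ‖dt (DD ρ z p) d‖ * ‖d‖
      + c0 * ‖d‖ ^ 2 ≤ ρ z (p + d) := by
  have hC := hρ.isCompact_shell t0 R
  have hCU := shell_subset (ρ := ρ) (r := R) ht0
  obtain ⟨K0, hK0, hK⟩ := hρ.hypo _ hCU hC
  obtain ⟨m, hm, M, hM, hb⟩ := hρ.grad_bounds ht0
  obtain ⟨δ, hδ, H⟩ := hρ.so_unif hC hCU (ε := K0 / 4) (by positivity)
  -- constants: |x| ≤ A |μ|, |x| ≤ B |d|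
  set A := M / m ^ 2 with hA
  have hA0 : 0 < A := by positivity
  set B := A * (n * M) with hB
  have hB0 : 0 ≤ B := by positivity
  refine ⟨δ, hδ, K0 * A + (M * (2 * (1 + B) + B) * A) , by positivity, K0 / 4, by positivity, ?_⟩
  intro z hz p h1 h2 d hd
  have hp : (z, p) ∈ {p : ℂ × (Fin n → ℂ) | p.1 ∈ Circ ∧ t0 ≤ ρ p.1 p.2 ∧ euclNorm p.2 ≤ R} :=
    ⟨hz, h1, (hρ.le_R_iff hz).1 h2⟩
  obtain ⟨b1, b2, b3⟩ := hb z hz p h1 h2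
  obtain ⟨-, H1⟩ := H _ hp d hd
  simp only at H1
  rw [fderiv_eq_dt] at H1
  set D := DD ρ z p with hD
  set μ := dt D d with hμ
  set x : Fin n → ℂ := (μ / ((euclNorm D ^ 2 : ℝ) : ℂ)) • cj D with hx
  have hE : 0 < euclNorm D := lt_of_lt_of_le hm b1
  have hxD : dt D x = μ := by
    rw [hx, dt_smul, dt_cj]
    have : ((euclNorm D ^ 2 : ℝ) : ℂ) ≠ 0 := by exact_mod_cast (by positivity : euclNorm D ^ 2 ≠ 0)
    field_simp
  have hxA : ‖x‖ ≤ A * ‖μ‖ := by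
    rw [hx, norm_smul, norm_cj, norm_div, Complex.norm_real, Real.norm_eq_abs, abs_of_pos (by positivity), hA]
    have : euclNorm D ^ 2 ≥ m ^ 2 := by gcongr
    calc ‖μ‖ / euclNorm D ^ 2 * ‖D‖ ≤ ‖μ‖ / m ^ 2 * M := by gcongr
      _ = _ := by ring
  have hμB : ‖μ‖ ≤ n * M * ‖d‖ := (norm_dt_le D d).trans (by gcongr)
  have hxB : ‖x‖ ≤ B * ‖d‖ := hxA.trans (by
    rw [hB]; calc A * ‖μ‖ ≤ A * (n * M * ‖d‖) := by gcongr
      _ = _ := by ring)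
  set y := d - x with hy
  have hyT : dt D y = 0 := by rw [hy, dt_sub, hxD, hμ, sub_self]
  have hK1 := hK _ hp y (by rw [← hyT, dt_comm]; rfl)
  simp only at hK1
  rw [iter2_eq_D2] at hK1
  have hyn : ‖y‖ ≤ (1 + B) * ‖d‖ := by
    calc ‖y‖ ≤ ‖d‖ + ‖x‖ := norm_sub_le _ _
      _ ≤ _ := by linarith
  have hyl : ‖d‖ ^ 2 - 2 * ‖d‖ * ‖x‖ ≤ ‖y‖ ^ 2 := by
    have h3 : ‖d‖ - ‖x‖ ≤ ‖y‖ := norm_sub_norm_le _ _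
    rcases le_or_gt ‖x‖ ‖d‖ with h4 | h4
    · have : (‖d‖ - ‖x‖) ^ 2 ≤ ‖y‖ ^ 2 := by
        apply pow_le_pow_left₀ (by linarith) h3
      nlinarith [sq_nonneg ‖x‖]
    · nlinarith [norm_nonneg d, sq_nonneg ‖y‖]
  have hye : ‖y‖ ^ 2 ≤ euclNorm y ^ 2 := pow_le_pow_left₀ (norm_nonneg _) (norm_le_euclNorm y) 2
  have hdec : D2 ρ z p d d = D2 ρ z p y y + (D2 ρ z p y x + D2 ρ z p x y + D2 ρ z p x x) := by
    have : d = y + x := by rw [hy]; abel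
    rw [this]; simp only [map_add, add_apply]; ring
  have hbil : ∀ a b : Fin n → ℂ, -(M * ‖a‖ * ‖b‖) ≤ D2 ρ z p a b := by
    intro a b
    have := (D2 ρ z p).le_opNorm₂ a b
    have h5 : ‖D2 ρ z p a b‖ ≤ M * ‖a‖ * ‖b‖ := this.trans (by gcongr)
    rw [Real.norm_eq_abs] at h5
    exact (abs_le.1 h5).1
  have e1 := hbil y x
  have e2 := hbil x y
  have e3 := hbil x x
  have e4 : M * ‖y‖ * ‖x‖ ≤ M * ((1 + B) * ‖d‖) * (A * ‖μ‖) := by gcongr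
  have e5 : M * ‖x‖ * ‖x‖ ≤ M * (B * ‖d‖) * (A * ‖μ‖) := by gcongr
  have e6 : ‖d‖ * ‖x‖ ≤ ‖d‖ * (A * ‖μ‖) := by gcongr
  have e7 : K0 * (‖d‖ ^ 2 - 2 * ‖d‖ * ‖x‖) ≤ K0 * euclNorm y ^ 2 := by gcongr; exact hyl.trans hye
  have e8 : K0 * (‖d‖ * ‖x‖) ≤ K0 * (‖d‖ * (A * ‖μ‖)) := by gcongr
  have hpos1 : 0 ≤ M * (2 * (1 + B) + B) * A * ‖μ‖ * ‖d‖ := by positivity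
  have H2 := (abs_le.1 H1).1
  rw [hdec] at H2
  linarith [H2, e1, e2, e3, e4, e5, e7, e8, hK1, hpos1]

end Cond3
end LC



section LC2
open scoped Topology
variable {n : ℕ} {ρ : ℂ → (Fin n → ℂ) → ℝ} {R : ℝ}

namespace Cond3
variable (hρ : Cond3 n ρ R (fun _ => 0))
include hρ

lemma contOn_DD_slice {z : ℂ} (hz : z ∈ Circ) : ContinuousOn (fun p => DD ρ z p) {p | ρ z p ≠ 0} :=
  hρ.contOn_DD.comp (f := fun p => ((z, p) : ℂ × (Fin n → ℂ))) (by fun_prop) (fun _ hw => ⟨hz, hw⟩)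

/-- the perturbation step -/
lemma lc_step {z : ℂ} (hz : z ∈ Circ) {δ C0 c0 : ℝ} (hδ : 0 < δ) (hC0 : 0 < C0) (hc0 : 0 < c0)
    {p0 v0 : Fin n → ℂ} (h0 : 0 < ρ z p0) (hR : ρ z p0 < R) (hv : v0 ≠ p0)
    (hT : dt (DD ρ z p0) (v0 - p0) = 0)
    (hS : ∀ d : Fin n → ℂ, ‖d‖ < δ → ρ z p0 + 2 * (dt (DD ρ z p0) d).re - C0 * ‖dt (DD ρ z p0) d‖ * ‖d‖
      + c0 * ‖d‖ ^ 2 ≤ ρ z (p0 + d)) :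
    ∃ p1, ρ z p0 < ρ z p1 ∧ ρ z p1 ≤ R ∧ dt (DD ρ z p1) (v0 - p1) = 0 := by
  set m := ρ z p0 with hm
  set D := DD ρ z p0 with hD
  obtain ⟨k, hk⟩ : ∃ k, v0 k ≠ p0 k := by
    by_contra h; push Not at h; exact hv (funext h)
  have hk' : v0 k - p0 k ≠ 0 := sub_ne_zero.2 hk
  set α : (Fin n → ℂ) → ℂ := fun v => (v k - v0 k) / (v0 k - p0 k) with hα
  have hαc : Continuous α := by rw [hα]; fun_prop
  have hαp : α p0 = -1 := by
    rw [hα]; show (p0 k - v0 k) / (v0 k - p0 k) = -1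
    rw [div_eq_iff hk']; ring
  have hE : 0 < euclNorm D := euclNorm_pos.2 (hρ.DD_ne hz h0 hR.le)
  -- choose the radius
  obtain ⟨r, hr0, hrδ, hrC, hrα⟩ : ∃ r > 0, r < δ ∧ C0 * r ≤ 2 / 5 ∧ ∀ v ∈ closedBall p0 r, ‖α v + 1‖ ≤ 1 / 4 := by
    have h1 : ∀ᶠ v in 𝓝 p0, ‖α v + 1‖ < 1 / 4 := by
      have : Tendsto (fun v => ‖α v + 1‖) (𝓝 p0) (𝓝 ‖α p0 + 1‖) :=
        (by fun_prop : Continuous fun v => ‖α v + 1‖).tendsto p0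
      rw [hαp] at this
      exact this.eventually (gt_mem_nhds (by simp))
    obtain ⟨r1, hr1, h2⟩ := Metric.nhds_basis_closedBall.eventually_iff.1 h1
    refine ⟨min r1 (min (δ / 2) (2 / 5 / C0)), by positivity, ?_, ?_, fun v hv => ?_⟩
    · exact lt_of_le_of_lt ((min_le_right _ _).trans (min_le_left _ _)) (by linarith)
    · have : min r1 (min (δ / 2) (2 / 5 / C0)) ≤ 2 / 5 / C0 := (min_le_right _ _).trans (min_le_right _ _)
      calc C0 * _ ≤ C0 * (2 / 5 / C0) := by gcongr
        _ = 2 / 5 := by field_simp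
    · exact (h2 (closedBall_subset_closedBall (min_le_left _ _) hv)).le
  -- lower bound on the planes
  have hlow : ∀ s > (0:ℝ), ∀ v ∈ closedBall p0 r, dt D (v - p0) + s * α v = 0 →
      m + c0 * ‖v - p0‖ ^ 2 + s ≤ ρ z v := by
    intro s hs v hv hPL
    have h1 := hS (v - p0) (lt_of_le_of_lt (by simpa [dist_eq_norm] using hv) hrδ)
    rw [add_sub_cancel] at h1
    have h2 : dt D (v - p0) = s - s * (α v + 1) := by linear_combination hPL
    have h3 := hrα v hv
    have h4 : s * (3 / 4) ≤ (dt D (v - p0)).re := by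
      rw [h2, sub_re, ofReal_re, re_ofReal_mul]
      have := (abs_le.1 ((Complex.abs_re_le_norm _).trans h3)).2
      nlinarith
    have h5 : ‖dt D (v - p0)‖ ≤ s * (5 / 4) := by
      rw [h2]
      refine (norm_sub_le _ _).trans ?_
      rw [norm_mul, Complex.norm_real, Real.norm_eq_abs, abs_of_pos hs]
      nlinarith
    have h6 : ‖v - p0‖ ≤ r := by simpa [dist_eq_norm] using hv
    have h7 : C0 * ‖dt D (v - p0)‖ * ‖v - p0‖ ≤ C0 * (s * (5 / 4)) * r := by gcongr
    nlinarith [h7, hrC]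
  -- a point in the planes
  set e : Fin n → ℂ := (((euclNorm D ^ 2 : ℝ) : ℂ))⁻¹ • cj D with he
  have heD : dt D e = 1 := by
    rw [he, dt_smul, dt_cj]
    have : ((euclNorm D ^ 2 : ℝ) : ℂ) ≠ 0 := by exact_mod_cast (by positivity : euclNorm D ^ 2 ≠ 0)
    field_simp
  set β := e k / (v0 k - p0 k) with hβ
  set x : ℝ → (Fin n → ℂ) := fun s => p0 + ((s : ℂ) / (1 + s * β)) • e with hx
  have hxt : Tendsto x (𝓝 0) (𝓝 p0) := by
    have h1 : ContinuousAt x 0 := by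
      have hq : ContinuousAt (fun s : ℝ => ((s : ℂ) / (1 + s * β))) 0 :=
        ContinuousAt.div (by fun_prop) (by fun_prop) (by simp)
      exact continuousAt_const.add (hq.smul continuousAt_const)
    have : x 0 = p0 := by simp [hx]
    have h2 := h1.tendsto
    rwa [this] at h2
  have hρx : Tendsto (fun s => ρ z (x s)) (𝓝 0) (𝓝 m) :=
    ((hρ.cont_slice hz).tendsto p0).comp hxt
  have hden : ∀ᶠ s : ℝ in 𝓝 0, (1 + (s:ℂ) * β) ≠ 0 := by
    have : ContinuousAt (fun s : ℝ => (1 + (s:ℂ) * β)) 0 := by fun_prop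
    exact this.eventually_ne (by simp)
  have hev : ∀ᶠ s : ℝ in 𝓝 0, x s ∈ closedBall p0 r ∧ ρ z (x s) < m + c0 * r ^ 2 ∧ ρ z (x s) < R ∧
      (1 + (s:ℂ) * β) ≠ 0 := by
    filter_upwards [hxt.eventually (closedBall_mem_nhds p0 hr0),
      hρx.eventually (gt_mem_nhds (by nlinarith [mul_pos hc0 (pow_pos hr0 2)] : m < m + c0 * r ^ 2)),
      hρx.eventually (gt_mem_nhds hR), hden] with s a b c d
    exact ⟨a, b, c, d⟩
  obtain ⟨s, hs1, hs⟩ : ∃ s : ℝ, (x s ∈ closedBall p0 r ∧ ρ z (x s) < m + c0 * r ^ 2 ∧ ρ z (x s) < R ∧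
      (1 + (s:ℂ) * β) ≠ 0) ∧ 0 < s := by
    have h1 : ∀ᶠ s in 𝓝[>] (0:ℝ), _ := nhdsWithin_le_nhds hev
    exact (h1.and self_mem_nhdsWithin).exists
  obtain ⟨hxr, hxm, hxR, hsβ⟩ := hs1
  have hxPL : dt D (x s - p0) + s * α (x s) = 0 := by
    have h1 : x s - p0 = ((s : ℂ) / (1 + s * β)) • e := by simp [hx]
    have h2 : α (x s) = -1 + ((s : ℂ) / (1 + s * β)) * β := by
      have : x s k = p0 k + ((s : ℂ) / (1 + s * β)) * e k := by simp [hx]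
      rw [hα]; simp only; rw [this, hβ]
      field_simp
      ring
    rw [h1, h2, dt_smul, heD]
    field_simp
    ring
  set PL : Set (Fin n → ℂ) := {v | dt D (v - p0) + s * α v = 0} with hPL
  have hPLc : IsClosed PL := isClosed_eq
    (((continuous_const).dt (continuous_id.sub continuous_const)).add (continuous_const.mul hαc)) continuous_const
  obtain ⟨p1, hp1, hmin⟩ := ((isCompact_closedBall p0 r).inter_right hPLc).exists_isMinOn ⟨x s, hxr, hxPL⟩
    (hρ.cont_slice hz).continuousOn
  have hle : ρ z p1 ≤ ρ z (x s) := hmin ⟨hxr, hxPL⟩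
  have hl1 := hlow s hs p1 hp1.1 hp1.2
  have hsq : 0 ≤ c0 * ‖p1 - p0‖ ^ 2 := by positivity
  have hgt : m < ρ z p1 := by linarith
  have hIntg : ‖p1 - p0‖ < r := by
    by_contra h
    have h1 : ‖p1 - p0‖ ≤ r := by simpa [dist_eq_norm] using hp1.1
    have h2 : ‖p1 - p0‖ = r := le_antisymm h1 (not_lt.1 h)
    rw [h2] at hl1
    linarith
  refine ⟨p1, hgt, by linarith, ?_⟩
  have hU : (z, p1) ∈ UU ρ := ⟨hz, by show ρ z p1 ≠ 0; linarith⟩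
  have hv0PL : dt D (v0 - p0) + s * α v0 = 0 := by rw [hT]; simp [hα]
  have hline : ∀ τ : ℂ, p1 + τ • (v0 - p1) ∈ PL := by
    intro τ
    show dt D (p1 + τ • (v0 - p1) - p0) + s * α (p1 + τ • (v0 - p1)) = 0
    have h1 : p1 + τ • (v0 - p1) - p0 = (p1 - p0) + τ • ((v0 - p0) - (p1 - p0)) := by
      ext j; simp; ring
    have h2 : α (p1 + τ • (v0 - p1)) = α p1 + τ * (α v0 - α p1) := by
      rw [hα]; simp only [Pi.add_apply, Pi.smul_apply, Pi.sub_apply, smul_eq_mul]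
      field_simp
      ring
    rw [h1, h2, dt_add, dt_smul, dt_sub D (v0 - p0) (p1 - p0)]
    have h3 : dt D (p1 - p0) + s * α p1 = 0 := hp1.2
    linear_combination (1 - τ) * h3 + τ * hv0PL
  have hder : ∀ c : ℂ, fderiv ℝ (ρ z) p1 (c • (v0 - p1)) = 0 := by
    intro c
    have hl : HasDerivAt (fun s : ℝ => p1 + s • (c • (v0 - p1))) (c • (v0 - p1)) 0 := by
      simpa using ((hasDerivAt_id (0:ℝ)).smul_const (c • (v0 - p1))).const_add p1
    have hd : HasDerivAt (fun s : ℝ => ρ z (p1 + s • (c • (v0 - p1)))) (fderiv ℝ (ρ z) p1 (c • (v0 - p1))) 0 := by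
      have h1 : HasFDerivAt (ρ z) (fderiv ℝ (ρ z) p1) (p1 + (0:ℝ) • (c • (v0 - p1))) := by
        simpa using hρ.hasFDerivAt hU
      exact h1.comp_hasDerivAt (0:ℝ) hl
    refine IsLocalMin.hasDerivAt_eq_zero ?_ hd
    have h2 : Tendsto (fun s : ℝ => p1 + s • (c • (v0 - p1))) (𝓝 0) (𝓝 p1) := by
      have := hl.continuousAt.tendsto
      simpa using this
    have h3 : ∀ᶠ y in 𝓝 p1, y ∈ closedBall p0 r := by
      have : ball p0 r ∈ 𝓝 p1 := isOpen_ball.mem_nhds (by simpa [dist_eq_norm] using hIntg)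
      filter_upwards [this] with y hy using ball_subset_closedBall hy
    filter_upwards [h2.eventually h3] with y hy
    have h4 : p1 + y • (c • (v0 - p1)) ∈ PL := by
      have := hline ((y:ℂ) * c)
      rwa [mul_smul, coe_smul] at this
    have h5 : ρ z p1 ≤ ρ z (p1 + y • (c • (v0 - p1))) := hmin ⟨hy, h4⟩
    simpa using h5
  have h1 := hder 1
  have h2 := hder (-I)
  rw [fderiv_eq_dt, dt_smul] at h1 h2
  apply Complex.ext
  · simpa using h1
  · simpa using h2

theorem lc {z : ℂ} (hz : z ∈ Circ) {p v : Fin n → ℂ} (h0 : 0 < ρ z p) (hR : ρ z p ≤ R) (hv : v ≠ p)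
    (hT : dt (DD ρ z p) (v - p) = 0) : ρ z p < ρ z v := by
  by_contra hcon
  push Not at hcon
  obtain ⟨δ, hδ, C0, hC0, c0, hc0, hS⟩ := hρ.soe h0
  set t0 := ρ z p with ht0
  have hloc : ∀ p v, t0 ≤ ρ z p → ρ z p ≤ R → v ≠ p → dt (DD ρ z p) (v - p) = 0 → ‖v - p‖ < δ →
      ρ z p < ρ z v := by
    intro p v h1 h2 h3 h4 h5
    have := hS z hz p h1 h2 (v - p) h5
    rw [h4, add_sub_cancel] at this
    have h6 : 0 < c0 * ‖v - p‖ ^ 2 := by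
      have : 0 < ‖v - p‖ := norm_pos_iff.2 (sub_ne_zero.2 h3)
      positivity
    simp at this
    linarith
  set X : Set ((Fin n → ℂ) × (Fin n → ℂ)) :=
    ({p | euclNorm p ≤ R} ×ˢ {p | euclNorm p ≤ R}) ∩ {q | t0 ≤ ρ z q.1} with hX
  have hc1 : Continuous (fun q : (Fin n → ℂ) × (Fin n → ℂ) => ρ z q.1) := (hρ.cont_slice hz).comp continuous_fst
  have hc2 : Continuous (fun q : (Fin n → ℂ) × (Fin n → ℂ) => ρ z q.2) := (hρ.cont_slice hz).comp continuous_snd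
  have hXc : IsCompact X := ((isCompact_eucl R).prod (isCompact_eucl R)).inter_right
    (isClosed_le continuous_const hc1)
  have hcD : ContinuousOn (fun q : (Fin n → ℂ) × (Fin n → ℂ) => dt (DD ρ z q.1) (q.2 - q.1)) X := by
    refine ContinuousOn.dt ?_ (by fun_prop)
    refine (hρ.contOn_DD_slice hz).comp continuousOn_fst fun q hq => ?_
    have : t0 ≤ ρ z q.1 := hq.2
    show ρ z q.1 ≠ 0
    linarith
  have hYc := hXc.of_isClosed_subset (hcD.preimage_isClosed_of_isClosed hXc.isClosed (isClosed_singleton (x := 0)))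
    inter_subset_left
  have hZc := (hYc.inter_right (isClosed_le hc2 hc1)).inter_right
    (isClosed_le (continuous_const (y := δ)) (by fun_prop :
      Continuous (fun q : (Fin n → ℂ) × (Fin n → ℂ) => ‖q.2 - q.1‖)))
  set Z := ((X ∩ (fun q : (Fin n → ℂ) × (Fin n → ℂ) => dt (DD ρ z q.1) (q.2 - q.1)) ⁻¹' {0}) ∩
    {q | ρ z q.2 ≤ ρ z q.1}) ∩ {q | δ ≤ ‖q.2 - q.1‖} with hZ
  have hmemZ : ∀ p v, t0 ≤ ρ z p → ρ z p ≤ R → v ≠ p → dt (DD ρ z p) (v - p) = 0 → ρ z v ≤ ρ z p →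
      (p, v) ∈ Z := by
    intro p v h1 h2 h3 h4 h5
    refine ⟨⟨⟨⟨⟨(hρ.le_R_iff hz).1 h2, (hρ.le_R_iff hz).1 (h5.trans h2)⟩, h1⟩, h4⟩, h5⟩, ?_⟩
    by_contra h6
    exact absurd (hloc p v h1 h2 h3 h4 (not_le.1 h6)) (not_lt.2 h5)
  obtain ⟨⟨p0, v0⟩, hq, hmax⟩ := hZc.exists_isMaxOn ⟨(p, v), hmemZ p v le_rfl hR hv hT hcon⟩ hc1.continuousOn
  have hp0 : t0 ≤ ρ z p0 := hq.1.1.1.2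
  have hp0R : ρ z p0 ≤ R := (hρ.le_R_iff hz).2 hq.1.1.1.1.1
  have hv0R : euclNorm v0 ≤ R := hq.1.1.1.1.2
  have hT0 : dt (DD ρ z p0) (v0 - p0) = 0 := hq.1.1.2
  have hle0 : ρ z v0 ≤ ρ z p0 := hq.1.2
  have hne0 : v0 ≠ p0 := by
    rintro rfl
    have : δ ≤ ‖v0 - v0‖ := hq.2
    simp at this; linarith
  rcases hp0R.lt_or_eq with hlt | heq
  · obtain ⟨p1, a1, a2, a3⟩ := hρ.lc_step hz hδ hC0 hc0 (h0.trans_le hp0) hlt hne0 hT0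
      (hS z hz p0 hp0 hp0R)
    have hb : (p1, v0) ∈ Z := hmemZ p1 v0 (hp0.trans a1.le) a2 (by rintro rfl; linarith) a3 (by linarith)
    have : ρ z p1 ≤ ρ z p0 := hmax hb
    linarith
  · -- on the outer sphere
    have hd : 0 < ‖v0 - p0‖ := norm_pos_iff.2 (sub_ne_zero.2 hne0)
    obtain ⟨s, hs0, hs1, hs2⟩ : ∃ s : ℝ, 0 < s ∧ s ≤ 1 ∧ s * ‖v0 - p0‖ < δ := by
      refine ⟨min 1 (δ / (2 * ‖v0 - p0‖)), by positivity, min_le_left _ _, ?_⟩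
      calc _ ≤ δ / (2 * ‖v0 - p0‖) * ‖v0 - p0‖ := by gcongr; exact min_le_right _ _
        _ = δ / 2 := by field_simp
        _ < δ := by linarith
    have h1 := hloc p0 (p0 + s • (v0 - p0)) hp0 hp0R (by
        simpa [hs0.ne'] using sub_ne_zero.2 hne0) (by rw [add_sub_cancel_left, dt_rsmul, hT0, mul_zero]) (by
        rw [add_sub_cancel_left, norm_smul, Real.norm_eq_abs, abs_of_pos hs0]; exact hs2)
    have h2 : p0 + s • (v0 - p0) ∈ {w : Fin n → ℂ | euclNorm w ≤ R} :=
      (convex_eucl R).add_smul_sub_mem hq.1.1.1.1.1 hv0R ⟨hs0.le, hs1⟩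
    have h3 := (hρ.le_R_iff hz).2 h2
    linarith

end Cond3
end LC2



section S2
open scoped Topology
variable {n : ℕ}

/-- the normalized normal covector -/
def Gm (ρ : ℂ → (Fin n → ℂ) → ℝ) (z : ℂ) (p : Fin n → ℂ) : Fin n → ℂ :=
  (dt (DD ρ z p) p)⁻¹ • DD ρ z p

/-- the affine function whose zero set is the complex tangent plane -/
def qq (ρ : ℂ → (Fin n → ℂ) → ℝ) (z : ℂ) (p v : Fin n → ℂ) : ℂ := 1 - dt (Gm ρ z p) v

variable {ρ : ℂ → (Fin n → ℂ) → ℝ} {R : ℝ}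

lemma qq_zero (z : ℂ) (p : Fin n → ℂ) : qq ρ z p 0 = 1 := by simp [qq, dt_zero]

namespace Cond3
variable (hρ : Cond3 n ρ R (fun _ => 0))
include hρ

lemma lam_ne {z : ℂ} (hz : z ∈ Circ) {p : Fin n → ℂ} (h0 : 0 < ρ z p) (hR : ρ z p ≤ R) :
    dt (DD ρ z p) p ≠ 0 := by
  intro h
  have hp : (0 : Fin n → ℂ) ≠ p := ((hρ.pos_iff hz).1 h0).symm
  have := hρ.lc hz h0 hR hp (by rw [dt_sub, dt_zero, h, sub_zero])
  rw [hρ.rho_zero hz] at this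
  linarith

lemma lam_mul_qq {z : ℂ} (hz : z ∈ Circ) {p : Fin n → ℂ} (h0 : 0 < ρ z p) (hR : ρ z p ≤ R)
    (v : Fin n → ℂ) : dt (DD ρ z p) p * qq ρ z p v = - dt (DD ρ z p) (v - p) := by
  have h := hρ.lam_ne hz h0 hR
  rw [qq, Gm, smul_dt, dt_sub]
  field_simp
  ring

lemma Gm_dot {z : ℂ} (hz : z ∈ Circ) {p : Fin n → ℂ} (h0 : 0 < ρ z p) (hR : ρ z p ≤ R) :
    dt (Gm ρ z p) p = 1 := by
  rw [Gm, smul_dt, inv_mul_cancel₀ (hρ.lam_ne hz h0 hR)]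

lemma Gm_ne {z : ℂ} (hz : z ∈ Circ) {p : Fin n → ℂ} (h0 : 0 < ρ z p) (hR : ρ z p ≤ R) :
    Gm ρ z p ≠ 0 := by
  intro h
  have := hρ.Gm_dot hz h0 hR
  rw [h, zero_dt] at this
  exact zero_ne_one this

lemma qq_ne {z : ℂ} (hz : z ∈ Circ) {p v : Fin n → ℂ} (h0 : 0 < ρ z p) (hR : ρ z p ≤ R)
    (hv : ρ z v ≤ ρ z p) (hne : v ≠ p) : qq ρ z p v ≠ 0 := by
  intro h
  have h1 := hρ.lam_mul_qq hz h0 hR v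
  rw [h, mul_zero] at h1
  have := hρ.lc hz h0 hR hne (by linear_combination h1)
  linarith

lemma qq_ne' {z : ℂ} (hz : z ∈ Circ) {p v : Fin n → ℂ} (h0 : 0 < ρ z p) (hR : ρ z p ≤ R)
    (hv : ρ z v < ρ z p) : qq ρ z p v ≠ 0 :=
  hρ.qq_ne hz h0 hR hv.le (by rintro rfl; exact lt_irrefl _ hv)

lemma contOn_Gm : ContinuousOn (fun p : ℂ × (Fin n → ℂ) => Gm ρ p.1 p.2)
    {p | p.1 ∈ Circ ∧ 0 < ρ p.1 p.2 ∧ ρ p.1 p.2 ≤ R} := by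
  have h1 : ContinuousOn (fun p : ℂ × (Fin n → ℂ) => DD ρ p.1 p.2)
      {p | p.1 ∈ Circ ∧ 0 < ρ p.1 p.2 ∧ ρ p.1 p.2 ≤ R} := hρ.contOn_DD.mono fun p hp => ⟨hp.1, hp.2.1.ne'⟩
  exact ((h1.dt continuousOn_snd).inv₀ fun p hp => hρ.lam_ne hp.1 hp.2.1 hp.2.2).smul h1

lemma contOn_qq : ContinuousOn (fun x : ℂ × (Fin n → ℂ) × (Fin n → ℂ) => qq ρ x.1 x.2.1 x.2.2)
    {x | x.1 ∈ Circ ∧ 0 < ρ x.1 x.2.1 ∧ ρ x.1 x.2.1 ≤ R} := by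
  refine continuousOn_const.sub (ContinuousOn.dt ?_ (by fun_prop))
  exact hρ.contOn_Gm.comp (f := fun x : ℂ × (Fin n → ℂ) × (Fin n → ℂ) => (x.1, x.2.1)) (by fun_prop)
    fun x hx => hx

/-- compactness of the shell -/
lemma isCompact_lev {t0 : ℝ} : IsCompact {p : ℂ × (Fin n → ℂ) | p.1 ∈ Circ ∧ t0 ≤ ρ p.1 p.2 ∧ ρ p.1 p.2 ≤ R} := by
  convert hρ.isCompact_shell t0 R using 1
  ext p
  constructor
  · rintro ⟨a, b, c⟩; exact ⟨a, b, (hρ.le_R_iff a).1 c⟩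
  · rintro ⟨a, b, c⟩; exact ⟨a, b, (hρ.le_R_iff a).2 c⟩

/-- compactness of pairs `(z,p,v)` -/
lemma isCompact_pairs (t0 s0 : ℝ) : IsCompact {x : ℂ × (Fin n → ℂ) × (Fin n → ℂ) | x.1 ∈ Circ ∧
    t0 ≤ ρ x.1 x.2.1 ∧ ρ x.1 x.2.1 ≤ R ∧ ρ x.1 x.2.2 + s0 ≤ ρ x.1 x.2.1 ∧ ρ x.1 x.2.2 ≤ R} := by
  have h1 : IsCompact (Circ ×ˢ ({w : Fin n → ℂ | euclNorm w ≤ R} ×ˢ {w : Fin n → ℂ | euclNorm w ≤ R})) :=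
    isCompact_circ.prod ((isCompact_eucl R).prod (isCompact_eucl R))
  have c1 : ContinuousOn (fun x : ℂ × (Fin n → ℂ) × (Fin n → ℂ) => ρ x.1 x.2.1)
      (Circ ×ˢ ({w : Fin n → ℂ | euclNorm w ≤ R} ×ˢ {w : Fin n → ℂ | euclNorm w ≤ R})) :=
    hρ.cont.comp (f := fun x : ℂ × (Fin n → ℂ) × (Fin n → ℂ) => (x.1, x.2.1)) (by fun_prop) fun x hx => hx.1
  have c2 : ContinuousOn (fun x : ℂ × (Fin n → ℂ) × (Fin n → ℂ) => ρ x.1 x.2.2)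
      (Circ ×ˢ ({w : Fin n → ℂ | euclNorm w ≤ R} ×ˢ {w : Fin n → ℂ | euclNorm w ≤ R})) :=
    hρ.cont.comp (f := fun x : ℂ × (Fin n → ℂ) × (Fin n → ℂ) => (x.1, x.2.2)) (by fun_prop) fun x hx => hx.1
  have h2 := (h1.of_isClosed_subset ((c1.prodMk c2).preimage_isClosed_of_isClosed h1.isClosed
    (t := {y : ℝ × ℝ | t0 ≤ y.1 ∧ y.2 + s0 ≤ y.1})
    ((isClosed_le continuous_const continuous_fst).inter (isClosed_le (by fun_prop) continuous_fst))) inter_subset_left)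
  convert h2 using 1
  ext x
  constructor
  · rintro ⟨a, b, c, d, e⟩
    exact ⟨⟨a, (hρ.le_R_iff a).1 c, (hρ.le_R_iff a).1 e⟩, b, d⟩
  · rintro ⟨⟨a, b, c⟩, d, e⟩
    exact ⟨a, d, (hρ.le_R_iff a).2 b, e, (hρ.le_R_iff a).2 c⟩

/-- uniform strict linear convexity -/
lemma unif_lc {t0 ε : ℝ} (ht0 : 0 < t0) (hε : 0 < ε) : ∃ c > 0, ∀ z ∈ Circ, ∀ p v, t0 ≤ ρ z p → ρ z p ≤ R →
    ρ z v ≤ ρ z p → ε ≤ ‖v - p‖ → c ≤ ‖qq ρ z p v‖ := by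
  have hc := (hρ.isCompact_pairs t0 0).inter_right (isClosed_le (continuous_const (y := ε))
    (by fun_prop : Continuous (fun x : ℂ × (Fin n → ℂ) × (Fin n → ℂ) => ‖x.2.2 - x.2.1‖)))
  set C := {x : ℂ × (Fin n → ℂ) × (Fin n → ℂ) | x.1 ∈ Circ ∧
    t0 ≤ ρ x.1 x.2.1 ∧ ρ x.1 x.2.1 ≤ R ∧ ρ x.1 x.2.2 + 0 ≤ ρ x.1 x.2.1 ∧ ρ x.1 x.2.2 ≤ R} ∩
    {x | ε ≤ ‖x.2.2 - x.2.1‖} with hC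
  have hmem : ∀ z ∈ Circ, ∀ p v, t0 ≤ ρ z p → ρ z p ≤ R → ρ z v ≤ ρ z p → ε ≤ ‖v - p‖ → (z, p, v) ∈ C :=
    fun z hz p v h1 h2 h3 h4 => ⟨⟨hz, h1, h2, by simpa using h3, h3.trans h2⟩, h4⟩
  rcases eq_empty_or_nonempty C with he | hne
  · refine ⟨1, one_pos, fun z hz p v h1 h2 h3 h4 => ?_⟩
    have := hmem z hz p v h1 h2 h3 h4
    rw [he] at this; exact absurd this (notMem_empty _)
  · have hcq : ContinuousOn (fun x : ℂ × (Fin n → ℂ) × (Fin n → ℂ) => ‖qq ρ x.1 x.2.1 x.2.2‖) C :=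
      hρ.contOn_qq.norm.mono fun x hx => ⟨hx.1.1, ht0.trans_le hx.1.2.1, hx.1.2.2.1⟩
    obtain ⟨x, hx, hmin⟩ := hc.exists_isMinOn hne hcq
    have hmin' : ∀ y ∈ C, ‖qq ρ x.1 x.2.1 x.2.2‖ ≤ ‖qq ρ y.1 y.2.1 y.2.2‖ := fun y hy => hmin hy
    refine ⟨‖qq ρ x.1 x.2.1 x.2.2‖, norm_pos_iff.2 ?_, fun z hz p v h1 h2 h3 h4 =>
      hmin' (z, p, v) (hmem z hz p v h1 h2 h3 h4)⟩
    refine hρ.qq_ne hx.1.1 (ht0.trans_le hx.1.2.1) hx.1.2.2.1 (by simpa using hx.1.2.2.2.1) ?_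
    intro h
    have : ε ≤ ‖x.2.2 - x.2.1‖ := hx.2
    rw [h] at this; simp at this; linarith

lemma Gm_bound {t0 : ℝ} (ht0 : 0 < t0) : ∃ M > 0, ∀ z ∈ Circ, ∀ p, t0 ≤ ρ z p → ρ z p ≤ R → ‖Gm ρ z p‖ ≤ M := by
  obtain ⟨M, hM⟩ := (hρ.isCompact_lev (t0 := t0)).exists_bound_of_continuousOn
    (hρ.contOn_Gm.mono fun p hp => ⟨hp.1, ht0.trans_le hp.2.1, hp.2.2⟩)
  exact ⟨max M 1, by positivity, fun z hz p h1 h2 => (hM (z, p) ⟨hz, h1, h2⟩).trans (le_max_left _ _)⟩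

lemma no_crit {z : ℂ} (hz : z ∈ Circ) {p : Fin n → ℂ} (h0 : 0 < ρ z p) (hR : ρ z p ≤ R) :
    ¬ IsLocalMin (ρ z) p ∧ ¬ IsLocalMax (ρ z) p :=
  ⟨fun h => hρ.grad_ne z hz p h0 hR h.fderiv_eq_zero, fun h => hρ.grad_ne z hz p h0 hR h.fderiv_eq_zero⟩

lemma isOpen_sub {z : ℂ} (hz : z ∈ Circ) (t : ℝ) : IsOpen {v | ρ z v < t} :=
  isOpen_lt (hρ.cont_slice hz) continuous_const

lemma isCompact_sub {z : ℂ} (hz : z ∈ Circ) {t : ℝ} (ht : t ≤ R) : IsCompact {v | ρ z v ≤ t} :=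
  (isCompact_eucl R).of_isClosed_subset (isClosed_le (hρ.cont_slice hz) continuous_const)
    fun _ hv => (hρ.le_R_iff hz).1 (le_trans hv ht)

lemma sub_connected {z : ℂ} (hz : z ∈ Circ) {t : ℝ} (ht : 0 < t) (htR : t ≤ R) :
    IsConnected {v | ρ z v < t} := by
  set U := {v | ρ z v < t} with hU
  have hUo : IsOpen U := hρ.isOpen_sub hz t
  have h0U : (0 : Fin n → ℂ) ∈ U := by show ρ z 0 < t; rw [hρ.rho_zero hz]; exact ht
  have key : ∀ v ∈ U, (0 : Fin n → ℂ) ∈ connectedComponentIn U v := by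
    intro v hv
    set C := connectedComponentIn U v with hC
    have hCU : C ⊆ U := connectedComponentIn_subset U v
    have hCo : IsOpen C := hUo.connectedComponentIn
    have hvC : v ∈ C := mem_connectedComponentIn hv
    have hcl : closure C ⊆ {v | ρ z v ≤ t} := closure_minimal (fun x hx => (le_of_lt (hCU hx : ρ z x < t) : ρ z x ≤ t))
      (isClosed_le (hρ.cont_slice hz) continuous_const)
    have hcc : IsCompact (closure C) := (hρ.isCompact_sub hz htR).of_isClosed_subset isClosed_closure hcl
    obtain ⟨x, hx, hmin⟩ := hcc.exists_isMinOn ⟨v, subset_closure hvC⟩ (hρ.cont_slice hz).continuousOn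
    have hxt : ρ z x < t := lt_of_le_of_lt (hmin (subset_closure hvC)) (hv : ρ z v < t)
    have hxU : x ∈ U := hxt
    have hxC : x ∈ C := by
      have h1 : IsPreconnected (insert x C) :=
        (isPreconnected_connectedComponentIn (x := v) (F := U)).subset_closure (subset_insert _ _)
          (insert_subset hx subset_closure)
      exact h1.subset_connectedComponentIn (mem_insert_of_mem _ hvC) (insert_subset hxU hCU) (mem_insert _ _)
    have hloc : IsLocalMin (ρ z) x := by
      filter_upwards [hCo.mem_nhds hxC] with y hy using hmin (subset_closure hy)
    by_cases hx0 : x = 0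
    · rwa [hx0] at hxC
    · exact absurd hloc (hρ.no_crit hz ((hρ.pos_iff hz).2 hx0) (hxt.le.trans htR)).1
  refine ⟨⟨0, h0U⟩, ?_⟩
  have : U = connectedComponentIn U 0 := by
    refine subset_antisymm (fun v hv => ?_) (connectedComponentIn_subset U 0)
    rw [← connectedComponentIn_eq (key v hv)]
    exact mem_connectedComponentIn hv
  rw [this]; exact isPreconnected_connectedComponentIn

lemma eucl_Gm_le {z : ℂ} (hz : z ∈ Circ) {p : Fin n → ℂ} (hp : ρ z p = R) : euclNorm (Gm ρ z p) ≤ 1 / R := by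
  have hR := hρ.R_pos
  have hp0 : 0 < ρ z p := by rw [hp]; exact hR
  set c := Gm ρ z p with hc
  have hc0 : 0 < euclNorm c := euclNorm_pos.2 (hρ.Gm_ne hz hp0 hp.le)
  set v : Fin n → ℂ := (((euclNorm c ^ 2 : ℝ) : ℂ))⁻¹ • cj c with hv
  have hne : ((euclNorm c ^ 2 : ℝ) : ℂ) ≠ 0 := by exact_mod_cast (by positivity : euclNorm c ^ 2 ≠ 0)
  have h1 : dt c v = 1 := by rw [hv, dt_smul, dt_cj, inv_mul_cancel₀ hne]
  have hec : euclNorm (cj c) = euclNorm c := by simp [euclNorm, cj]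
  have h2 : euclNorm v = 1 / euclNorm c := by
    rw [hv, euclNorm_smul, hec, norm_inv, Complex.norm_real, Real.norm_eq_abs, abs_of_pos (by positivity)]
    field_simp
  have h3 : R ≤ euclNorm v := by
    by_contra h
    have h4 : ρ z v < R := (hρ.lt_R_iff hz).2 (not_le.1 h)
    exact hρ.qq_ne' hz (v := v) hp0 hp.le (by rw [hp]; exact h4) (by rw [qq, ← hc, h1, sub_self])
  rw [h2, le_div_iff₀ hc0] at h3
  rw [le_div_iff₀ hR]; linarith

/-- first order decrease -/
lemma fo_decr {t0 c : ℝ} (ht0 : 0 < t0) (hc : 0 < c) : ∃ δ > 0, ∀ z ∈ Circ, ∀ p, t0 ≤ ρ z p → ρ z p ≤ R →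
    ∀ h : Fin n → ℂ, ‖h‖ < δ → (dt (DD ρ z p) h).re ≤ - c * ‖h‖ → ρ z (p + h) ≤ ρ z p - c * ‖h‖ := by
  obtain ⟨δ, hδ, H⟩ := hρ.fo_unif (hρ.isCompact_lev (t0 := t0)) (fun p hp => ⟨hp.1, (ht0.trans_le hp.2.1).ne'⟩) hc
  refine ⟨δ, hδ, fun z hz p h1 h2 h hh hd => ?_⟩
  have := (abs_le.1 (H (z, p) ⟨hz, h1, h2⟩ h hh).2).2
  simp only [fderiv_eq_dt] at this
  linarith

/-- pushing inward -/
lemma push {t0 : ℝ} (ht0 : 0 < t0) : ∃ s0 > 0, ∃ c > 0, ∀ z ∈ Circ, ∀ p, t0 ≤ ρ z p → ρ z p ≤ R →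
    ∀ s, 0 ≤ s → s ≤ s0 → ρ z (p - s • cj (DD ρ z p)) ≤ ρ z p - c * s := by
  obtain ⟨m, hm, M, hM, H⟩ := hρ.grad_bounds ht0
  obtain ⟨δ, hδ, Hd⟩ := hρ.fo_decr (c := m ^ 2 / M) ht0 (by positivity)
  obtain ⟨_, _, M', hM', _⟩ := hρ.grad_bounds ht0
  have hlow : ∃ m1 > 0, ∀ z ∈ Circ, ∀ p, t0 ≤ ρ z p → ρ z p ≤ R → m1 ≤ ‖DD ρ z p‖ := by
    by_cases hn : n = 0
    · exact absurd hρ.hn (by omega)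
    refine ⟨m / (n * 1 + 1), by positivity, fun z hz p h1 h2 => ?_⟩
    have h3 := (H z hz p h1 h2).1
    have h4 := norm_dt_le (DD ρ z p) (cj (DD ρ z p))
    rw [dt_cj, norm_cj, Complex.norm_real, Real.norm_eq_abs, abs_of_nonneg (by positivity)] at h4
    have h5 : (0:ℝ) ≤ n := by positivity
    rw [div_le_iff₀ (by positivity)]
    by_contra h6
    push Not at h6
    have h7 := norm_nonneg (DD ρ z p)
    have h8 : (‖DD ρ z p‖ * (n * 1 + 1)) * (‖DD ρ z p‖ * (n * 1 + 1)) < m * m := by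
      apply mul_lt_mul'' h6 h6 <;> positivity
    have h9 : m ^ 2 ≤ euclNorm (DD ρ z p) ^ 2 := by gcongr
    nlinarith [mul_nonneg (mul_nonneg h5 h5) (mul_nonneg h7 h7), mul_nonneg h5 (mul_nonneg h7 h7)]
  obtain ⟨m1, hm1, H1⟩ := hlow
  refine ⟨δ / (2 * M), by positivity, m ^ 2 / M * m1, by positivity, fun z hz p h1 h2 s hs hs0 => ?_⟩
  obtain ⟨a1, a2, -⟩ := H z hz p h1 h2
  have hnorm : ‖-(s • cj (DD ρ z p))‖ = s * ‖DD ρ z p‖ := by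
    rw [norm_neg, norm_smul, norm_cj, Real.norm_eq_abs, abs_of_nonneg hs]
  have h3 := Hd z hz p h1 h2 (-(s • cj (DD ρ z p))) (by
      rw [hnorm]
      calc s * ‖DD ρ z p‖ ≤ δ / (2 * M) * M := by gcongr
        _ = δ / 2 := by field_simp
        _ < δ := by linarith) (by
      rw [hnorm, ← smul_neg, dt_rsmul, re_ofReal_mul]
      have : dt (DD ρ z p) (-cj (DD ρ z p)) = -((euclNorm (DD ρ z p) ^ 2 : ℝ) : ℂ) := by
        rw [← dt_cj, ← sub_eq_zero, sub_neg_eq_add, ← dt_add, neg_add_cancel, dt_zero]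
      rw [this, neg_re, ofReal_re]
      have h9 : m ^ 2 ≤ euclNorm (DD ρ z p) ^ 2 := by gcongr
      have h10 : m ^ 2 / M * ‖DD ρ z p‖ ≤ m ^ 2 := by
        calc m ^ 2 / M * ‖DD ρ z p‖ ≤ m ^ 2 / M * M := by gcongr
          _ = m ^ 2 := by field_simp
      nlinarith)
  rw [hnorm, ← sub_eq_add_neg] at h3
  have h4 : m ^ 2 / M * m1 * s ≤ m ^ 2 / M * (s * ‖DD ρ z p‖) := by
    have := H1 z hz p h1 h2
    rw [mul_assoc, mul_comm m1 s]
    gcongr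
  linarith

end Cond3
end S2



section S3
open scoped Topology
variable {n : ℕ}

lemma log_unique {X : Type*} [TopologicalSpace X] {S : Set X} (hS : IsPreconnected S) {L1 L2 : X → ℂ}
    (h1 : ContinuousOn L1 S) (h2 : ContinuousOn L2 S) (he : ∀ x ∈ S, exp (L1 x) = exp (L2 x)) {x0 : X}
    (hx0 : x0 ∈ S) (h0 : L1 x0 = L2 x0) : ∀ x ∈ S, L1 x = L2 x :=
  isCoveringMap_exp.eqOn_of_comp_eqOn hS h1 h2 (fun x hx => Subtype.ext (he x hx)) hx0 h0

lemma slit_of_close {a b : ℂ} (h : ‖b - a‖ < ‖a‖) : b / a ∈ slitPlane := by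
  have ha : a ≠ 0 := by
    rintro rfl
    simp at h
    exact absurd h (not_lt.2 (norm_nonneg _))
  have : b / a = 1 + (b - a) / a := by field_simp; ring
  rw [this]
  apply mem_slitPlane_of_norm_lt_one
  rw [norm_div, div_lt_one (norm_pos_iff.2 ha)]; exact h

variable {ρ : ℂ → (Fin n → ℂ) → ℝ} {R : ℝ}

lemma qq_diff (z z' : ℂ) (p p' v : Fin n → ℂ) :
    ‖qq ρ z' p' v - qq ρ z p v‖ ≤ n * ‖Gm ρ z' p' - Gm ρ z p‖ * ‖v‖ := by
  have : qq ρ z' p' v - qq ρ z p v = - dt (Gm ρ z' p' - Gm ρ z p) v := by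
    rw [qq, qq, sub_dt]; ring
  rw [this, norm_neg]; exact norm_dt_le _ _

/-- a continuous logarithm exists on a closed sublevel set -/
def GoodLog (ρ : ℂ → (Fin n → ℂ) → ℝ) (z : ℂ) (s : ℝ) (p : Fin n → ℂ) : Prop :=
  ∃ L : (Fin n → ℂ) → ℂ, ContinuousOn L {v | ρ z v ≤ s} ∧ ∀ v, ρ z v ≤ s → exp (L v) = qq ρ z p v

lemma continuous_qq_v (z : ℂ) (p : Fin n → ℂ) : Continuous (fun v => qq ρ z p v) :=
  continuous_const.sub (continuous_const.dt continuous_id)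

lemma GoodLog.near {z : ℂ} {s : ℝ} {p p' : Fin n → ℂ} (h : GoodLog ρ z s p)
    (hc : ∀ v, ρ z v ≤ s → ‖qq ρ z p' v - qq ρ z p v‖ < ‖qq ρ z p v‖) : GoodLog ρ z s p' := by
  obtain ⟨L, hL, hexp⟩ := h
  have hne : ∀ v, ρ z v ≤ s → qq ρ z p v ≠ 0 := fun v hv => by rw [← hexp v hv]; exact exp_ne_zero _
  refine ⟨fun v => L v + Complex.log (qq ρ z p' v / qq ρ z p v), hL.add ?_, fun v hv => ?_⟩
  · exact ContinuousOn.clog ((continuous_qq_v z p').continuousOn.div (continuous_qq_v z p).continuousOn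
      fun v hv => hne v hv) fun v hv => slit_of_close (hc v hv)
  · have h1 := slitPlane_ne_zero (slit_of_close (hc v hv))
    rw [exp_add, hexp v hv, Complex.exp_log h1, mul_div_cancel₀ _ (hne v hv)]

namespace Cond3
variable (hρ : Cond3 n ρ R (fun _ => 0))
include hρ

lemma norm_le_R {z : ℂ} (hz : z ∈ Circ) {v : Fin n → ℂ} (h : ρ z v ≤ R) : ‖v‖ ≤ R :=
  (norm_le_euclNorm v).trans ((hρ.le_R_iff hz).1 h)

/-- uniform closeness near a given `(z,p)` on a compact subset of the open sublevel set -/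
lemma close_near {z : ℂ} (hz : z ∈ Circ) {p : Fin n → ℂ} (h0 : 0 < ρ z p) (hR : ρ z p ≤ R)
    {S : Set (Fin n → ℂ)} (hS : IsCompact S) (hSp : ∀ v ∈ S, ρ z v < ρ z p) :
    ∀ᶠ x in 𝓝[{x : ℂ × (Fin n → ℂ) | x.1 ∈ Circ ∧ 0 < ρ x.1 x.2 ∧ ρ x.1 x.2 ≤ R}] (z, p),
      ∀ v ∈ S, ‖qq ρ x.1 x.2 v - qq ρ z p v‖ < ‖qq ρ z p v‖ ∧
        ‖qq ρ z p v - qq ρ x.1 x.2 v‖ < ‖qq ρ x.1 x.2 v‖ := by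
  obtain ⟨c, hc, hcv⟩ : ∃ c > 0, ∀ v ∈ S, c ≤ ‖qq ρ z p v‖ := by
    rcases S.eq_empty_or_nonempty with he | hne
    · exact ⟨1, one_pos, fun v hv => by rw [he] at hv; exact absurd hv (notMem_empty v)⟩
    · obtain ⟨x, hx, hmin⟩ := hS.exists_isMinOn hne (continuous_qq_v (ρ := ρ) z p).norm.continuousOn
      exact ⟨‖qq ρ z p x‖, norm_pos_iff.2 (hρ.qq_ne' hz h0 hR (hSp x hx)), fun v hv => hmin hv⟩
  have hRp := hρ.R_pos
  have hcont := hρ.contOn_Gm (z, p) ⟨hz, h0, hR⟩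
  have h1 : Tendsto (fun x : ℂ × (Fin n → ℂ) => n * ‖Gm ρ x.1 x.2 - Gm ρ z p‖ * R)
      (𝓝[{x : ℂ × (Fin n → ℂ) | x.1 ∈ Circ ∧ 0 < ρ x.1 x.2 ∧ ρ x.1 x.2 ≤ R}] (z, p)) (𝓝 (n * ‖Gm ρ z p - Gm ρ z p‖ * R)) :=
    ((hcont.sub tendsto_const_nhds).norm.const_mul _).mul_const _
  rw [sub_self, norm_zero, mul_zero, zero_mul] at h1
  filter_upwards [h1.eventually (gt_mem_nhds (half_pos hc))] with x hx v hv
  have h2 : ‖qq ρ x.1 x.2 v - qq ρ z p v‖ < c / 2 := by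
    refine lt_of_le_of_lt ((qq_diff _ _ _ _ _).trans ?_) hx
    gcongr
    exact hρ.norm_le_R hz ((hSp v hv).le.trans hR)
  have h3 := hcv v hv
  refine ⟨by linarith, ?_⟩
  rw [norm_sub_rev]
  have h4 := norm_sub_norm_le (qq ρ z p v) (qq ρ x.1 x.2 v)
  rw [norm_sub_rev] at h4
  linarith

lemma close_near' {z : ℂ} (hz : z ∈ Circ) {s : ℝ} (hs : 0 ≤ s) {p : Fin n → ℂ} (h0 : s < ρ z p) (hR : ρ z p ≤ R) :
    ∀ᶠ p' in 𝓝[{p' | s < ρ z p' ∧ ρ z p' ≤ R}] p, GoodLog ρ z s p' ↔ GoodLog ρ z s p := by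
  have h := hρ.close_near hz (hs.trans_lt h0) hR (hρ.isCompact_sub hz (h0.le.trans hR)) (fun v hv => lt_of_le_of_lt hv h0)
  have ht : Tendsto (fun p' : Fin n → ℂ => ((z, p') : ℂ × (Fin n → ℂ))) (𝓝[{p' | s < ρ z p' ∧ ρ z p' ≤ R}] p)
      (𝓝[{x : ℂ × (Fin n → ℂ) | x.1 ∈ Circ ∧ 0 < ρ x.1 x.2 ∧ ρ x.1 x.2 ≤ R}] (z, p)) := by
    refine tendsto_nhdsWithin_of_tendsto_nhds_of_eventually_within _ ?_ ?_
    · exact ((by fun_prop : Continuous (fun p' : Fin n → ℂ => ((z, p') : ℂ × (Fin n → ℂ)))).tendsto p).mono_left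
        nhdsWithin_le_nhds
    · filter_upwards [self_mem_nhdsWithin] with p' hp'
      exact ⟨hz, hs.trans_lt hp'.1, hp'.2⟩
  filter_upwards [ht.eventually h] with p' hp'
  exact ⟨fun hg => hg.near fun v hv => (hp' v hv).2, fun hg => hg.near fun v hv => (hp' v hv).1⟩

lemma goodLog {z : ℂ} (hz : z ∈ Circ) {s : ℝ} (hs : 0 ≤ s) {p1 : Fin n → ℂ} (h1 : s < ρ z p1) (hR1 : ρ z p1 ≤ R) :
    GoodLog ρ z s p1 := by
  by_contra hbad
  set B := {p | ρ z p1 ≤ ρ z p ∧ ρ z p ≤ R ∧ ¬ GoodLog ρ z s p} with hB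
  have hcl : IsClosed B := by
    rw [← closure_subset_iff_isClosed]
    intro x hx
    have hx1 : ρ z p1 ≤ ρ z x := closure_minimal (fun y (hy : y ∈ B) => hy.1)
      (isClosed_le continuous_const (hρ.cont_slice hz)) hx
    have hx2 : ρ z x ≤ R := closure_minimal (fun y (hy : y ∈ B) => hy.2.1)
      (isClosed_le (hρ.cont_slice hz) continuous_const) hx
    refine ⟨hx1, hx2, fun hg => ?_⟩
    have hne : (𝓝[B] x).NeBot := mem_closure_iff_nhdsWithin_neBot.1 hx
    have h2 : ∀ᶠ p' in 𝓝[B] x, GoodLog ρ z s p' ↔ GoodLog ρ z s x :=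
      nhdsWithin_mono _ (show B ⊆ {p' | s < ρ z p' ∧ ρ z p' ≤ R} from fun y (hy : y ∈ B) => ⟨h1.trans_le hy.1, hy.2.1⟩)
        (hρ.close_near' hz hs (h1.trans_le hx1) hx2)
    obtain ⟨y, hy1, hy2⟩ := (h2.and self_mem_nhdsWithin).exists
    exact hy2.2.2 (hy1.2 hg)
  have hcp : IsCompact B := (isCompact_eucl R).of_isClosed_subset hcl fun y hy => (hρ.le_R_iff hz).1 hy.2.1
  obtain ⟨p0, hp0, hmax⟩ := hcp.exists_isMaxOn ⟨p1, le_rfl, hR1, hbad⟩ (hρ.cont_slice hz).continuousOn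
  have hp0s : s < ρ z p0 := h1.trans_le hp0.1
  rcases hp0.2.1.lt_or_eq with hlt | heq
  · refine (hρ.no_crit hz (hs.trans_lt hp0s) hp0.2.1).2 ?_
    have hA : {p' | s < ρ z p' ∧ ρ z p' < R} ∈ 𝓝 p0 :=
      ((isOpen_lt continuous_const (hρ.cont_slice hz)).inter (hρ.isOpen_sub hz R)).mem_nhds ⟨hp0s, hlt⟩
    have h3 := hρ.close_near' hz hs hp0s hp0.2.1
    rw [nhdsWithin_eq_nhds.2 (mem_of_superset hA (show {p' | s < ρ z p' ∧ ρ z p' < R} ⊆ {p' | s < ρ z p' ∧ ρ z p' ≤ R} from fun y hy => ⟨hy.1, le_of_lt hy.2⟩))] at h3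
    filter_upwards [h3, hA] with y hy1 hy2
    by_cases hle : ρ z p1 ≤ ρ z y
    · exact hmax (show y ∈ B from ⟨hle, hy2.2.le, fun hg => hp0.2.2 (hy1.1 hg)⟩)
    · exact (not_le.1 hle).le.trans hp0.1
  · apply hp0.2.2
    have hlt : ∀ v, ρ z v ≤ s → ‖dt (Gm ρ z p0) v‖ < 1 := by
      intro v hv
      have hRp := hρ.R_pos
      have h4 : euclNorm v < R := (hρ.lt_R_iff hz).1 (by linarith)
      refine (norm_dt_le' _ _).trans_lt ?_
      calc _ ≤ 1 / R * euclNorm v := by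
            have := hρ.eucl_Gm_le hz heq
            have := euclNorm_nonneg v
            gcongr
        _ < 1 / R * R := by gcongr
        _ = 1 := by field_simp
    have hsl : ∀ v, ρ z v ≤ s → qq ρ z p0 v ∈ slitPlane := by
      intro v hv
      rw [qq, sub_eq_add_neg]
      exact mem_slitPlane_of_norm_lt_one (by rw [norm_neg]; exact hlt v hv)
    exact ⟨fun v => Complex.log (qq ρ z p0 v), ContinuousOn.clog (continuous_qq_v z p0).continuousOn
      fun v hv => hsl v hv, fun v hv => Complex.exp_log (slitPlane_ne_zero (hsl v hv))⟩

/-- logs on the open sublevel set -/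
lemma exists_log1 {z : ℂ} (hz : z ∈ Circ) {p : Fin n → ℂ} (h0 : 0 < ρ z p) (hR : ρ z p ≤ R) :
    ∃ L : (Fin n → ℂ) → ℂ, ContinuousOn L {v | ρ z v < ρ z p} ∧ (∀ v, ρ z v < ρ z p → exp (L v) = qq ρ z p v) ∧
      L 0 = 0 := by
  have hch : ∀ s : ℝ, ∃ L : (Fin n → ℂ) → ℂ, 0 ≤ s → s < ρ z p → ContinuousOn L {v | ρ z v ≤ s} ∧
      (∀ v, ρ z v ≤ s → exp (L v) = qq ρ z p v) ∧ L 0 = 0 := by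
    intro s
    by_cases hs : 0 ≤ s ∧ s < ρ z p
    · obtain ⟨L, hL, hexp⟩ := hρ.goodLog hz hs.1 hs.2 hR
      have hL0 : exp (L 0) = 1 := by rw [hexp 0 (by rw [hρ.rho_zero hz]; exact hs.1), qq_zero]
      refine ⟨fun v => L v - L 0, fun _ _ => ⟨hL.sub continuousOn_const, fun v hv => ?_, by simp⟩⟩
      rw [exp_sub, hL0, div_one, hexp v hv]
    · exact ⟨0, fun h1 h2 => absurd ⟨h1, h2⟩ hs⟩
  choose Ls hLs using hch
  have hagree : ∀ s s', 0 ≤ s → s < ρ z p → s' < ρ z p → s ≤ s' → ∀ v, ρ z v < s → Ls s v = Ls s' v := by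
    intro s s' a b c d v hv
    have hs0 : 0 < s := (hρ.nonneg z hz v).trans_lt hv
    obtain ⟨c1, e1, z1⟩ := hLs s a b
    obtain ⟨c2, e2, z2⟩ := hLs s' (a.trans d) c
    refine log_unique (hρ.sub_connected hz hs0 (b.le.trans hR)).isPreconnected
      (c1.mono fun y (hy : ρ z y < s) => (le_of_lt hy : ρ z y ≤ s)) (c2.mono fun y (hy : ρ z y < s) => ((le_of_lt hy).trans d : ρ z y ≤ s')) ?_
      (x0 := 0) (by show ρ z 0 < s; rw [hρ.rho_zero hz]; exact hs0) (z1.trans z2.symm) v hv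
    intro y hy
    rw [e1 y (le_of_lt hy), e2 y ((le_of_lt hy).trans d : ρ z y ≤ s')]
  have hmid : ∀ v, ρ z v < ρ z p → 0 ≤ (ρ z v + ρ z p) / 2 ∧ (ρ z v + ρ z p) / 2 < ρ z p ∧ ρ z v < (ρ z v + ρ z p) / 2 := by
    intro v hv
    have := hρ.nonneg z hz v
    refine ⟨by linarith, by linarith, by linarith⟩
  refine ⟨fun v => Ls ((ρ z v + ρ z p) / 2) v, fun v hv => ?_, fun v hv => ?_, ?_⟩
  · obtain ⟨a, b, c⟩ := hmid v hv
    set s := (ρ z v + ρ z p) / 2 with hs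
    have hU : {y | ρ z y < s} ∈ 𝓝 v := (hρ.isOpen_sub hz s).mem_nhds c
    have h1 : ContinuousAt (Ls s) v := (hLs s a b).1.continuousAt (mem_of_superset hU fun y (hy : ρ z y < s) => (le_of_lt hy : ρ z y ≤ s))
    refine ContinuousAt.continuousWithinAt (h1.congr ?_)
    filter_upwards [hU] with y hy
    obtain ⟨a', b', c'⟩ := hmid y (lt_trans hy b)
    rcases le_total s ((ρ z y + ρ z p) / 2) with h | h
    · exact hagree _ _ a b b' h y hy
    · exact (hagree _ _ a' b' b h y c').symm
  · obtain ⟨a, b, c⟩ := hmid v hv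
    exact (hLs _ a b).2.1 v c.le
  · obtain ⟨a, b, c⟩ := hmid 0 (by rw [hρ.rho_zero hz]; exact h0)
    exact (hLs _ a b).2.2

/-- jointly continuous logarithm -/
theorem exists_log : ∃ L : ℂ → (Fin n → ℂ) → (Fin n → ℂ) → ℂ,
    ContinuousOn (fun x : ℂ × (Fin n → ℂ) × (Fin n → ℂ) => L x.1 x.2.1 x.2.2)
      {x | x.1 ∈ Circ ∧ 0 < ρ x.1 x.2.1 ∧ ρ x.1 x.2.1 ≤ R ∧ ρ x.1 x.2.2 < ρ x.1 x.2.1} ∧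
    ∀ z ∈ Circ, ∀ p, 0 < ρ z p → ρ z p ≤ R → ContinuousOn (L z p) {v | ρ z v < ρ z p} ∧
      (∀ v, ρ z v < ρ z p → exp (L z p v) = qq ρ z p v) ∧ L z p 0 = 0 := by
  have hch : ∀ z p, ∃ L : (Fin n → ℂ) → ℂ, z ∈ Circ → 0 < ρ z p → ρ z p ≤ R →
      ContinuousOn L {v | ρ z v < ρ z p} ∧ (∀ v, ρ z v < ρ z p → exp (L v) = qq ρ z p v) ∧ L 0 = 0 := by
    intro z p
    by_cases h : z ∈ Circ ∧ 0 < ρ z p ∧ ρ z p ≤ R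
    · obtain ⟨L, hL⟩ := hρ.exists_log1 h.1 h.2.1 h.2.2
      exact ⟨L, fun _ _ _ => hL⟩
    · exact ⟨0, fun a b c => absurd ⟨a, b, c⟩ h⟩
  choose L hL using hch
  refine ⟨L, ?_, fun z hz p h0 hR => hL z p hz h0 hR⟩
  rintro ⟨z0, p0, v0⟩ ⟨hz0, h0, hR0, hv0⟩
  simp only at hz0 h0 hR0 hv0
  obtain ⟨cL, eL, L0⟩ := hL z0 p0 hz0 h0 hR0
  set W := {x : ℂ × (Fin n → ℂ) × (Fin n → ℂ) | x.1 ∈ Circ ∧ 0 < ρ x.1 x.2.1 ∧ ρ x.1 x.2.1 ≤ R ∧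
    ρ x.1 x.2.2 < ρ x.1 x.2.1} with hW
  -- a compact connected set containing `0` and a neighbourhood of `v0`
  obtain ⟨S, hSc, hSp, hS0, hSn, hSl⟩ : ∃ S : Set (Fin n → ℂ), IsCompact S ∧ IsPreconnected S ∧ 0 ∈ S ∧ S ∈ 𝓝 v0 ∧
      ∀ v ∈ S, ρ z0 v < ρ z0 p0 := by
    have hopen := hρ.isOpen_sub hz0 (ρ z0 p0)
    have hpc := (hopen.isConnected_iff_isPathConnected).1 (hρ.sub_connected hz0 h0 hR0)
    have hj := hpc.joinedIn 0 (by show ρ z0 0 < _; rw [hρ.rho_zero hz0]; exact h0) v0 hv0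
    obtain ⟨r, hr, hb⟩ := Metric.nhds_basis_closedBall.mem_iff.1 (hopen.mem_nhds hv0)
    refine ⟨range hj.somePath ∪ closedBall v0 r, ?_, ?_, ?_, ?_, ?_⟩
    · exact (isCompact_range hj.somePath.continuous).union (isCompact_closedBall _ _)
    · refine IsPreconnected.union v0 ⟨1, hj.somePath.target⟩ (mem_closedBall_self hr.le)
        (isPreconnected_range hj.somePath.continuous) (convex_closedBall v0 r).isPreconnected
    · exact Or.inl ⟨0, hj.somePath.source⟩
    · exact mem_of_superset (closedBall_mem_nhds v0 hr) subset_union_right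
    · rintro v (⟨t, rfl⟩ | hv)
      · exact hj.somePath_mem t
      · exact hb hv
  have ht : Tendsto (fun x : ℂ × (Fin n → ℂ) × (Fin n → ℂ) => ((x.1, x.2.1) : ℂ × (Fin n → ℂ))) (𝓝[W] (z0, p0, v0))
      (𝓝[{x : ℂ × (Fin n → ℂ) | x.1 ∈ Circ ∧ 0 < ρ x.1 x.2 ∧ ρ x.1 x.2 ≤ R}] (z0, p0)) := by
    refine tendsto_nhdsWithin_of_tendsto_nhds_of_eventually_within _ ?_ ?_
    · exact ((by fun_prop : Continuous (fun x : ℂ × (Fin n → ℂ) × (Fin n → ℂ) =>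
        ((x.1, x.2.1) : ℂ × (Fin n → ℂ)))).tendsto _).mono_left nhdsWithin_le_nhds
    · filter_upwards [self_mem_nhdsWithin] with x hx
      exact ⟨hx.1, hx.2.1, hx.2.2.1⟩
  -- eventually `S` lies in the sublevel set
  have hlev : ∀ᶠ x in 𝓝[{x : ℂ × (Fin n → ℂ) | x.1 ∈ Circ ∧ 0 < ρ x.1 x.2 ∧ ρ x.1 x.2 ≤ R}] (z0, p0),
      ∀ v ∈ S, ρ x.1 v < ρ x.1 x.2 := by
    have h5 : ∀ᶠ x in 𝓝 (z0, p0), ∀ v ∈ S, (fun (x : ℂ × (Fin n → ℂ)) v => x.1 ∈ Circ → ρ x.1 v < ρ x.1 x.2) x v := by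
      refine IsCompact.eventually_forall_of_forall_eventually (x₀ := (z0, p0))
        (P := fun (x : ℂ × (Fin n → ℂ)) v => x.1 ∈ Circ → ρ x.1 v < ρ x.1 x.2) hSc fun v hv => ?_
      have hc : ContinuousOn (fun y : (ℂ × (Fin n → ℂ)) × (Fin n → ℂ) => ρ y.1.1 y.1.2 - ρ y.1.1 y.2)
          {y | y.1.1 ∈ Circ} := by
        refine ContinuousOn.sub ?_ ?_
        · exact hρ.cont.comp (f := fun y : (ℂ × (Fin n → ℂ)) × (Fin n → ℂ) => (y.1.1, y.1.2))
            (by fun_prop : Continuous _).continuousOn fun y hy => hy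
        · exact hρ.cont.comp (f := fun y : (ℂ × (Fin n → ℂ)) × (Fin n → ℂ) => (y.1.1, y.2))
            (by fun_prop : Continuous _).continuousOn fun y hy => hy
      have h6 := (hc ((z0, p0), v) hz0).eventually (lt_mem_nhds (sub_pos.2 (hSl v hv)))
      rw [eventually_nhdsWithin_iff] at h6
      filter_upwards [h6] with y hy hy1
      exact sub_pos.1 (hy hy1)
    filter_upwards [nhdsWithin_le_nhds h5, self_mem_nhdsWithin] with x hx hx1 v hv
    exact hx v hv hx1.1
  have hcl := hρ.close_near hz0 h0 hR0 hSc hSl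
  have hEq : ∀ᶠ x in 𝓝[W] (z0, p0, v0), L x.1 x.2.1 x.2.2 =
      L z0 p0 x.2.2 + Complex.log (qq ρ x.1 x.2.1 x.2.2 / qq ρ z0 p0 x.2.2) := by
    have hv : ∀ᶠ x in 𝓝[W] (z0, p0, v0), x.2.2 ∈ S := by
      have : Tendsto (fun x : ℂ × (Fin n → ℂ) × (Fin n → ℂ) => x.2.2) (𝓝[W] (z0, p0, v0)) (𝓝 v0) :=
        ((by fun_prop : Continuous (fun x : ℂ × (Fin n → ℂ) × (Fin n → ℂ) => x.2.2)).tendsto (z0, p0, v0)).mono_left nhdsWithin_le_nhds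
      exact this.eventually hSn
    filter_upwards [ht.eventually hlev, ht.eventually hcl, hv, self_mem_nhdsWithin] with x h1 h2 h3 h4
    obtain ⟨c', e', z'⟩ := hL x.1 x.2.1 h4.1 h4.2.1 h4.2.2.1
    refine log_unique hSp (L1 := L x.1 x.2.1)
      (L2 := fun v => L z0 p0 v + Complex.log (qq ρ x.1 x.2.1 v / qq ρ z0 p0 v)) (c'.mono h1) ((cL.mono hSl).add ?_) ?_ hS0 ?_ _ h3
    · exact ContinuousOn.clog ((continuous_qq_v _ _).continuousOn.div (continuous_qq_v _ _).continuousOn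
        fun v hv => hρ.qq_ne' hz0 h0 hR0 (hSl v hv)) fun v hv => slit_of_close (h2 v hv).1
    · intro v hv
      rw [e' v (h1 v hv), exp_add, eL v (hSl v hv), Complex.exp_log (slitPlane_ne_zero (slit_of_close (h2 v hv).1)),
        mul_div_cancel₀ _ (hρ.qq_ne' hz0 h0 hR0 (hSl v hv))]
    · simp [z', L0, qq_zero]
  have hval : L z0 p0 v0 = L z0 p0 v0 + Complex.log (qq ρ z0 p0 v0 / qq ρ z0 p0 v0) := by
    rw [div_self (hρ.qq_ne' hz0 h0 hR0 hv0)]; simp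
  refine ContinuousWithinAt.congr_of_eventuallyEq ?_ hEq hval
  have hv2 : ContinuousWithinAt (fun x : ℂ × (Fin n → ℂ) × (Fin n → ℂ) => x.2.2) W (z0, p0, v0) := by fun_prop
  have hc1 : ContinuousAt (L z0 p0) v0 := cL.continuousAt ((hρ.isOpen_sub hz0 _).mem_nhds hv0)
  refine ContinuousWithinAt.add ?_ ?_
  · exact ContinuousAt.comp_continuousWithinAt (f := fun x : ℂ × (Fin n → ℂ) × (Fin n → ℂ) => x.2.2) hc1 hv2
  · refine ContinuousWithinAt.clog (ContinuousWithinAt.div ?_ ?_ (hρ.qq_ne' hz0 h0 hR0 hv0)) ?_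
    · exact (hρ.contOn_qq (z0, p0, v0) ⟨hz0, h0, hR0⟩).mono fun x hx => ⟨hx.1, hx.2.1, hx.2.2.1⟩
    · exact ((continuous_qq_v z0 p0).comp (by fun_prop : Continuous
        (fun x : ℂ × (Fin n → ℂ) × (Fin n → ℂ) => x.2.2))).continuousWithinAt
    · rw [div_self (hρ.qq_ne' hz0 h0 hR0 hv0)]; exact one_mem_slitPlane

end Cond3
end S3



section S4
open scoped Topology
variable {n : ℕ} {ρ : ℂ → (Fin n → ℂ) → ℝ} {R : ℝ}

lemma slit_of_seg {ω : ℂ} (h : ∀ τ : ℝ, 0 ≤ τ → τ ≤ 1 → 1 + (τ : ℂ) * (ω - 1) ≠ 0) : ω ∈ slitPlane := by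
  by_contra hn
  rw [mem_slitPlane_iff] at hn
  push Not at hn
  have h1 : 0 < 1 - ω.re := by linarith [hn.1]
  apply h (1 / (1 - ω.re)) (by positivity) ((div_le_one h1).2 (by linarith [hn.1]))
  have h2 : ω = ((ω.re : ℝ) : ℂ) := Complex.ext (by simp) (by simp [hn.2])
  have h3 : ((1 - ω.re : ℝ) : ℂ) ≠ 0 := by exact_mod_cast h1.ne'
  rw [h2]
  push_cast at h3 ⊢
  rw [Complex.ofReal_re]
  field_simp
  ring

lemma seg_slit {ω : ℂ} (h : ω ∈ slitPlane) {τ : ℝ} (h0 : 0 ≤ τ) (h1 : τ ≤ 1) : 1 + (τ : ℂ) * (ω - 1) ∈ slitPlane := by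
  have := starConvex_one_slitPlane h (a := 1 - τ) (b := τ) (by linarith) h0 (by ring)
  convert this using 1
  simp only [Complex.real_smul]
  push_cast; ring

lemma qq_seg (z : ℂ) (p u u' : Fin n → ℂ) (τ : ℝ) :
    qq ρ z p (u + τ • (u' - u)) = qq ρ z p u + τ * (qq ρ z p u' - qq ρ z p u) := by
  simp only [qq, dt_add, dt_rsmul, dt_sub]; ring

namespace Cond3
variable (hρ : Cond3 n ρ R (fun _ => 0))

/-- the chosen logarithm -/
def LL : ℂ → (Fin n → ℂ) → (Fin n → ℂ) → ℂ := Classical.choose hρ.exists_log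

lemma contOn_LL : ContinuousOn (fun x : ℂ × (Fin n → ℂ) × (Fin n → ℂ) => hρ.LL x.1 x.2.1 x.2.2)
      {x | x.1 ∈ Circ ∧ 0 < ρ x.1 x.2.1 ∧ ρ x.1 x.2.1 ≤ R ∧ ρ x.1 x.2.2 < ρ x.1 x.2.1} :=
  (Classical.choose_spec hρ.exists_log).1

lemma contOn_LL_v {z : ℂ} (hz : z ∈ Circ) {p : Fin n → ℂ} (h0 : 0 < ρ z p) (hR : ρ z p ≤ R) :
    ContinuousOn (hρ.LL z p) {v | ρ z v < ρ z p} :=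
  ((Classical.choose_spec hρ.exists_log).2 z hz p h0 hR).1

lemma exp_LL {z : ℂ} (hz : z ∈ Circ) {p : Fin n → ℂ} (h0 : 0 < ρ z p) (hR : ρ z p ≤ R) {v : Fin n → ℂ}
    (hv : ρ z v < ρ z p) : exp (hρ.LL z p v) = qq ρ z p v :=
  ((Classical.choose_spec hρ.exists_log).2 z hz p h0 hR).2.1 v hv

lemma seg {z : ℂ} (hz : z ∈ Circ) {p u u' : Fin n → ℂ} (h0 : 0 < ρ z p) (hR : ρ z p ≤ R)
    (hs : ∀ τ : ℝ, 0 ≤ τ → τ ≤ 1 → ρ z (u + τ • (u' - u)) < ρ z p) :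
    hρ.LL z p u' - hρ.LL z p u = Complex.log (qq ρ z p u' / qq ρ z p u) := by
  have hu : ρ z u < ρ z p := by simpa using hs 0 le_rfl zero_le_one
  have hne := hρ.qq_ne' hz h0 hR hu
  set ω := qq ρ z p u' / qq ρ z p u with hω
  have e1 : ∀ τ : ℝ, qq ρ z p (u + τ • (u' - u)) = qq ρ z p u * (1 + (τ : ℂ) * (ω - 1)) := by
    intro τ
    rw [qq_seg, hω]; field_simp
  have hsl : ω ∈ slitPlane := by
    apply slit_of_seg
    intro τ h1 h2 h3
    apply hρ.qq_ne' hz h0 hR (hs τ h1 h2)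
    rw [e1, h3, mul_zero]
  have hpath : Continuous (fun τ : ℝ => u + τ • (u' - u)) := by fun_prop
  have := log_unique (S := Icc (0:ℝ) 1) isPreconnected_Icc
    (L1 := fun τ => hρ.LL z p (u + τ • (u' - u)))
    (L2 := fun τ => hρ.LL z p u + Complex.log (1 + (τ : ℂ) * (ω - 1)))
    ((hρ.contOn_LL_v hz h0 hR).comp hpath.continuousOn fun τ hτ => hs τ hτ.1 hτ.2)
    (continuousOn_const.add (ContinuousOn.clog (by fun_prop) fun τ hτ => seg_slit hsl hτ.1 hτ.2))
    (fun τ hτ => by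
      rw [hρ.exp_LL hz h0 hR (hs τ hτ.1 hτ.2), e1, exp_add, hρ.exp_LL hz h0 hR hu,
        Complex.exp_log (slitPlane_ne_zero (seg_slit hsl hτ.1 hτ.2))])
    (x0 := 0) ⟨le_rfl, zero_le_one⟩ (by simp) 1 ⟨zero_le_one, le_rfl⟩
  simp at this
  rw [this]; ring

include hρ
lemma LL_bound {t0 : ℝ} (ht0 : 0 < t0) : ∃ M > 0, ∀ z ∈ Circ, ∀ p v, t0 ≤ ρ z p → ρ z p ≤ R → ρ z v < ρ z p →
    |(hρ.LL z p v).im| ≤ M := by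
  obtain ⟨s0, hs0, c, hc, H⟩ := hρ.push (half_pos ht0)
  set k := min (c * s0) (t0 / 2) with hk
  have hk0 : 0 < k := lt_min (by positivity) (by positivity)
  obtain ⟨M, hM⟩ := (hρ.isCompact_pairs t0 k).exists_bound_of_continuousOn
    (hρ.contOn_LL.mono fun x hx => ⟨hx.1, ht0.trans_le hx.2.1, hx.2.2.1, by linarith [hx.2.2.2.1]⟩)
  have hM' : ∀ z ∈ Circ, ∀ p v, t0 ≤ ρ z p → ρ z p ≤ R → ρ z v + k ≤ ρ z p → |(hρ.LL z p v).im| ≤ M :=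
    fun z hz p v h1 h2 h3 => (abs_im_le_norm _).trans (hM (z, p, v) ⟨hz, h1, h2, h3, by
      have : ρ z v + k ≤ ρ z p := h3
      show ρ z v ≤ R
      linarith⟩)
  refine ⟨max M 0 + Real.pi, by positivity, fun z hz p v h1 h2 h3 => ?_⟩
  have hMm := le_max_left M 0
  have hpi := Real.pi_pos
  by_cases hv : t0 / 2 ≤ ρ z v
  · have hseg := hρ.seg hz (ht0.trans_le h1) h2 (u := v) (u' := v - s0 • cj (DD ρ z v)) (fun τ a b => by
      have := H z hz v hv (by linarith) (τ * s0) (by positivity) (by nlinarith)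
      have e : v + τ • (v - s0 • cj (DD ρ z v) - v) = v - (τ * s0) • cj (DD ρ z v) := by
        rw [mul_smul, sub_sub_cancel_left, smul_neg]; abel
      rw [e]
      have : 0 ≤ c * (τ * s0) := by positivity
      linarith)
    have h4 := H z hz v hv (by linarith) s0 hs0.le le_rfl
    have h5 := hM' z hz p (v - s0 • cj (DD ρ z v)) h1 h2 (by linarith [min_le_left (c * s0) (t0 / 2)])
    have h6 := Complex.abs_arg_le_pi (qq ρ z p (v - s0 • cj (DD ρ z v)) / qq ρ z p v)
    have h7 := congrArg Complex.im hseg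
    rw [Complex.log_im, Complex.sub_im] at h7
    rw [← h7] at h6
    rw [abs_le] at *
    constructor <;> linarith [h5.1, h5.2, h6.1, h6.2]
  · have := hM' z hz p v h1 h2 (by linarith [min_le_right (c * s0) (t0 / 2), not_le.1 hv])
    linarith

omit hρ in
lemma abs_arg_le_of {ε : ℝ} (he : 0 < ε) (he2 : ε < Real.pi / 2) {w : ℂ} (hw : w ≠ 0) (h : - Real.sin ε * ‖w‖ ≤ w.re) :
    |w.arg| ≤ Real.pi / 2 + ε := by
  by_contra hn
  push Not at hn
  have h1 : Real.cos |w.arg| < Real.cos (Real.pi / 2 + ε) :=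
    Real.cos_lt_cos_of_nonneg_of_le_pi (by linarith [Real.pi_pos]) (abs_arg_le_pi w) hn
  rw [Real.cos_abs, Complex.cos_arg hw, add_comm, Real.cos_add_pi_div_two,
    div_lt_iff₀ (norm_pos_iff.2 hw)] at h1
  linarith

/-- inward push from nearby points -/
lemma push2 {t0 : ℝ} (ht0 : 0 < t0) : ∃ δ > 0, ∃ s1 : ℝ, 0 < s1 ∧ ∀ z ∈ Circ, ∀ p, t0 ≤ ρ z p → ρ z p ≤ R →
    ∀ u, ‖u - p‖ < δ → ρ z u ≤ R → ∀ s : ℝ, 0 ≤ s → s ≤ s1 → ρ z (u - s • cj (DD ρ z p)) ≤ ρ z u := by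
  obtain ⟨m, hm, M, hM, HB⟩ := hρ.grad_bounds ht0
  have hn : 0 < (n : ℝ) := by exact_mod_cast (by linarith [hρ.hn] : 0 < n)
  obtain ⟨δ1, hδ1, H1⟩ := hρ.unif_close (hρ.isCompact_lev (t0 := t0)) (fun p hp => ⟨hp.1, (ht0.trans_le hp.2.1).ne'⟩)
    (φ := fun p => ρ p.1 p.2) (hρ.cont.mono fun p hp => hp.1) (half_pos ht0)
  obtain ⟨δ2, hδ2, H2⟩ := hρ.unif_close (hρ.isCompact_lev (t0 := t0)) (fun p hp => ⟨hp.1, (ht0.trans_le hp.2.1).ne'⟩)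
    (φ := fun p => DD ρ p.1 p.2) hρ.contOn_DD (ε := m ^ 2 / 2 / (n * M)) (by positivity)
  obtain ⟨δ3, hδ3, H3⟩ := hρ.fo_decr (half_pos ht0) (c := m ^ 2 / 2 / M) (by positivity)
  refine ⟨min δ1 δ2, lt_min hδ1 hδ2, δ3 / (2 * M), by positivity, fun z hz p h1 h2 u hu huR s hs0 hs1 => ?_⟩
  obtain ⟨hb1, hb2, -⟩ := HB z hz p h1 h2
  have e : p + (u - p) = u := by abel
  have a1 := (H1 (z, p) ⟨hz, h1, h2⟩ (u - p) (hu.trans_le (min_le_left _ _))).2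
  have a2 := (H2 (z, p) ⟨hz, h1, h2⟩ (u - p) (hu.trans_le (min_le_right _ _))).2
  simp only [e] at a1 a2
  rw [Real.dist_eq, abs_lt] at a1
  rw [dist_eq_norm] at a2
  set D := DD ρ z p with hD
  have hh : ‖-(s • cj D)‖ = s * ‖D‖ := by rw [norm_neg, norm_smul, norm_cj, Real.norm_of_nonneg hs0]
  have hsM : s * ‖D‖ ≤ s * M := by gcongr
  have hre : m ^ 2 / 2 ≤ (dt (DD ρ z u) (cj D)).re := by
    have e2 : dt (DD ρ z u) (cj D) = dt D (cj D) + dt (DD ρ z u - D) (cj D) := by rw [sub_dt]; ring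
    have h5 : ‖dt (DD ρ z u - D) (cj D)‖ ≤ m ^ 2 / 2 := by
      refine (norm_dt_le _ _).trans ?_
      rw [norm_cj]
      calc _ ≤ n * (m ^ 2 / 2 / (n * M)) * M := by gcongr
        _ = m ^ 2 / 2 := by field_simp
    have h6 := neg_le_of_abs_le ((abs_re_le_norm _).trans h5)
    rw [e2, dt_cj, Complex.add_re, Complex.ofReal_re]
    have : m ^ 2 ≤ euclNorm D ^ 2 := by gcongr
    linarith
  have h7 := H3 z hz u (by linarith [a1.1]) huR (-(s • cj D)) (by
      rw [hh]
      have : s * M ≤ δ3 / (2 * M) * M := by gcongr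
      have e3 : δ3 / (2 * M) * M = δ3 / 2 := by field_simp
      linarith) (by
      rw [hh, ← neg_smul, dt_rsmul, Complex.re_ofReal_mul]
      have : m ^ 2 / 2 / M * (s * ‖D‖) ≤ m ^ 2 / 2 / M * (s * M) := by gcongr
      have e3 : m ^ 2 / 2 / M * (s * M) = s * (m ^ 2 / 2) := by field_simp
      have : s * (m ^ 2 / 2) ≤ s * (dt (DD ρ z u) (cj D)).re := by gcongr
      linarith)
  rw [sub_eq_add_neg]
  have : 0 ≤ m ^ 2 / 2 / M * ‖-(s • cj D)‖ := by positivity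
  linarith

lemma contOn_inw {t0 : ℝ} (ht0 : 0 < t0) (s : ℝ) :
    ContinuousOn (fun x : ℂ × (Fin n → ℂ) => x.2 - s • cj (DD ρ x.1 x.2))
      {p | p.1 ∈ Circ ∧ t0 ≤ ρ p.1 p.2 ∧ ρ p.1 p.2 ≤ R} := by
  have h1 : ContinuousOn (fun x : ℂ × (Fin n → ℂ) => cj (DD ρ x.1 x.2))
      {p | p.1 ∈ Circ ∧ t0 ≤ ρ p.1 p.2 ∧ ρ p.1 p.2 ≤ R} :=
    continuous_cj.comp_continuousOn (hρ.contOn_DD.mono fun x hx => ⟨hx.1, (ht0.trans_le hx.2.1).ne'⟩)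
  have h2 : ContinuousOn (fun x : ℂ × (Fin n → ℂ) => s • cj (DD ρ x.1 x.2))
      {p | p.1 ∈ Circ ∧ t0 ≤ ρ p.1 p.2 ∧ ρ p.1 p.2 ≤ R} :=
    (continuous_const_smul s).comp_continuousOn h1
  exact continuousOn_snd.sub h2

lemma push3 {t0 s c : ℝ} (ht0 : 0 < t0) (hspos : 0 < s) (hc : 0 < c)
    (Hp : ∀ z ∈ Circ, ∀ p, t0 ≤ ρ z p → ρ z p ≤ R → ρ z (p - s • cj (DD ρ z p)) ≤ ρ z p - c * s) :
    ∃ δ4 > 0, ∀ z ∈ Circ, ∀ p, t0 ≤ ρ z p → ρ z p ≤ R → ∀ d : Fin n → ℂ, ‖d‖ < δ4 →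
        ρ z (p - s • cj (DD ρ z p) + d) < ρ z p := by
  have hC := (hρ.isCompact_lev (t0 := t0)).prod (isCompact_closedBall (0 : Fin n → ℂ) 1)
  set C := ({p : ℂ × (Fin n → ℂ) | p.1 ∈ Circ ∧ t0 ≤ ρ p.1 p.2 ∧ ρ p.1 p.2 ≤ R} ×ˢ closedBall (0 : Fin n → ℂ) 1) with hCd
  have h1 : ContinuousOn (fun x : (ℂ × (Fin n → ℂ)) × (Fin n → ℂ) => x.1.2 - s • cj (DD ρ x.1.1 x.1.2)) C :=
    (hρ.contOn_inw ht0 s).comp (f := fun x : (ℂ × (Fin n → ℂ)) × (Fin n → ℂ) => x.1) continuousOn_fst (fun x hx => hx.1)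
  have h2 : ContinuousOn (fun x : (ℂ × (Fin n → ℂ)) × (Fin n → ℂ) =>
      (x.1.1, x.1.2 - s • cj (DD ρ x.1.1 x.1.2) + x.2)) C :=
    (continuous_fst.comp continuous_fst).continuousOn.prodMk (h1.add continuousOn_snd)
  have hcont : ContinuousOn (fun x : (ℂ × (Fin n → ℂ)) × (Fin n → ℂ) =>
      ρ x.1.1 (x.1.2 - s • cj (DD ρ x.1.1 x.1.2) + x.2)) C :=
    hρ.cont.comp h2 (fun x hx => hx.1.1)
  obtain ⟨δ, hδ, H⟩ := Metric.uniformContinuousOn_iff.1 (hC.uniformContinuousOn_of_continuous hcont) (c * s) (by positivity)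
  refine ⟨min δ 1, lt_min hδ one_pos, fun z hz p h1 h2 d hd => ?_⟩
  have h5 := H ((z, p), d) ⟨⟨hz, h1, h2⟩, by
      rw [mem_closedBall_zero_iff]; exact (hd.trans_le (min_le_right _ _)).le⟩ ((z, p), 0)
      ⟨⟨hz, h1, h2⟩, by simp⟩ (by
        rw [Prod.dist_eq]; simp only [dist_self, dist_zero_right]
        exact max_lt hδ (hd.trans_le (min_le_left _ _)))
  simp only [add_zero, Real.dist_eq, abs_lt] at h5
  have h6 := Hp z hz p h1 h2
  linarith [h5.2]

set_option maxHeartbeats 1000000 in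
theorem exists_theta {t0 : ℝ} (ht0 : 0 < t0) : ∃ θ : ℂ → (Fin n → ℂ) → ℝ,
    ContinuousOn (fun x : ℂ × (Fin n → ℂ) => θ x.1 x.2) {p | p.1 ∈ Circ ∧ t0 ≤ ρ p.1 p.2 ∧ ρ p.1 p.2 ≤ R} ∧
    (∀ z ∈ Circ, ∀ p, t0 ≤ ρ z p → ρ z p ≤ R →
      dt (DD ρ z p) p = ‖dt (DD ρ z p) p‖ * exp (θ z p * I)) ∧
    ∀ ε > 0, ∃ δ > 0, ∀ z ∈ Circ, ∀ p u, t0 ≤ ρ z p → ρ z p ≤ R → ρ z u < ρ z p → ‖qq ρ z p u‖ < δ →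
      |(hρ.LL z p u).im + θ z p| ≤ Real.pi / 2 + ε := by
  obtain ⟨δ1, hδ1, s1, hs1, Hp2⟩ := hρ.push2 ht0
  obtain ⟨s2, hs2, c, hc, Hp⟩ := hρ.push ht0
  obtain ⟨m, hm, M, hM, HB⟩ := hρ.grad_bounds ht0
  set s := min s1 s2 with hs
  have hspos : 0 < s := lt_min hs1 hs2
  have hpp : ∀ z ∈ Circ, ∀ p, t0 ≤ ρ z p → ρ z p ≤ R → ρ z (p - s • cj (DD ρ z p)) < ρ z p := by
    intro z hz p h1 h2
    have := Hp z hz p h1 h2 s hspos.le (min_le_right _ _)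
    have : 0 < c * s := by positivity
    linarith
  have hqp : ∀ z ∈ Circ, ∀ p, t0 ≤ ρ z p → ρ z p ≤ R → ∀ u, dt (DD ρ z p) p * qq ρ z p (u - s • cj (DD ρ z p)) =
      dt (DD ρ z p) p * qq ρ z p u + ((s * euclNorm (DD ρ z p) ^ 2 : ℝ) : ℂ) := by
    intro z hz p h1 h2 u
    rw [hρ.lam_mul_qq hz (ht0.trans_le h1) h2, hρ.lam_mul_qq hz (ht0.trans_le h1) h2]
    rw [sub_right_comm, dt_sub _ (u - p), dt_rsmul, dt_cj]
    push_cast; ring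
  have hqpp : ∀ z ∈ Circ, ∀ p, t0 ≤ ρ z p → ρ z p ≤ R → dt (DD ρ z p) p * qq ρ z p p = 0 := by
    intro z hz p h1 h2
    rw [hρ.lam_mul_qq hz (ht0.trans_le h1) h2, sub_self, dt_zero, neg_zero]
  refine ⟨fun z p => - (hρ.LL z p (p - s • cj (DD ρ z p))).im, ?_, ?_, ?_⟩
  · refine ContinuousOn.neg (Complex.continuous_im.comp_continuousOn ?_)
    refine hρ.contOn_LL.comp (f := fun x : ℂ × (Fin n → ℂ) => (x.1, x.2, x.2 - s • cj (DD ρ x.1 x.2))) ?_ ?_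
    · exact continuousOn_fst.prodMk (continuousOn_snd.prodMk (hρ.contOn_inw ht0 s))
    · exact fun x hx => ⟨hx.1, ht0.trans_le hx.2.1, hx.2.2, hpp _ hx.1 _ hx.2.1 hx.2.2⟩
  · intro z hz p h1 h2
    have h0 := ht0.trans_le h1
    have hl := hρ.lam_ne hz h0 h2
    have e1 := hqp z hz p h1 h2 p
    rw [hqpp z hz p h1 h2, zero_add, ← hρ.exp_LL hz h0 h2 (hpp z hz p h1 h2)] at e1
    set lam := dt (DD ρ z p) p
    set ℓ := hρ.LL z p (p - s • cj (DD ρ z p))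
    have hpos : 0 < s * euclNorm (DD ρ z p) ^ 2 := by
      have := (HB z hz p h1 h2).1
      have : 0 < euclNorm (DD ρ z p) := by linarith
      positivity
    have e2 := congrArg norm e1
    rw [norm_mul, Complex.norm_exp, Complex.norm_real, Real.norm_of_nonneg hpos.le] at e2
    have e3 : lam * exp ℓ = (‖lam‖ * Real.exp ℓ.re : ℝ) := by rw [e1, e2]
    have e4 : exp ℓ = Real.exp ℓ.re * exp (ℓ.im * I) := by
      rw [Complex.ofReal_exp, ← exp_add, re_add_im]
    rw [e4] at e3
    push_cast at e3
    have h5 : exp (ℓ.re : ℂ) ≠ 0 := exp_ne_zero _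
    have e6 : lam * exp (ℓ.im * I) = ‖lam‖ := by
      apply mul_right_cancel₀ h5
      rw [← e3]; push_cast; ring
    have e7 : exp (((-ℓ.im : ℝ) : ℂ) * I) * exp (ℓ.im * I) = 1 := by
      rw [← exp_add]; simp
    show lam = (‖lam‖ : ℂ) * exp (((-ℓ.im : ℝ) : ℂ) * I)
    rw [← e6, mul_assoc, mul_comm (exp _), e7, mul_one]
  · intro ε hε
    wlog hε2 : ε < Real.pi / 2 generalizing ε
    · obtain ⟨δ, hδ, H⟩ := this (Real.pi / 4) (by linarith [Real.pi_pos]) (by linarith [Real.pi_pos])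
      refine ⟨δ, hδ, fun z hz p u a b c d => (H z hz p u a b c d).trans ?_⟩
      linarith [not_lt.1 hε2, Real.pi_pos]
    obtain ⟨δ2, hδ2, C0, hC0, c0, hc0, Hs⟩ := hρ.soe ht0
    have hsin : 0 < Real.sin (ε / 2) := Real.sin_pos_of_pos_of_lt_pi (by positivity) (by linarith [Real.pi_pos])
    -- distance thresholds
    obtain ⟨δ3, hδ3, Hc⟩ := Metric.continuousAt_iff.1 (continuousAt_arg (one_mem_slitPlane)) (ε / 2) (by positivity)
    have hCpt : IsCompact {x : ℂ × (Fin n → ℂ) | x.1 ∈ Circ ∧ ρ x.1 x.2 ≤ R} := by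
      have := hρ.isCompact_lev (t0 := 0)
      convert this using 1
      ext x
      exact ⟨fun h => ⟨h.1, hρ.nonneg _ h.1 _, h.2⟩, fun h => ⟨h.1, h.2.2⟩⟩
    -- the segment from u - s n to p - s n
    obtain ⟨δ4, hδ4, H4⟩ : ∃ δ4 > 0, ∀ z ∈ Circ, ∀ p, t0 ≤ ρ z p → ρ z p ≤ R → ∀ d : Fin n → ℂ, ‖d‖ < δ4 →
        ρ z (p - s • cj (DD ρ z p) + d) < ρ z p := by
      exact hρ.push3 ht0 hspos hc fun z hz p h1 h2 => Hp z hz p h1 h2 s hspos.le (min_le_right _ _)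
    set r := min (min δ1 δ2) (min δ4 (Real.sin (ε / 2) / C0)) with hr
    have hrpos : 0 < r := lt_min (lt_min hδ1 hδ2) (lt_min hδ4 (by positivity))
    obtain ⟨c5, hc5, H5⟩ := hρ.unif_lc ht0 hrpos
    obtain ⟨Ml, hMl⟩ : ∃ Ml > 0, ∀ z ∈ Circ, ∀ p, t0 ≤ ρ z p → ρ z p ≤ R → ‖dt (DD ρ z p) p‖ ≤ Ml := by
      have hRp := hρ.R_pos
      refine ⟨n * M * R, by have : 0 < n := by linarith [hρ.hn]
                            positivity, fun z hz p h1 h2 => (norm_dt_le _ _).trans ?_⟩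
      have := (HB z hz p h1 h2).2.1
      have := hρ.norm_le_R hz h2
      gcongr
    set k := s * m ^ 2 with hk
    have hkpos : 0 < k := by positivity
    refine ⟨min c5 (min δ3 (1 / 2) * k / Ml), ?_, ?_⟩
    · have := hMl.1
      exact lt_min hc5 (by positivity)
    intro z hz p u h1 h2 h3 hq
    have h0 := ht0.trans_le h1
    have hl := hρ.lam_ne hz h0 h2
    have hd : ‖u - p‖ < r := by
      by_contra hcon
      have := H5 z hz p u h1 h2 h3.le (not_lt.1 hcon)
      linarith [hq.trans_le (min_le_left _ _)]
    have hd1 : ‖u - p‖ < δ1 := hd.trans_le ((min_le_left _ _).trans (min_le_left _ _))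
    have hd2 : ‖u - p‖ < δ2 := hd.trans_le ((min_le_left _ _).trans (min_le_right _ _))
    have hd4 : ‖u - p‖ < δ4 := hd.trans_le ((min_le_right _ _).trans (min_le_left _ _))
    have hd5 : ‖u - p‖ < Real.sin (ε / 2) / C0 := hd.trans_le ((min_le_right _ _).trans (min_le_right _ _))
    have hDm := (HB z hz p h1 h2).1
    set D := DD ρ z p with hD
    set A : ℝ := s * euclNorm D ^ 2 with hA
    have hAk : k ≤ A := by rw [hk, hA]; gcongr
    have hApos : 0 < A := hkpos.trans_le hAk
    have hAc : (A : ℂ) ≠ 0 := by exact_mod_cast hApos.ne'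
    have hqu := hρ.qq_ne' hz h0 h2 h3
    set X : ℂ := dt D p * qq ρ z p u / A with hX
    have hXne : X ≠ 0 := div_ne_zero (mul_ne_zero hl hqu) hAc
    have hXs : ‖X‖ < min δ3 (1 / 2) := by
      rw [hX, norm_div, norm_mul, Complex.norm_real, Real.norm_of_nonneg hApos.le, div_lt_iff₀ hApos]
      have hq2 := hq.trans_le (min_le_right _ _)
      have hM0 := hMl.1
      rw [lt_div_iff₀ hM0] at hq2
      have h6 : ‖dt D p‖ * ‖qq ρ z p u‖ ≤ Ml * ‖qq ρ z p u‖ := by gcongr; exact hMl.2 z hz p h1 h2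
      have h7 : min δ3 (1 / 2) * k ≤ min δ3 (1 / 2) * A := by gcongr
      linarith
    -- first segment
    have s1' := hρ.seg hz h0 h2 (u := u) (u' := u - s • cj D) (fun τ a b => by
      have e : u + τ • (u - s • cj D - u) = u - (τ * s) • cj D := by
        rw [mul_smul, sub_sub_cancel_left, smul_neg]; abel
      rw [e]
      refine (Hp2 z hz p h1 h2 u hd1 (by linarith) (τ * s) (by positivity) ?_).trans_lt h3
      exact (mul_le_of_le_one_left hspos.le b).trans (min_le_left _ _))
    have s2' := hρ.seg hz h0 h2 (u := p - s • cj D) (u' := u - s • cj D) (fun τ a b => by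
      have e : p - s • cj D + τ • (u - s • cj D - (p - s • cj D)) = p - s • cj D + τ • (u - p) := by
        congr 2; abel
      rw [e]
      refine H4 z hz p h1 h2 _ ?_
      rw [norm_smul, Real.norm_of_nonneg a]
      exact (mul_le_of_le_one_left (norm_nonneg _) b).trans_lt hd4)
    have r1 : qq ρ z p (u - s • cj D) / qq ρ z p u = 1 + 1 / X := by
      have := hqp z hz p h1 h2 u
      rw [← hD, ← hA] at this
      rw [hX]
      rw [div_eq_iff hqu]
      apply mul_left_cancel₀ hl
      rw [this]; field_simp
    have r2 : qq ρ z p (u - s • cj D) / qq ρ z p (p - s • cj D) = 1 + X := by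
      have e1 := hqp z hz p h1 h2 u
      have e2 := hqp z hz p h1 h2 p
      rw [hqpp z hz p h1 h2, zero_add] at e2
      rw [← hD, ← hA] at e1 e2
      rw [← mul_div_mul_left _ _ hl, e1, e2, hX]; field_simp; ring
    rw [r1] at s1'
    rw [r2] at s2'
    have i1 := congrArg Complex.im s1'
    have i2 := congrArg Complex.im s2'
    rw [Complex.log_im, Complex.sub_im] at i1 i2
    have a2 : |(1 + X).arg| < ε / 2 := by
      have := Hc (x := 1 + X) (by rw [dist_eq_norm, add_sub_cancel_left]; exact hXs.trans_le (min_le_left _ _))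
      rwa [Real.dist_eq, Complex.arg_one, sub_zero] at this
    have a1 : |(1 + 1 / X).arg| ≤ Real.pi / 2 + ε / 2 := by
      have hXp : 0 < ‖X‖ := norm_pos_iff.2 hXne
      have hXh : ‖X‖ < 1 / 2 := hXs.trans_le (min_le_right _ _)
      -- real part of X
      have hXre : - (Real.sin (ε / 2) / 2) * ‖X‖ ≤ X.re := by
        have h6 := Hs z hz p h1 h2 (u - p) hd2
        rw [← hD, show p + (u - p) = u by abel] at h6
        have h7 : dt D (u - p) = - (A * X) := by
          have := hρ.lam_mul_qq hz h0 h2 u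
          rw [← hD] at this
          rw [hX, mul_div_cancel₀ _ hAc, this, neg_neg]
        rw [h7, norm_neg, norm_mul, Complex.norm_real, Real.norm_of_nonneg hApos.le, Complex.neg_re,
          Complex.re_ofReal_mul] at h6
        have h8 : C0 * ‖u - p‖ ≤ Real.sin (ε / 2) := by
          rw [lt_div_iff₀ hC0] at hd5; linarith
        have h9 : C0 * (A * ‖X‖) * ‖u - p‖ ≤ Real.sin (ε / 2) * (A * ‖X‖) := by
          have : C0 * (A * ‖X‖) * ‖u - p‖ = (C0 * ‖u - p‖) * (A * ‖X‖) := by ring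
          rw [this]; gcongr
        have h10 : 0 ≤ c0 * ‖u - p‖ ^ 2 := by positivity
        have h11 : A * (-(Real.sin (ε / 2) / 2) * ‖X‖) ≤ A * X.re := by linarith
        exact le_of_mul_le_mul_left h11 hApos
      have hne : (1 + 1 / X) ≠ 0 := by
        intro h
        have : X = -1 := by field_simp at h; linear_combination h
        rw [this] at hXh; norm_num at hXh
      refine abs_arg_le_of (by positivity) (by linarith) hne ?_
      have hnorm : 1 / (2 * ‖X‖) ≤ ‖1 + 1 / X‖ := by
        have := norm_sub_le (1 + 1 / X) 1
        rw [add_sub_cancel_left, norm_div, norm_one] at this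
        have e : 1 / (2 * ‖X‖) = 1 / ‖X‖ - 1 / (2 * ‖X‖) := by field_simp; norm_num
        have : 1 ≤ 1 / (2 * ‖X‖) := by rw [le_div_iff₀ (by positivity)]; linarith
        linarith
      have hre : (1 + 1 / X).re = 1 + X.re / ‖X‖ ^ 2 := by
        rw [Complex.add_re, Complex.one_re, one_div, Complex.inv_re, Complex.normSq_eq_norm_sq]
      rw [hre]
      have h12 : - (Real.sin (ε / 2)) * (1 / (2 * ‖X‖)) ≤ X.re / ‖X‖ ^ 2 := by
        rw [le_div_iff₀ (by positivity)]
        have : -Real.sin (ε / 2) * (1 / (2 * ‖X‖)) * ‖X‖ ^ 2 = - (Real.sin (ε / 2) / 2) * ‖X‖ := by field_simp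
        rw [this]; exact hXre
      have h13 : Real.sin (ε / 2) * (1 / (2 * ‖X‖)) ≤ Real.sin (ε / 2) * ‖1 + 1 / X‖ := by gcongr
      linarith
    have : (hρ.LL z p u).im + -(hρ.LL z p (p - s • cj D)).im = (1 + X).arg - (1 + 1 / X).arg := by
      rw [← i1, ← i2]; ring
    rw [this]
    rw [abs_lt] at a2
    rw [abs_le] at *
    constructor <;> linarith [a1.1, a1.2, a2.1, a2.2]

end Cond3
end S4



section E1
open scoped Topology
variable {n : ℕ} {ρ : ℂ → (Fin n → ℂ) → ℝ} {R : ℝ}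

lemma avg_norm_le {a : ℂ} (ha : ‖a‖ < 1) {H : ℂ → ℂ} (hH : ContinuousOn H Circ) :
    ‖avg a H‖ ≤ avg a (fun z => ‖H z‖) := by
  by_cases h0 : avg a H = 0
  · rw [h0, norm_zero]
    exact avg_nonneg ha hH.norm fun z _ => norm_nonneg _
  set c : ℂ := (starRingEnd ℂ) (avg a H) / ‖avg a H‖ with hc
  have hn : (‖avg a H‖ : ℂ) ≠ 0 := by exact_mod_cast norm_ne_zero_iff.2 h0
  have hcn : ‖c‖ = 1 := by
    rw [hc, norm_div, RCLike.norm_conj, Complex.norm_real, norm_norm, div_self (norm_ne_zero_iff.2 h0)]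
  have h1 : avg a (fun z => c * H z) = c * avg a H := by
    have := Real.circleAverage_fun_smul (a := c) (f := fun z => H (mob a z)) (c := 0) (R := 1)
    simpa [avg] using this
  have h2 : c * avg a H = (‖avg a H‖ : ℂ) := by
    rw [hc, div_mul_eq_mul_div, mul_comm, Complex.mul_conj, Complex.normSq_eq_norm_sq]
    push_cast
    rw [pow_two, mul_div_assoc, div_self hn, mul_one]
  have h3 := avg_re ha (H := fun z => c * H z) (continuousOn_const.mul hH)
  rw [h1, h2, Complex.ofReal_re] at h3
  rw [← h3]
  refine avg_mono ha (Complex.continuous_re.comp_continuousOn (continuousOn_const.mul hH)) hH.norm fun z _ => ?_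
  calc (c * H z).re ≤ ‖c * H z‖ := Complex.re_le_norm _
    _ = ‖H z‖ := by rw [norm_mul, hcn, one_mul]

lemma mob0 (z : ℂ) : mob 0 z = z := by simp [mob]

lemma cauchy_bound {a : ℂ} (ha : ‖a‖ < 1) {H : ℂ → ℂ} (hH : MemA H) :
    ‖H a‖ ≤ avg 0 (fun z => ‖H z‖) / (1 - ‖a‖) := by
  have h1 := DiffContOnCl.circleAverage_smul_div (f := H) (c := 0) (R := 1) (w := a)
    (by rw [abs_one]; exact hH.diffContOnCl) (by simpa using ha)
  have hd : ∀ z ∈ Circ, 1 - ‖a‖ ≤ ‖z - a‖ := fun z hz => by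
    have := norm_sub_norm_le z a
    rw [norm_of_circ hz] at this; exact this
  have h1a : 0 < 1 - ‖a‖ := by linarith
  have hne : ∀ z ∈ Circ, z - a ≠ 0 := fun z hz => norm_pos_iff.1 (h1a.trans_le (hd z hz))
  have hHc : ContinuousOn H Circ := hH.1.mono circ_sub_disk
  have hcont : ContinuousOn (fun z => z / (z - a) * H z) Circ :=
    (continuousOn_id.div (continuousOn_id.sub continuousOn_const) hne).mul hHc
  have h2 : avg 0 (fun z => z / (z - a) * H z) = H a := by
    rw [← h1]; simp [avg, mob0]
  rw [← h2]
  refine (avg_norm_le (by simp) hcont).trans ?_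
  rw [div_eq_inv_mul, ← avg_mul]
  refine avg_mono (by simp) hcont.norm (continuousOn_const.mul hHc.norm) fun z hz => ?_
  rw [norm_mul, norm_div, norm_of_circ hz, one_div]
  gcongr
  exact hd z hz

lemma MemAV.contOn {f : ℂ → Fin n → ℂ} (hf : MemAV f) : ContinuousOn f Disk := continuousOn_pi.2 fun j => (hf j).1
lemma MemAV.contOnC {f : ℂ → Fin n → ℂ} (hf : MemAV f) : ContinuousOn f Circ := hf.contOn.mono circ_sub_disk
lemma MemAV.dt {f g : ℂ → Fin n → ℂ} (hf : MemAV f) (hg : MemAV g) : MemA (fun z => dt (f z) (g z)) :=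
  MemA.sum fun j _ => (hf j).mul (hg j)
lemma MemAV.const (c : Fin n → ℂ) : MemAV (fun _ => c) := fun j => MemA.const (c j)
lemma MemAV.add {f g : ℂ → Fin n → ℂ} (hf : MemAV f) (hg : MemAV g) : MemAV (fun z => f z + g z) :=
  fun j => (hf j).add (hg j)
lemma MemAV.sub {f g : ℂ → Fin n → ℂ} (hf : MemAV f) (hg : MemAV g) : MemAV (fun z => f z - g z) :=
  fun j => (hf j).sub (hg j)
lemma MemAV.smul {c : ℂ → ℂ} {f : ℂ → Fin n → ℂ} (hc : MemA c) (hf : MemAV f) : MemAV (fun z => c z • f z) :=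
  fun j => hc.mul (hf j)

lemma euclNorm_cj (a : Fin n → ℂ) : euclNorm (cj a) = euclNorm a := by
  simp [euclNorm, cj, Complex.normSq_conj]

lemma MemAV.eucl_le {f : ℂ → Fin n → ℂ} (hf : MemAV f) {C : ℝ} (h : ∀ z ∈ Circ, euclNorm (f z) ≤ C) :
    ∀ z ∈ Disk, euclNorm (f z) ≤ C := by
  intro z0 hz0
  have hC : 0 ≤ C := (euclNorm_nonneg _).trans (h 1 one_mem_circ)
  by_cases h0 : euclNorm (f z0) = 0
  · rw [h0]; exact hC
  have hpos := lt_of_le_of_ne (euclNorm_nonneg (f z0)) (Ne.symm h0)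
  have h1 := (MemAV.dt hf (MemAV.const (cj (f z0)))).norm_le (C := C * euclNorm (f z0)) (fun z hz => by
    refine (norm_dt_le' _ _).trans ?_
    rw [euclNorm_cj]; gcongr; exact h z hz) z0 hz0
  rw [dt_cj, Complex.norm_real, Real.norm_of_nonneg (by positivity), pow_two] at h1
  exact le_of_mul_le_mul_right h1 hpos

lemma MemAV.norm_le {f : ℂ → Fin n → ℂ} (hf : MemAV f) {C : ℝ} (hC : 0 ≤ C) (h : ∀ z ∈ Circ, ‖f z‖ ≤ C) :
    ∀ z ∈ Disk, ‖f z‖ ≤ C := fun z hz =>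
  (pi_norm_le_iff_of_nonneg hC).2 fun j => (hf j).norm_le (fun y hy => (norm_le_pi_norm _ j).trans (h y hy)) z hz

/-- the family of extremal discs -/
structure Fam (ρ : ℂ → (Fin n → ℂ) → ℝ) (R : ℝ) (F G : (Fin n → ℂ) → ℂ → (Fin n → ℂ)) (P : (Fin n → ℂ) → ℝ) : Prop where
  hρ : Cond3 n ρ R (fun _ => 0)
  memF : ∀ w, w ≠ 0 → euclNorm w ≤ R → MemAV (F w)
  memG : ∀ w, w ≠ 0 → euclNorm w ≤ R → MemAV (G w)
  cen : ∀ w, w ≠ 0 → euclNorm w ≤ R → F w 0 = w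
  lev : ∀ w, w ≠ 0 → euclNorm w ≤ R → ∀ z ∈ Circ, ρ z (F w z) = P w
  pair : ∀ w, w ≠ 0 → euclNorm w ≤ R → ∀ z ∈ Disk, dt (G w z) (F w z) = 1
  tan : ∀ w, w ≠ 0 → euclNorm w ≤ R → ∀ z ∈ Circ, ∀ v, dt (G w z) v = 1 ↔ dt (DD ρ z (F w z)) (v - F w z) = 0
  Pc : ContinuousOn P {w : Fin n → ℂ | euclNorm w ≤ R}
  P0 : P 0 = 0

namespace Fam
variable {F G : (Fin n → ℂ) → ℂ → (Fin n → ℂ)} {P : (Fin n → ℂ) → ℝ} (X : Fam ρ R F G P)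
include X

lemma P_pos {w : Fin n → ℂ} (h0 : w ≠ 0) (hR : euclNorm w ≤ R) : 0 < P w := by
  have h1 := X.lev w h0 hR 1 one_mem_circ
  have h2 := X.hρ.nonneg 1 one_mem_circ (F w 1)
  refine lt_of_le_of_ne (h1 ▸ h2) fun h => ?_
  rw [← h, X.hρ.zero_iff one_mem_circ] at h1
  have := X.pair w h0 hR 1 (circ_sub_disk one_mem_circ)
  rw [h1, dt_zero] at this
  exact zero_ne_one this

lemma G_eq' {w : Fin n → ℂ} (h0 : w ≠ 0) (hR : euclNorm w ≤ R) (hP : P w ≤ R) {z : ℂ} (hz : z ∈ Circ) :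
    G w z = Gm ρ z (F w z) := by
  have hl := X.lev w h0 hR z hz
  have hpos := X.P_pos h0 hR
  have hne := X.hρ.lam_ne hz (p := F w z) (by rw [hl]; exact hpos) (by rw [hl]; exact hP)
  have hp := X.pair w h0 hR z (circ_sub_disk hz)
  set p := F w z with hpd
  have key : ∀ h, dt (G w z) h = dt (Gm ρ z p) h := by
    intro h
    have h1 := (X.tan w h0 hR z hz (p + (h - (dt (DD ρ z p) h / dt (DD ρ z p) p) • p))).2 (by
      rw [← hpd, add_sub_cancel_left, dt_sub, dt_smul, div_mul_cancel₀ _ hne, sub_self])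
    rw [dt_add, hp, dt_sub, dt_smul, hp] at h1
    rw [Gm, smul_dt]
    field_simp at h1 ⊢
    linear_combination h1
  funext j
  have := key (Pi.single j 1)
  simpa [dt, Pi.single_apply] using this

lemma R_le_of {w : Fin n → ℂ} (h0 : w ≠ 0) (hR : euclNorm w ≤ R) (hP : P w = R) : R ≤ euclNorm w := by
  have hRp := X.hρ.R_pos
  have h1 := (X.memG w h0 hR).eucl_le (C := 1 / R) (fun z hz => by
    rw [X.G_eq' h0 hR hP.le hz]
    exact X.hρ.eucl_Gm_le hz (by rw [X.lev w h0 hR z hz, hP])) 0 (by simp [mem_disk_iff])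
  have h2 := X.pair w h0 hR 0 (by simp [mem_disk_iff])
  rw [X.cen w h0 hR] at h2
  have h3 := norm_dt_le' (G w 0) w
  rw [h2, norm_one] at h3
  have h4 : euclNorm (G w 0) * euclNorm w ≤ 1 / R * euclNorm w := by
    have := euclNorm_nonneg w
    gcongr
  have h5 : 1 ≤ euclNorm w / R := by rw [div_eq_inv_mul, ← one_div]; linarith
  rwa [le_div_iff₀ hRp, one_mul] at h5

lemma P_le {w : Fin n → ℂ} (hR : euclNorm w ≤ R) : P w ≤ R := by
  have hRp := X.hρ.R_pos
  by_contra hcon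
  push Not at hcon
  have hw0 : w ≠ 0 := by rintro rfl; rw [X.P0] at hcon; linarith
  have hcont : ContinuousOn (fun τ : ℝ => P (τ • w)) (Icc 0 1) := by
    refine X.Pc.comp (by fun_prop) fun τ hτ => ?_
    show euclNorm (τ • w) ≤ R
    rw [euclNorm_rsmul, abs_of_nonneg hτ.1]
    exact (mul_le_of_le_one_left (euclNorm_nonneg _) hτ.2).trans hR
  obtain ⟨τ, hτ, he⟩ := intermediate_value_Icc zero_le_one hcont
    (show R ∈ Icc (P ((0:ℝ) • w)) (P ((1:ℝ) • w)) by rw [zero_smul, one_smul, X.P0]; exact ⟨hRp.le, hcon.le⟩)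
  simp only at he
  have hτ0 : τ ≠ 0 := by rintro rfl; rw [zero_smul, X.P0] at he; linarith
  have hτ1 : τ ≠ 1 := by rintro rfl; rw [one_smul] at he; linarith
  have hτlt : τ < 1 := lt_of_le_of_ne hτ.2 hτ1
  have hlt : euclNorm (τ • w) < R := by
    rw [euclNorm_rsmul, abs_of_nonneg hτ.1]
    have : 0 < euclNorm w := (euclNorm_pos).2 hw0
    nlinarith
  have := X.R_le_of (smul_ne_zero hτ0 hw0) hlt.le he
  linarith

lemma F_le {w : Fin n → ℂ} (h0 : w ≠ 0) (hR : euclNorm w ≤ R) {z : ℂ} (hz : z ∈ Disk) : euclNorm (F w z) ≤ R :=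
  (X.memF w h0 hR).eucl_le (fun y hy => (X.hρ.le_R_iff hy).1 (by rw [X.lev w h0 hR y hy]; exact X.P_le hR)) z hz

lemma G_eq {w : Fin n → ℂ} (h0 : w ≠ 0) (hR : euclNorm w ≤ R) {z : ℂ} (hz : z ∈ Circ) :
    G w z = Gm ρ z (F w z) := X.G_eq' h0 hR (X.P_le hR) hz

lemma P_eq_R {w : Fin n → ℂ} (h0 : w ≠ 0) (hR : euclNorm w = R) : P w = R := by
  refine le_antisymm (X.P_le hR.le) (not_lt.1 fun hlt => ?_)
  have hc : ContinuousOn (fun z => euclNorm (F w z)) Circ :=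
    continuous_euclNorm.comp_continuousOn (X.memF w h0 hR.le).contOnC
  obtain ⟨z0, hz0, hmax⟩ := isCompact_circ.exists_isMaxOn ⟨1, one_mem_circ⟩ hc
  have h1 := (X.memF w h0 hR.le).eucl_le (C := euclNorm (F w z0)) (fun z hz => hmax hz) 0 (by simp [mem_disk_iff])
  have h2 := (X.hρ.lt_R_iff hz0).1 (by rw [X.lev w h0 hR.le z0 hz0]; exact hlt)
  rw [X.cen w h0 hR.le] at h1
  linarith

lemma P_lt_R {w : Fin n → ℂ} (hR : euclNorm w < R) : P w < R := by
  by_cases h0 : w = 0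
  · rw [h0, X.P0]; exact X.hρ.R_pos
  refine lt_of_le_of_ne (X.P_le hR.le) fun h => ?_
  linarith [X.R_le_of h0 hR.le h]

lemma F_const {w : Fin n → ℂ} (h0 : w ≠ 0) (hR : euclNorm w = R) {z : ℂ} (hz : z ∈ Disk) : F w z = w := by
  have hd : DiffContOnCl ℂ (fun z => (WithLp.toLp 2 (F w z) : EuclideanSpace ℂ (Fin n))) (ball 0 1) := by
    have h1 : ∀ j, DiffContOnCl ℂ (fun z => F w z j) (ball 0 1) := fun j => (X.memF w h0 hR.le j).diffContOnCl
    refine ⟨?_, ?_⟩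
    · have : DifferentiableOn ℂ (fun z => F w z) (ball 0 1) := differentiableOn_pi.2 fun j => (h1 j).1
      exact (PiLp.continuousLinearEquiv 2 ℂ (fun _ : Fin n => ℂ)).symm.differentiable.comp_differentiableOn this
    · have : ContinuousOn (fun z => F w z) (closure (ball 0 1)) := continuousOn_pi.2 fun j => (h1 j).2
      exact (PiLp.continuousLinearEquiv 2 ℂ (fun _ : Fin n => ℂ)).symm.continuous.comp_continuousOn this
  have := Complex.eqOn_closure_of_isPreconnected_of_isMaxOn_norm (convex_ball (0:ℂ) 1).isPreconnected isOpen_ball hd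
    (mem_ball_self one_pos) (fun y hy => by
      show ‖(WithLp.toLp 2 (F w y) : EuclideanSpace ℂ (Fin n))‖ ≤ ‖(WithLp.toLp 2 (F w 0) : EuclideanSpace ℂ (Fin n))‖
      rw [← euclNorm_eq, ← euclNorm_eq, X.cen w h0 hR.le, hR]
      exact X.F_le h0 hR.le (ball_subset_closedBall hy))
  rw [closure_ball _ one_ne_zero] at this
  have h2 := this hz
  simp only [Function.const_apply] at h2
  rw [X.cen w h0 hR.le] at h2
  exact (WithLp.toLp_injective 2) h2

end Fam
end E1



section E2
open scoped Topology
variable {n : ℕ} {ρ : ℂ → (Fin n → ℂ) → ℝ} {R : ℝ}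

lemma rpow_abs_sub_le {x y β : ℝ} (hx : 0 ≤ x) (hy : 0 ≤ y) (h0 : 0 ≤ β) (h1 : β ≤ 1) :
    |x ^ β - y ^ β| ≤ |x - y| ^ β := by
  have key : ∀ x y : ℝ, 0 ≤ x → 0 ≤ y → x ^ β - y ^ β ≤ |x - y| ^ β := by
    intro x y hx hy
    have h2 : x ^ β ≤ (|x - y| + y) ^ β :=
      Real.rpow_le_rpow hx (by linarith [le_abs_self (x - y)]) h0
    have h3 := Real.rpow_add_le_add_rpow (abs_nonneg (x - y)) hy h0 h1
    linarith
  rw [abs_le]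
  constructor
  · have := key y x hy hx
    rw [abs_sub_comm] at this
    linarith
  · exact key x y hx hy

/-- continuity of `z ↦ (z, f z)` type maps -/
lemma contOn_pair {f : ℂ → Fin n → ℂ} (hf : ContinuousOn f Circ) : ContinuousOn (fun z => (z, f z)) Circ :=
  continuousOn_id.prodMk hf

lemma contOn_trip {f g : ℂ → Fin n → ℂ} (hf : ContinuousOn f Circ) (hg : ContinuousOn g Circ) :
    ContinuousOn (fun z => (z, f z, g z)) Circ :=
  continuousOn_id.prodMk (hf.prodMk hg)

/-- if `‖e‖` direction: real part estimate -/
lemma re_dir {lam Q : ℂ} {th s : ℝ} (hl : lam = ‖lam‖ * exp (th * I)) (hQ : |Q.im - th| ≤ s)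
    (hs : s ≤ Real.pi) : ‖lam‖ * Real.exp (-Q.re) * Real.cos s ≤ (lam * exp (-Q)).re := by
  have h1 : lam * exp (-Q) = (‖lam‖ * Real.exp (-Q.re) : ℝ) * exp (((th - Q.im : ℝ) : ℂ) * I) := by
    conv_lhs => rw [hl]
    push_cast
    rw [mul_assoc, mul_assoc, ← exp_add, ← exp_add]
    congr 2
    apply Complex.ext <;> simp
    ring
  rw [h1, re_ofReal_mul, exp_ofReal_mul_I_re]
  apply mul_le_mul_of_nonneg_left _ (by positivity)
  rw [← Real.cos_abs (th - Q.im), abs_sub_comm]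
  exact Real.cos_le_cos_of_nonneg_of_le_pi (abs_nonneg _) hs hQ

namespace Fam
variable {F G : (Fin n → ℂ) → ℂ → (Fin n → ℂ)} {P : (Fin n → ℂ) → ℝ} (X : Fam ρ R F G P)
include X

lemma H_mem {w : Fin n → ℂ} (h0 : w ≠ 0) (hR : euclNorm w ≤ R) {v : ℂ → Fin n → ℂ} (hv : MemAV v) :
    MemA (fun z => 1 - dt (G w z) (v z)) :=
  (MemA.const 1).sub ((X.memG w h0 hR).dt hv)

lemma H_eq {w : Fin n → ℂ} (h0 : w ≠ 0) (hR : euclNorm w ≤ R) (v : ℂ → Fin n → ℂ) {z : ℂ} (hz : z ∈ Circ) :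
    1 - dt (G w z) (v z) = qq ρ z (F w z) (v z) := by
  rw [X.G_eq h0 hR hz, qq]

lemma L_cont {w : Fin n → ℂ} (h0 : w ≠ 0) (hR : euclNorm w ≤ R) {v : ℂ → Fin n → ℂ} (hv : MemAV v)
    (hlt : ∀ z ∈ Circ, ρ z (v z) < P w) : ContinuousOn (fun z => X.hρ.LL z (F w z) (v z)) Circ :=
  X.hρ.contOn_LL.comp (contOn_trip (X.memF w h0 hR).contOnC hv.contOnC)
    fun z hz => ⟨hz, by simpa [X.lev w h0 hR z hz] using X.P_pos h0 hR,
      by simpa [X.lev w h0 hR z hz] using X.P_le hR, by simpa [X.lev w h0 hR z hz] using hlt z hz⟩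

lemma L_exp {w : Fin n → ℂ} (h0 : w ≠ 0) (hR : euclNorm w ≤ R) {v : ℂ → Fin n → ℂ}
    (hlt : ∀ z ∈ Circ, ρ z (v z) < P w) : ∀ z ∈ Circ, exp (X.hρ.LL z (F w z) (v z)) = 1 - dt (G w z) (v z) := by
  intro z hz
  have hl := X.lev w h0 hR z hz
  rw [X.H_eq h0 hR v hz, X.hρ.exp_LL hz (by rw [hl]; exact X.P_pos h0 hR) (by rw [hl]; exact X.P_le hR)
    (by rw [hl]; exact hlt z hz)]

lemma H_ne {w : Fin n → ℂ} (h0 : w ≠ 0) (hR : euclNorm w ≤ R) {v : ℂ → Fin n → ℂ} (hv : MemAV v)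
    (hlt : ∀ z ∈ Circ, ρ z (v z) < P w) {a : ℂ} (ha : ‖a‖ < 1) : 1 - dt (G w a) (v a) ≠ 0 :=
  (log_disk_avg (X.H_mem h0 hR hv) (X.L_cont h0 hR hv hlt) (X.L_exp h0 hR hlt) ha).1

lemma DD_cont {w : Fin n → ℂ} (h0 : w ≠ 0) (hR : euclNorm w ≤ R) : ContinuousOn (fun z => DD ρ z (F w z)) Circ := by
  have h1 := contOn_pair (X.memF w h0 hR).contOnC
  have hm : ∀ z ∈ Circ, (z, F w z) ∈ UU ρ := by
    intro z hz
    refine ⟨hz, ?_⟩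
    have h2 := X.lev w h0 hR z hz
    have h3 := (X.P_pos h0 hR).ne'
    rw [← h2] at h3
    exact h3
  have h4 := ContinuousOn.comp X.hρ.contOn_DD h1 hm
  exact h4

lemma lam_low {w : Fin n → ℂ} (h0 : w ≠ 0) (hR : euclNorm w ≤ R) : ∃ m > 0, ∀ z ∈ Circ,
    m ≤ ‖dt (DD ρ z (F w z)) (F w z)‖ := by
  have hlc : ContinuousOn (fun z => ‖dt (DD ρ z (F w z)) (F w z)‖) Circ :=
    (ContinuousOn.dt (X.DD_cont h0 hR) (X.memF w h0 hR).contOnC).norm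
  obtain ⟨z0, hz0, hmin⟩ := isCompact_circ.exists_isMinOn ⟨1, one_mem_circ⟩ hlc
  refine ⟨_, norm_pos_iff.2 (X.hρ.lam_ne hz0 ?_ ?_), fun z hz => hmin hz⟩
  · rw [X.lev w h0 hR z0 hz0]; exact X.P_pos h0 hR
  · rw [X.lev w h0 hR z0 hz0]; exact X.P_le hR

lemma inward {w : Fin n → ℂ} (h0 : w ≠ 0) (hR : euclNorm w ≤ R) : ∃ e : ℂ → ℂ, MemA e ∧ ∃ η0 > 0, ∀ η : ℝ,
    0 < η → η < η0 → ∀ z ∈ Circ, ρ z ((1 - η * e z) • F w z) < P w := by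
  have hPp := X.P_pos h0 hR
  have hRp := X.hρ.R_pos
  obtain ⟨θ, hθc, hθ, -⟩ := X.hρ.exists_theta hPp
  have hFc := (X.memF w h0 hR).contOnC
  have hlev := X.lev w h0 hR
  have hPR := X.P_le hR
  have hθ' : ContinuousOn (fun z => θ z (F w z)) Circ := hθc.comp (contOn_pair hFc)
    fun z hz => ⟨hz, (hlev z hz).ge, (hlev z hz).trans_le hPR⟩
  obtain ⟨Q, hQ, hQa⟩ := exists_entire_im_approx hθ' (ε := Real.pi / 3) (by positivity)
  obtain ⟨m, hm0, hmin'⟩ := X.lam_low h0 hR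
  obtain ⟨δ, hδ, Hd⟩ := X.hρ.fo_decr hPp (c := m / (2 * R)) (by positivity)
  have he : MemA (fun z => exp (-Q z)) := .of_differentiable (by fun_prop)
  obtain ⟨M, hM⟩ := isCompact_circ.exists_bound_of_continuousOn (he.1.mono circ_sub_disk)
  have hM' : 0 < max M 1 := by positivity
  refine ⟨fun z => exp (-Q z), he, δ / (max M 1 * R), by positivity, fun η hη hη' z hz => ?_⟩
  set f := F w z with hf
  have hfR : ‖f‖ ≤ R := X.hρ.norm_le_R hz (by rw [hlev z hz]; exact hPR)
  have hfn : f ≠ 0 := by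
    have := (X.hρ.pos_iff hz (w := f)).1 (by rw [hlev z hz]; exact hPp)
    exact this
  have hfn' := norm_pos_iff.2 hfn
  set h : Fin n → ℂ := (-(η * exp (-Q z)) : ℂ) • f with hh
  have hnh : ‖h‖ = η * ‖exp (-Q z)‖ * ‖f‖ := by
    rw [hh, norm_smul, norm_neg, norm_mul, norm_real, Real.norm_of_nonneg hη.le]
  have hhp : 0 < ‖h‖ := by
    rw [hnh]; have := norm_pos_iff.2 (exp_ne_zero (-Q z)); positivity
  have h2 : (1 - η * exp (-Q z)) • f = f + h := by
    rw [hh, sub_smul, one_smul, neg_smul, sub_eq_add_neg]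
  show ρ z ((1 - η * exp (-Q z)) • f) < P w
  rw [h2]
  have h3 : ‖h‖ < δ := by
    rw [hnh]
    have e1 : ‖exp (-Q z)‖ ≤ max M 1 := (hM z hz).trans (le_max_left _ _)
    calc η * ‖exp (-Q z)‖ * ‖f‖ ≤ η * max M 1 * R := by gcongr
      _ = η * (max M 1 * R) := by ring
      _ < δ := by rwa [lt_div_iff₀ (by positivity)] at hη'
  have h4 : (dt (DD ρ z f) h).re ≤ -(m / (2 * R)) * ‖h‖ := by
    have e1 : dt (DD ρ z f) h = -((η : ℝ) * (dt (DD ρ z f) f * exp (-Q z))) := by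
      rw [hh, dt_smul]; ring
    rw [e1, neg_re, re_ofReal_mul]
    have e2 := re_dir (hθ z hz f (hlev z hz).ge ((hlev z hz).trans_le hPR)) (hQa z hz).le (by linarith [Real.pi_pos])
    rw [Real.cos_pi_div_three] at e2
    have e3 : ‖exp (-Q z)‖ = Real.exp (-Q z).re := norm_exp _
    rw [neg_re] at e3
    rw [hnh, e3]
    have e4 := hmin' z hz
    have e5 : m / (2 * R) * (η * Real.exp (-(Q z).re) * ‖f‖) ≤ η * (‖dt (DD ρ z f) f‖ * Real.exp (-(Q z).re) * (1/2)) := by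
      calc m / (2 * R) * (η * Real.exp (-(Q z).re) * ‖f‖) ≤ m / (2 * R) * (η * Real.exp (-(Q z).re) * R) := by gcongr
        _ = η * (m * Real.exp (-(Q z).re) * (1/2)) := by field_simp
        _ ≤ _ := by gcongr
    have e6 := mul_le_mul_of_nonneg_left e2 hη.le
    linarith
  have h5 := Hd z hz f (hlev z hz).ge ((hlev z hz).trans_le hPR) h h3 h4
  have h6 : 0 < m / (2 * R) * ‖h‖ := by positivity
  rw [hlev z hz] at h5
  linarith

end Fam
end E2



section E3
open scoped Topology
variable {n : ℕ} {ρ : ℂ → (Fin n → ℂ) → ℝ} {R : ℝ}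

/-- compact set of pairs of points with levels in `[t0, R]` -/
def C3 (ρ : ℂ → (Fin n → ℂ) → ℝ) (R t0 : ℝ) : Set (ℂ × (Fin n → ℂ) × (Fin n → ℂ)) :=
  {x | x.1 ∈ Circ ∧ (t0 ≤ ρ x.1 x.2.1 ∧ ρ x.1 x.2.1 ≤ R) ∧ (t0 ≤ ρ x.1 x.2.2 ∧ ρ x.1 x.2.2 ≤ R)}

lemma mem_C3 {t0 : ℝ} {z : ℂ} {p q : Fin n → ℂ} (hz : z ∈ Circ) (h1 : t0 ≤ ρ z p) (h2 : ρ z p ≤ R)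
    (h3 : t0 ≤ ρ z q) (h4 : ρ z q ≤ R) : (z, p, q) ∈ C3 ρ R t0 := ⟨hz, ⟨h1, h2⟩, ⟨h3, h4⟩⟩

namespace Cond3
variable (hρ : Cond3 n ρ R (fun _ => 0))
include hρ

lemma isCompact_C3 (t0 : ℝ) : IsCompact (C3 ρ R t0) := by
  have h1 := (hρ.isCompact_lev (t0 := t0)).prod (hρ.isCompact_lev (t0 := t0))
  have h2 := h1.inter_right (isClosed_eq (f := fun x : (ℂ × (Fin n → ℂ)) × (ℂ × (Fin n → ℂ)) => x.1.1)
    (g := fun x => x.2.1) (by fun_prop) (by fun_prop))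
  have h3 := h2.image (f := fun x : (ℂ × (Fin n → ℂ)) × (ℂ × (Fin n → ℂ)) => (x.1.1, x.1.2, x.2.2)) (by fun_prop)
  convert h3 using 1
  ext ⟨z, p, q⟩
  constructor
  · rintro ⟨a, b, c⟩
    exact ⟨((z, p), (z, q)), ⟨⟨⟨a, b⟩, ⟨a, c⟩⟩, rfl⟩, rfl⟩
  · rintro ⟨⟨⟨z1, p1⟩, ⟨z2, p2⟩⟩, ⟨⟨⟨a, b⟩, ⟨c, d⟩⟩, e⟩, f⟩
    simp only [Set.mem_ofPred_eq] at e
    simp only [Prod.mk.injEq] at f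
    obtain ⟨rfl, rfl, rfl⟩ := f
    subst e
    exact ⟨a, b, d⟩

lemma B_bound {t0 β ε : ℝ} (ht0 : 0 < t0) (hβ : 0 < β) (hε : 0 < ε)
    {B : ℂ × (Fin n → ℂ) × (Fin n → ℂ) → ℝ} (hB : ContinuousOn B (C3 ρ R t0))
    (hB0 : ∀ z p, B (z, p, p) = 0) : ∃ C ≥ 0, ∀ z ∈ Circ, ∀ p q, t0 ≤ ρ z p → ρ z p ≤ R → t0 ≤ ρ z q →
      ρ z q ≤ ρ z p → B (z, p, q) ≤ ε + C * ‖qq ρ z p q‖ ^ β := by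
  have hK := hρ.isCompact_C3 t0
  obtain ⟨M, hM⟩ := hK.exists_bound_of_continuousOn hB
  obtain ⟨δ, hδ, hu⟩ := Metric.uniformContinuousOn_iff.1 (hK.uniformContinuousOn_of_continuous hB) ε hε
  obtain ⟨c, hc, hlc⟩ := hρ.unif_lc ht0 hδ
  refine ⟨max M 0 / c ^ β, by positivity, fun z hz p q h1 h2 h3 h4 => ?_⟩
  have hm := mem_C3 (ρ := ρ) hz h1 h2 h3 (h4.trans h2)
  by_cases hd : ‖q - p‖ < δ
  · have h5 := hu _ hm _ (mem_C3 (ρ := ρ) hz h1 h2 h1 h2) (by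
      rw [Prod.dist_eq, Prod.dist_eq]
      simp only [dist_self]
      rw [dist_eq_norm]
      simp [hd])
    rw [hB0, Real.dist_eq, sub_zero] at h5
    have : 0 ≤ max M 0 / c ^ β * ‖qq ρ z p q‖ ^ β := by positivity
    linarith [le_abs_self (B (z, p, q))]
  · have h5 := hlc z hz p q h1 h2 h4 (not_lt.1 hd)
    have h6 : c ^ β ≤ ‖qq ρ z p q‖ ^ β := Real.rpow_le_rpow hc.le h5 hβ.le
    have h7 : B (z, p, q) ≤ max M 0 := (le_abs_self _).trans ((hM _ hm).trans (le_max_left _ _))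
    have h8 : max M 0 ≤ max M 0 / c ^ β * ‖qq ρ z p q‖ ^ β := by
      calc max M 0 = max M 0 / c ^ β * c ^ β := by field_simp
        _ ≤ _ := by gcongr
    linarith

end Cond3

namespace Fam
variable {F G : (Fin n → ℂ) → ℂ → (Fin n → ℂ)} {P : (Fin n → ℂ) → ℝ} (X : Fam ρ R F G P)
include X

lemma avg_pow {t0 : ℝ} (ht0 : 0 < t0) : ∃ β : ℝ, 0 < β ∧ β ≤ 1 ∧ ∀ w, w ≠ 0 → euclNorm w ≤ R → t0 ≤ P w →
    ∀ w', w' ≠ 0 → euclNorm w' ≤ R → P w' ≤ P w → ∀ a : ℂ, ‖a‖ < 1 →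
    avg a (fun z => ‖1 - dt (G w z) (F w' z)‖ ^ β) ≤ 2 * ‖1 - dt (G w a) (F w' a)‖ ^ β := by
  obtain ⟨M, hM, hLL⟩ := X.hρ.LL_bound ht0
  refine ⟨min 1 (Real.pi / 4 / M), by positivity, min_le_left _ _, ?_⟩
  set β := min 1 (Real.pi / 4 / M) with hβ
  have hβ0 : 0 < β := by positivity
  have hβ1 : β ≤ 1 := min_le_left _ _
  have hβM : β * M ≤ Real.pi / 4 := by
    rw [← le_div_iff₀ hM]; exact min_le_right _ _
  clear_value β
  intro w h0 hR ht w' h0' hR' hPP a ha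
  obtain ⟨e, he, η0, hη0, hin⟩ := X.inward h0' hR'
  have had : a ∈ Disk := mem_disk_iff.2 ha.le
  have hgf : MemA (fun z => dt (G w z) (F w' z)) := (X.memG w h0 hR).dt (X.memF w' h0' hR')
  obtain ⟨B, hB⟩ := isCompact_disk.exists_bound_of_continuousOn (he.mul hgf).1
  have hH : MemA (fun z => 1 - dt (G w z) (F w' z)) := X.H_mem h0 hR (X.memF w' h0' hR')
  have hB0 : 0 ≤ B := (norm_nonneg _).trans (hB a had)
  have key : ∀ η : ℝ, 0 < η → η < η0 → avg a (fun z => ‖1 - dt (G w z) (F w' z)‖ ^ β) ≤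
      2 * ‖1 - dt (G w a) (F w' a)‖ ^ β + 3 * (η * B) ^ β := by
    intro η hη hη'
    set v : ℂ → Fin n → ℂ := fun z => (1 - η * e z) • F w' z with hv
    have hvA : MemAV v := MemAV.smul ((MemA.const 1).sub ((MemA.const η).mul he)) (X.memF w' h0' hR')
    have hlt : ∀ z ∈ Circ, ρ z (v z) < P w := fun z hz => (hin η hη hη' z hz).trans_le hPP
    have h1 := (log_disk_avg (X.H_mem h0 hR hvA) (X.L_cont h0 hR hvA hlt) (X.L_exp h0 hR hlt) ha).2.2 β M hβ0 hβM
      (fun z hz => hLL z hz _ _ (by rw [X.lev w h0 hR z hz]; exact ht) (by rw [X.lev w h0 hR z hz]; exact X.P_le hR)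
        (by rw [X.lev w h0 hR z hz]; exact hlt z hz))
    have h2 : ∀ z ∈ Disk, |‖1 - dt (G w z) (F w' z)‖ ^ β - ‖1 - dt (G w z) (v z)‖ ^ β| ≤ (η * B) ^ β := by
      intro z hz
      refine (rpow_abs_sub_le (norm_nonneg _) (norm_nonneg _) hβ0.le hβ1).trans ?_
      refine Real.rpow_le_rpow (abs_nonneg _) ((abs_norm_sub_norm_le _ _).trans ?_) hβ0.le
      have e1 : 1 - dt (G w z) (F w' z) - (1 - dt (G w z) (v z)) = -(η * (e z * dt (G w z) (F w' z))) := by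
        simp only [hv, dt_smul]; ring
      rw [e1, norm_neg, norm_mul, norm_real, Real.norm_of_nonneg hη.le]
      exact mul_le_mul_of_nonneg_left (hB z hz) hη.le
    have c1 : ContinuousOn (fun z => ‖1 - dt (G w z) (F w' z)‖ ^ β) Circ :=
      (hH.1.mono circ_sub_disk).norm.rpow_const fun z _ => Or.inr hβ0.le
    have c2 : ContinuousOn (fun z => ‖1 - dt (G w z) (v z)‖ ^ β) Circ :=
      ((X.H_mem h0 hR hvA).1.mono circ_sub_disk).norm.rpow_const fun z _ => Or.inr hβ0.le
    have h3 := avg_dist_le ha c1 c2 fun z hz => h2 z (circ_sub_disk hz)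
    have h4 := h2 a had
    rw [abs_le] at h3 h4
    linarith [h3.1, h3.2, h4.1, h4.2]
  have hlim : Tendsto (fun η : ℝ => 2 * ‖1 - dt (G w a) (F w' a)‖ ^ β + 3 * (η * B) ^ β) (𝓝[>] 0)
      (𝓝 (2 * ‖1 - dt (G w a) (F w' a)‖ ^ β + 3 * (0 * B) ^ β)) := by
    have : Continuous (fun η : ℝ => 2 * ‖1 - dt (G w a) (F w' a)‖ ^ β + 3 * (η * B) ^ β) :=
      continuous_const.add (continuous_const.mul ((continuous_id.mul continuous_const).rpow_const fun _ => Or.inr hβ0.le))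
    exact (this.tendsto 0).mono_left nhdsWithin_le_nhds
  rw [zero_mul, Real.zero_rpow hβ0.ne', mul_zero, add_zero] at hlim
  refine ge_of_tendsto hlim ?_
  filter_upwards [Ioo_mem_nhdsGT hη0] with η hη
  exact key η hη.1 hη.2

lemma Ga_bound {t0 : ℝ} (ht0 : 0 < t0) : ∃ M > 0, ∀ w, w ≠ 0 → euclNorm w ≤ R → t0 ≤ P w → ∀ a ∈ Disk, ‖G w a‖ ≤ M := by
  obtain ⟨M, hM, H⟩ := X.hρ.Gm_bound ht0
  refine ⟨M, hM, fun w h0 hR ht a ha => (X.memG w h0 hR).norm_le hM.le (fun z hz => ?_) a ha⟩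
  rw [X.G_eq h0 hR hz]
  exact H z hz _ (by rw [X.lev w h0 hR z hz]; exact ht) (by rw [X.lev w h0 hR z hz]; exact X.P_le hR)

lemma Ha_le {t0 : ℝ} (ht0 : 0 < t0) : ∃ M > 0, ∀ w, w ≠ 0 → euclNorm w ≤ R → t0 ≤ P w → ∀ a ∈ Disk, ∀ v,
    ‖1 - dt (G w a) v‖ ≤ M * ‖F w a - v‖ := by
  obtain ⟨M, hM, H⟩ := X.Ga_bound ht0
  refine ⟨n * M + 1, by positivity, fun w h0 hR ht a ha v => ?_⟩
  rw [← X.pair w h0 hR a ha, ← dt_sub]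
  refine (norm_dt_le _ _).trans ?_
  have := H w h0 hR ht a ha
  have h2 : n * ‖G w a‖ * ‖F w a - v‖ ≤ n * M * ‖F w a - v‖ := by gcongr
  nlinarith [norm_nonneg (F w a - v)]

lemma comp_C3 {t0 : ℝ} {w : Fin n → ℂ} (h0 : w ≠ 0) (hR : euclNorm w ≤ R) (ht : t0 ≤ P w) {w' : Fin n → ℂ}
    (h0' : w' ≠ 0) (hR' : euclNorm w' ≤ R) (ht' : t0 ≤ P w') {B : ℂ × (Fin n → ℂ) × (Fin n → ℂ) → ℝ}
    (hB : ContinuousOn B (C3 ρ R t0)) : ContinuousOn (fun z => B (z, F w z, F w' z)) Circ := by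
  have h1 := contOn_trip (X.memF w h0 hR).contOnC (X.memF w' h0' hR').contOnC
  refine ContinuousOn.comp hB h1 ?_
  intro z hz
  have e1 := X.lev w h0 hR z hz
  have e2 := X.lev w' h0' hR' z hz
  exact mem_C3 (ρ := ρ) hz (by rw [e1]; exact ht) (by rw [e1]; exact X.P_le hR) (by rw [e2]; exact ht')
    (by rw [e2]; exact X.P_le hR')

omit X in
lemma avg_affine {a : ℂ} (ha : ‖a‖ < 1) (x y : ℝ) {f : ℂ → ℝ} (hf : ContinuousOn f Circ) :
    avg a (fun z => x + y * f z) = x + y * avg a f := by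
  have h2 : ContinuousOn (fun z => y * f z) Circ := continuousOn_const.mul hf
  have := avg_add ha (f := fun _ => x) continuousOn_const h2
  rw [this, avg_const, avg_mul]

/-- main continuity estimate, one sided -/
lemma avg_B1 {t0 : ℝ} (ht0 : 0 < t0) : ∃ β : ℝ, 0 < β ∧ ∀ B : ℂ × (Fin n → ℂ) × (Fin n → ℂ) → ℝ,
    ContinuousOn B (C3 ρ R t0) → (∀ z p, B (z, p, p) = 0) →
    ∀ ε > 0, ∃ C ≥ 0, ∀ w, w ≠ 0 → euclNorm w ≤ R → t0 ≤ P w →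
    ∀ w', w' ≠ 0 → euclNorm w' ≤ R → t0 ≤ P w' → P w' ≤ P w → ∀ a : ℂ, ‖a‖ < 1 →
    avg a (fun z => B (z, F w z, F w' z)) ≤ ε + C * ‖1 - dt (G w a) (F w' a)‖ ^ β := by
  obtain ⟨β, hβ0, hβ1, hav⟩ := X.avg_pow ht0
  refine ⟨β, hβ0, fun B hB hB0 ε hε => ?_⟩
  obtain ⟨C, hC, hCB⟩ := X.hρ.B_bound ht0 hβ0 hε hB hB0
  refine ⟨C * 2, by positivity, ?_⟩
  intro w h0 hR ht w' h0' hR' ht' hPP a ha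
  have c1 := X.comp_C3 h0 hR ht h0' hR' ht' hB
  have hH : MemA (fun z => 1 - dt (G w z) (F w' z)) := X.H_mem h0 hR (X.memF w' h0' hR')
  have c2 : ContinuousOn (fun z => ‖1 - dt (G w z) (F w' z)‖ ^ β) Circ :=
    (hH.1.mono circ_sub_disk).norm.rpow_const fun z _ => Or.inr hβ0.le
  have c3 : ContinuousOn (fun z => ε + C * ‖1 - dt (G w z) (F w' z)‖ ^ β) Circ :=
    continuousOn_const.add (continuousOn_const.mul c2)
  have h1 := avg_mono ha c1 c3 fun z hz => by
    have e1 := X.lev w h0 hR z hz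
    have e2 := X.lev w' h0' hR' z hz
    have := hCB z hz (F w z) (F w' z) (by rw [e1]; exact ht) (by rw [e1]; exact X.P_le hR)
      (by rw [e2]; exact ht') (by rw [e1, e2]; exact hPP)
    rwa [← X.H_eq h0 hR (F w') hz] at this
  rw [avg_affine ha _ _ c2] at h1
  have h2 := mul_le_mul_of_nonneg_left (hav w h0 hR ht w' h0' hR' hPP a ha) hC
  linarith

/-- main continuity estimate -/
lemma avg_B {t0 : ℝ} (ht0 : 0 < t0) {B : ℂ × (Fin n → ℂ) × (Fin n → ℂ) → ℝ}
    (hB : ContinuousOn B (C3 ρ R t0)) (hB0 : ∀ z p, B (z, p, p) = 0) (hsym : ∀ z p q, B (z, p, q) = B (z, q, p))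
    {ε : ℝ} (hε : 0 < ε) : ∃ δ > 0, ∀ w, w ≠ 0 → euclNorm w ≤ R → t0 ≤ P w →
    ∀ w', w' ≠ 0 → euclNorm w' ≤ R → t0 ≤ P w' → ∀ a : ℂ, ‖a‖ < 1 → ‖F w a - F w' a‖ < δ →
    avg a (fun z => B (z, F w z, F w' z)) ≤ ε := by
  obtain ⟨β, hβ0, hav⟩ := X.avg_B1 ht0
  obtain ⟨M, hM, HM⟩ := X.Ha_le ht0
  obtain ⟨C, hC, hCB⟩ := hav B hB hB0 (ε / 2) (half_pos hε)
  have hlim : Tendsto (fun x : ℝ => C * (M * x) ^ β) (𝓝 0) (𝓝 (C * (M * 0) ^ β)) := by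
    have : Continuous (fun x : ℝ => C * (M * x) ^ β) :=
      continuous_const.mul ((continuous_const.mul continuous_id).rpow_const fun _ => Or.inr hβ0.le)
    exact this.tendsto 0
  rw [mul_zero, Real.zero_rpow hβ0.ne', mul_zero] at hlim
  obtain ⟨δ, hδ, hd⟩ := Metric.tendsto_nhds_nhds.1 hlim (ε / 2) (half_pos hε)
  refine ⟨δ, hδ, ?_⟩
  have key : ∀ w, w ≠ 0 → euclNorm w ≤ R → t0 ≤ P w →
    ∀ w', w' ≠ 0 → euclNorm w' ≤ R → t0 ≤ P w' → P w' ≤ P w → ∀ a : ℂ, ‖a‖ < 1 → ‖F w a - F w' a‖ < δ →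
    avg a (fun z => B (z, F w z, F w' z)) ≤ ε := by
    intro w h0 hR ht w' h0' hR' ht' hPP a ha hlt
    have h1 := hCB w h0 hR ht w' h0' hR' ht' hPP a ha
    have h3 := HM w h0 hR ht a (mem_disk_iff.2 ha.le) (F w' a)
    have h4 : C * ‖1 - dt (G w a) (F w' a)‖ ^ β ≤ C * (M * ‖F w a - F w' a‖) ^ β :=
      mul_le_mul_of_nonneg_left (Real.rpow_le_rpow (norm_nonneg _) h3 hβ0.le) hC
    have h5 := hd (x := ‖F w a - F w' a‖) (by rwa [Real.dist_eq, sub_zero, abs_norm])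
    rw [Real.dist_eq, sub_zero] at h5
    linarith [le_abs_self (C * (M * ‖F w a - F w' a‖) ^ β)]
  intro w h0 hR ht w' h0' hR' ht' a ha hlt
  rcases le_total (P w') (P w) with h | h
  · exact key w h0 hR ht w' h0' hR' ht' h a ha hlt
  · rw [norm_sub_rev] at hlt
    have := key w' h0' hR' ht' w h0 hR ht h a ha hlt
    simpa only [hsym _ (F w _) (F w' _)] using this

lemma F_avg {t0 : ℝ} (ht0 : 0 < t0) {ε : ℝ} (hε : 0 < ε) : ∃ δ > 0, ∀ w, w ≠ 0 → euclNorm w ≤ R → t0 ≤ P w →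
    ∀ w', w' ≠ 0 → euclNorm w' ≤ R → t0 ≤ P w' → ∀ a : ℂ, ‖a‖ < 1 → ‖F w a - F w' a‖ < δ →
    avg a (fun z => ‖F w z - F w' z‖) ≤ ε :=
  X.avg_B ht0 (B := fun x => ‖x.2.1 - x.2.2‖) (by fun_prop) (by simp) (fun z p q => norm_sub_rev _ _) hε

omit X in
lemma norm_le_avg {f : ℂ → Fin n → ℂ} (hf : MemAV f) {a : ℂ} (ha : ‖a‖ < 1) : ‖f a‖ ≤ avg a (fun z => ‖f z‖) := by
  have hc := hf.contOnC.norm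
  have h0 := avg_nonneg ha hc fun z _ => norm_nonneg _
  refine (pi_norm_le_iff_of_nonneg h0).2 fun j => ?_
  rw [← avg_mean ha (hf j)]
  have hj : ContinuousOn (fun z => f z j) Circ := (hf j).1.mono circ_sub_disk
  exact (avg_norm_le ha hj).trans (avg_mono ha hj.norm hc fun z _ => norm_le_pi_norm (f z) j)

omit X in
lemma norm_le_avg0 {f : ℂ → Fin n → ℂ} (hf : MemAV f) {a : ℂ} (ha : ‖a‖ < 1) :
    ‖f a‖ ≤ avg 0 (fun z => ‖f z‖) / (1 - ‖a‖) := by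
  have hc := hf.contOnC.norm
  have h00 : ‖(0:ℂ)‖ < 1 := by simp
  have h0 := avg_nonneg h00 hc fun z _ => norm_nonneg _
  have h1 : 0 < 1 - ‖a‖ := by linarith
  refine (pi_norm_le_iff_of_nonneg (by positivity)).2 fun j => ?_
  have hj : ContinuousOn (fun z => f z j) Circ := (hf j).1.mono circ_sub_disk
  refine (cauchy_bound ha (hf j)).trans ?_
  gcongr
  exact avg_mono h00 hj.norm hc fun z _ => norm_le_pi_norm (f z) j

lemma F_dist {t0 : ℝ} (ht0 : 0 < t0) {ε : ℝ} (hε : 0 < ε) : ∃ δ > 0, ∀ w, w ≠ 0 → euclNorm w ≤ R → t0 ≤ P w →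
    ∀ w', w' ≠ 0 → euclNorm w' ≤ R → t0 ≤ P w' → ‖w - w'‖ < δ → ∀ a : ℂ, ‖a‖ < 1 →
    ‖F w a - F w' a‖ ≤ ε / (1 - ‖a‖) := by
  obtain ⟨δ, hδ, H⟩ := X.F_avg ht0 hε
  refine ⟨δ, hδ, fun w h0 hR ht w' h0' hR' ht' hlt a ha => ?_⟩
  have h1 := H w h0 hR ht w' h0' hR' ht' 0 (by simp) (by rwa [X.cen w h0 hR, X.cen w' h0' hR'])
  refine (norm_le_avg0 ((X.memF w h0 hR).sub (X.memF w' h0' hR')) ha).trans ?_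
  have : 0 < 1 - ‖a‖ := by linarith
  gcongr

lemma G_dist {t0 : ℝ} (ht0 : 0 < t0) {ε : ℝ} (hε : 0 < ε) : ∃ δ > 0, ∀ w, w ≠ 0 → euclNorm w ≤ R → t0 ≤ P w →
    ∀ w', w' ≠ 0 → euclNorm w' ≤ R → t0 ≤ P w' → ∀ a : ℂ, ‖a‖ < 1 → ‖F w a - F w' a‖ < δ →
    ‖G w a - G w' a‖ ≤ ε := by
  have hBc : ContinuousOn (fun x : ℂ × (Fin n → ℂ) × (Fin n → ℂ) => ‖Gm ρ x.1 x.2.1 - Gm ρ x.1 x.2.2‖) (C3 ρ R t0) := by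
    have h1 : ContinuousOn (fun x : ℂ × (Fin n → ℂ) × (Fin n → ℂ) => (x.1, x.2.1)) (C3 ρ R t0) := by fun_prop
    have h2 : ContinuousOn (fun x : ℂ × (Fin n → ℂ) × (Fin n → ℂ) => (x.1, x.2.2)) (C3 ρ R t0) := by fun_prop
    refine (ContinuousOn.sub (ContinuousOn.comp X.hρ.contOn_Gm h1 ?_) (ContinuousOn.comp X.hρ.contOn_Gm h2 ?_)).norm
    · intro x hx; exact ⟨hx.1, ht0.trans_le hx.2.1.1, hx.2.1.2⟩
    · intro x hx; exact ⟨hx.1, ht0.trans_le hx.2.2.1, hx.2.2.2⟩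
  obtain ⟨δ, hδ, H⟩ := X.avg_B ht0 hBc (by simp) (fun z p q => norm_sub_rev _ _) hε
  refine ⟨δ, hδ, fun w h0 hR ht w' h0' hR' ht' a ha hlt => ?_⟩
  have h1 := H w h0 hR ht w' h0' hR' ht' a ha hlt
  have h2 := norm_le_avg ((X.memG w h0 hR).sub (X.memG w' h0' hR')) ha
  refine h2.trans (le_of_eq_of_le (avg_congr ha fun z hz => ?_) h1)
  simp only [X.G_eq h0 hR hz, X.G_eq h0' hR' hz]

lemma u_dist {t0 : ℝ} (ht0 : 0 < t0) {θ : ℂ → (Fin n → ℂ) → ℝ}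
    (hθ : ContinuousOn (fun x : ℂ × (Fin n → ℂ) => θ x.1 x.2) {p | p.1 ∈ Circ ∧ t0 ≤ ρ p.1 p.2 ∧ ρ p.1 p.2 ≤ R})
    {ε : ℝ} (hε : 0 < ε) : ∃ δ > 0, ∀ w, w ≠ 0 → euclNorm w ≤ R → t0 ≤ P w →
    ∀ w', w' ≠ 0 → euclNorm w' ≤ R → t0 ≤ P w' → ∀ a : ℂ, ‖a‖ < 1 → ‖F w a - F w' a‖ < δ →
    |avg a (fun z => θ z (F w z)) - avg a (fun z => θ z (F w' z))| ≤ ε := by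
  have hBc : ContinuousOn (fun x : ℂ × (Fin n → ℂ) × (Fin n → ℂ) => |θ x.1 x.2.1 - θ x.1 x.2.2|) (C3 ρ R t0) := by
    have h1 : ContinuousOn (fun x : ℂ × (Fin n → ℂ) × (Fin n → ℂ) => (x.1, x.2.1)) (C3 ρ R t0) := by fun_prop
    have h2 : ContinuousOn (fun x : ℂ × (Fin n → ℂ) × (Fin n → ℂ) => (x.1, x.2.2)) (C3 ρ R t0) := by fun_prop
    refine (ContinuousOn.sub (ContinuousOn.comp hθ h1 ?_) (ContinuousOn.comp hθ h2 ?_)).abs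
    · intro x hx; exact ⟨hx.1, hx.2.1.1, hx.2.1.2⟩
    · intro x hx; exact ⟨hx.1, hx.2.2.1, hx.2.2.2⟩
  obtain ⟨δ, hδ, H⟩ := X.avg_B ht0 hBc (by simp) (fun z p q => abs_sub_comm _ _) hε
  refine ⟨δ, hδ, fun w h0 hR ht w' h0' hR' ht' a ha hlt => ?_⟩
  have h1 := H w h0 hR ht w' h0' hR' ht' a ha hlt
  have c : ∀ w, w ≠ 0 → euclNorm w ≤ R → t0 ≤ P w → ContinuousOn (fun z => θ z (F w z)) Circ := by
    intro w h0 hR ht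
    refine ContinuousOn.comp hθ (contOn_pair (X.memF w h0 hR).contOnC) ?_
    intro z hz
    have e := X.lev w h0 hR z hz
    exact ⟨hz, ht.trans e.ge, e.le.trans (X.P_le hR)⟩
  rw [← avg_sub ha (c w h0 hR ht) (c w' h0' hR' ht')]
  exact (avg_abs_le _).trans h1

end Fam
end E3



section E4
open scoped Topology
variable {n : ℕ} {ρ : ℂ → (Fin n → ℂ) → ℝ} {R : ℝ}

namespace Cond3
variable (hρ : Cond3 n ρ R (fun _ => 0))
include hρ

lemma rho_small {ε : ℝ} (hε : 0 < ε) : ∃ η > 0, ∀ z ∈ Circ, ∀ v, ρ z v < η → ‖v‖ < ε := by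
  have hc := (hρ.isCompact_lev (t0 := 0)).inter_right (isClosed_le (continuous_const (y := ε))
    (by fun_prop : Continuous (fun x : ℂ × (Fin n → ℂ) => ‖x.2‖)))
  set C := {p : ℂ × (Fin n → ℂ) | p.1 ∈ Circ ∧ 0 ≤ ρ p.1 p.2 ∧ ρ p.1 p.2 ≤ R} ∩ {x | ε ≤ ‖x.2‖} with hC
  have hρc : ContinuousOn (fun p : ℂ × (Fin n → ℂ) => ρ p.1 p.2) C := hρ.cont.mono fun p hp => by
    first | exact ⟨hp.1.1, trivial⟩ | exact hp.1.1
  by_cases hne : C.Nonempty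
  · obtain ⟨x0, hx0, hmin⟩ := hc.exists_isMinOn hne hρc
    have hmin' : ∀ x ∈ C, ρ x0.1 x0.2 ≤ ρ x.1 x.2 := fun x hx => hmin hx
    have hp : 0 < ρ x0.1 x0.2 := by
      refine (hρ.pos_iff hx0.1.1).2 fun h => ?_
      have h1 : ε ≤ ‖x0.2‖ := hx0.2
      rw [h, norm_zero] at h1
      linarith
    refine ⟨min (ρ x0.1 x0.2) R, lt_min hp hρ.R_pos, fun z hz v hv => ?_⟩
    by_contra hcon
    have := hmin' (z, v) ⟨⟨hz, hρ.nonneg z hz v, (hv.trans_le (min_le_right _ _)).le⟩, not_lt.1 hcon⟩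
    linarith [hv.trans_le (min_le_left _ _)]
  · refine ⟨R, hρ.R_pos, fun z hz v hv => ?_⟩
    by_contra hcon
    exact hne ⟨(z, v), ⟨⟨hz, hρ.nonneg z hz v, hv.le⟩, not_lt.1 hcon⟩⟩

end Cond3

namespace Fam
variable {F G : (Fin n → ℂ) → ℂ → (Fin n → ℂ)} {P : (Fin n → ℂ) → ℝ} (X : Fam ρ R F G P)
include X

/-- level injectivity -/
lemma level_inj {w w' : Fin n → ℂ} (h0 : w ≠ 0) (hR : euclNorm w ≤ R) (h0' : w' ≠ 0) (hR' : euclNorm w' ≤ R)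
    {a : ℂ} (ha : ‖a‖ < 1) (hlt : P w' < P w) : 1 - dt (G w a) (F w' a) ≠ 0 :=
  X.H_ne h0 hR (X.memF w' h0' hR') (fun z hz => by rw [X.lev w' h0' hR' z hz]; exact hlt) ha

lemma plane_unique {w w' : Fin n → ℂ} (h0 : w ≠ 0) (hR : euclNorm w ≤ R) (h0' : w' ≠ 0) (hR' : euclNorm w' ≤ R)
    (hPP : P w' ≤ P w) (hd : dt (G w 0) w' = 1) : w' = w ∧ P w' = P w ∨ False := by
  left
  have h00 : ‖(0:ℂ)‖ < 1 := by simp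
  have hP : P w' = P w := by
    refine le_antisymm hPP (not_lt.1 fun hlt => ?_)
    have := X.level_inj h0 hR h0' hR' h00 hlt
    rw [X.cen w' h0' hR', hd, sub_self] at this
    exact this rfl
  refine ⟨?_, hP⟩
  have hp := X.P_pos h0 hR
  obtain ⟨β, hβ, hav⟩ := X.avg_B1 hp
  have h1 : ∀ ε > 0, ‖w - w'‖ ≤ 0 + ε := by
    intro ε hε
    obtain ⟨C, hC, hCB⟩ := hav (fun x => ‖x.2.1 - x.2.2‖) (by fun_prop) (by simp) ε hε
    have h2 := hCB w h0 hR le_rfl w' h0' hR' hP.ge hPP 0 h00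
    rw [X.cen w' h0' hR', hd, sub_self, norm_zero, Real.zero_rpow hβ.ne', mul_zero, add_zero] at h2
    have h3 := norm_le_avg ((X.memF w h0 hR).sub (X.memF w' h0' hR')) h00
    rw [X.cen w h0 hR, X.cen w' h0' hR'] at h3
    linarith
  have h2 := le_of_forall_pos_le_add h1
  exact (sub_eq_zero.1 (norm_le_zero_iff.1 h2)).symm

omit X in
lemma exists_dt_zero (hn : 2 ≤ n) (g : Fin n → ℂ) : ∃ u : Fin n → ℂ, u ≠ 0 ∧ dt g u = 0 := by
  let i : Fin n := ⟨0, by omega⟩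
  let j : Fin n := ⟨1, by omega⟩
  have hij : i ≠ j := by simp [i, j]
  by_cases h : g i = 0
  · refine ⟨Pi.single i 1, by simp, ?_⟩
    simp [dt, Pi.single_apply, h]
  · refine ⟨Pi.single j (g i) - Pi.single i (g j), ?_, ?_⟩
    · intro h2
      have := congrFun h2 j
      simp [Pi.single_apply, hij.symm] at this
      exact h this
    · simp [dt, mul_sub, Finset.sum_sub_distrib, Pi.single_apply, mul_comm]

lemma no_local_max {w : Fin n → ℂ} (h0 : w ≠ 0) (hR : euclNorm w < R) {δ : ℝ} (hδ : 0 < δ) :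
    ∃ w', w' ≠ 0 ∧ euclNorm w' ≤ R ∧ ‖w' - w‖ < δ ∧ P w < P w' := by
  obtain ⟨u, hu, hdu⟩ := exists_dt_zero X.hρ.hn (G w 0)
  have hc : Continuous (fun s : ℝ => w + s • u) := by fun_prop
  have h1 : ∀ᶠ s in 𝓝 (0:ℝ), w + s • u ≠ 0 :=
    (hc.tendsto 0).eventually_ne (by simpa using h0)
  have h2 : ∀ᶠ s in 𝓝 (0:ℝ), euclNorm (w + s • u) < R := by
    have := (continuous_euclNorm.comp hc).tendsto 0
    refine this.eventually_lt_const ?_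
    simpa using hR
  have h3 : ∀ᶠ s in 𝓝 (0:ℝ), ‖w + s • u - w‖ < δ := by
    have : Continuous (fun s : ℝ => ‖w + s • u - w‖) := by fun_prop
    exact (this.tendsto 0).eventually_lt_const (by simpa using hδ)
  have h4 : ∀ᶠ s in 𝓝[>] (0:ℝ), w + s • u ≠ 0 ∧ euclNorm (w + s • u) < R ∧ ‖w + s • u - w‖ < δ :=
    ((h1.and (h2.and h3))).filter_mono nhdsWithin_le_nhds
  obtain ⟨s, ⟨e1, e2, e3⟩, hs⟩ := (h4.and self_mem_nhdsWithin).exists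
  have hs' : 0 < s := hs
  refine ⟨w + s • u, e1, e2.le, e3, not_le.1 fun hle => ?_⟩
  have h00 : (0:ℂ) ∈ Disk := mem_disk_iff.2 (by simp)
  have hp := X.pair w h0 hR.le 0 h00
  rw [X.cen w h0 hR.le] at hp
  have hd : dt (G w 0) (w + s • u) = 1 := by
    rw [dt_add, hp, dt_rsmul, hdu]; simp
  rcases X.plane_unique h0 hR.le e1 e2.le hle hd with ⟨h, -⟩ | h
  · have : s • u = 0 := by simpa using h
    exact (smul_ne_zero hs'.ne' hu) this
  · exact h

open Classical in
/-- evaluation map on the closed ball -/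
def TT (F : (Fin n → ℂ) → ℂ → (Fin n → ℂ)) (a : ℂ) (w : Fin n → ℂ) : Fin n → ℂ := if w = 0 then 0 else F w a

omit X in
lemma TT_of (a : ℂ) {w : Fin n → ℂ} (h : w ≠ 0) : TT F a w = F w a := by simp [TT, h]
omit X in
lemma TT_zero (a : ℂ) : TT F a 0 = 0 := by simp [TT]

lemma TT_cont {a : ℂ} (ha : ‖a‖ < 1) : ContinuousOn (TT F a) {w | euclNorm w ≤ R} := by
  intro w hw
  have hwR : euclNorm w ≤ R := hw
  rw [Metric.continuousWithinAt_iff]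
  intro ε hε
  by_cases h0 : w = 0
  · subst h0
    obtain ⟨η, hη, Hη⟩ := X.hρ.rho_small (half_pos hε)
    obtain ⟨δ, hδ, Hδ⟩ := Metric.continuousWithinAt_iff.1 (X.Pc 0 hw) η hη
    refine ⟨δ, hδ, fun x hx hd => ?_⟩
    rw [TT_zero, dist_zero_right]
    by_cases hx0 : x = 0
    · rw [hx0, TT_zero, norm_zero]; exact hε
    rw [TT_of a hx0]
    have h1 := Hδ hx hd
    rw [X.P0, Real.dist_eq, sub_zero] at h1
    have h2 := (X.memF x hx0 hx).norm_le (half_pos hε).le (fun z hz => (Hη z hz _ (by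
      rw [X.lev x hx0 hx z hz]; exact (le_abs_self _).trans_lt h1)).le) a (mem_disk_iff.2 ha.le)
    linarith
  · have hp := X.P_pos h0 hwR
    have ha' : 0 < 1 - ‖a‖ := by linarith
    obtain ⟨δ1, hδ1, H1⟩ := X.F_dist (half_pos hp) (ε := ε / 2 * (1 - ‖a‖)) (by positivity)
    obtain ⟨δ2, hδ2, H2⟩ := Metric.continuousWithinAt_iff.1 (X.Pc w hw) (P w / 2) (half_pos hp)
    refine ⟨min (min δ1 δ2) ‖w‖, by positivity, fun x hx hd => ?_⟩
    have d1 : dist x w < δ1 := hd.trans_le ((min_le_left _ _).trans (min_le_left _ _))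
    have d2 : dist x w < δ2 := hd.trans_le ((min_le_left _ _).trans (min_le_right _ _))
    have d3 : dist x w < ‖w‖ := hd.trans_le (min_le_right _ _)
    have hx0 : x ≠ 0 := by
      rintro rfl
      rw [dist_zero_left] at d3
      exact lt_irrefl _ d3
    have hP := H2 hx d2
    rw [Real.dist_eq, abs_lt] at hP
    rw [TT_of a hx0, TT_of a h0, dist_eq_norm]
    have := H1 x hx0 hx (by linarith [hP.1]) w h0 hwR (by linarith) (by rwa [← dist_eq_norm]) a ha
    rw [mul_div_assoc, div_self ha'.ne', mul_one] at this
    linarith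

open Classical in
lemma surj {a : ℂ} (ha : ‖a‖ < 1) {v : Fin n → ℂ} (hv : euclNorm v ≤ R) : ∃ w, euclNorm w ≤ R ∧ TT F a w = v := by
  have hRp := X.hρ.R_pos
  have had : a ∈ Disk := mem_disk_iff.2 ha.le
  have hbd : ∀ w : Fin n → ℂ, euclNorm w = R → TT F a w = w := by
    intro w hw
    have h0 : w ≠ 0 := euclNorm_pos.1 (by rw [hw]; exact hRp)
    rw [TT_of a h0, X.F_const h0 hw had]
  set T : (Fin n → ℂ) → (Fin n → ℂ) := fun w => if euclNorm w ≤ R then TT F a w else w with hT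
  have hTc : Continuous T := continuous_if_le continuous_euclNorm continuous_const (X.TT_cont ha) continuousOn_id hbd
  have hsur := brouwer_fin T hTc (R + 1) (fun x hx => by
    have : R < euclNorm x := by linarith [norm_le_euclNorm x]
    simp only [hT, if_neg (not_le.2 this)])
  obtain ⟨w, hw⟩ := hsur v
  by_cases h : euclNorm w ≤ R
  · exact ⟨w, h, by simpa only [hT, if_pos h] using hw⟩
  · simp only [hT, if_neg h] at hw
    exact absurd (hw ▸ hv) h

end Fam
end E4



section H1
open scoped Topology
variable {n : ℕ} {ρ : ℂ → (Fin n → ℂ) → ℝ} {R : ℝ}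

/-- polynomial approximation in the disk algebra -/
lemma MemA.exists_poly {H : ℂ → ℂ} (hH : MemA H) {ε : ℝ} (hε : 0 < ε) :
    ∃ (N : ℕ) (c : ℕ → ℂ), ∀ z ∈ Disk, ‖H z - ∑ k ∈ Finset.range N, c k * z ^ k‖ ≤ ε := by
  obtain ⟨δ, hδ, hu⟩ := Metric.uniformContinuousOn_iff.1 (isCompact_disk.uniformContinuousOn_of_continuous hH.1)
    (ε / 2) (half_pos hε)
  set r : ℝ := max (1 - δ / 2) (1 / 2) with hr
  have hr0 : 0 < r := lt_of_lt_of_le (by norm_num) (le_max_right _ _)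
  have hr1 : r < 1 := max_lt (by linarith) (by norm_num)
  have hrd : 1 - r < δ := by have := le_max_left (1 - δ / 2) (1 / 2); rw [← hr] at this; linarith
  obtain ⟨s, hs⟩ : ∃ s : NNReal, (s : ℝ) = (1 + r) / 2 := ⟨Real.toNNReal _, Real.coe_toNNReal _ (by positivity)⟩
  obtain ⟨r', hr'⟩ : ∃ s : NNReal, (s : ℝ) = (1 + 3 * r) / 4 := ⟨Real.toNNReal _, Real.coe_toNNReal _ (by positivity)⟩
  have hs0 : 0 < s := by rw [← NNReal.coe_pos, hs]; positivity
  have hd : DifferentiableOn ℂ H (closedBall 0 s) := hH.2.mono (closedBall_subset_ball (by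
    rw [hs]; linarith))
  have hps := hd.hasFPowerSeriesOnBall hs0
  have hrs : (r' : ENNReal) < s := by
    rw [ENNReal.coe_lt_coe, ← NNReal.coe_lt_coe, hs, hr']; linarith
  have htu := hps.tendstoUniformlyOn hrs
  rw [Metric.tendstoUniformlyOn_iff] at htu
  obtain ⟨N, hN⟩ := (htu (ε / 2) (half_pos hε)).exists
  refine ⟨N, fun k => (cauchyPowerSeries H 0 s).coeff k * (r : ℂ) ^ k, fun z hz => ?_⟩
  have hz1 := mem_disk_iff.1 hz
  have hnrz : ‖(r : ℂ) * z‖ = r * ‖z‖ := by rw [norm_mul, norm_real, Real.norm_of_nonneg hr0.le]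
  have hrz : (r : ℂ) * z ∈ ball (0:ℂ) r' := by
    rw [mem_ball_zero_iff, hnrz, hr']
    nlinarith [norm_nonneg z]
  have h1 := hN _ hrz
  rw [zero_add, dist_eq_norm, FormalMultilinearSeries.partialSum] at h1
  have h2 : ∑ k ∈ Finset.range N, (cauchyPowerSeries H 0 s k) (fun _ => (r : ℂ) * z) =
      ∑ k ∈ Finset.range N, (cauchyPowerSeries H 0 s).coeff k * (r : ℂ) ^ k * z ^ k := by
    refine Finset.sum_congr rfl fun k _ => ?_
    rw [FormalMultilinearSeries.apply_eq_pow_smul_coeff, smul_eq_mul, mul_pow]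
    ring
  rw [h2] at h1
  have h3 := hu z hz ((r : ℂ) * z) (mem_disk_iff.2 (by rw [hnrz]; nlinarith [norm_nonneg z])) (by
    rw [dist_eq_norm]
    have : z - r * z = ((1 - r : ℝ) : ℂ) * z := by push_cast; ring
    rw [this, norm_mul, norm_real, Real.norm_of_nonneg (by linarith)]
    nlinarith [norm_nonneg z])
  rw [dist_eq_norm] at h3
  have h4 := norm_add_le (H z - H (r * z)) (H (r * z) - ∑ k ∈ Finset.range N,
    (cauchyPowerSeries H 0 s).coeff k * (r : ℂ) ^ k * z ^ k)
  rw [sub_add_sub_cancel] at h4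
  linarith

lemma polyApprox_q {Y : Set (ℂ × (Fin n → ℂ))} {C : ℝ} (hY : ∀ p ∈ Y, p.1 ∈ Disk ∧ ‖p.2‖ ≤ C)
    {g : ℂ → Fin n → ℂ} (hg : MemAV g) : PolyApprox Y (fun p => 1 - dt (g p.1) p.2) := by
  intro ε hε
  set C' := max C 0 with hC'
  have hC0 : 0 ≤ C' := le_max_right _ _
  have hε' : 0 < ε / (n * C' + 1) := by positivity
  choose N c hc using fun j => (hg j).exists_poly hε'
  refine ⟨1 - ∑ j, (∑ k ∈ Finset.range (N j), MvPolynomial.C (c j k) * MvPolynomial.X 0 ^ k) * MvPolynomial.X j.succ, ?_⟩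
  intro p hp
  obtain ⟨h1, h2⟩ := hY p hp
  simp only [map_sub, map_one, map_sum, map_mul, map_pow, MvPolynomial.eval_C, MvPolynomial.eval_X, pcoords_zero,
    pcoords_succ]
  rw [sub_sub_sub_cancel_left, dt, ← Finset.sum_sub_distrib]
  refine (norm_sum_le _ _).trans ?_
  have : ∀ j ∈ Finset.univ, ‖(∑ k ∈ Finset.range (N j), c j k * p.1 ^ k) * p.2 j - g p.1 j * p.2 j‖ ≤
      ε / (n * C' + 1) * C' := by
    intro j _
    rw [← sub_mul, norm_mul, norm_sub_rev]
    exact mul_le_mul (hc j p.1 h1) ((norm_le_pi_norm _ _).trans (h2.trans (le_max_left _ _))) (norm_nonneg _) hε'.le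
  refine (Finset.sum_le_sum this).trans ?_
  rw [Finset.sum_const, Finset.card_univ, Fintype.card_fin, nsmul_eq_mul]
  have h5 : 0 < n * C' + 1 := by positivity
  calc (n:ℝ) * (ε / (n * C' + 1) * C') = ε * ((n * C') / (n * C' + 1)) := by ring
    _ ≤ ε * 1 := by
      gcongr
      rw [div_le_one h5]; linarith
    _ = ε := mul_one _

lemma polyHull_empty : polyHull (∅ : Set (ℂ × (Fin n → ℂ))) = ∅ := by
  refine eq_empty_iff_forall_notMem.2 fun p hp => ?_
  have := hp 1 (-1) (by simp)
  have h2 := norm_nonneg (MvPolynomial.eval (pcoords p) (1 : MvPolynomial (Fin (n+1)) ℂ))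
  linarith

lemma hull_low {X : Set (ℂ × (Fin n → ℂ))} (hX : IsCompact X)
    {q : ℂ × (Fin n → ℂ) → ℂ} (hq : PolyApprox (polyHull X) q)
    (hq0 : ∀ p ∈ polyHull X, q p ≠ 0) {δ : ℝ} (hδ : 0 < δ) (hqX : ∀ p ∈ X, δ ≤ ‖q p‖) :
    ∀ p ∈ polyHull X, δ ≤ ‖q p‖ := by
  rcases X.eq_empty_or_nonempty with h | h
  · subst h; rw [polyHull_empty]; intro p hp; exact absurd hp (notMem_empty p)
  · exact hull_lower_bound hX h hq hq0 hδ hqX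

lemma polyHull_mono {X Y : Set (ℂ × (Fin n → ℂ))} (h : X ⊆ Y) : polyHull X ⊆ polyHull Y :=
  fun _ hp P M hM => hp P M fun q hq => hM q (h hq)

lemma hull_disk {X : Set (ℂ × (Fin n → ℂ))} (h : ∀ p ∈ X, p.1 ∈ Disk) : ∀ p ∈ polyHull X, p.1 ∈ Disk := by
  intro p hp
  have := hp (MvPolynomial.X 0) 1 (fun q hq => by
    rw [MvPolynomial.eval_X, pcoords_zero]; exact mem_disk_iff.1 (h q hq))
  rw [MvPolynomial.eval_X, pcoords_zero] at this
  exact mem_disk_iff.2 this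

lemma hull_eucl {X : Set (ℂ × (Fin n → ℂ))} {C : ℝ} (hC : 0 ≤ C) (h : ∀ p ∈ X, euclNorm p.2 ≤ C) :
    ∀ p ∈ polyHull X, euclNorm p.2 ≤ C := by
  intro p hp
  have hev : ∀ x : ℂ × (Fin n → ℂ), MvPolynomial.eval (pcoords x) (∑ j : Fin n, MvPolynomial.C (cj p.2 j) * MvPolynomial.X j.succ) =
      dt (cj p.2) x.2 := by
    intro x
    simp only [map_sum, map_mul, MvPolynomial.eval_C, MvPolynomial.eval_X, pcoords_succ, dt]
  have := hp (∑ j : Fin n, MvPolynomial.C (cj p.2 j) * MvPolynomial.X j.succ) (euclNorm p.2 * C) (fun q hq => by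
    rw [hev]
    refine (norm_dt_le' _ _).trans ?_
    rw [euclNorm_cj]
    exact mul_le_mul_of_nonneg_left (h q hq) (euclNorm_nonneg _))
  rw [hev, dt_comm, dt_cj, norm_real, Real.norm_of_nonneg (by positivity)] at this
  by_contra hcon
  push Not at hcon
  nlinarith [euclNorm_nonneg p.2]

lemma isCompact_hull {X : Set (ℂ × (Fin n → ℂ))} {C : ℝ} (hC : 0 ≤ C) (h1 : ∀ p ∈ X, p.1 ∈ Disk)
    (h : ∀ p ∈ X, euclNorm p.2 ≤ C) : IsCompact (polyHull X) :=
  (isCompact_disk.prod (isCompact_eucl C)).of_isClosed_subset (isClosed_polyHull X)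
    fun p hp => ⟨hull_disk h1 p hp, hull_eucl hC h p hp⟩

lemma MemA.peval {f : ℂ → Fin n → ℂ} (hf : MemAV f) (P : MvPolynomial (Fin (n+1)) ℂ) :
    MemA (fun z => MvPolynomial.eval (pcoords (z, f z)) P) := by
  induction P using MvPolynomial.induction_on with
  | C c => simpa using MemA.const c
  | add p q hp hq => simpa using hp.add hq
  | mul_X p i hp =>
    have : MemA (fun z => pcoords (z, f z) i) := by
      refine Fin.cases ?_ (fun j => ?_) i
      · simpa [pcoords_zero] using MemA.of_differentiable (differentiable_fun_id (𝕜 := ℂ) (E := ℂ))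
      · simpa [pcoords_succ] using hf j
    simpa using hp.mul this

/-- a disc with boundary in the hull is in the hull -/
lemma disc_hull {X : Set (ℂ × (Fin n → ℂ))} {f : ℂ → Fin n → ℂ} (hf : MemAV f)
    (h : ∀ z ∈ Circ, (z, f z) ∈ polyHull X) {a : ℂ} (ha : a ∈ Disk) : (a, f a) ∈ polyHull X := by
  intro P M hM
  exact (MemA.peval hf P).norm_le (fun z hz => h z hz P M hM) a ha

/-- peak function -/
def pk (ζ z : ℂ) : ℂ := (1 + (starRingEnd ℂ) ζ * z) / 2

lemma pk_self {ζ : ℂ} (hζ : ζ ∈ Circ) : pk ζ ζ = 1 := by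
  have h := norm_of_circ hζ
  rw [pk, mul_comm, mul_conj, normSq_eq_norm_sq, h]; norm_num

lemma pk_sq {ζ z : ℂ} (hζ : ζ ∈ Circ) (hz : z ∈ Circ) : ‖pk ζ z‖ ^ 2 = 1 - ‖z - ζ‖ ^ 2 / 4 := by
  have h1 := norm_of_circ hζ
  have h2 := norm_of_circ hz
  have h3 : ζ.re ^ 2 + ζ.im ^ 2 = 1 := by
    have := Complex.sq_norm ζ; rw [h1, normSq_apply] at this; linarith
  have h4 : z.re ^ 2 + z.im ^ 2 = 1 := by
    have := Complex.sq_norm z; rw [h2, normSq_apply] at this; linarith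
  rw [Complex.sq_norm, Complex.sq_norm, pk, normSq_div, normSq_apply, normSq_apply, normSq_apply]
  simp
  linear_combination (1 + z.re ^ 2 + z.im ^ 2) / 4 * h3 + 1 / 2 * h4

lemma pk_le {ζ z : ℂ} (hζ : ζ ∈ Circ) (hz : z ∈ Circ) : ‖pk ζ z‖ ≤ 1 := by
  have := pk_sq hζ hz
  nlinarith [norm_nonneg (pk ζ z), sq_nonneg ‖z - ζ‖]

lemma pk_far {ζ : ℂ} (hζ : ζ ∈ Circ) {δ : ℝ} (hδ : 0 < δ) : ∃ c : ℝ, 0 ≤ c ∧ c < 1 ∧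
    ∀ z ∈ Circ, δ ≤ ‖z - ζ‖ → ‖pk ζ z‖ ≤ c := by
  refine ⟨Real.sqrt (1 - δ ^ 2 / 4), Real.sqrt_nonneg _, ?_, fun z hz hd => ?_⟩
  · rw [Real.sqrt_lt' one_pos]; nlinarith
  · apply Real.le_sqrt_of_sq_le
    rw [pk_sq hζ hz]
    nlinarith

lemma pk_mem (ζ : ℂ) (N : ℕ) : MemA (fun z => pk ζ z ^ N) := by
  refine .of_differentiable ?_
  unfold pk
  fun_prop

end H1



section H2
open scoped Topology
variable {n : ℕ} {ρ : ℂ → (Fin n → ℂ) → ℝ} {R : ℝ}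

/-- the compact set whose hull is described -/
def KK (ρ : ℂ → (Fin n → ℂ) → ℝ) : Set (ℂ × (Fin n → ℂ)) := {p | p.1 ∈ Circ ∧ ρ p.1 p.2 = 1}

lemma differentiable_peval (z : ℂ) (P : MvPolynomial (Fin (n+1)) ℂ) :
    Differentiable ℂ (fun v : Fin n → ℂ => MvPolynomial.eval (pcoords (z, v)) P) := by
  induction P using MvPolynomial.induction_on with
  | C c => simp
  | add p q hp hq => simp only [map_add]; exact hp.fun_add hq
  | mul_X p i hp =>
    have : Differentiable ℂ (fun v : Fin n → ℂ => pcoords (z, v) i) := by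
      refine Fin.cases ?_ (fun j => ?_) i
      · simp [pcoords_zero]
      · simp only [pcoords_succ]; fun_prop
    simp only [map_mul, MvPolynomial.eval_X]; exact hp.fun_mul this

namespace Cond3
variable (hρ : Cond3 n ρ R (fun _ => 0))
include hρ

lemma KK_compact : IsCompact (KK ρ) := hρ.levelCompact 1 one_pos hρ.hR.le

lemma KK_r0 : ∃ r0, 0 ≤ r0 ∧ r0 < R ∧ ∀ p ∈ KK ρ, euclNorm p.2 ≤ r0 := by
  by_cases hne : (KK ρ).Nonempty
  · obtain ⟨x, hx, hmax⟩ := hρ.KK_compact.exists_isMaxOn hne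
      (continuous_euclNorm.comp continuous_snd).continuousOn
    refine ⟨euclNorm x.2, euclNorm_nonneg _, (hρ.lt_R_iff hx.1).1 (by rw [hx.2]; exact hρ.hR), fun p hp => hmax hp⟩
  · exact ⟨0, le_rfl, hρ.R_pos, fun p hp => absurd ⟨p, hp⟩ hne⟩

omit hρ in
lemma hull_KK_disk : ∀ p ∈ polyHull (KK ρ), p.1 ∈ Disk := hull_disk fun _ hp => circ_sub_disk hp.1

lemma hull_KK_r0 : ∃ r0, 0 ≤ r0 ∧ r0 < R ∧ ∀ p ∈ polyHull (KK ρ), euclNorm p.2 ≤ r0 := by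
  obtain ⟨r0, h0, h1, h2⟩ := hρ.KK_r0
  exact ⟨r0, h0, h1, hull_eucl h0 h2⟩

lemma hull_KK_lt {z : ℂ} {v : Fin n → ℂ} (h : (z, v) ∈ polyHull (KK ρ)) : euclNorm v < R := by
  obtain ⟨r0, h0, h1, h2⟩ := hρ.hull_KK_r0
  exact (h2 _ h).trans_lt h1

/-- sublevel sets on boundary fibres are in the hull -/
lemma sub_hull {z : ℂ} (hz : z ∈ Circ) {v : Fin n → ℂ} (hv : ρ z v ≤ 1) : (z, v) ∈ polyHull (KK ρ) := by
  rcases hv.eq_or_lt with h | h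
  · exact subset_polyHull _ ⟨hz, h⟩
  · intro P M hM
    have : Nonempty (Fin n) := ⟨⟨0, by have := hρ.hn; omega⟩⟩
    have : Nontrivial (Fin n → ℂ) := Function.nontrivial
    have hb : Bornology.IsBounded {v | ρ z v < 1} :=
      (hρ.isCompact_sub hz hρ.hR.le).isBounded.subset fun w (hw : ρ z w < 1) => hw.le
    refine Complex.norm_le_of_forall_mem_frontier_norm_le (f := fun v => MvPolynomial.eval (pcoords (z, v)) P) hb
      (differentiable_peval z P).diffContOnCl (fun w hw => ?_) (subset_closure h)
    have h1 := frontier_lt_subset_eq (hρ.cont_slice hz) continuous_const hw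
    exact hM (z, w) ⟨hz, h1⟩

lemma disc_in_hull {f : ℂ → Fin n → ℂ} (hf : MemAV f) (h : ∀ z ∈ Circ, ρ z (f z) ≤ 1) {a : ℂ} (ha : a ∈ Disk) :
    (a, f a) ∈ polyHull (KK ρ) :=
  disc_hull hf (fun z hz => hρ.sub_hull hz (h z hz)) ha

lemma qq_low {t0 s0 : ℝ} (ht0 : 0 < t0) (hs0 : 0 < s0) : ∃ c > 0, ∀ z ∈ Circ, ∀ p v, t0 ≤ ρ z p → ρ z p ≤ R →
    ρ z v + s0 ≤ ρ z p → c ≤ ‖qq ρ z p v‖ := by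
  have hc := hρ.isCompact_pairs t0 s0
  set C := {x : ℂ × (Fin n → ℂ) × (Fin n → ℂ) | x.1 ∈ Circ ∧
    t0 ≤ ρ x.1 x.2.1 ∧ ρ x.1 x.2.1 ≤ R ∧ ρ x.1 x.2.2 + s0 ≤ ρ x.1 x.2.1 ∧ ρ x.1 x.2.2 ≤ R} with hC
  by_cases hne : C.Nonempty
  · have hcont : ContinuousOn (fun x : ℂ × (Fin n → ℂ) × (Fin n → ℂ) => ‖qq ρ x.1 x.2.1 x.2.2‖) C :=
      (hρ.contOn_qq.mono fun x hx => ⟨hx.1, ht0.trans_le hx.2.1, hx.2.2.1⟩).norm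
    obtain ⟨x, hx, hmin⟩ := hc.exists_isMinOn hne hcont
    have hmin' : ∀ y ∈ C, ‖qq ρ x.1 x.2.1 x.2.2‖ ≤ ‖qq ρ y.1 y.2.1 y.2.2‖ := fun y hy => hmin hy
    refine ⟨_, norm_pos_iff.2 (hρ.qq_ne' hx.1 (ht0.trans_le hx.2.1) hx.2.2.1 (by linarith [hx.2.2.2.1])),
      fun z hz p v h1 h2 h3 => hmin' (z, p, v) ⟨hz, h1, h2, h3, by show ρ z v ≤ R; linarith⟩⟩
  · exact ⟨1, one_pos, fun z hz p v h1 h2 h3 => absurd ⟨(z, p, v), hz, h1, h2, h3, by show ρ z v ≤ R; linarith⟩ hne⟩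

lemma go_up {z : ℂ} (hz : z ∈ Circ) {v : Fin n → ℂ} (h0 : 0 < ρ z v) (hR : ρ z v < R) {δ : ℝ} (hδ : 0 < δ) :
    ∃ p, ‖p - v‖ < δ ∧ ρ z v < ρ z p ∧ ρ z p ≤ R := by
  have h1 := (hρ.no_crit hz h0 hR.le).2
  have h2 : ∃ᶠ p in 𝓝 v, ρ z v < ρ z p := by
    intro h; apply h1
    filter_upwards [h] with p hp using not_lt.1 hp
  have h3 : ∀ᶠ p in 𝓝 v, ρ z p < R := ((hρ.cont_slice hz).tendsto v).eventually_lt_const hR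
  have h4 : ∀ᶠ p in 𝓝 v, ‖p - v‖ < δ := by
    filter_upwards [Metric.ball_mem_nhds v hδ] with p hp
    rwa [mem_ball, dist_eq_norm] at hp
  obtain ⟨p, a, b, c⟩ := (h2.and_eventually (h3.and h4)).exists
  exact ⟨p, c, a, b.le⟩

lemma fib_nonempty {z : ℂ} (hz : z ∈ Circ) : ∃ v, ρ z v = 1 := by
  have hn := hρ.hn
  let i : Fin n := ⟨0, by omega⟩
  have h1 : R ≤ ρ z (Pi.single i (R : ℂ)) := by
    refine (hρ.levelR z hz _).2 ?_ |>.ge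
    have := euclNorm_sq (Pi.single i (R : ℂ) : Fin n → ℂ)
    rw [Finset.sum_eq_single i (fun j _ hj => by simp [hj]) (by simp)] at this
    rw [Pi.single_eq_same, normSq_ofReal, ← sq] at this
    exact (pow_left_inj₀ (euclNorm_nonneg _) hρ.R_pos.le two_ne_zero).1 this
  have := intermediate_value_univ (0 : Fin n → ℂ) (Pi.single i (R : ℂ)) (hρ.cont_slice hz)
  exact this ⟨by rw [hρ.rho_zero hz]; exact zero_le_one, hρ.hR.le.trans h1⟩

/-- localisation on peak points -/
lemma hull_fib {ζ : ℂ} (hζ : ζ ∈ Circ) {v : Fin n → ℂ} (hv : (ζ, v) ∈ polyHull (KK ρ)) :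
    (ζ, v) ∈ polyHull {p : ℂ × (Fin n → ℂ) | p.1 = ζ ∧ ρ ζ p.2 = 1} := by
  intro P M hM
  obtain ⟨v1, hv1⟩ := hρ.fib_nonempty hζ
  have hM0 : 0 ≤ M := (norm_nonneg _).trans (hM (ζ, v1) ⟨rfl, hv1⟩)
  refine le_of_forall_pos_le_add fun ε hε => ?_
  have hPc : Continuous (fun p : ℂ × (Fin n → ℂ) => ‖MvPolynomial.eval (pcoords p) P‖) := (continuous_peval P).norm
  obtain ⟨C, hC⟩ := hρ.KK_compact.exists_bound_of_continuousOn hPc.continuousOn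
  have hC' : ∀ p ∈ KK ρ, ‖MvPolynomial.eval (pcoords p) P‖ ≤ C := fun p hp => by
    have := hC p hp; rwa [norm_norm] at this
  have hB := hρ.KK_compact.inter_right (isClosed_le (continuous_const (y := M + ε)) hPc)
  set B := KK ρ ∩ {p | M + ε ≤ ‖MvPolynomial.eval (pcoords p) P‖} with hBd
  have hd : ∃ d > 0, ∀ p ∈ B, d ≤ ‖p.1 - ζ‖ := by
    by_cases hne : B.Nonempty
    · obtain ⟨x, hx, hmin⟩ := hB.exists_isMinOn hne (f := fun p => ‖p.1 - ζ‖) (by fun_prop)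
      refine ⟨‖x.1 - ζ‖, norm_pos_iff.2 fun h => ?_, fun p hp => hmin hp⟩
      have h1 := sub_eq_zero.1 h
      have h2 := hM x ⟨h1, by rw [← h1]; exact hx.1.2⟩
      have h3 : M + ε ≤ ‖MvPolynomial.eval (pcoords x) P‖ := hx.2
      linarith
    · exact ⟨1, one_pos, fun p hp => absurd ⟨p, hp⟩ hne⟩
  obtain ⟨d, hd0, hd1⟩ := hd
  obtain ⟨c, hc0, hc1, hc⟩ := pk_far hζ hd0
  have ht : Tendsto (fun N : ℕ => c ^ N * C) atTop (𝓝 0) := by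
    have := (tendsto_pow_atTop_nhds_zero_of_lt_one hc0 hc1).mul_const C
    rwa [zero_mul] at this
  obtain ⟨N, hN⟩ := (ht.eventually_lt_const (show 0 < M + ε by linarith)).exists
  have hev : ∀ p : ℂ × (Fin n → ℂ), MvPolynomial.eval (pcoords p) ((MvPolynomial.C (1/2 : ℂ) *
      (1 + MvPolynomial.C ((starRingEnd ℂ) ζ) * MvPolynomial.X 0)) ^ N * P) = pk ζ p.1 ^ N * MvPolynomial.eval (pcoords p) P := by
    intro p
    simp only [map_mul, map_pow, map_add, map_one, MvPolynomial.eval_C, MvPolynomial.eval_X, pcoords_zero, pk]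
    congr 2; ring
  have := hv ((MvPolynomial.C (1/2 : ℂ) *
      (1 + MvPolynomial.C ((starRingEnd ℂ) ζ) * MvPolynomial.X 0)) ^ N * P) (M + ε) (fun p hp => by
    rw [hev, norm_mul, norm_pow]
    by_cases hpB : p ∈ B
    · have h1 := hc p.1 hp.1 (hd1 p hpB)
      have h2 : ‖pk ζ p.1‖ ^ N ≤ c ^ N := pow_le_pow_left₀ (norm_nonneg _) h1 N
      exact (mul_le_mul h2 (hC' p hp) (norm_nonneg _) (pow_nonneg hc0 N)).trans hN.le
    · have h1 : ‖MvPolynomial.eval (pcoords p) P‖ < M + ε := not_le.1 fun h => hpB ⟨hp, h⟩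
      have h2 : ‖pk ζ p.1‖ ^ N ≤ 1 := pow_le_one₀ (norm_nonneg _) (pk_le hζ hp.1)
      nlinarith [norm_nonneg (MvPolynomial.eval (pcoords p) P)])
  rw [hev] at this
  simpa [pk_self hζ] using this

/-- boundary fibres of the hull -/
lemma hull_bdry {ζ : ℂ} (hζ : ζ ∈ Circ) {v : Fin n → ℂ} (hv : (ζ, v) ∈ polyHull (KK ρ)) : ρ ζ v ≤ 1 := by
  set X := {p : ℂ × (Fin n → ℂ) | p.1 = ζ ∧ ρ ζ p.2 = 1} with hX
  have hvX := hρ.hull_fib hζ hv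
  rw [← hX] at hvX
  have hXK : X ⊆ KK ρ := fun p hp => ⟨by rw [hp.1]; exact hζ, by rw [hp.1]; exact hp.2⟩
  obtain ⟨r0, h0, h1, h2⟩ := hρ.hull_KK_r0
  have hXe : ∀ p ∈ X, euclNorm p.2 ≤ r0 := fun p hp => h2 p (subset_polyHull _ (hXK hp))
  have hXd : ∀ p ∈ X, p.1 ∈ Disk := fun p hp => circ_sub_disk (hXK hp).1
  have hYc := isCompact_hull h0 hXd hXe
  have hXc : IsCompact X := hρ.KK_compact.of_isClosed_subset
    ((isClosed_eq continuous_fst continuous_const).inter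
      (isClosed_eq ((hρ.cont_slice hζ).comp continuous_snd) continuous_const)) hXK
  have hYz : ∀ p ∈ polyHull X, p.1 = ζ := by
    intro p hp
    have := hp (MvPolynomial.X 0 - MvPolynomial.C ζ) 0 (fun q hq => by
      simp [pcoords_zero, hq.1])
    simp only [map_sub, MvPolynomial.eval_X, MvPolynomial.eval_C, pcoords_zero] at this
    exact sub_eq_zero.1 (norm_le_zero_iff.1 this)
  obtain ⟨y, hy, hmax⟩ := hYc.exists_isMaxOn ⟨_, hvX⟩ ((hρ.cont_slice hζ).comp continuous_snd).continuousOn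
  have hmax' : ∀ p ∈ polyHull X, ρ ζ p.2 ≤ ρ ζ y.2 := fun p hp => hmax hp
  refine (hmax' _ hvX).trans (not_lt.1 fun hm => ?_)
  obtain ⟨δ, hδ, Hδ⟩ := hρ.qq_low (t0 := ρ ζ y.2) (s0 := ρ ζ y.2 - 1) (by linarith) (by linarith)
  obtain ⟨M, hM, HM⟩ := hρ.Gm_bound (t0 := ρ ζ y.2) (by linarith)
  have hyR : ρ ζ y.2 < R := (hρ.lt_R_iff hζ).2 ((h2 y (polyHull_mono hXK hy)).trans_lt h1)
  have hy0 : 0 < ρ ζ y.2 := by linarith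
  obtain ⟨p, hp1, hp2, hp3⟩ := hρ.go_up hζ hy0 hyR (δ := δ / (n * M + 1)) (by positivity)
  have hlow := hull_low hXc (q := fun x => 1 - dt (Gm ρ ζ p) x.2)
    (polyApprox_q (C := r0) (g := fun _ => Gm ρ ζ p) (fun x hx => ⟨hull_disk hXd x hx,
      (norm_le_euclNorm _).trans (hull_eucl h0 hXe x hx)⟩) (MemAV.const _))
    (fun x hx => hρ.qq_ne' hζ (hy0.trans hp2) hp3 ((hmax' x hx).trans_lt hp2)) hδ
    (fun x hx => Hδ ζ hζ p x.2 hp2.le hp3 (by rw [hx.2]; linarith)) y hy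
  have h3 : 1 - dt (Gm ρ ζ p) y.2 = dt (Gm ρ ζ p) (p - y.2) := by
    rw [dt_sub, hρ.Gm_dot hζ (hy0.trans hp2) hp3]
  have h4 := norm_dt_le (Gm ρ ζ p) (p - y.2)
  rw [← h3] at h4
  have h5 := HM ζ hζ p hp2.le hp3
  have h6 : (n:ℝ) * ‖Gm ρ ζ p‖ * ‖p - y.2‖ ≤ (n * M) * (δ / (n * M + 1)) := by
    gcongr
  have h7 : (n * M) * (δ / (n * M + 1)) < δ := by
    rw [mul_div_assoc', div_lt_iff₀ (by positivity)]; nlinarith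
  linarith

end Cond3
end H2



section H3
open scoped Topology
variable {n : ℕ} {ρ : ℂ → (Fin n → ℂ) → ℝ} {R : ℝ}

lemma pos_min {X : Type*} [TopologicalSpace X] {C : Set X} (hC : IsCompact C) {f : X → ℝ} (hf : ContinuousOn f C)
    (h : ∀ x ∈ C, 0 < f x) : ∃ δ > 0, ∀ x ∈ C, δ ≤ f x := by
  by_cases hne : C.Nonempty
  · obtain ⟨x, hx, hmin⟩ := hC.exists_isMinOn hne hf
    exact ⟨f x, h x hx, fun y hy => hmin hy⟩
  · exact ⟨1, one_pos, fun x hx => absurd ⟨x, hx⟩ hne⟩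

namespace Cond3
variable (hρ : Cond3 n ρ R (fun _ => 0))
include hρ

lemma near_lt {v1 : ℂ → Fin n → ℂ} (hv1 : ContinuousOn v1 Circ) {t : ℝ} (h : ∀ z ∈ Circ, ρ z (v1 z) < t) :
    ∃ δ > 0, ∀ z ∈ Circ, ∀ c : Fin n → ℂ, ‖c‖ < δ → ρ z (v1 z + c) < t := by
  have h1 : IsCompact (Circ ×ˢ closedBall (0 : Fin n → ℂ) 1) := isCompact_circ.prod (isCompact_closedBall _ _)
  have h2 : ContinuousOn (fun x : ℂ × (Fin n → ℂ) => ρ x.1 (v1 x.1 + x.2)) (Circ ×ˢ closedBall (0 : Fin n → ℂ) 1) := by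
    have h3 : ContinuousOn (fun x : ℂ × (Fin n → ℂ) => (x.1, v1 x.1 + x.2)) (Circ ×ˢ closedBall (0 : Fin n → ℂ) 1) :=
      continuousOn_fst.prodMk ((hv1.comp continuousOn_fst fun x hx => hx.1).add continuousOn_snd)
    have hm : MapsTo (fun x : ℂ × (Fin n → ℂ) => (x.1, v1 x.1 + x.2)) (Circ ×ˢ closedBall (0 : Fin n → ℂ) 1)
      {p : ℂ × (Fin n → ℂ) | p.1 ∈ Circ} := fun x hx => hx.1
    exact hρ.cont.comp h3 hm
  have h4 := h2.preimage_isClosed_of_isClosed h1.isClosed (isClosed_Ici (a := t))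
  have h5 := h1.of_isClosed_subset h4 inter_subset_left
  obtain ⟨δ, hδ, H⟩ := pos_min h5 (f := fun x => ‖x.2‖) (by fun_prop) (fun x hx => norm_pos_iff.2 fun h0 => by
    have h6 : t ≤ ρ x.1 (v1 x.1 + x.2) := hx.2
    rw [h0, add_zero] at h6
    exact absurd (h x.1 hx.1.1) (not_lt.2 h6))
  refine ⟨min δ 1, by positivity, fun z hz c hc => not_le.1 fun hle => ?_⟩
  have := H (z, c) ⟨⟨hz, by simpa using (hc.trans_le (min_le_right _ _)).le⟩, hle⟩
  exact absurd (hc.trans_le (min_le_left _ _)) (not_lt.2 this)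

omit hρ in
/-- points of a boundary fibre which are hit by discs strictly below level `t` -/
def Reach (ρ : ℂ → (Fin n → ℂ) → ℝ) (ζ : ℂ) (t : ℝ) (x : Fin n → ℂ) : Prop :=
  ∃ v1 : ℂ → Fin n → ℂ, MemAV v1 ∧ v1 ζ = x ∧ ∀ z ∈ Circ, ρ z (v1 z) < t

lemma reach_step {ζ : ℂ} (hζ : ζ ∈ Circ) {t : ℝ} {x : Fin n → ℂ} (hx : ρ ζ x < t) :
    ∃ r > 0, ∀ y y', ‖y - x‖ < r → ‖y' - x‖ < r → Reach ρ ζ t y → Reach ρ ζ t y' := by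
  have h1 : ∀ᶠ p in 𝓝[{p : ℂ × (Fin n → ℂ) | p.1 ∈ Circ}] (ζ, x), ρ p.1 p.2 < t :=
    (hρ.cont (ζ, x) hζ).eventually_lt_const hx
  obtain ⟨r, hr, Hr⟩ := Metric.mem_nhdsWithin_iff.1 h1
  have Hr' : ∀ z ∈ Circ, ∀ u, ‖z - ζ‖ < r → ‖u - x‖ < r → ρ z u < t := by
    intro z hz u h2 h3
    have : (z, u) ∈ ball (ζ, x) r ∩ {p : ℂ × (Fin n → ℂ) | p.1 ∈ Circ} :=
      ⟨by rw [mem_ball, Prod.dist_eq, dist_eq_norm, dist_eq_norm]; exact max_lt h2 h3, hz⟩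
    exact Hr this
  refine ⟨r / 4, by positivity, fun y y' hy hy' hR => ?_⟩
  obtain ⟨v1, hv1, hv1ζ, hv1t⟩ := hR
  obtain ⟨δ, hδ, Hδ⟩ := hρ.near_lt hv1.contOnC hv1t
  obtain ⟨η, hη, Hη⟩ := Metric.continuousWithinAt_iff.1 (hv1.contOnC ζ hζ) (r / 4) (by positivity)
  have hηr : 0 < min η r := by positivity
  obtain ⟨c, hc0, hc1, hc⟩ := pk_far hζ hηr
  have ht : Tendsto (fun N : ℕ => c ^ N * ‖y' - y‖) atTop (𝓝 0) := by
    have := (tendsto_pow_atTop_nhds_zero_of_lt_one hc0 hc1).mul_const ‖y' - y‖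
    rwa [zero_mul] at this
  obtain ⟨N, hN⟩ := (ht.eventually_lt_const hδ).exists
  refine ⟨fun z => v1 z + pk ζ z ^ N • (y' - y), hv1.add (MemAV.smul (pk_mem ζ N) (MemAV.const _)), ?_, fun z hz => ?_⟩
  · show v1 ζ + pk ζ ζ ^ N • (y' - y) = y'
    rw [pk_self hζ, one_pow, one_smul, hv1ζ]; abel
  · by_cases hzz : ‖z - ζ‖ < min η r
    · refine Hr' z hz _ (hzz.trans_le (min_le_right _ _)) ?_
      have e1 := Hη hz (by rw [dist_eq_norm]; exact hzz.trans_le (min_le_left _ _))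
      rw [hv1ζ, dist_eq_norm] at e1
      have e2 : ‖pk ζ z ^ N • (y' - y)‖ ≤ ‖y' - y‖ := by
        rw [norm_smul, norm_pow]
        exact mul_le_of_le_one_left (norm_nonneg _) (pow_le_one₀ (norm_nonneg _) (pk_le hζ hz))
      have e3 : ‖y' - y‖ ≤ ‖y' - x‖ + ‖y - x‖ := by
        have := norm_sub_le (y' - x) (y - x); rwa [sub_sub_sub_cancel_right] at this
      have e4 : v1 z + pk ζ z ^ N • (y' - y) - x = (v1 z - y) + (y - x) + pk ζ z ^ N • (y' - y) := by abel
      rw [e4]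
      have := norm_add₃_le (a := v1 z - y) (b := y - x) (c := pk ζ z ^ N • (y' - y))
      linarith
    · apply Hδ z hz
      rw [norm_smul, norm_pow]
      refine lt_of_le_of_lt (mul_le_mul_of_nonneg_right ?_ (norm_nonneg _)) hN
      exact pow_le_pow_left₀ (norm_nonneg _) (hc z hz (not_lt.1 hzz)) N

lemma reach {ζ : ℂ} (hζ : ζ ∈ Circ) {t : ℝ} (ht0 : 0 < t) (htR : t ≤ R) {x : Fin n → ℂ} (hx : ρ ζ x < t) :
    Reach ρ ζ t x := by
  have h0 : Reach ρ ζ t 0 := ⟨fun _ => 0, MemAV.const _, rfl, fun z hz => by rw [hρ.rho_zero hz]; exact ht0⟩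
  have hc := (hρ.sub_connected hζ ht0 htR).isPreconnected
  have := hc.induction₂' (fun x y => Reach ρ ζ t x → Reach ρ ζ t y) (fun x hx => ?_)
    (fun _ _ _ _ _ _ h1 h2 h => h2 (h1 h)) (x := 0) (y := x) (by show ρ ζ 0 < t; rw [hρ.rho_zero hζ]; exact ht0) hx
  · exact this h0
  · obtain ⟨r, hr, H⟩ := hρ.reach_step hζ hx
    filter_upwards [nhdsWithin_le_nhds (Metric.ball_mem_nhds x hr)] with y hy
    rw [mem_ball, dist_eq_norm] at hy
    have h1 : ‖x - x‖ < r := by simpa using hr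
    exact ⟨H x y h1 hy, H y x hy h1⟩

end Cond3
end H3



section H4
open scoped Topology
variable {n : ℕ} {ρ : ℂ → (Fin n → ℂ) → ℝ} {R : ℝ}

namespace Fam
variable {F G : (Fin n → ℂ) → ℂ → (Fin n → ℂ)} {P : (Fin n → ℂ) → ℝ} (X : Fam ρ R F G P)
include X

lemma TT_le {a : ℂ} (ha : a ∈ Disk) {w : Fin n → ℂ} (hR : euclNorm w ≤ R) : euclNorm (TT F a w) ≤ R := by
  by_cases h : w = 0
  · rw [h, TT_zero, euclNorm_zero]; exact X.hρ.R_pos.le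
  · rw [TT_of a h]; exact X.F_le h hR ha

lemma ne_of_P {w : Fin n → ℂ} (h : 0 < P w) : w ≠ 0 := by
  rintro rfl; rw [X.P0] at h; exact lt_irrefl _ h

lemma hullP_int {m : ℝ} (hm : 1 < m)
    (hsup : ∀ z, ‖z‖ < 1 → ∀ x, euclNorm x ≤ R → (z, TT F z x) ∈ polyHull (KK ρ) → P x ≤ m)
    {w : Fin n → ℂ} (hR : euclNorm w ≤ R) (hPw : P w = m) {a : ℂ} (ha : ‖a‖ < 1)
    (hw : (a, F w a) ∈ polyHull (KK ρ)) : False := by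
  have h0 : w ≠ 0 := X.ne_of_P (by rw [hPw]; linarith)
  have haD : a ∈ Disk := mem_disk_iff.2 ha.le
  have hRs : euclNorm w < R := by
    refine lt_of_le_of_ne hR fun h => ?_
    have h1 := X.hρ.hull_KK_lt hw
    rw [X.F_const h0 h haD, h] at h1
    exact lt_irrefl _ h1
  have hm0 : 0 < m := by linarith
  have ha1 : 0 < 1 - ‖a‖ := by linarith
  obtain ⟨δ, hδ, Hδ⟩ := X.hρ.qq_low (t0 := m) (s0 := m - 1) hm0 (by linarith)
  obtain ⟨M, hM, HM⟩ := X.Ha_le hm0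
  obtain ⟨δ', hδ', HF⟩ := X.F_dist hm0 (ε := δ / (2 * M) * (1 - ‖a‖)) (by positivity)
  obtain ⟨w', h0', hR', hd, hP'⟩ := X.no_local_max h0 hRs hδ'
  rw [hPw] at hP'
  have h1 := HF w' h0' hR' hP'.le w h0 hR hPw.ge hd a ha
  rw [mul_div_assoc, div_self ha1.ne', mul_one] at h1
  have hlow := hull_low X.hρ.KK_compact (q := fun x => 1 - dt (G w' x.1) x.2)
    (polyApprox_q (C := R) (fun x hx => ⟨Cond3.hull_KK_disk x hx,
      (norm_le_euclNorm _).trans (X.hρ.hull_KK_lt hx).le⟩) (X.memG w' h0' hR'))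
    (fun x hx => ?_) hδ (fun x hx => ?_) (a, F w a) hw
  · have h2 := HM w' h0' hR' hP'.le a haD (F w a)
    have h3 : M * ‖F w' a - F w a‖ ≤ M * (δ / (2 * M)) := by gcongr
    have h4 : M * (δ / (2 * M)) = δ / 2 := by field_simp
    have h5 : δ ≤ ‖1 - dt (G w' a) (F w a)‖ := hlow
    linarith
  · obtain ⟨z, v⟩ := x
    show 1 - dt (G w' z) v ≠ 0
    have hzD := mem_disk_iff.1 (Cond3.hull_KK_disk _ hx)
    rcases lt_or_eq_of_le hzD with hz | hz
    · obtain ⟨x, hxR, hxv⟩ := X.surj hz (X.hρ.hull_KK_lt hx).le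
      by_cases hx0 : x = 0
      · rw [hx0, TT_zero] at hxv
        rw [← hxv, dt_zero, sub_zero]; exact one_ne_zero
      · have h2 := hsup z hz x hxR (by rw [hxv]; exact hx)
        rw [← hxv, TT_of z hx0]
        exact X.level_inj h0' hR' hx0 hxR hz (h2.trans_lt hP')
    · have hzC : z ∈ Circ := by rw [Circ, mem_sphere_zero_iff_norm]; exact hz
      have h2 := X.hρ.hull_bdry hzC hx
      have hl := X.lev w' h0' hR' z hzC
      rw [X.G_eq h0' hR' hzC]
      exact X.hρ.qq_ne' hzC (by rw [hl]; linarith) (by rw [hl]; exact X.P_le hR') (by rw [hl]; linarith)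
  · obtain ⟨z, v⟩ := x
    show δ ≤ ‖1 - dt (G w' z) v‖
    have hzC : z ∈ Circ := hx.1
    have hv : ρ z v = 1 := hx.2
    have hl := X.lev w' h0' hR' z hzC
    rw [X.G_eq h0' hR' hzC]
    exact Hδ z hzC (F w' z) v (by rw [hl]; exact hP'.le) (by rw [hl]; exact X.P_le hR') (by rw [hl, hv]; linarith)

lemma hullP_bd {m : ℝ} (hm : 1 < m) (hmR : m ≤ R) {z : ℕ → ℂ} {w : ℕ → Fin n → ℂ} (hz : ∀ k, ‖z k‖ < 1)
    (hw : ∀ k, euclNorm (w k) ≤ R) (hhull : ∀ k, (z k, TT F (z k) (w k)) ∈ polyHull (KK ρ))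
    (hP : Tendsto (fun k => P (w k)) atTop (𝓝 m)) {ζ : ℂ} (hζ : ζ ∈ Circ) (hzt : Tendsto z atTop (𝓝 ζ))
    {v : Fin n → ℂ} (hvt : Tendsto (fun k => TT F (z k) (w k)) atTop (𝓝 v)) : False := by
  have hv : (ζ, v) ∈ polyHull (KK ρ) :=
    (isClosed_polyHull _).mem_of_tendsto (hzt.prodMk_nhds hvt) (Eventually.of_forall hhull)
  have h1 := X.hρ.hull_bdry hζ hv
  obtain ⟨v1, hv1, hv1ζ, hlt⟩ := X.hρ.reach hζ (t := (1 + m) / 2) (by linarith) (by linarith) (x := v) (by linarith)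
  obtain ⟨δ, hδ, H⟩ := X.hρ.near_lt hv1.contOnC hlt
  have h2 : Tendsto (fun k => v1 (z k)) atTop (𝓝 v) := by
    have h3 := (hv1.contOn ζ (circ_sub_disk hζ)).tendsto
    rw [hv1ζ] at h3
    exact h3.comp (tendsto_nhdsWithin_iff.2 ⟨hzt, Eventually.of_forall fun k => mem_disk_iff.2 (hz k).le⟩)
  have h3 : Tendsto (fun k => ‖TT F (z k) (w k) - v1 (z k)‖) atTop (𝓝 0) := by
    have := (hvt.sub h2).norm
    rwa [sub_self, norm_zero] at this
  obtain ⟨k, hk1, hk2⟩ := ((h3.eventually_lt_const hδ).and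
    (hP.eventually_const_lt (show (1 + m) / 2 < m by linarith))).exists
  have h0 : w k ≠ 0 := X.ne_of_P (by linarith)
  have h4 := X.H_ne h0 (hw k) (hv1.add (MemAV.const (TT F (z k) (w k) - v1 (z k))))
    (fun y hy => (H y hy _ hk1).trans hk2) (hz k)
  rw [add_sub_cancel, TT_of _ h0, X.pair _ h0 (hw k) _ (mem_disk_iff.2 (hz k).le), sub_self] at h4
  exact h4 rfl

/-- points of the hull lie below level one -/
lemma hull_P {a : ℂ} (ha : ‖a‖ < 1) {w : Fin n → ℂ} (hR : euclNorm w ≤ R)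
    (hw : (a, TT F a w) ∈ polyHull (KK ρ)) : P w ≤ 1 := by
  by_contra hcon
  push Not at hcon
  set A : Set (ℂ × (Fin n → ℂ)) := {p | ‖p.1‖ < 1 ∧ euclNorm p.2 ≤ R ∧ (p.1, TT F p.1 p.2) ∈ polyHull (KK ρ)} with hA
  set S : Set ℝ := (fun p : ℂ × (Fin n → ℂ) => P p.2) '' A with hS
  have hne : S.Nonempty := ⟨P w, (a, w), ⟨ha, hR, hw⟩, rfl⟩
  have hb : BddAbove S := ⟨R, by rintro _ ⟨p, hp, rfl⟩; exact X.P_le hp.2.1⟩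
  obtain ⟨u, -, hu1, hu2⟩ := exists_seq_tendsto_sSup hne hb
  set m := sSup S with hm
  have hwm : P w ≤ m := le_csSup hb ⟨(a, w), ⟨ha, hR, hw⟩, rfl⟩
  have hsup : ∀ z, ‖z‖ < 1 → ∀ x, euclNorm x ≤ R → (z, TT F z x) ∈ polyHull (KK ρ) → P x ≤ m :=
    fun z hz x hx hh => le_csSup hb ⟨(z, x), ⟨hz, hx, hh⟩, rfl⟩
  have hmR : m ≤ R := csSup_le hne (by rintro _ ⟨p, hp, rfl⟩; exact X.P_le hp.2.1)
  choose p hpA hpu using hu2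
  have hc : IsCompact (Disk ×ˢ ({w : Fin n → ℂ | euclNorm w ≤ R} ×ˢ {w : Fin n → ℂ | euclNorm w ≤ R})) :=
    isCompact_disk.prod ((isCompact_eucl R).prod (isCompact_eucl R))
  obtain ⟨⟨ζ, w0, v⟩, ⟨hζ, hw0, hv⟩, φ, hφ, hlim⟩ := hc.tendsto_subseq (x := fun k => ((p k).1, (p k).2, TT F (p k).1 (p k).2))
    (fun k => ⟨mem_disk_iff.2 (hpA k).1.le, (hpA k).2.1, X.TT_le (mem_disk_iff.2 (hpA k).1.le) (hpA k).2.1⟩)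
  rw [Prod.tendsto_iff, Prod.tendsto_iff] at hlim
  obtain ⟨l1, l2, l3⟩ := hlim
  have lP : Tendsto (fun k => P (p (φ k)).2) atTop (𝓝 m) := by
    have : (fun k => P (p (φ k)).2) = u ∘ φ := by funext k; exact hpu (φ k)
    rw [this]; exact hu1.comp hφ.tendsto_atTop
  have lP2 : Tendsto (fun k => P (p (φ k)).2) atTop (𝓝 (P w0)) :=
    (X.Pc w0 hw0).tendsto.comp (tendsto_nhdsWithin_iff.2 ⟨l2, Eventually.of_forall fun k => (hpA (φ k)).2.1⟩)
  have hPw0 : P w0 = m := tendsto_nhds_unique lP2 lP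
  have hζ' : ‖ζ‖ ≤ 1 := mem_disk_iff.1 hζ
  rcases lt_or_eq_of_le hζ' with h | h
  · have h0 : w0 ≠ 0 := X.ne_of_P (by linarith)
    have hTv : v = F w0 ζ := by
      refine eq_of_forall_dist_le fun ε hε => ?_
      have h1z : 0 < 1 - ‖ζ‖ := by linarith
      obtain ⟨δ, hδ, H⟩ := X.F_dist (t0 := m / 2) (by linarith) (ε := ε / 2 * ((1 - ‖ζ‖) / 2)) (by positivity)
      have l4 : Tendsto (fun k => F w0 (p (φ k)).1) atTop (𝓝 (F w0 ζ)) :=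
        ((X.memF w0 h0 hw0).contOn ζ hζ).tendsto.comp
          (tendsto_nhdsWithin_iff.2 ⟨l1, Eventually.of_forall fun k => mem_disk_iff.2 (hpA (φ k)).1.le⟩)
      have l5 := l3.dist l4
      refine (le_of_tendsto l5 ?_).trans (half_le_self hε.le)
      have e1 : ∀ᶠ k in atTop, ‖(p (φ k)).2 - w0‖ < δ := by
        filter_upwards [l2 (Metric.ball_mem_nhds w0 hδ)] with k hk
        rw [← dist_eq_norm]; exact hk
      have e2 : ∀ᶠ k in atTop, m / 2 < P (p (φ k)).2 := lP.eventually_const_lt (by linarith)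
      have e3 : ∀ᶠ k in atTop, ‖(p (φ k)).1‖ < (1 + ‖ζ‖) / 2 := l1.norm.eventually_lt_const (by linarith)
      filter_upwards [e1, e2, e3] with k h1 h2 h3
      have hk0 : (p (φ k)).2 ≠ 0 := X.ne_of_P (by linarith)
      have h4 := H _ hk0 (hpA (φ k)).2.1 h2.le w0 h0 hw0 (by linarith) h1 _ (hpA (φ k)).1
      show dist (TT F (p (φ k)).1 (p (φ k)).2) (F w0 (p (φ k)).1) ≤ ε / 2
      rw [TT_of _ hk0, dist_eq_norm]
      refine h4.trans ?_
      rw [div_le_iff₀ (by linarith)]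
      gcongr
      linarith
    refine X.hullP_int (m := m) (by linarith) hsup hw0 hPw0 h ?_
    rw [← hTv]
    exact (isClosed_polyHull _).mem_of_tendsto (l1.prodMk_nhds l3) (Eventually.of_forall fun k => (hpA (φ k)).2.2)
  · exact X.hullP_bd (m := m) (by linarith) hmR (fun k => (hpA (φ k)).1) (fun k => (hpA (φ k)).2.1)
      (fun k => (hpA (φ k)).2.2) lP (by rw [Circ, mem_sphere_zero_iff_norm]; exact h) l1 l3

lemma TT_hull {a : ℂ} (ha : a ∈ Disk) {w : Fin n → ℂ} (hR : euclNorm w ≤ R) (hP : P w ≤ 1) :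
    (a, TT F a w) ∈ polyHull (KK ρ) := by
  by_cases h0 : w = 0
  · rw [h0, TT_zero]
    exact X.hρ.disc_in_hull (MemAV.const 0) (fun z hz => by rw [X.hρ.rho_zero hz]; exact zero_le_one) ha
  · rw [TT_of a h0]
    exact X.hρ.disc_in_hull (X.memF w h0 hR) (fun z hz => by rw [X.lev w h0 hR z hz]; exact hP) ha

/-- description of the interior fibres -/
lemma hull_iff {a : ℂ} (ha : ‖a‖ < 1) {v : Fin n → ℂ} :
    (a, v) ∈ polyHull (KK ρ) ↔ ∃ w, euclNorm w ≤ R ∧ P w ≤ 1 ∧ TT F a w = v := by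
  constructor
  · intro h
    obtain ⟨w, hw, hv⟩ := X.surj ha (X.hρ.hull_KK_lt h).le
    exact ⟨w, hw, X.hull_P ha hw (by rw [hv]; exact h), hv⟩
  · rintro ⟨w, hw, hP, rfl⟩
    exact X.TT_hull (mem_disk_iff.2 ha.le) hw hP

lemma hull_zero : {w : Fin n → ℂ | ((0:ℂ), w) ∈ polyHull (KK ρ)} = {w | euclNorm w ≤ R ∧ P w ≤ 1} := by
  have hT : ∀ w, euclNorm w ≤ R → TT F 0 w = w := by
    intro w hw
    by_cases h : w = 0
    · rw [h, TT_zero]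
    · rw [TT_of 0 h, X.cen w h hw]
  ext w
  show ((0:ℂ), w) ∈ polyHull (KK ρ) ↔ euclNorm w ≤ R ∧ P w ≤ 1
  rw [X.hull_iff (by simp)]
  constructor
  · rintro ⟨w', h1, h2, h3⟩
    rw [hT w' h1] at h3; subst h3; exact ⟨h1, h2⟩
  · rintro ⟨h1, h2⟩; exact ⟨w, h1, h2, hT w h1⟩

/-- hypoconvexity of the fibres -/
lemma hypoconvex {a : ℂ} (ha : a ∈ Disk) : HypoconvexSet {w : Fin n → ℂ | (a, w) ∈ polyHull (KK ρ)} := by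
  intro v hv
  have hv' : (a, v) ∉ polyHull (KK ρ) := hv
  have hRp := X.hρ.R_pos
  by_cases hvR : R < euclNorm v
  · refine ⟨cj v, (euclNorm v ^ 2 : ℝ), ?_, ?_, fun w hw h => ?_⟩
    · intro h
      have h1 := euclNorm_cj v
      rw [h, euclNorm_zero] at h1; linarith
    · have := dt_cj v; rw [dt_comm] at this; exact this
    · have h1 := X.hρ.hull_KK_lt hw
      have h2 := norm_dt_le' (cj v) w
      have h3 : dt (cj v) w = (euclNorm v ^ 2 : ℝ) := h
      rw [h3, euclNorm_cj, norm_real, Real.norm_of_nonneg (by positivity)] at h2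
      nlinarith
  push Not at hvR
  rcases lt_or_eq_of_le (mem_disk_iff.1 ha) with h | h
  · obtain ⟨w, hw, rfl⟩ := X.surj h hvR
    have hP : 1 < P w := not_le.1 fun hle => hv' (X.TT_hull ha hw hle)
    have h0 : w ≠ 0 := X.ne_of_P (by linarith)
    have hp := X.pair w h0 hw a ha
    refine ⟨G w a, 1, ?_, ?_, fun x hx hxe => ?_⟩
    · intro h1; rw [h1, zero_dt] at hp; exact zero_ne_one hp
    · rw [TT_of a h0]; exact hp
    · obtain ⟨w', h1, h2, rfl⟩ := (X.hull_iff h).1 hx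
      have hxe' : dt (G w a) (TT F a w') = 1 := hxe
      by_cases h0' : w' = 0
      · rw [h0', TT_zero, dt_zero] at hxe'; exact zero_ne_one hxe'
      · rw [TT_of a h0'] at hxe'
        exact X.level_inj h0 hw h0' h1 h (by linarith) (by rw [hxe', sub_self])
  · have hC : a ∈ Circ := by rw [Circ, mem_sphere_zero_iff_norm]; exact h
    have hP : 1 < ρ a v := not_le.1 fun hle => hv' (X.hρ.sub_hull hC hle)
    have hR1 := (X.hρ.le_R_iff hC).2 hvR
    refine ⟨Gm ρ a v, 1, X.hρ.Gm_ne hC (by linarith) hR1, X.hρ.Gm_dot hC (by linarith) hR1, fun x hx hxe => ?_⟩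
    have hxe' : dt (Gm ρ a v) x = 1 := hxe
    exact X.hρ.qq_ne' hC (v := x) (by linarith) hR1 (by linarith [X.hρ.hull_bdry hC hx]) (by rw [qq, hxe', sub_self])

end Fam
end H4



section C1
open scoped Topology
variable {n : ℕ} {ρ : ℂ → (Fin n → ℂ) → ℝ} {R : ℝ}

lemma Cond3.bdry_fibre (hρ : Cond3 n ρ R (fun _ => 0)) {a : ℂ} (ha : a ∈ Circ) :
    CkBoundary 1 {w : Fin n → ℂ | (a, w) ∈ polyHull (KK ρ)} := by
  have hA : {w : Fin n → ℂ | (a, w) ∈ polyHull (KK ρ)} = {w | ρ a w ≤ 1} := by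
    ext w; exact ⟨fun h => hρ.hull_bdry ha h, fun h => hρ.sub_hull ha h⟩
  rw [hA]
  have hcs := hρ.cont_slice ha
  intro p hp
  have hp1 : ρ a p = 1 := frontier_le_subset_eq hcs continuous_const hp
  set U := {w | 0 < ρ a w} ∩ {w | ρ a w < R} with hU
  refine ⟨U, (isOpen_lt continuous_const hcs).inter (isOpen_lt hcs continuous_const),
    ⟨by show 0 < ρ a p; rw [hp1]; exact one_pos, by show ρ a p < R; rw [hp1]; exact hρ.hR⟩, fun w => ρ a w - 1, ?_, ?_, ?_⟩
  · have h1 : ContDiffOn ℝ 6 (ρ a) U := by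
      have hm : MapsTo (fun w : Fin n → ℂ => (a, w)) U {p | p.1 ∈ Circ ∧ ρ p.1 p.2 ≠ 0} := by
        intro w hw
        exact ⟨ha, (show 0 < ρ a w from hw.1).ne'⟩
      have h2 : ContDiffOn ℝ 6 (fun w : Fin n → ℂ => (a, w)) U := by fun_prop
      have h3 := ContDiffOn.comp hρ.smooth h2 hm
      exact h3
    exact (h1.sub contDiffOn_const).of_le (by norm_num)
  · intro x hx
    rw [fderiv_sub_const]
    exact hρ.grad_ne a ha x hx.1 (le_of_lt hx.2)
  · ext x
    constructor
    · rintro ⟨h1, h2⟩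
      have h3 : ρ a x = 1 := frontier_le_subset_eq hcs continuous_const h1
      exact ⟨by show ρ a x - 1 = 0; rw [h3, sub_self], h2⟩
    · rintro ⟨h1, h2⟩
      have h3 : ρ a x = 1 := sub_eq_zero.1 h1
      refine ⟨⟨subset_closure h3.le, fun hi => ?_⟩, h2⟩
      obtain ⟨δ, hδ, hb⟩ := Metric.mem_nhds_iff.1 (mem_interior_iff_mem_nhds.1 hi)
      obtain ⟨q, hq1, hq2, -⟩ := hρ.go_up ha h2.1 h2.2 hδ
      have : ρ a q ≤ 1 := hb (by rw [mem_ball, dist_eq_norm]; exact hq1)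
      linarith

lemma re_rot (ω : ℂ) (τ : ℝ) : (ω * exp (τ * I)).re ≤ ω.re + |τ| * ‖ω‖ := by
  have h1 : ω * exp (τ * I) = ω + ω * (exp (I * τ) - 1) := by rw [mul_comm I]; ring
  have h2 := Real.norm_exp_I_mul_ofReal_sub_one_le (x := τ)
  have h3 := Complex.re_le_norm (ω * (exp (I * τ) - 1))
  rw [norm_mul] at h3
  rw [h1, add_re]
  rw [Real.norm_eq_abs] at h2
  nlinarith [norm_nonneg ω]

namespace Fam
variable {F G : (Fin n → ℂ) → ℂ → (Fin n → ℂ)} {P : (Fin n → ℂ) → ℝ} (X : Fam ρ R F G P)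
include X

lemma DD_eq {w : Fin n → ℂ} (h0 : w ≠ 0) (hR : euclNorm w ≤ R) {z : ℂ} (hz : z ∈ Circ) (v : Fin n → ℂ) :
    dt (DD ρ z (F w z)) v = dt (DD ρ z (F w z)) (F w z) * dt (G w z) v := by
  have hl := X.lev w h0 hR z hz
  have hne := X.hρ.lam_ne hz (by rw [hl]; exact X.P_pos h0 hR) (by rw [hl]; exact X.P_le hR)
  rw [X.G_eq h0 hR hz, Gm, smul_dt, mul_inv_cancel_left₀ hne]

lemma inner_cone {w : Fin n → ℂ} (h0 : w ≠ 0) (hR : euclNorm w ≤ R) (hP : P w = 1) {a : ℂ} (ha : ‖a‖ < 1)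
    {θ : ℂ → ℝ} (hθ : ContinuousOn θ Circ)
    (hθ2 : ∀ z ∈ Circ, dt (DD ρ z (F w z)) (F w z) = ‖dt (DD ρ z (F w z)) (F w z)‖ * exp (θ z * I))
    {ε : ℝ} (hε : 0 < ε) : ∃ δ > 0, ∀ d : Fin n → ℂ, ‖d‖ < δ →
      (exp ((avg a θ : ℝ) * I) * dt (G w a) d).re < - ε * ‖d‖ → (a, F w a + d) ∈ polyHull (KK ρ) := by
  have haD : a ∈ Disk := mem_disk_iff.2 ha.le
  set C := n * ‖G w a‖ + 1 with hC
  have hCp : 0 < C := by positivity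
  obtain ⟨Q, hQd, hQ⟩ := exists_entire_im_approx hθ (ε := ε / (4 * C)) (by positivity)
  have hQA : MemA Q := .of_differentiable hQd
  have hQa : |(Q a).im - avg a θ| ≤ ε / (4 * C) := by
    have h1 := avg_im ha (hQA.1.mono circ_sub_disk)
    rw [avg_mean ha hQA] at h1
    rw [← h1]
    exact avg_dist_le ha (continuous_im.comp_continuousOn (hQA.1.mono circ_sub_disk)) hθ fun z hz => (hQ z hz).le
  set e : ℂ → ℂ := fun z => exp (Q a - Q z) with he
  have heA : MemA e := .of_differentiable (by fun_prop)
  have hf := X.memF w h0 hR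
  have hg := X.memG w h0 hR
  obtain ⟨m, hm, Hm⟩ := X.lam_low h0 hR
  obtain ⟨Bf, hBf⟩ := isCompact_circ.exists_bound_of_continuousOn hf.contOnC
  obtain ⟨Bg, hBg⟩ := isCompact_circ.exists_bound_of_continuousOn hg.contOnC
  obtain ⟨Be, hBe⟩ := isCompact_circ.exists_bound_of_continuousOn (heA.1.mono circ_sub_disk)
  obtain ⟨me, hme, Hme⟩ := pos_min isCompact_circ (f := fun z => ‖e z‖) (heA.1.mono circ_sub_disk).norm
    (fun z _ => norm_pos_iff.2 (exp_ne_zero _))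
  have hBf0 : 0 ≤ Bf := (norm_nonneg _).trans (hBf 1 one_mem_circ)
  have hBg0 : 0 ≤ Bg := (norm_nonneg _).trans (hBg 1 one_mem_circ)
  have hBe0 : 0 ≤ Be := (norm_nonneg _).trans (hBe 1 one_mem_circ)
  set C2 := 1 + n * Bg * Bf + C * Be * Bf with hC2
  have hC2p : 0 < C2 := by positivity
  obtain ⟨δ, hδ, Hδ⟩ := X.hρ.fo_decr (t0 := 1) (c := m * me * (ε / 2) / C2) one_pos (by positivity)
  refine ⟨δ / C2, by positivity, fun d hd hre => ?_⟩
  set h : ℂ → Fin n → ℂ := fun z => d - dt (G w z) d • F w z + (dt (G w a) d * e z) • F w z with hh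
  have hhA : MemAV h := ((MemAV.const d).sub (MemAV.smul (hg.dt (MemAV.const d)) hf)).add
    (MemAV.smul ((MemA.const (dt (G w a) d)).mul heA) hf)
  have hgad : ‖dt (G w a) d‖ ≤ C * ‖d‖ := by
    have := norm_dt_le (G w a) d
    rw [hC]; nlinarith [norm_nonneg d]
  have hhn : ∀ z ∈ Circ, ‖h z‖ ≤ C2 * ‖d‖ := by
    intro z hz
    have h1 := norm_dt_le (G w z) d
    have h2 : ‖dt (G w z) d • F w z‖ ≤ n * Bg * ‖d‖ * Bf := by
      rw [norm_smul]
      refine mul_le_mul (h1.trans ?_) (hBf z hz) (norm_nonneg _) (by positivity)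
      gcongr
      exact hBg z hz
    have h3 : ‖(dt (G w a) d * e z) • F w z‖ ≤ C * ‖d‖ * Be * Bf := by
      rw [norm_smul, norm_mul]
      exact mul_le_mul (mul_le_mul hgad (hBe z hz) (norm_nonneg _) (by positivity)) (hBf z hz) (norm_nonneg _)
        (by positivity)
    have h4 := norm_add_le (d - dt (G w z) d • F w z) ((dt (G w a) d * e z) • F w z)
    have h5 := norm_sub_le d (dt (G w z) d • F w z)
    have h6 : ‖h z‖ ≤ ‖d‖ + n * Bg * ‖d‖ * Bf + C * ‖d‖ * Be * Bf := by
      show ‖d - dt (G w z) d • F w z + (dt (G w a) d * e z) • F w z‖ ≤ _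
      linarith
    refine h6.trans (le_of_eq ?_)
    rw [hC2]; ring
  have hhre : ∀ z ∈ Circ, (dt (DD ρ z (F w z)) (h z)).re ≤ -(m * me * (ε / 2)) * ‖d‖ := by
    intro z hz
    have hp := X.pair w h0 hR z (circ_sub_disk hz)
    set lam := dt (DD ρ z (F w z)) (F w z) with hlam
    have h1 : dt (DD ρ z (F w z)) (h z) = lam * (dt (G w a) d * e z) := by
      rw [X.DD_eq h0 hR hz]
      show lam * dt (G w z) (d - dt (G w z) d • F w z + (dt (G w a) d * e z) • F w z) = _
      rw [dt_add, dt_sub, dt_smul, dt_smul, hp]; ring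
    set τ : ℝ := θ z + (Q a).im - (Q z).im - avg a θ with hτ
    have h2 : lam * (dt (G w a) d * e z) = ((‖lam‖ * ‖e z‖ : ℝ) : ℂ) * ((exp ((avg a θ : ℝ) * I) * dt (G w a) d) * exp (τ * I)) := by
      have e1 : e z = ‖e z‖ * exp (((Q a).im - (Q z).im : ℝ) * I) := by
        show exp (Q a - Q z) = ‖exp (Q a - Q z)‖ * _
        rw [norm_exp, ofReal_exp, ← exp_add]
        congr 1
        apply Complex.ext <;> simp
      have e2 : exp (θ z * I) * exp (((Q a).im - (Q z).im : ℝ) * I) = exp ((avg a θ : ℝ) * I) * exp (τ * I) := by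
        rw [← exp_add, ← exp_add, hτ]; congr 1; push_cast; ring
      calc lam * (dt (G w a) d * e z) = (‖lam‖ * exp (θ z * I)) * (dt (G w a) d * (‖e z‖ * exp (((Q a).im - (Q z).im : ℝ) * I))) := by
            rw [← e1, ← hθ2 z hz]
        _ = ‖lam‖ * ‖e z‖ * dt (G w a) d * (exp (θ z * I) * exp (((Q a).im - (Q z).im : ℝ) * I)) := by ring
        _ = _ := by rw [e2]; push_cast; ring
    rw [h1, h2, re_ofReal_mul]
    have h3 := re_rot (exp ((avg a θ : ℝ) * I) * dt (G w a) d) τ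
    rw [norm_mul, norm_exp_ofReal_mul_I, one_mul] at h3
    have h4 : |τ| ≤ ε / (2 * C) := by
      have e1 := (hQ z hz).le
      have e2 : τ = ((Q a).im - avg a θ) - ((Q z).im - θ z) := by rw [hτ]; ring
      have e3 : ε / (2 * C) = ε / (4 * C) + ε / (4 * C) := by field_simp; ring
      rw [e2, e3]
      exact (abs_sub _ _).trans (add_le_add hQa e1)
    have h5 : |τ| * ‖dt (G w a) d‖ ≤ ε / 2 * ‖d‖ := by
      calc |τ| * ‖dt (G w a) d‖ ≤ ε / (2 * C) * (C * ‖d‖) := mul_le_mul h4 hgad (norm_nonneg _) (by positivity)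
        _ = ε / 2 * ‖d‖ := by field_simp
    have h6 : (exp ((avg a θ : ℝ) * I) * dt (G w a) d * exp (τ * I)).re ≤ -(ε / 2 * ‖d‖) := by linarith
    have h7 : m * me ≤ ‖lam‖ * ‖e z‖ := mul_le_mul (Hm z hz) (Hme z hz) hme.le (norm_nonneg _)
    have h8 : 0 ≤ ε / 2 * ‖d‖ := by positivity
    nlinarith [mul_le_mul_of_nonneg_right h7 h8, mul_nonneg (norm_nonneg lam) (norm_nonneg (e z))]
  have key : ∀ z ∈ Circ, ρ z (F w z + h z) ≤ 1 := by
    intro z hz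
    have hl := X.lev w h0 hR z hz
    rw [hP] at hl
    have h1 := hhn z hz
    have hc0 : 0 ≤ m * me * (ε / 2) / C2 := by positivity
    have h2 := Hδ z hz (F w z) hl.ge (by rw [hl]; exact X.hρ.hR.le) (h z) (h1.trans_lt (by
      rw [lt_div_iff₀ hC2p] at hd; linarith)) ((hhre z hz).trans (by
      have h3 : m * me * (ε / 2) / C2 * ‖h z‖ ≤ m * me * (ε / 2) / C2 * (C2 * ‖d‖) := mul_le_mul_of_nonneg_left h1 hc0
      have h4 : m * me * (ε / 2) / C2 * (C2 * ‖d‖) = m * me * (ε / 2) * ‖d‖ := by field_simp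
      linarith))
    have : 0 ≤ m * me * (ε / 2) / C2 * ‖h z‖ := mul_nonneg hc0 (norm_nonneg _)
    linarith
  have hres := X.hρ.disc_in_hull (hf.add hhA) key haD
  have hha : h a = d := by
    show d - dt (G w a) d • F w a + (dt (G w a) d * exp (Q a - Q a)) • F w a = d
    rw [sub_self, exp_zero, mul_one, sub_add_cancel]
  rwa [hha] at hres

end Fam
end C1



section C2
open scoped Topology
variable {n : ℕ} {ρ : ℂ → (Fin n → ℂ) → ℝ} {R : ℝ}

lemma cos_low {α x : ℝ} (hx : 0 ≤ x) (h : |α| ≤ Real.pi / 2 + x) : -x ≤ Real.cos α := by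
  by_cases h1 : |α| ≤ Real.pi / 2
  · have := Real.cos_nonneg_of_mem_Icc (abs_le.1 h1)
    linarith
  · push Not at h1
    have h2 : Real.cos α = - Real.sin (|α| - Real.pi / 2) := by
      rw [Real.sin_sub_pi_div_two, Real.cos_abs, neg_neg]
    have h3 := Real.sin_le (x := |α| - Real.pi / 2) (by linarith)
    rw [h2]
    linarith

lemma re_exp_low {h : ℂ} {α u x : ℝ} (hh : h = ‖h‖ * exp (α * I)) (hx : 0 ≤ x) (hα : |α + u| ≤ Real.pi / 2 + x) :
    -x * ‖h‖ ≤ (exp (u * I) * h).re := by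
  have h1 : exp (u * I) * h = (‖h‖ : ℂ) * exp (((α + u : ℝ) : ℂ) * I) := by
    conv_lhs => rw [hh]
    push_cast
    rw [add_mul, Complex.exp_add]; ring
  rw [h1, re_ofReal_mul, exp_ofReal_mul_I_re]
  have := mul_le_mul_of_nonneg_left (cos_low hx hα) (norm_nonneg h)
  linarith

namespace Fam
variable {F G : (Fin n → ℂ) → ℂ → (Fin n → ℂ)} {P : (Fin n → ℂ) → ℝ} (X : Fam ρ R F G P)
include X

lemma arg_est {t0 : ℝ} (ht0 : 0 < t0) {θ : ℂ → (Fin n → ℂ) → ℝ} {w : Fin n → ℂ} (h0 : w ≠ 0) (hR : euclNorm w ≤ R)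
    (ht : t0 ≤ P w) (hθ : ContinuousOn (fun z => θ z (F w z)) Circ)
    (hθ3 : ∀ ε > 0, ∃ δ > 0, ∀ z ∈ Circ, ∀ p u, t0 ≤ ρ z p → ρ z p ≤ R → ρ z u < ρ z p → ‖qq ρ z p u‖ < δ →
      |(X.hρ.LL z p u).im + θ z p| ≤ Real.pi / 2 + ε) {ε : ℝ} (hε : 0 < ε) :
    ∃ C ≥ 0, ∃ β : ℝ, 0 < β ∧ ∀ v : ℂ → Fin n → ℂ, MemAV v → (∀ z ∈ Circ, ρ z (v z) < P w) → ∀ a : ℂ, ‖a‖ < 1 →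
      -(ε + C * ‖1 - dt (G w a) (v a)‖ ^ β) * ‖1 - dt (G w a) (v a)‖ ≤
        (exp ((avg a (fun z => θ z (F w z)) : ℝ) * I) * (1 - dt (G w a) (v a))).re := by
  obtain ⟨M, hM, hLL⟩ := X.hρ.LL_bound ht0
  obtain ⟨T, hT⟩ := isCompact_circ.exists_bound_of_continuousOn hθ
  obtain ⟨δ, hδ, hq⟩ := hθ3 ε hε
  have hT0 : 0 ≤ T := (norm_nonneg _).trans (hT 1 one_mem_circ)
  set β := Real.pi / 4 / M with hβ
  have hβ0 : 0 < β := by positivity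
  have hβM : β * M ≤ Real.pi / 4 := by rw [hβ]; field_simp; exact le_refl _
  clear_value β
  refine ⟨(M + T) / δ ^ β * 2, by positivity, β, hβ0, fun v hv hlt a ha => ?_⟩
  have hlev := X.lev w h0 hR
  have hHm := X.H_mem h0 hR hv
  have hLc := X.L_cont h0 hR hv hlt
  have hlb : ∀ z ∈ Circ, |(X.hρ.LL z (F w z) (v z)).im| ≤ M := fun z hz =>
    hLL z hz _ _ (by rw [hlev z hz]; exact ht) (by rw [hlev z hz]; exact X.P_le hR)
        (by rw [hlev z hz]; exact hlt z hz)
  obtain ⟨-, hH, hpow⟩ := log_disk_avg hHm hLc (X.L_exp h0 hR hlt) ha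
  have hpow := hpow β M hβ0 hβM hlb
  have cI : ContinuousOn (fun z => (X.hρ.LL z (F w z) (v z)).im) Circ := Complex.continuous_im.comp_continuousOn hLc
  have cN : ContinuousOn (fun z => ‖1 - dt (G w z) (v z)‖ ^ β) Circ :=
    (hHm.1.mono circ_sub_disk).norm.rpow_const fun z _ => Or.inr hβ0.le
  refine re_exp_low hH (by positivity) ?_
  rw [← avg_add ha cI hθ]
  refine (avg_abs_le _).trans ?_
  have hpt : ∀ z ∈ Circ, |(X.hρ.LL z (F w z) (v z)).im + θ z (F w z)| ≤
      (Real.pi / 2 + ε) + (M + T) / δ ^ β * ‖1 - dt (G w z) (v z)‖ ^ β := by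
    intro z hz
    have hz0 : 0 ≤ (M + T) / δ ^ β * ‖1 - dt (G w z) (v z)‖ ^ β := by positivity
    by_cases hd : ‖1 - dt (G w z) (v z)‖ < δ
    · have h1 := hq z hz (F w z) (v z) (by rw [hlev z hz]; exact ht) (by rw [hlev z hz]; exact X.P_le hR)
        (by rw [hlev z hz]; exact hlt z hz) (by rw [← X.H_eq h0 hR v hz]; exact hd)
      linarith
    · push Not at hd
      have h6 : δ ^ β ≤ ‖1 - dt (G w z) (v z)‖ ^ β := Real.rpow_le_rpow hδ.le hd hβ0.le
      have h8 : M + T ≤ (M + T) / δ ^ β * ‖1 - dt (G w z) (v z)‖ ^ β := by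
        calc M + T = (M + T) / δ ^ β * δ ^ β := by field_simp
          _ ≤ _ := by gcongr
      have h9 := abs_add_le (X.hρ.LL z (F w z) (v z)).im (θ z (F w z))
      have h10 := hlb z hz
      have h11 := hT z hz
      rw [Real.norm_eq_abs] at h11
      have := Real.pi_pos
      linarith
  have h1 := avg_mono ha (cI.add hθ).abs (continuousOn_const.add (continuousOn_const.mul cN)) hpt
  have h2 := avg_affine ha (Real.pi / 2 + ε) ((M + T) / δ ^ β) cN
  have h3 : avg a (fun z => (Real.pi / 2 + ε) + (M + T) / δ ^ β * ‖1 - dt (G w z) (v z)‖ ^ β) =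
    (Real.pi / 2 + ε) + (M + T) / δ ^ β * avg a (fun z => ‖1 - dt (G w z) (v z)‖ ^ β) := h2
  have h4 := mul_le_mul_of_nonneg_left hpow (show 0 ≤ (M + T) / δ ^ β by positivity)
  have h5 : avg a (fun z => |(X.hρ.LL z (F w z) (v z)).im + θ z (F w z)|) ≤ 
    avg a (fun z => (Real.pi / 2 + ε) + (M + T) / δ ^ β * ‖1 - dt (G w z) (v z)‖ ^ β) := h1
  refine h5.trans ?_
  rw [h3]
  linarith

lemma arg_est' {t0 : ℝ} (ht0 : 0 < t0) {θ : ℂ → (Fin n → ℂ) → ℝ} {w : Fin n → ℂ} (h0 : w ≠ 0) (hR : euclNorm w ≤ R)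
    (ht : t0 ≤ P w) (hθ : ContinuousOn (fun z => θ z (F w z)) Circ)
    (hθ3 : ∀ ε > 0, ∃ δ > 0, ∀ z ∈ Circ, ∀ p u, t0 ≤ ρ z p → ρ z p ≤ R → ρ z u < ρ z p → ‖qq ρ z p u‖ < δ →
      |(X.hρ.LL z p u).im + θ z p| ≤ Real.pi / 2 + ε) {ε : ℝ} (hε : 0 < ε) :
    ∃ C ≥ 0, ∃ β : ℝ, 0 < β ∧ ∀ w', w' ≠ 0 → euclNorm w' ≤ R → P w' ≤ P w → ∀ a : ℂ, ‖a‖ < 1 →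
      -(ε + C * ‖1 - dt (G w a) (F w' a)‖ ^ β) * ‖1 - dt (G w a) (F w' a)‖ ≤
        (exp ((avg a (fun z => θ z (F w z)) : ℝ) * I) * (1 - dt (G w a) (F w' a))).re := by
  obtain ⟨C, hC, β, hβ, H⟩ := X.arg_est ht0 h0 hR ht hθ hθ3 hε
  refine ⟨C, hC, β, hβ, fun w' h0' hR' hPP a ha => ?_⟩
  obtain ⟨e, he, η0, hη0, hin⟩ := X.inward h0' hR'
  set k : ℝ → ℂ := fun η => 1 - dt (G w a) ((1 - (η : ℂ) * e a) • F w' a) with hk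
  have hkc : Continuous k := by
    have : k = fun η : ℝ => 1 - (1 - (η : ℂ) * e a) * dt (G w a) (F w' a) := by
      funext η; simp only [hk, dt_smul]
    rw [this]; fun_prop
  have hk0 : k 0 = 1 - dt (G w a) (F w' a) := by simp [hk]
  have key : ∀ η : ℝ, 0 < η → η < η0 → -(ε + C * ‖k η‖ ^ β) * ‖k η‖ ≤
      (exp ((avg a (fun z => θ z (F w z)) : ℝ) * I) * k η).re := by
    intro η hη hη'
    have hvA : MemAV (fun z => (1 - (η : ℂ) * e z) • F w' z) :=
      MemAV.smul ((MemA.const 1).sub ((MemA.const η).mul he)) (X.memF w' h0' hR')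
    exact H _ hvA (fun z hz => (hin η hη hη' z hz).trans_le hPP) a ha
  have c1 : Continuous (fun η => -(ε + C * ‖k η‖ ^ β) * ‖k η‖) :=
    ((continuous_const.add (continuous_const.mul (hkc.norm.rpow_const fun _ => Or.inr hβ.le))).neg).mul hkc.norm
  have c2 : Continuous (fun η => (exp ((avg a (fun z => θ z (F w z)) : ℝ) * I) * k η).re) :=
    Complex.continuous_re.comp (continuous_const.mul hkc)
  have l1 : Tendsto _ (𝓝[>] (0:ℝ)) _ := (c1.tendsto 0).mono_left nhdsWithin_le_nhds
  have l2 : Tendsto _ (𝓝[>] (0:ℝ)) _ := (c2.tendsto 0).mono_left nhdsWithin_le_nhds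
  have := le_of_tendsto_of_tendsto l1 l2 (by
    filter_upwards [Ioo_mem_nhdsGT hη0] with η hη
    exact key η hη.1 hη.2)
  simpa only [hk0] using this

lemma outer_cone {θ : ℂ → (Fin n → ℂ) → ℝ} {w : Fin n → ℂ} (h0 : w ≠ 0) (hR : euclNorm w ≤ R) (hP : P w = 1)
    {a : ℂ} (ha : ‖a‖ < 1) (hθ : ContinuousOn (fun z => θ z (F w z)) Circ)
    (hθ3 : ∀ ε > 0, ∃ δ > 0, ∀ z ∈ Circ, ∀ p u, 1 ≤ ρ z p → ρ z p ≤ R → ρ z u < ρ z p → ‖qq ρ z p u‖ < δ →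
      |(X.hρ.LL z p u).im + θ z p| ≤ Real.pi / 2 + ε) {ε : ℝ} (hε : 0 < ε) :
    ∃ δ > 0, ∀ d : Fin n → ℂ, ‖d‖ < δ →
      ε * ‖d‖ < (exp ((avg a (fun z => θ z (F w z)) : ℝ) * I) * dt (G w a) d).re →
      (a, F w a + d) ∉ polyHull (KK ρ) := by
  obtain ⟨M, hM, hMb⟩ := X.Ha_le one_pos
  have had : a ∈ Disk := mem_disk_iff.2 ha.le
  set ε1 := ε / (2 * M) with hε1
  have hε1' : 0 < ε1 := by positivity
  obtain ⟨C, hC, β, hβ, H⟩ := X.arg_est' one_pos h0 hR hP.ge hθ hθ3 hε1'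
  have hF0 : F w a ≠ 0 := by
    intro h
    have := X.pair w h0 hR a had
    rw [h, dt_zero] at this
    exact zero_ne_one this
  obtain ⟨δ1, hδ1, hδ1'⟩ : ∃ δ1 > 0, ∀ x : ℝ, 0 ≤ x → x < δ1 → C * (M * x) ^ β ≤ ε1 := by
    have hc : Continuous (fun x : ℝ => C * (M * x) ^ β) :=
      continuous_const.mul ((continuous_const.mul continuous_id).rpow_const fun _ => Or.inr hβ.le)
    obtain ⟨δ1, hδ1, h⟩ := Metric.continuous_iff.1 hc 0 ε1 hε1'
    refine ⟨δ1, hδ1, fun x hx hx' => ?_⟩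
    have := h x (by rw [Real.dist_eq, sub_zero, abs_of_nonneg hx]; exact hx')
    rw [Real.dist_eq, mul_zero, Real.zero_rpow hβ.ne', mul_zero, sub_zero] at this
    exact (le_abs_self _).trans this.le
  refine ⟨min δ1 ‖F w a‖, lt_min hδ1 (norm_pos_iff.2 hF0), fun d hd hcone hmem => ?_⟩
  obtain ⟨w', hR', hP', hw'⟩ := (X.hull_iff ha).1 hmem
  by_cases h0' : w' = 0
  · rw [h0', TT_zero] at hw'
    have : d = - F w a := by rw [eq_neg_iff_add_eq_zero, add_comm]; exact hw'.symm
    rw [this, norm_neg] at hd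
    exact lt_irrefl _ (hd.trans_le (min_le_right _ _))
  · rw [TT_of a h0'] at hw'
    have h1 := H w' h0' hR' (by rw [hP]; exact hP') a ha
    have e1 : 1 - dt (G w a) (F w' a) = - dt (G w a) d := by
      rw [hw', dt_add, X.pair w h0 hR a had]; ring
    have h2 := hMb w h0 hR hP.ge a had (F w' a)
    have e2 : F w a - F w' a = - d := by rw [hw']; abel
    rw [e2, norm_neg] at h2
    rw [e1, mul_neg, Complex.neg_re] at h1
    rw [e1] at h2
    rw [norm_neg] at h1 h2
    have h3 := hδ1' ‖d‖ (norm_nonneg _) (hd.trans_le (min_le_left _ _))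
    have h4 : C * ‖dt (G w a) d‖ ^ β ≤ ε1 := by
      refine le_trans ?_ h3
      exact mul_le_mul_of_nonneg_left (Real.rpow_le_rpow (norm_nonneg _) h2 hβ.le) hC
    have h5 : (ε1 + C * ‖dt (G w a) d‖ ^ β) * ‖dt (G w a) d‖ ≤ (2 * ε1) * (M * ‖d‖) :=
      mul_le_mul (by linarith) h2 (norm_nonneg _) (by positivity)
    have h6 : (2 * ε1) * (M * ‖d‖) = ε * ‖d‖ := by rw [hε1]; field_simp
    linarith

end Fam
end C2



section C3
open scoped Topology
variable {n : ℕ} {ρ : ℂ → (Fin n → ℂ) → ℝ} {R : ℝ}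

/-- the real linear functional `d ↦ Re ⟨g, d⟩` -/
def NN (g : Fin n → ℂ) : (Fin n → ℂ) →L[ℝ] ℝ :=
  LinearMap.toContinuousLinearMap
    { toFun := fun d => (dt g d).re
      map_add' := fun x y => by rw [dt_add, Complex.add_re]
      map_smul' := fun c x => by
        rw [show c • x = (c : ℂ) • x from (Complex.coe_smul c x).symm, dt_smul, re_ofReal_mul]; rfl }

lemma NN_apply (g d : Fin n → ℂ) : NN g d = (dt g d).re := rfl

lemma continuous_NN : Continuous (NN (n := n)) := by
  let L : (Fin n → ℂ) →ₗ[ℝ] ((Fin n → ℂ) →L[ℝ] ℝ) :=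
    { toFun := NN
      map_add' := fun x y => by
        ext d
        rw [ContinuousLinearMap.add_apply, NN_apply, NN_apply, NN_apply, dt_comm, dt_add, Complex.add_re,
          dt_comm d x, dt_comm d y]
      map_smul' := fun c x => by
        ext d
        rw [ContinuousLinearMap.smul_apply, NN_apply, NN_apply, dt_comm,
          show c • x = (c : ℂ) • x from (Complex.coe_smul c x).symm, dt_smul, re_ofReal_mul, dt_comm d x]; rfl }
  exact L.continuous_of_finiteDimensional

namespace Fam
variable {F G : (Fin n → ℂ) → ℂ → (Fin n → ℂ)} {P : (Fin n → ℂ) → ℝ} (X : Fam ρ R F G P)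
include X

lemma F_ne {w : Fin n → ℂ} (h0 : w ≠ 0) (hR : euclNorm w ≤ R) {a : ℂ} (ha : a ∈ Disk) : F w a ≠ 0 := by
  intro h
  have := X.pair w h0 hR a ha
  rw [h, dt_zero] at this
  exact zero_ne_one this

lemma isClosed_fib (a : ℂ) : IsClosed {v : Fin n → ℂ | (a, v) ∈ polyHull (KK ρ)} :=
  (isClosed_polyHull (KK ρ)).preimage (show Continuous fun v : Fin n → ℂ => (a, v) by fun_prop)

lemma front {a : ℂ} (ha : ‖a‖ < 1) {p : Fin n → ℂ} (hp : p ∈ frontier {v : Fin n → ℂ | (a, v) ∈ polyHull (KK ρ)}) :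
    ∃ w, w ≠ 0 ∧ euclNorm w ≤ R ∧ P w = 1 ∧ F w a = p := by
  have had : a ∈ Disk := mem_disk_iff.2 ha.le
  have hpA : (a, p) ∈ polyHull (KK ρ) := (X.isClosed_fib a).frontier_subset hp
  have hpR := X.hρ.hull_KK_lt hpA
  obtain ⟨w, hR, hP, hw⟩ := (X.hull_iff ha).1 hpA
  rcases lt_or_eq_of_le hP with hP1 | hP1
  · exfalso
    set E : Set (Fin n → ℂ) := {x | euclNorm x ≤ R} with hE
    have hEc : IsCompact E := isCompact_eucl R
    set B : Set (Fin n → ℂ) := E ∩ P ⁻¹' (Ici 1) with hB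
    have hBc : IsCompact B := hEc.of_isClosed_subset (X.Pc.preimage_isClosed_of_isClosed hEc.isClosed isClosed_Ici)
      inter_subset_left
    have hTB : IsClosed (TT F a '' B) := (hBc.image_of_continuousOn ((X.TT_cont ha).mono inter_subset_left)).isClosed
    have hpn : p ∉ TT F a '' B := by
      rintro ⟨w', ⟨hR', hP'⟩, e⟩
      have hP'' : 1 ≤ P w' := hP'
      have h0' : w' ≠ 0 := X.ne_of_P (by linarith)
      rw [TT_of a h0'] at e
      by_cases h0 : w = 0
      · rw [h0, TT_zero] at hw
        exact X.F_ne h0' hR' had (e.trans hw.symm)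
      · rw [TT_of a h0] at hw
        have := X.level_inj h0' hR' h0 hR ha (hP1.trans_le hP'')
        rw [hw, ← e, X.pair w' h0' hR' a had, sub_self] at this
        exact this rfl
    have hU : IsOpen ((TT F a '' B)ᶜ ∩ {x | euclNorm x < R}) :=
      hTB.isOpen_compl.inter (isOpen_lt continuous_euclNorm continuous_const)
    have hsub : (TT F a '' B)ᶜ ∩ {x | euclNorm x < R} ⊆ {v : Fin n → ℂ | (a, v) ∈ polyHull (KK ρ)} := by
      rintro v ⟨h1, h2⟩
      obtain ⟨w', hR', e⟩ := X.surj ha (le_of_lt (show euclNorm v < R from h2))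
      refine (X.hull_iff ha).2 ⟨w', hR', ?_, e⟩
      by_contra h3
      push Not at h3
      exact h1 ⟨w', ⟨hR', h3.le⟩, e⟩
    exact hp.2 (interior_maximal hsub hU ⟨hpn, hpR⟩)
  · have h0 : w ≠ 0 := X.ne_of_P (by linarith)
    exact ⟨w, h0, hR, hP1, by rw [← hw, TT_of a h0]⟩

lemma inner_fibre {a : ℂ} (ha : ‖a‖ < 1) : CkBoundary 1 {v : Fin n → ℂ | (a, v) ∈ polyHull (KK ρ)} := by
  have had : a ∈ Disk := mem_disk_iff.2 ha.le
  set A := {v : Fin n → ℂ | (a, v) ∈ polyHull (KK ρ)} with hA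
  obtain ⟨θ, hθc, hθ2, hθ3⟩ := X.hρ.exists_theta one_pos
  have hθw : ∀ w, w ≠ 0 → euclNorm w ≤ R → P w = 1 → ContinuousOn (fun z => θ z (F w z)) Circ := by
    intro w h0 hR hP
    have hm : MapsTo (fun z => (z, F w z)) Circ {p | p.1 ∈ Circ ∧ 1 ≤ ρ p.1 p.2 ∧ ρ p.1 p.2 ≤ R} := by
      intro z hz
      have h1 := X.lev w h0 hR z hz
      exact ⟨hz, by show 1 ≤ ρ z (F w z); rw [h1, hP], by show ρ z (F w z) ≤ R; rw [h1]; exact X.P_le hR⟩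
    have h4 := ContinuousOn.comp hθc (contOn_pair (X.memF w h0 hR).contOnC) hm
    exact h4
  have hch : ∀ p : Fin n → ℂ, ∃ w, p ∈ frontier A → w ≠ 0 ∧ euclNorm w ≤ R ∧ P w = 1 ∧ F w a = p := by
    intro p
    by_cases hp : p ∈ frontier A
    · obtain ⟨w, hw⟩ := X.front ha hp
      exact ⟨w, fun _ => hw⟩
    · exact ⟨0, fun h => absurd h hp⟩
  choose W hW using hch
  set u : (Fin n → ℂ) → ℝ := fun p => avg a (fun z => θ z (F (W p) z)) with hu
  have hGc : ContinuousOn (fun p => G (W p) a) (frontier A) := by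
    rw [Metric.continuousOn_iff]
    intro p hp ε hε
    obtain ⟨δ, hδ, H⟩ := X.G_dist one_pos (half_pos hε)
    refine ⟨δ, hδ, fun q hq hd => ?_⟩
    obtain ⟨a1, a2, a3, a4⟩ := hW p hp
    obtain ⟨b1, b2, b3, b4⟩ := hW q hq
    rw [dist_eq_norm] at hd ⊢
    exact (H _ b1 b2 b3.ge _ a1 a2 a3.ge a ha (by rw [a4, b4]; exact hd)).trans_lt (half_lt_self hε)
  have huc : ContinuousOn u (frontier A) := by
    rw [Metric.continuousOn_iff]
    intro p hp ε hε
    obtain ⟨δ, hδ, H⟩ := X.u_dist one_pos hθc (half_pos hε)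
    refine ⟨δ, hδ, fun q hq hd => ?_⟩
    obtain ⟨a1, a2, a3, a4⟩ := hW p hp
    obtain ⟨b1, b2, b3, b4⟩ := hW q hq
    rw [dist_eq_norm] at hd
    rw [Real.dist_eq]
    exact (H _ b1 b2 b3.ge _ a1 a2 a3.ge a ha (by rw [a4, b4]; exact hd)).trans_lt (half_lt_self hε)
  have hNa : ∀ p d, NN (exp ((u p : ℂ) * I) • G (W p) a) d = (exp ((u p : ℂ) * I) * dt (G (W p) a) d).re := by
    intro p d
    rw [NN_apply, smul_dt]
  refine cone_boundary A (X.isClosed_fib a) (fun p => NN (exp ((u p : ℂ) * I) • G (W p) a)) ?_ ?_ ?_ ?_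
  · have hc1 : ContinuousOn (fun p => exp ((u p : ℂ) * I)) (frontier A) :=
      Complex.continuous_exp.comp_continuousOn
        ((Complex.continuous_ofReal.comp_continuousOn huc).mul continuousOn_const)
    have hc2 : ContinuousOn (fun p => exp ((u p : ℂ) * I) • G (W p) a) (frontier A) := hc1.smul hGc
    exact continuous_NN.comp_continuousOn hc2
  · intro p hp h
    obtain ⟨a1, a2, a3, a4⟩ := hW p hp
    have h1 := hNa p (exp (-((u p : ℂ) * I)) • F (W p) a)
    rw [dt_smul, X.pair _ a1 a2 a had, mul_one, ← Complex.exp_add, add_neg_cancel, Complex.exp_zero] at h1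
    have h2 : NN (exp ((u p : ℂ) * I) • G (W p) a) = 0 := h
    rw [h2] at h1
    simp at h1
  · intro p hp ε hε
    obtain ⟨a1, a2, a3, a4⟩ := hW p hp
    obtain ⟨δ, hδ, H⟩ := X.outer_cone a1 a2 a3 ha (hθw _ a1 a2 a3) hθ3 hε
    refine ⟨δ, hδ, fun d hd h => ?_⟩
    have h' : ε * ‖d‖ < NN (exp ((u p : ℂ) * I) • G (W p) a) d := h
    rw [hNa] at h'
    have h3 := H d hd h'
    rw [a4] at h3
    exact h3
  · intro p hp ε hε
    obtain ⟨a1, a2, a3, a4⟩ := hW p hp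
    have h5 := X.lev _ a1 a2
    obtain ⟨δ, hδ, H⟩ := X.inner_cone a1 a2 a3 ha (hθw _ a1 a2 a3)
      (fun z hz => hθ2 z hz _ (by rw [h5 z hz, a3]) (by rw [h5 z hz]; exact X.P_le a2)) hε
    refine ⟨δ, hδ, fun d hd h => ?_⟩
    have h' : NN (exp ((u p : ℂ) * I) • G (W p) a) d < - ε * ‖d‖ := h
    rw [hNa] at h'
    have h3 := H d hd h'
    rw [a4] at h3
    exact h3

end Fam
end C3

/-- Theorem 2, hypoconvexity of the fibers of the hull. -/
theorem statement3 {n : ℕ} (ρ : ℂ → (Fin n → ℂ) → ℝ) (R : ℝ)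
    (hρ : Cond3 n ρ R (fun _ => 0))
    (K : Set (ℂ × (Fin n → ℂ)))
    (hK : K = {p : ℂ × (Fin n → ℂ) | p.1 ∈ Circ ∧ ρ p.1 p.2 = 1})
    (F G : (Fin n → ℂ) → ℂ → (Fin n → ℂ)) (P : (Fin n → ℂ) → ℝ)
    (hF12 : ∀ w : Fin n → ℂ, 0 < euclNorm w → euclNorm w ≤ R → MemH12V (F w) ∧ MemH12V (G w))
    (hcen : ∀ w : Fin n → ℂ, 0 < euclNorm w → euclNorm w ≤ R → F w 0 = w)
    (hlev : ∀ w : Fin n → ℂ, 0 < euclNorm w → euclNorm w ≤ R → ∀ z ∈ Circ, ρ z (F w z) = P w)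
    (hpair : ∀ w : Fin n → ℂ, 0 < euclNorm w → euclNorm w ≤ R →
      ∀ z ∈ Circ, ∑ j, F w z j * G w z j = 1)
    (htan : ∀ w : Fin n → ℂ, 0 < euclNorm w → euclNorm w ≤ R →
      ∀ z ∈ Circ, {v : Fin n → ℂ | ∑ j, G w z j * v j = 1} = TangentPlane (ρ z) (F w z))
    (hPc : ContinuousOn P {w : Fin n → ℂ | euclNorm w ≤ R}) (hP0 : P 0 = 0) :
    (∀ z ∈ Disk, HypoconvexSet {w : Fin n → ℂ | (z, w) ∈ polyHull K} ∧
      CkBoundary 1 {w : Fin n → ℂ | (z, w) ∈ polyHull K}) ∧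
    {w : Fin n → ℂ | ((0:ℂ), w) ∈ polyHull K} = {w : Fin n → ℂ | euclNorm w ≤ R ∧ P w ≤ 1} := by
  have pos : ∀ w : Fin n → ℂ, w ≠ 0 → 0 < euclNorm w := fun w h => euclNorm_pos.2 h
  have X : Fam ρ R F G P :=
    { hρ := hρ
      memF := fun w h0 hR j => ⟨((hF12 w (pos w h0) hR).1 j).1, ((hF12 w (pos w h0) hR).1 j).2.1⟩
      memG := fun w h0 hR j => ⟨((hF12 w (pos w h0) hR).2 j).1, ((hF12 w (pos w h0) hR).2 j).2.1⟩
      cen := fun w h0 hR => hcen w (pos w h0) hR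
      lev := fun w h0 hR => hlev w (pos w h0) hR
      pair := by
        intro w h0 hR
        have mF : MemAV (F w) := fun j => ⟨((hF12 w (pos w h0) hR).1 j).1, ((hF12 w (pos w h0) hR).1 j).2.1⟩
        have mG : MemAV (G w) := fun j => ⟨((hF12 w (pos w h0) hR).2 j).1, ((hF12 w (pos w h0) hR).2 j).2.1⟩
        refine MemA.eq_const (mG.dt mF) fun z hz => ?_
        rw [dt_comm]
        exact hpair w (pos w h0) hR z hz
      tan := by
        intro w h0 hR z hz v
        have h1 : v ∈ {v : Fin n → ℂ | ∑ j, G w z j * v j = 1} ↔ v ∈ TangentPlane (ρ z) (F w z) := by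
          rw [htan w (pos w h0) hR z hz]
        rw [dt_comm (DD ρ z (F w z))]
        exact h1
      Pc := hPc
      P0 := hP0 }
  have hKK : K = KK ρ := hK
  subst hKK
  refine ⟨fun z hz => ⟨X.hypoconvex hz, ?_⟩, X.hull_zero⟩
  rcases lt_or_eq_of_le (mem_disk_iff.1 hz) with h | h
  · exact X.inner_fibre h
  · exact hρ.bdry_fibre (show z ∈ Circ by simpa [Circ] using h)
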